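/- Let F and G be constant-coefficient trilinear (resp. bilinear) classical null forms and let n ≥ 1 be an integer. There exist C > 0 and ε0 > 0 (depending only on F, G, n) such that the following holds for every R ≥ 1 and every 0 < ε < ε0. Let φ1, φ2 be smooth solutions on [0,∞)×ℝ³ of □φ_h + F(dφ_h, d²φ_h) = G(dφ_h, dφ_h), whose initial data (φ_h(0,·), ∂_tφ_h(0,·)) are supported in the ball of radius R/2 centered at q_h (q1 = (−R,0,0), q2 = (R,0,0)) and satisfy |∂̂^k φ_h(0,·)| ≤ ε(1+r_h)^{−k−2} and |∂̂^k ∂_tφ_h(0,·)| ≤ ε(1+r_h)^{−k−3} for all 0 ≤ k ≤ n+7, where r_h is the distance to q_h. Let ψ be the smooth solution of the linear inhomogeneous problem □ψ + F(dφ1, d²φ2) + F(dφ2, d²φ1) = 2G(dφ1, dφ2) with ψ(0,·) = 0 and ∂_tψ(0,·) = 0. Then for each h ∈ {1,2} and every list I of at most n−1 vector fields from Γ^{(h)}, sup_{t ≥ 0} ‖∂ V^I ψ‖_{L²(Σ_t)} ≤ C ε² / R. -/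

import Mathlib

open MeasureTheory

noncomputable section

/-- A spacetime point in `ℝ^{1+3}`; index `0` is the time coordinate. -/
abbrev Pt : Type := Fin 4 → ℝ

/-- A spatial point in `ℝ³`. -/
abbrev Sp : Type := Fin 3 → ℝ

/-- The inclusion of spatial indices into spacetime indices. -/
def sidx (i : Fin 3) : Fin 4 := i.succ

/-- Coordinate partial derivative `∂_i` on spacetime. -/
def pd (i : Fin 4) (f : Pt → ℝ) : Pt → ℝ := fun p => fderiv ℝ f p (Pi.single i 1)

/-- Derivative of `f` along the (spacetime) vector field `X`. -/
def vApp (X : Pt → Pt) (f : Pt → ℝ) : Pt → ℝ := fun p => fderiv ℝ f p (X p)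

/-- Successive application of a list of vector fields: `vIter [X₁, …, Xₘ] f = X₁ X₂ ⋯ Xₘ f`. -/
def vIter : List (Pt → Pt) → (Pt → ℝ) → Pt → ℝ
  | [], f => f
  | X :: L, f => vApp X (vIter L f)

/-- The Minkowski quadratic form on `ℝ^{1+3}`. -/
def mink (ξ : Pt) : ℝ := -(ξ 0) ^ 2 + (ξ 1) ^ 2 + (ξ 2) ^ 2 + (ξ 3) ^ 2

/-- The wave operator `□ = −∂_t² + Δ`. -/
def box (f : Pt → ℝ) : Pt → ℝ := fun p =>
  -pd 0 (pd 0 f) p + pd 1 (pd 1 f) p + pd 2 (pd 2 f) p + pd 3 (pd 3 f) p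

/-- A constant-coefficient trilinear classical null form. -/
def NullForm3 (F : Fin 4 → Fin 4 → Fin 4 → ℝ) : Prop :=
  ∀ ξ : Pt, mink ξ = 0 → (∑ a, ∑ b, ∑ c, F a b c * ξ a * ξ b * ξ c) = 0

/-- A constant-coefficient bilinear classical null form. -/
def NullForm2 (G : Fin 4 → Fin 4 → ℝ) : Prop :=
  ∀ ξ : Pt, mink ξ = 0 → (∑ a, ∑ b, G a b * ξ a * ξ b) = 0

/-- `F(dη, d²ζ) = F^{αβγ} ∂_αη ∂_β∂_γζ`. -/
def nf3 (F : Fin 4 → Fin 4 → Fin 4 → ℝ) (η ζ : Pt → ℝ) : Pt → ℝ := fun p =>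
  ∑ a, ∑ b, ∑ c, F a b c * pd a η p * pd b (pd c ζ) p

/-- `G(dη, dζ) = G^{αβ} ∂_αη ∂_βζ`. -/
def nf2 (G : Fin 4 → Fin 4 → ℝ) (η ζ : Pt → ℝ) : Pt → ℝ := fun p =>
  ∑ a, ∑ b, G a b * pd a η p * pd b ζ p

/-- Glue a time and a spatial point into a spacetime point. -/
def stp (t : ℝ) (x : Sp) : Pt := ![t, x 0, x 1, x 2]

/-- Euclidean length of a spatial point. -/
def rad3 (x : Sp) : ℝ := Real.sqrt ((x 0) ^ 2 + (x 1) ^ 2 + (x 2) ^ 2)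

/-- Euclidean distance between two spatial points. -/
def dist3 (x y : Sp) : ℝ := rad3 (x - y)

/-- Distance from the spatial part of the spacetime point `p` to the spatial center `q`. -/
def radq (q : Sp) (p : Pt) : ℝ :=
  Real.sqrt ((p 1 - q 0) ^ 2 + (p 2 - q 1) ^ 2 + (p 3 - q 2) ^ 2)

/-- `|∂f|` : the sum of the absolute values of the four coordinate derivatives. -/
def pdAbs (f : Pt → ℝ) (p : Pt) : ℝ :=
  |pd 0 f p| + |pd 1 f p| + |pd 2 f p| + |pd 3 f p|

/-- Sum of `|∂_a ∂_b f|` over all pairs of coordinate directions. -/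
def pd2Abs (f : Pt → ℝ) (p : Pt) : ℝ := ∑ a, ∑ b, |pd a (pd b f) p|

/-- Sum of `|∂_a ∂_b ∂_c f|` over all triples of coordinate directions. -/
def pd3Abs (f : Pt → ℝ) (p : Pt) : ℝ := ∑ a, ∑ b, ∑ c, |pd a (pd b (pd c f)) p|

/-- The null (outgoing) direction `∂_t + ∂_{r_q}` adapted to the spatial center `q`. -/
def nullVF (q : Sp) : Pt → Pt := fun p =>
  ![1, (p 1 - q 0) / radq q p, (p 2 - q 1) / radq q p, (p 3 - q 2) / radq q p]

/-- Rotation vector field about the center `q` in the spatial plane `(i,j)`. -/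
def rotVF (q : Sp) (i j : Fin 3) : Pt → Pt := fun p =>
  (p (sidx i) - q i) • (Pi.single (sidx j) 1 : Pt) -
    (p (sidx j) - q j) • (Pi.single (sidx i) 1 : Pt)

/-- `|∂̄^{(q)} f|` : sum of the absolute values of the good derivatives adapted to the
center `q`, namely `∂_t + ∂_{r_q}` and `(1+r_q)⁻¹` times each rotation about `q`. -/
def goodAbs (q : Sp) (f : Pt → ℝ) (p : Pt) : ℝ :=
  |vApp (nullVF q) f p|
    + (1 + radq q p)⁻¹ * |vApp (rotVF q 0 1) f p|
    + (1 + radq q p)⁻¹ * |vApp (rotVF q 0 2) f p|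
    + (1 + radq q p)⁻¹ * |vApp (rotVF q 1 2) f p|

/-- Translation vector field `∂_a`. -/
def transVF (a : Fin 4) : Pt → Pt := fun _ => Pi.single a 1

/-- Lorentz boost `t∂_{x_i} + (x_i − q_i)∂_t` centered at `q`. -/
def boostVF (q : Sp) (i : Fin 3) : Pt → Pt := fun p =>
  (p 0) • (Pi.single (sidx i) 1 : Pt) + (p (sidx i) - q i) • (Pi.single 0 1 : Pt)

/-- Scaling vector field `t∂_t + (x−q)·∇` centered at `q`. -/
def scaleVF (q : Sp) : Pt → Pt := fun p => ![p 0, p 1 - q 0, p 2 - q 1, p 3 - q 2]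

/-- Rescaling of a vector field by a constant. -/
def smulVF (c : ℝ) (X : Pt → Pt) : Pt → Pt := fun p => c • X p

/-- The spatial origin. -/
def o3 : Sp := ![0, 0, 0]

/-- The point `(a,0,0)` on the x-axis. -/
def axisPt (a : ℝ) : Sp := ![a, 0, 0]

/-- The eleven fields of `K` centered at `q`: translations, rotations, boosts and scaling. -/
def Kfields (q : Sp) : List (Pt → Pt) :=
  [transVF 0, transVF 1, transVF 2, transVF 3,
   rotVF q 0 1, rotVF q 0 2, rotVF q 1 2,
   boostVF q 0, boostVF q 1, boostVF q 2, scaleVF q]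

/-- `K_R` centered at `q`: the translations together with `R⁻¹` times the rotations,
boosts and scaling. -/
def KRfields (R : ℝ) (q : Sp) : List (Pt → Pt) :=
  [transVF 0, transVF 1, transVF 2, transVF 3] ++
    ([rotVF q 0 1, rotVF q 0 2, rotVF q 1 2,
      boostVF q 0, boostVF q 1, boostVF q 2, scaleVF q].map (smulVF R⁻¹))

/-- `Γ^{(a)}`: the good fields `Γ̄` (the rotation and boosts not involving `x`), the
translations, and `R⁻¹` times the rotations, boosts and scaling centered at `(a,0,0)`. -/
def GammaFields (R a : ℝ) : List (Pt → Pt) :=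
  [rotVF (axisPt a) 1 2, boostVF (axisPt a) 1, boostVF (axisPt a) 2,
   transVF 0, transVF 1, transVF 2, transVF 3] ++
    ([rotVF (axisPt a) 0 1, rotVF (axisPt a) 0 2, rotVF (axisPt a) 1 2,
      boostVF (axisPt a) 0, boostVF (axisPt a) 1, boostVF (axisPt a) 2,
      scaleVF (axisPt a)].map (smulVF R⁻¹))

/-- Spatial coordinate partial derivative. -/
def spd (i : Fin 3) (g : Sp → ℝ) : Sp → ℝ := fun x => fderiv ℝ g x (Pi.single i 1)

/-- Iterated spatial derivative along a list of coordinate directions. -/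
def spdIter : List (Fin 3) → (Sp → ℝ) → Sp → ℝ
  | [], g => g
  | i :: L, g => spd i (spdIter L g)

/-- `|∂̂^k g|` : the sum of the absolute values of all `k`-fold iterated spatial
coordinate partial derivatives of `g`. -/
def hatD (k : ℕ) (g : Sp → ℝ) (x : Sp) : ℝ :=
  ∑ I : Fin k → Fin 3, |spdIter (List.ofFn I) g x|

/-- The `L²(Σ_t)` norm of `f` on the time slice `Σ_t`. -/
def slice2 (f : Pt → ℝ) (t : ℝ) : ℝ := Real.sqrt (∫ x : Sp, (f (stp t x)) ^ 2)

/-- The `H^k(ℝ³)` Sobolev norm (square root of the sum of the squared `L²` norms of all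
iterated spatial derivatives of order at most `k`). -/
def sobNorm (k : ℕ) (g : Sp → ℝ) : ℝ :=
  Real.sqrt (∑ j ∈ Finset.range (k + 1), ∑ I : Fin j → Fin 3,
    ∫ x : Sp, (spdIter (List.ofFn I) g x) ^ 2)

/-- Derivative of `g : ℝ³ → ℝ` along a spatial vector field. -/
def svApp (X : Sp → Sp) (g : Sp → ℝ) : Sp → ℝ := fun x => fderiv ℝ g x (X x)

/-- Successive application of a list of spatial vector fields. -/
def svIter : List (Sp → Sp) → (Sp → ℝ) → Sp → ℝ
  | [], g => g
  | X :: L, g => svApp X (svIter L g)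

/-- The point of the unit sphere with spherical angles `(θ, φ)` (measured from the x-axis). -/
def sphPt (θ φ : ℝ) : Sp :=
  ![Real.cos θ, Real.sin θ * Real.cos φ, Real.sin θ * Real.sin φ]

/-- The point of the hyperboloid `H_τ` with parameters `(α, x, φ)`. -/
def hpt (τ α x φ : ℝ) : Pt :=
  ![τ * Real.cosh α, x, τ * Real.sinh α * Real.cos φ, τ * Real.sinh α * Real.sin φ]

open Finset (sum_congr mul_sum sum_mul sum_comm sum_le_card_nsmul univ single_le_sum sum_nonneg sum_add_distrib abs_sum_le_sum_abs range mem_univ sum_sub_distrib sum_le_sum card_univ sum_neg_distrib sum_eq_zero sum_le_sum_of_subset_of_nonneg mem_range card_le_card)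
open ENNReal (ofReal ofReal_mul ofReal_le_ofReal)
open Set (Icc)

/-- A real function on spacetime. -/
notation "Fld" => Pt → ℝ

/-- The coefficients of a bilinear form. -/
abbrev Ten2 := Fin 4 → Fin 4 → ℝ

/-- The coefficients of a trilinear form. -/
abbrev Ten3 := Fin 4 → Fin 4 → Fin 4 → ℝ

variable {A B C D K L M R S T c c1 c2 m r t β ε : ℝ} {W e f g h v φ ψ : Fld} {γ : ℝ → Pt} {p : Pt} {F : Ten3} {k n : ℕ} {G : Ten2}

/-- Smoothness of a function. -/
notation "Sm" f:max => ContDiff ℝ (⊤ : ℕ∞) f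

lemma ContDiff.diffble (hf : Sm f) : Differentiable ℝ f := hf.differentiable (by simp)

@[fun_prop]
lemma ContDiff.pd (hf : Sm f) (a : Fin 4) : Sm (pd a f) := by
  have h : ContDiff ℝ (⊤ : ℕ∞) (fderiv ℝ f) := hf.fderiv_right (by simp)
  exact h.clm_apply contDiff_const

lemma vApp_eq (X : Pt → Pt) (p : Pt) : vApp X f p = ∑ a, X p a * pd a f p := by
  have h : X p = ∑ a, X p a • (Pi.single a 1 : Pt) := by
    ext i
    simp [Finset.sum_apply, Pi.single_apply]
  unfold vApp pd
  conv_lhs => rw [h]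
  simp [map_sum]

lemma pd_add (hf : Sm f) (hg : Sm g) (a : Fin 4) : pd a (fun p => f p + g p) = fun p => pd a f p +
    pd a g p := by
  ext p
  simp [pd, fderiv_fun_add (hf.diffble p) (hg.diffble p)]

lemma pd_sub (hf : Sm f) (hg : Sm g) (a : Fin 4) : pd a (fun p => f p - g p) = fun p => pd a f p -
    pd a g p := by
  ext p
  simp [pd, fderiv_fun_sub (hf.diffble p) (hg.diffble p)]

lemma pd_neg (a : Fin 4) : pd a (fun p => - f p) = fun p => - pd a f p := by
  ext p
  simp [pd]

lemma pd_mul (hf : Sm f) (hg : Sm g) (a : Fin 4) : pd a (fun p => f p * g p) = fun p => f p * pd a g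
    p + g p * pd a f p := by
  ext p
  simp [pd, fderiv_fun_mul (hf.diffble p) (hg.diffble p)]

lemma pd_const_mul (hf : Sm f) (c : ℝ) (a : Fin 4) : pd a (fun p => c * f p) = fun p => c * pd a f p
    := by
  ext p
  simp [pd, fderiv_const_mul (hf.diffble p)]

lemma pd_const (c : ℝ) (a : Fin 4) : pd a (fun _ => c) = fun _ => 0 := by
  ext p
  simp [pd]

lemma pd_coord (b a : Fin 4) : pd a (fun p => p b) = fun _ => if b = a then 1 else 0 := by
  ext p
  have : HasFDerivAt (fun p : Pt => p b) (ContinuousLinearMap.proj (R := ℝ) (φ := fun _ : Fin 4 => ℝ) b) p :=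
    (ContinuousLinearMap.proj (R := ℝ) (φ := fun _ : Fin 4 => ℝ) b).hasFDerivAt
  simp [pd, this.fderiv, Pi.single_apply]

lemma pd_sq (hf : Sm f) (a : Fin 4) : pd a (fun p => f p ^ 2) = fun p => 2 * f p * pd a f p := by
  have : (fun p => f p ^ 2) = fun p => f p * f p := by ext; ring
  rw [this, pd_mul hf hf]
  ext; ring

lemma pd_sum {ι : Type*} (s : Finset ι) {f : ι → Fld} (hf : ∀ i, Sm (f i)) (a : Fin 4) : pd a (fun p
    => ∑ i ∈ s, f i p) = fun p => ∑ i ∈ s, pd a (f i) p := by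
  classical
  induction s using Finset.induction_on with
  | empty => simpa using pd_const 0 a
  | insert i s hi ih =>
    simp only [Finset.sum_insert hi]
    rw [pd_add (hf i) (ContDiff.sum fun i _ => hf i), ih]

lemma pd_comm (hf : Sm f) (a b : Fin 4) : pd a (pd b f) = pd b (pd a f) := by
  have h : ContDiff ℝ (⊤ : ℕ∞) (fderiv ℝ f) := hf.fderiv_right (by simp)
  have hd : Differentiable ℝ (fderiv ℝ f) := h.differentiable (by simp)
  have key : ∀ a b p, pd a (pd b f) p = fderiv ℝ (fderiv ℝ f) p (Pi.single a 1) (Pi.single b 1) := by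
    intro a b p
    unfold pd
    rw [fderiv_clm_apply (hd p) (differentiableAt_const _)]
    simp
  ext p
  rw [key, key]
  exact (hf.contDiffAt (x := p)).isSymmSndFDerivAt (by
    simpa using WithTop.coe_le_coe.2 (le_top (a := (2 : ℕ∞)))) _ _

/-- Vanishing on the closed upper half space is inherited by derivatives. -/
lemma pd_eq_zero_of_halfspace {U : Set Pt} (hU : IsOpen U) (hs : Sm h) (hz : ∀ p ∈ U, 0 ≤ p 0 → h p
    = 0) (a : Fin 4) : ∀ p ∈ U, 0 ≤ p 0 → pd a h p = 0 := by
  have hpos : ∀ p ∈ U, 0 < p 0 → pd a h p = 0 := fun p hp h0 => by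
    have : h =ᶠ[nhds p] fun _ => 0 := by
      filter_upwards [hU.mem_nhds hp, (continuous_apply (0 : Fin 4)).continuousAt.eventually
        (lt_mem_nhds h0)] with q h1 h2 using hz q h1 h2.le
    simp [pd, this.fderiv_eq]
  intro p hp h0
  have hl : Continuous fun s : ℝ => p + s • (Pi.single 0 1 : Pt) := by fun_prop
  have h1 : Filter.Tendsto (fun s : ℝ => pd a h (p + s • (Pi.single 0 1 : Pt)))
      (nhdsWithin 0 (Set.Ioi 0)) (nhds (pd a h p)) := by
    simpa [Function.comp_def] using (((hs.pd a).continuous.comp hl).tendsto 0).mono_left nhdsWithin_le_nhds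
  refine tendsto_nhds_unique h1 (tendsto_const_nhds.congr' ?_)
  filter_upwards [self_mem_nhdsWithin, nhdsWithin_le_nhds (hl.continuousAt.eventually (hU.mem_nhds
    (by simpa using hp)))] with s hs hs'
  exact (hpos _ hs' (by simpa using add_pos_of_nonneg_of_pos h0 hs)).symm

lemma contDiff_stp (t : ℝ) : ContDiff ℝ (⊤ : ℕ∞) (fun x : Sp => stp t x) := by
  rw [contDiff_pi]
  intro i
  fin_cases i <;> simp [stp] <;> fun_prop

@[fun_prop]
lemma continuous_stp : Continuous (fun q : ℝ × Sp => stp q.1 q.2) := by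
  refine continuous_pi fun i => ?_
  fin_cases i <;> simp [stp] <;> fun_prop

@[fun_prop]
lemma continuous_stp_right (t : ℝ) : Continuous (fun x : Sp => stp t x) :=
  (contDiff_stp t).continuous

@[simp] lemma stp_zero (t : ℝ) (x : Sp) : stp t x 0 = t := rfl
@[simp] lemma stp_one (t : ℝ) (x : Sp) : stp t x 1 = x 0 := rfl
@[simp] lemma stp_two (t : ℝ) (x : Sp) : stp t x 2 = x 1 := rfl
@[simp] lemma stp_three (t : ℝ) (x : Sp) : stp t x 3 = x 2 := rfl

lemma stp_sidx (t : ℝ) (x : Sp) (i : Fin 3) : stp t x (sidx i) = x i := by fin_cases i <;> rfl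

lemma stp_eta (p : Pt) : stp (p 0) (fun i => p (sidx i)) = p := by
  ext i
  fin_cases i <;> rfl

/-- Length of the spatial part of a spacetime point. -/
def rr (p : Pt) : ℝ := Real.sqrt ((p 1) ^ 2 + (p 2) ^ 2 + (p 3) ^ 2)

lemma rr_nonneg (p : Pt) : 0 ≤ rr p := Real.sqrt_nonneg _

lemma rr_sq (p : Pt) : rr p ^ 2 = (p 1) ^ 2 + (p 2) ^ 2 + (p 3) ^ 2 := Real.sq_sqrt (by positivity)

@[fun_prop]
lemma continuous_rr : Continuous rr := by
  unfold rr
  fun_prop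

lemma abs_coord_le_rr (p : Pt) (i : Fin 3) : |p (sidx i)| ≤ rr p := by
  apply Real.abs_le_sqrt
  fin_cases i <;> simp [sidx] <;> nlinarith [sq_nonneg (p 1), sq_nonneg (p 2), sq_nonneg (p 3)]

/-- Outgoing spatial support: `f` vanishes for `r > M + t`, `t ≥ 0`. -/
def Supp (M : ℝ) (f : Fld) : Prop := ∀ p : Pt, 0 ≤ p 0 → M + p 0 < rr p → f p = 0

lemma Supp.pder (hs : Sm f) (h : Supp M f) (a : Fin 4) : Supp M (pd a f) := by
  intro p h0 hp
  refine pd_eq_zero_of_halfspace (U := {p : Pt | M + p 0 < rr p}) ?_ hs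
    (fun q hq h0 => h q h0 hq) a p hp h0
  exact isOpen_lt (by fun_prop) (by fun_prop)

lemma Supp.sub (hf : Supp M f) (hg : Supp M g) : Supp M (fun p => f p - g p) := fun p h0 hp => by
    simp [hf p h0 hp, hg p h0 hp]

lemma Supp.mul_left (hg : Supp M g) : Supp M (fun p => f p * g p) := fun p h0 hp => by simp [hg p h0
    hp]

lemma Supp.mul_right (hf : Supp M f) : Supp M (fun p => f p * g p) := fun p h0 hp => by simp [hf p
    h0 hp]

lemma Supp.mono {M' : ℝ} (hf : Supp M f) (h : M ≤ M') : Supp M' f :=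
  fun p h0 hp => hf p h0 (by linarith)

lemma Supp.zero_of_notMem (hf : Supp M f) (ht : 0 ≤ t) (hT : t ≤ T) {x : Sp} (hx : x ∉
    Metric.closedBall (0 : Sp) (max (M + T) 0)) : f (stp t x) = 0 := by
  apply hf _ ht
  by_contra hc
  apply hx
  rw [mem_closedBall_zero_iff, pi_norm_le_iff_of_nonneg (le_max_right _ _)]
  intro i
  have := abs_coord_le_rr (stp t x) i
  rw [stp_sidx] at this
  rw [Real.norm_eq_abs]
  refine le_trans this (le_trans (not_lt.1 hc) (le_trans ?_ (le_max_left _ _)))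
  simpa using hT

lemma Supp.hasCompactSupport (hf : Supp M f) (ht : 0 ≤ t) : HasCompactSupport (fun x : Sp => f (stp
    t x)) :=
  HasCompactSupport.intro (isCompact_closedBall (0 : Sp) (max (M + t) 0))
    fun _ hx => hf.zero_of_notMem ht le_rfl hx

lemma Supp.integrable (hc : Continuous f) (hf : Supp M f) (ht : 0 ≤ t) : Integrable (fun x : Sp => f
    (stp t x)) :=
  (hc.comp (continuous_stp_right t)).integrable_of_hasCompactSupport (hf.hasCompactSupport ht)

lemma Supp.continuousOn_integral (hc : Continuous f) (hf : Supp M f) (T : ℝ) : ContinuousOn (fun t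
    => ∫ x, f (stp t x)) (Icc 0 T) := by
  refine continuousOn_integral_of_compact_support (f := fun t x => f (stp t x))
    (isCompact_closedBall (0 : Sp) (max (M + T) 0)) ?_ ?_
  · exact (hc.comp continuous_stp).continuousOn
  · intro t x ht hx
    exact hf.zero_of_notMem ht.1 ht.2 hx

lemma hasDerivAt_comp_stp (hs : Sm f) (t : ℝ) (x : Sp) : HasDerivAt (fun t => f (stp t x)) (pd 0 f
    (stp t x)) t := by
  have h1 : HasDerivAt (fun t => stp t x) (Pi.single 0 1) t := by
    rw [hasDerivAt_pi]
    intro i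
    fin_cases i
    · exact hasDerivAt_id t
    all_goals simpa [stp, Pi.single_apply] using hasDerivAt_const t _
  exact (hs.diffble (stp t x)).hasFDerivAt.comp_hasDerivAt t h1

lemma Supp.hasDerivAt_integral (hs : Sm f) (hf : Supp M f) (ht : 0 < t) : HasDerivAt (fun t => ∫ x,
    f (stp t x)) (∫ x, pd 0 f (stp t x)) t := by
  have hK := isCompact_closedBall (0 : Sp) (max (M + 2 * t) 0)
  have hK2 : IsCompact (Icc 0 (2 * t) ×ˢ Metric.closedBall (0 : Sp) (max (M + 2 * t) 0)) :=
    isCompact_Icc.prod hK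
  have hc : Continuous (fun q : ℝ × Sp => pd 0 f (stp q.1 q.2)) :=
    (hs.pd 0).continuous.comp continuous_stp
  obtain ⟨B, hB⟩ := hK2.exists_bound_of_continuousOn hc.continuousOn
  have hfc : ∀ t, Continuous fun x => f (stp t x) := fun t =>
    hs.continuous.comp (continuous_stp_right t)
  refine (hasDerivAt_integral_of_dominated_loc_of_deriv_le (s := Set.Ioo 0 (2 * t)) (F := fun t x =>
    f (stp t x)) (F' := fun t x => pd 0 f (stp t x)) (bound := (Metric.closedBall (0 : Sp) (max (M +
    2 * t) 0)).indicator fun _ => B) (Ioo_mem_nhds ht (by linarith)) ?_ ?_ ?_ ?_ ?_ ?_).2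
  · exact .of_forall fun t => (hfc t).aestronglyMeasurable
  · exact hf.integrable hs.continuous ht.le
  · exact ((hs.pd 0).continuous.comp (continuous_stp_right t)).aestronglyMeasurable
  · refine .of_forall fun x s hs' => ?_
    by_cases hx : x ∈ Metric.closedBall (0 : Sp) (max (M + 2 * t) 0)
    · rw [Set.indicator_of_mem hx]
      exact hB (s, x) ⟨⟨hs'.1.le, hs'.2.le⟩, hx⟩
    · rw [Set.indicator_of_notMem hx, (hf.pder hs 0).zero_of_notMem hs'.1.le hs'.2.le hx]
      simp
  · exact (integrable_indicator_iff measurableSet_closedBall).2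
      (integrableOn_const hK.measure_lt_top.ne)
  · exact .of_forall fun x s _ => hasDerivAt_comp_stp hs s x

lemma spd_comp_stp (hf : Sm f) (t : ℝ) (i : Fin 3) : spd i (fun y => f (stp t y)) = fun y => pd
    (sidx i) f (stp t y) := by
  funext x
  have h : HasFDerivAt (stp t) (.pi ![0, .proj 0, .proj 1, .proj 2] : Sp →L[ℝ] Pt) x := by
    refine hasFDerivAt_pi.2 fun j => ?_
    fin_cases j
    exacts [hasFDerivAt_const t x, hasFDerivAt_apply _ x, hasFDerivAt_apply _ x, hasFDerivAt_apply _
      x]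
  have h1 : fderiv ℝ (fun y => f (stp t y)) x = _ :=
    ((hf.diffble (stp t x)).hasFDerivAt.comp x h).fderiv
  rw [spd, h1, pd, ContinuousLinearMap.comp_apply]
  congr 1
  ext j
  fin_cases i <;> fin_cases j <;> simp [sidx]

lemma Supp.integral_pd_eq_zero (hs : Sm f) (hf : Supp M f) (ht : 0 ≤ t) (i : Fin 3) : ∫ x, pd (sidx
     i) f (stp t x) = 0 := by
  have hi := (hf.pder hs (sidx i)).integrable (hs.pd (sidx i)).continuous ht
  have e : ∀ x, fderiv ℝ (fun y => f (stp t y)) x (Pi.single i 1) = pd (sidx i) f (stp t x) :=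
    congrFun (spd_comp_stp hs t i)
  simpa [e] using integral_mul_fderiv_eq_neg_fderiv_mul_of_integrable (μ := volume)
    (f := fun _ : Sp => (1 : ℝ)) (g := fun x => f (stp t x)) (v := Pi.single i 1) (by simp)
    (by simpa [e] using hi) (by simpa using hf.integrable hs.continuous ht) (fun _ _ => by fun_prop)
    fun x _ => (hs.comp (contDiff_stp t)).differentiable (by simp) x

/-- Energy inequality from a differential identity in divergence form. -/
lemma energy_le {P : Fin 3 → Fld} (he : Sm e) (hP : ∀ i, Sm (P i)) (hes : Supp M e) (hPs : ∀ i, Supp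
    M (P i)) (heq : ∀ p : Pt, 0 ≤ p 0 → pd 0 e p + ∑ i, pd (sidx i) (P i) p = g p) (hS : 0 ≤ S) (hT
     : S ≤ T) {b b' : ℝ → ℝ} (hbc : ContinuousOn b (Icc S T)) (hb : ∀ t ∈ Set.Ioo S T, HasDerivAt b
    (b' t) t) (hg : ∀ t ∈ Set.Ioo S T, ∫ x, g (stp t x) ≤ b' t) : ∫ x, e (stp T x) ≤ (∫ x, e (stp S
    x)) + (b T - b S) := by
  have hd : ∀ t ∈ Set.Ioo S T, HasDerivAt (fun t => ∫ x, e (stp t x))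
      (∫ x, g (stp t x)) t := by
    intro t ht
    have h1 := hes.hasDerivAt_integral he (hS.trans_lt ht.1)
    have h2 : ∫ x, g (stp t x) = ∫ x, pd 0 e (stp t x) := by
      have : ∀ x : Sp, g (stp t x) = pd 0 e (stp t x) + ∑ i, pd (sidx i) (P i) (stp t x) :=
        fun x => (heq _ (hS.trans ht.1.le)).symm
      simp only [this]
      have hi := fun i => ((hPs i).pder (hP i) (sidx i)).integrable ((hP i).pd _).continuous (hS.trans ht.1.le)
      rw [integral_add ((hes.pder he 0).integrable (he.pd 0).continuous (hS.trans ht.1.le))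
        (integrable_finsetSum _ fun i _ => hi i), integral_finsetSum _ fun i _ => hi i]
      simp [Supp.integral_pd_eq_zero (hP _) (hPs _) (hS.trans ht.1.le)]
    rwa [h2]
  have hanti : AntitoneOn (fun t => (∫ x, e (stp t x)) - b t) (Icc S T) := by
    apply antitoneOn_of_deriv_nonpos (convex_Icc S T)
    · exact ((hes.continuousOn_integral he.continuous T).mono (Set.Icc_subset_Icc_left hS)).sub hbc
    · intro t ht
      rw [interior_Icc] at ht
      exact ((hd t ht).sub (hb t ht)).differentiableAt.differentiableWithinAt
    · intro t ht
      rw [interior_Icc] at ht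
      have : deriv (fun t => (∫ x, e (stp t x)) - b t) t = _ := ((hd t ht).sub (hb t ht)).deriv
      rw [this]
      linarith [hg t ht]
  have := hanti (Set.left_mem_Icc.2 hT) (Set.right_mem_Icc.2 hT) hT
  simp only at this
  linarith

lemma sidx_zero : sidx 0 = 1 := rfl
lemma sidx_one : sidx 1 = 2 := rfl
lemma sidx_two : sidx 2 = 3 := rfl

/-- Labels of the conformal Killing fields: translations, Lorentz fields, scaling. -/
abbrev ZI : Type := Fin 4 ⊕ (Fin 4 × Fin 4) ⊕ Unit

/-- Diagonal of the Minkowski metric. -/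
def m4 : Fin 4 → ℝ := ![-1, 1, 1, 1]

/-- Linear part of the field with label `Z`. -/
def zA : ZI → Ten2
  | Sum.inl _ => fun _ _ => 0
  | Sum.inr (Sum.inl (a, b)) => fun d c =>
      (if c = a then m4 a else 0) * (if d = b then 1 else 0)
        - (if c = b then m4 b else 0) * (if d = a then 1 else 0)
  | Sum.inr (Sum.inr _) => fun d c => if d = c then 1 else 0

/-- Constant part of the field with label `Z`. -/
def zb : ZI → Fin 4 → ℝ
  | Sum.inl d => fun a => if a = d then 1 else 0
  | Sum.inr _ => fun _ => 0

/-- Action of the field with label `Z`. -/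
def zap (Z : ZI) (f : Fld) : Fld := fun p =>
  ∑ a, (zb Z a + ∑ c, zA Z a c * p c) * pd a f p

/-- Iterated action; the head of the list acts first. -/
def gam : List ZI → (Fld) → Fld
  | [], f => f
  | Z :: J, f => gam J (zap Z f)

lemma zap_tr (a : Fin 4) (f : Fld) : zap (Sum.inl a) f = pd a f := by
  ext p
  simp [zap, zb, zA]

lemma zap_lor (a b : Fin 4) (f : Fld) (p : Pt) :
    zap (Sum.inr (Sum.inl (a, b))) f p = m4 a * p a * pd b f p - m4 b * p b * pd a f p := by
  simp [zap, zb, zA, sub_mul, sum_sub_distrib, mul_assoc]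

lemma zap_sc (f : Fld) (p : Pt) :
    zap (Sum.inr (Sum.inr ())) f p = ∑ a, p a * pd a f p := by
  simp [zap, zb, zA]

@[fun_prop]
lemma ContDiff.zap (hf : Sm f) (Z : ZI) : Sm (zap Z f) := by
  unfold _root_.zap
  fun_prop

@[fun_prop]
lemma ContDiff.gam (hf : Sm f) (J : List ZI) : Sm (gam J f) := by
  induction J generalizing f with
  | nil => exact hf
  | cons Z J ih => exact ih (hf.zap Z)

lemma gam_append (J K : List ZI) (f : Fld) : gam (J ++ K) f = gam K (gam J f) := by
  induction J generalizing f with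
  | nil => rfl
  | cons Z J ih => exact ih _

lemma gam_snoc (J : List ZI) (Z : ZI) (f : Fld) : gam (J ++ [Z]) f = zap Z (gam J f) :=
  gam_append J [Z] f

lemma Supp.zap (hs : Sm f) (h : Supp M f) (Z : ZI) :
    Supp M (zap Z f) := by
  intro p h0 hp
  simp [_root_.zap, h.pder hs _ p h0 hp]

lemma Supp.gam (hs : Sm f) (h : Supp M f) (J : List ZI) :
    Supp M (gam J f) := by
  induction J generalizing f with
  | nil => exact h
  | cons Z J ih => exact ih (hs.zap Z) (h.zap hs Z)

lemma zap_add (hf : Sm f) (hg : Sm g) (Z : ZI) :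
    zap Z (fun p => f p + g p) = fun p => zap Z f p + zap Z g p := by
  ext p
  simp [zap, pd_add hf hg, mul_add, sum_add_distrib]

lemma zap_const_mul (hf : Sm f) (c : ℝ) (Z : ZI) :
    zap Z (fun p => c * f p) = fun p => c * zap Z f p := by
  ext p
  simp only [zap, pd_const_mul hf, mul_sum]
  exact sum_congr rfl fun _ _ => by ring

lemma zap_mul (hf : Sm f) (hg : Sm g) (Z : ZI) :
    zap Z (fun p => f p * g p) = fun p => zap Z f p * g p + f p * zap Z g p := by
  ext p
  simp only [zap, pd_mul hf hg, sum_mul, mul_sum, ← sum_add_distrib]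
  exact sum_congr rfl fun _ _ => by ring

lemma zap_sum {ι : Type*} (s : Finset ι) {f : ι → Fld} (hf : ∀ i, Sm (f i)) (Z : ZI) :
    zap Z (fun p => ∑ i ∈ s, f i p) = fun p => ∑ i ∈ s, zap Z (f i) p := by
  ext p
  simp only [zap, pd_sum s hf, mul_sum]
  rw [sum_comm]

lemma gam_add (hf : Sm f) (hg : Sm g) (J : List ZI) :
    gam J (fun p => f p + g p) = fun p => gam J f p + gam J g p := by
  induction J generalizing f g with
  | nil => rfl
  | cons Z J ih => simp only [gam]; rw [zap_add hf hg, ih (hf.zap Z) (hg.zap Z)]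

lemma gam_const_mul (hf : Sm f) (c : ℝ) (J : List ZI) :
    gam J (fun p => c * f p) = fun p => c * gam J f p := by
  induction J generalizing f with
  | nil => rfl
  | cons Z J ih => simp only [gam]; rw [zap_const_mul hf, ih (hf.zap Z)]

lemma gam_sum {ι : Type*} (s : Finset ι) {f : ι → Fld} (hf : ∀ i, Sm (f i)) (J : List ZI) :
    gam J (fun p => ∑ i ∈ s, f i p) = fun p => ∑ i ∈ s, gam J (f i) p := by
  induction J generalizing f with
  | nil => rfl
  | cons Z J ih => simp only [gam]; rw [zap_sum s hf, ih fun i => (hf i).zap Z]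

/-- Commutator of a coordinate derivative with a field. -/
lemma pd_zap (hf : Sm f) (Z : ZI) (c : Fin 4) :
    pd c (zap Z f) = fun p => zap Z (pd c f) p + ∑ a, zA Z a c * pd a f p := by
  ext p
  have hlin : ∀ a : Fin 4, pd c (fun p : Pt => zb Z a + ∑ d, zA Z a d * p d) = fun _ => zA Z a c := by
    intro a
    rw [pd_add contDiff_const (by fun_prop), pd_const, pd_sum _ (fun d => by fun_prop)]
    ext p
    have : ∀ d : Fin 4, pd c (fun p : Pt => zA Z a d * p d) p = if d = c then zA Z a d else 0 := by
      intro d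
      rw [pd_const_mul (by fun_prop), pd_coord]
      simp
    simp [this]
  have h2 : ∀ a : Fin 4, pd c (fun p : Pt => (zb Z a + ∑ d, zA Z a d * p d) * pd a f p)
      = fun p => (zb Z a + ∑ d, zA Z a d * p d) * pd a (pd c f) p + pd a f p * zA Z a c := by
    intro a
    rw [pd_mul (by fun_prop) (by fun_prop), hlin, pd_comm hf]
  have h3 : zap Z f = fun p => ∑ a, (zb Z a + ∑ d, zA Z a d * p d) * pd a f p := rfl
  rw [h3, pd_sum _ (fun a => by fun_prop)]
  simp only [h2, sum_add_distrib, zap]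
  congr 1
  exact sum_congr rfl fun _ _ => by ring

lemma box_eq (f : Fld) : box f = fun p => ∑ d, m4 d * pd d (pd d f) p := by
  ext p
  simp [box, Fin.sum_univ_four, m4]

@[fun_prop]
lemma ContDiff.box (hf : Sm f) : Sm (box f) := by
  rw [box_eq]
  fun_prop

lemma box_add (hf : Sm f) (hg : Sm g) :
    box (fun p => f p + g p) = fun p => box f p + box g p := by
  ext p
  simp (disch := fun_prop) only [box, pd_add]
  ring

lemma box_const_mul (hf : Sm f) (c : ℝ) :
    box (fun p => c * f p) = fun p => c * box f p := by
  ext p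
  simp (disch := fun_prop) only [box, pd_const_mul]
  ring

lemma box_sum {ι : Type*} (s : Finset ι) {f : ι → Fld} (hf : ∀ i, Sm (f i)) :
    box (fun p => ∑ i ∈ s, f i p) = fun p => ∑ i ∈ s, box (f i) p := by
  ext p
  simp only [box, pd_sum s hf, pd_sum s fun i => (hf i).pd _, sum_add_distrib,
    sum_neg_distrib]

lemma box_mul (hf : Sm f) (hg : Sm g) :
    box (fun p => f p * g p) = fun p => f p * box g p + g p * box f p
      + 2 * ∑ d, m4 d * (pd d f p * pd d g p) := by
  ext p
  simp (disch := fun_prop) only [box, pd_mul, pd_add]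
  simp [Fin.sum_univ_four, m4]
  ring

/-- Scaling weight: `[□, Z] = zw Z □`. -/
def zw : ZI → ℝ
  | Sum.inl _ => 0
  | Sum.inr (Sum.inl _) => 0
  | Sum.inr (Sum.inr _) => 2

lemma zA_sym (Z : ZI) (a d : Fin 4) :
    m4 d * zA Z a d + m4 a * zA Z d a = if a = d then zw Z * m4 a else 0 := by
  rcases Z with c | ⟨⟨b, c⟩⟩ | u
  · simp [zA, zw]
  · revert a b c d
    simp only [Fin.forall_fin_succ, zA, m4, zw]
    simp [Fin.ext_iff]
  · by_cases h : a = d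
    · subst h; simp [zA, zw]; ring
    · simp [zA, h, Ne.symm h]

lemma box_zap (hf : Sm f) (Z : ZI) :
    box (zap Z f) = fun p => zap Z (box f) p + zw Z * box f p := by
  ext p
  have h1 : ∀ d, pd d (pd d (zap Z f)) p = zap Z (pd d (pd d f)) p
      + 2 * ∑ a, zA Z a d * pd a (pd d f) p := by
    intro d
    rw [pd_zap hf, pd_add (by fun_prop) (by fun_prop), pd_zap (hf.pd d), pd_sum _ (fun a => by fun_prop)]
    have : ∀ a, pd d (fun p => zA Z a d * pd a f p) p = zA Z a d * pd a (pd d f) p := by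
      intro a
      rw [pd_const_mul (by fun_prop), pd_comm hf]
    simp only [this]
    ring
  have h2 : zap Z (box f) p = ∑ d, m4 d * zap Z (pd d (pd d f)) p := by
    rw [box_eq, zap_sum _ (fun d => by fun_prop)]
    exact sum_congr rfl fun d _ => by rw [zap_const_mul (by fun_prop)]
  rw [h2, box_eq, box_eq]
  simp only [h1, mul_add, sum_add_distrib]
  congr 1
  have h3 : ∀ a d : Fin 4, pd a (pd d f) p = pd d (pd a f) p := fun a d => by rw [pd_comm hf]
  have h4 : ∑ d, m4 d * (2 * ∑ a, zA Z a d * pd a (pd d f) p)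
      = ∑ d, ∑ a, (m4 d * zA Z a d + m4 a * zA Z d a) * pd a (pd d f) p := by
    have e1 : ∑ d, ∑ a, m4 a * zA Z d a * pd a (pd d f) p
        = ∑ d, ∑ a, m4 d * zA Z a d * pd a (pd d f) p := by
      rw [sum_comm]
      exact sum_congr rfl fun d _ => sum_congr rfl fun a _ => by rw [h3]
    simp only [add_mul, sum_add_distrib]
    rw [e1, ← sum_add_distrib]
    refine sum_congr rfl fun d _ => ?_
    rw [← two_mul, mul_sum, mul_sum, mul_sum]
    exact sum_congr rfl fun a _ => by ring
  rw [h4]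
  simp only [zA_sym, ite_mul, zero_mul]
  simp [mul_sum, mul_assoc]

variable {J : List ZI}

/-- `1 + t + r`. -/
def ss (p : Pt) : ℝ := 1 + p 0 + rr p

/-- Sum of squares of the coordinate derivatives. -/
def flatE (v : Fld) : Fld := fun p =>
  (pd 0 v p) ^ 2 + (pd 1 v p) ^ 2 + (pd 2 v p) ^ 2 + (pd 3 v p) ^ 2

/-- `S v + 2 v`. -/
def scal2 (v : Fld) : Fld := fun p =>
  p 0 * pd 0 v p + p 1 * pd 1 v p + p 2 * pd 2 v p + p 3 * pd 3 v p + 2 * v p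

/-- Conformal energy density (twice the usual normalization). -/
def confE (v : Fld) : Fld := fun p =>
  (pd 0 v p) ^ 2 + (pd 1 v p) ^ 2 + (pd 2 v p) ^ 2 + (pd 3 v p) ^ 2 + (scal2 v p) ^ 2
    + (p 0 * pd 1 v p + p 1 * pd 0 v p) ^ 2 + (p 0 * pd 2 v p + p 2 * pd 0 v p) ^ 2
    + (p 0 * pd 3 v p + p 3 * pd 0 v p) ^ 2
    + (p 1 * pd 2 v p - p 2 * pd 1 v p) ^ 2 + (p 1 * pd 3 v p - p 3 * pd 1 v p) ^ 2
    + (p 2 * pd 3 v p - p 3 * pd 2 v p) ^ 2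

@[fun_prop] lemma ContDiff.flatE (hv : Sm v) : Sm (flatE v) := by
  unfold _root_.flatE; fun_prop

@[fun_prop] lemma ContDiff.scal2 (hv : Sm v) : Sm (scal2 v) := by
  unfold _root_.scal2; fun_prop

@[fun_prop] lemma ContDiff.confE (hv : Sm v) : Sm (confE v) := by
  unfold _root_.confE; fun_prop

lemma flatE_nonneg (v : Fld) (p : Pt) : 0 ≤ flatE v p := by unfold flatE; positivity

lemma confE_nonneg (v : Fld) (p : Pt) : 0 ≤ confE v p := by unfold confE; positivity

lemma flatE_le_confE (v : Fld) (p : Pt) : flatE v p ≤ confE v p := by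
  unfold flatE confE
  nlinarith [sq_nonneg (scal2 v p), sq_nonneg (p 0 * pd 1 v p + p 1 * pd 0 v p), sq_nonneg (p 0 * pd
    2 v p + p 2 * pd 0 v p), sq_nonneg (p 0 * pd 3 v p + p 3 * pd 0 v p), sq_nonneg (p 1 * pd 2 v p
    - p 2 * pd 1 v p), sq_nonneg (p 1 * pd 3 v p - p 3 * pd 1 v p), sq_nonneg (p 2 * pd 3 v p - p 3
    * pd 2 v p)]

lemma Supp.flatE (hs : Sm v) (h : Supp M v) : Supp M (flatE v) := by
  intro p h0 hp
  simp [_root_.flatE, h.pder hs _ p h0 hp]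

lemma Supp.scal2 (hs : Sm v) (h : Supp M v) : Supp M (scal2 v) := by
  intro p h0 hp
  simp [_root_.scal2, h.pder hs _ p h0 hp, h p h0 hp]

lemma Supp.confE (hs : Sm v) (h : Supp M v) : Supp M (confE v) := by
  intro p h0 hp
  simp [_root_.confE, h.pder hs _ p h0 hp, h.scal2 hs p h0 hp]

lemma Supp.box (hs : Sm v) (h : Supp M v) : Supp M (box v) := by
  intro p h0 hp
  simp [_root_.box, (h.pder hs _).pder (hs.pd _) _ p h0 hp]

/-- Energy inequality with a source bounded through Cauchy--Schwarz and power weights. -/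
lemma energy_le_rpow {X Y : Fld} {P : Fin 3 → Fld} (he : Sm e) (hP : ∀ i, Sm (P i)) (hes : Supp M e)
    (hPs : ∀ i, Supp M (P i)) (heq : ∀ p : Pt, 0 ≤ p 0 → pd 0 e p + ∑ i, pd (sidx i) (P i) p = g p)
    (hgc : Continuous g) (hgs : Supp M g) (hX : Continuous X) (hXs : Supp M X) (hY : Continuous Y)
    (hYs : Supp M Y) (hle : ∀ c : ℝ, 0 < c → ∀ p : Pt, 0 ≤ p 0 → g p ≤ c * X p + 2 * c⁻¹ * Y p) {α k
    l : ℝ} (hα : 0 < α) (hβ : 0 < β) (hr : r ≠ 0) (hkl : k + l + 1 = r) (hS : 0 ≤ S) (hT : S ≤ T)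
    (hXb : ∀ t, S ≤ t → t ≤ T → ∫ x, X (stp t x) ≤ α ^ 2 * (1 + t) ^ (2 * k)) (hYb : ∀ t, S ≤ t → t
    ≤ T → ∫ x, Y (stp t x) ≤ β ^ 2 * (1 + t) ^ (2 * l)) : ∫ x, e (stp T x) ≤ (∫ x, e (stp S x)) + 3
    * α * β * (((1 + T) ^ r - (1 + S) ^ r) / r) := by
  have key := energy_le (b := fun t => 3 * α * β * (((1 + t) ^ r - (1 + S) ^ r) / r))
    (b' := fun t => 3 * α * β * (1 + t) ^ (k + l)) he hP hes hPs heq hS hT ?_ ?_ ?_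
  · simpa using key
  · refine ContinuousOn.mul continuousOn_const (ContinuousOn.div_const (ContinuousOn.sub ?_
      continuousOn_const) _)
    refine ContinuousOn.rpow_const (by fun_prop) fun t ht => Or.inl ?_
    have : 0 < 1 + t := by linarith [ht.1]
    exact this.ne'
  · intro t ht
    have h1 : (0 : ℝ) < 1 + t := by linarith [ht.1]
    have h2 : HasDerivAt (fun t : ℝ => (1 + t) ^ r) (1 * r * (1 + t) ^ (r - 1)) t :=
      ((hasDerivAt_id t).const_add 1).rpow_const (Or.inl h1.ne')
    refine (((h2.sub_const _).div_const r).const_mul (3 * α * β)).congr_deriv ?_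
    have e : r - 1 = k + l := by linarith
    rw [e]
    field_simp
  · intro t ht
    have h1 : (0 : ℝ) < 1 + t := by linarith [ht.1]
    have h0 := hS.trans ht.1.le
    set c : ℝ := β / α * (1 + t) ^ (l - k) with hc
    have hcp : 0 < c := by positivity
    have hXi := (hXs.integrable hX h0).const_mul c
    have hYi := (hYs.integrable hY h0).const_mul (2 * c⁻¹)
    calc ∫ x, g (stp t x) ≤ ∫ x, (c * X (stp t x) + 2 * c⁻¹ * Y (stp t x)) :=
          integral_mono (hgs.integrable hgc h0) (hXi.add hYi)
            fun x => hle c hcp _ h0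
      _ = c * (∫ x, X (stp t x)) + 2 * c⁻¹ * ∫ x, Y (stp t x) := by
          rw [integral_add hXi hYi, integral_const_mul, integral_const_mul]
      _ ≤ c * (α ^ 2 * (1 + t) ^ (2 * k)) + 2 * c⁻¹ * (β ^ 2 * (1 + t) ^ (2 * l)) := by
          gcongr
          · exact hXb t ht.1.le ht.2.le
          · exact hYb t ht.1.le ht.2.le
      _ = 3 * α * β * (1 + t) ^ (k + l) := by
          have e1 : (1 + t) ^ (l - k) * (1 + t) ^ (2 * k) = (1 + t) ^ (k + l) := by
            rw [← Real.rpow_add h1]; congr 1; ring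
          have e2 : ((1 + t) ^ (l - k))⁻¹ * (1 + t) ^ (2 * l) = (1 + t) ^ (k + l) := by
            rw [← Real.rpow_neg h1.le, ← Real.rpow_add h1]; congr 1; ring
          have e3 : c * (α ^ 2 * (1 + t) ^ (2 * k))
              = α * β * ((1 + t) ^ (l - k) * (1 + t) ^ (2 * k)) := by rw [hc]; field_simp
          have e4 : 2 * c⁻¹ * (β ^ 2 * (1 + t) ^ (2 * l))
              = 2 * α * β * (((1 + t) ^ (l - k))⁻¹ * (1 + t) ^ (2 * l)) := by
            rw [hc, mul_inv]; field_simp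
          rw [e3, e4, e1, e2]; ring

lemma mul_le_weighted (c a b : ℝ) (hc : 0 < c) : a * b ≤ c * a ^ 2 + c⁻¹ * b ^ 2 := by
  have h : c⁻¹ * b ^ 2 = c * (c⁻¹ * b) ^ 2 := by field_simp
  rw [h]
  have h2 : a * b = c * (a * (c⁻¹ * b)) := by field_simp
  rw [h2]
  nlinarith [sq_nonneg (a - c⁻¹ * b), sq_nonneg (a + c⁻¹ * b), sq_nonneg a, sq_nonneg (c⁻¹ * b)]

lemma flat_energy (hv : Sm v) (hs : Supp M v) {α k l : ℝ} (hα : 0 < α) (hβ : 0 < β) (hr : r ≠ 0)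
    (hkl : k + l + 1 = r) (hS : 0 ≤ S) (hT : S ≤ T) (hXb : ∀ t, S ≤ t → t ≤ T → ∫ x, flatE v (stp t
    x) ≤ α ^ 2 * (1 + t) ^ (2 * k)) (hYb : ∀ t, S ≤ t → t ≤ T → ∫ x, (box v (stp t x)) ^ 2 ≤ β ^ 2 *
    (1 + t) ^ (2 * l)) : ∫ x, flatE v (stp T x) ≤ (∫ x, flatE v (stp S x)) + 6 * α * β * (((1 + T) ^
      r - (1 + S) ^ r) / r) := by
  have := energy_le_rpow (M := M) (e := fun p => 1 / 2 * flatE v p)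
    (g := fun p => -pd 0 v p * box v p)
    (P := fun i p => -(pd 0 v p * pd (sidx i) v p)) (X := flatE v) (Y := fun p => (box v p) ^ 2)
    (by fun_prop) (fun i => by fun_prop) (hs.flatE hv).mul_left
    (fun i p h0 hp => by simp [hs.pder hv _ p h0 hp]) ?_
    (by fun_prop) (hs.box hv).mul_left (hv.flatE).continuous (hs.flatE hv)
    (by fun_prop) (fun p h0 hp => by simp [hs.box hv p h0 hp]) ?_ hα hβ hr hkl hS hT hXb hYb
  · simp only [integral_const_mul] at this
    linarith
  · intro p _
    simp only [Fin.sum_univ_three, sidx_zero, sidx_one, sidx_two, flatE, box]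
    simp (disch := fun_prop) only [pd_add, pd_mul, pd_sq, pd_neg, pd_const]
    rw [pd_comm hv 0 1, pd_comm hv 0 2, pd_comm hv 0 3]
    simp
    ring
  · intro c hc p _
    have := mul_le_weighted c (-pd 0 v p) (box v p) hc
    have h1 : (-pd 0 v p) ^ 2 ≤ flatE v p := by
      unfold flatE; nlinarith [sq_nonneg (pd 1 v p), sq_nonneg (pd 2 v p), sq_nonneg (pd 3 v p)]
    have h2 : 0 ≤ c⁻¹ * box v p ^ 2 := by positivity
    nlinarith [mul_le_mul_of_nonneg_left h1 hc.le]

/-- The Morawetz multiplier applied to `v`. -/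
def morK (v : Fld) : Fld := fun p =>
  pd 0 v p + p 0 * scal2 v p + (p 1 * (p 0 * pd 1 v p + p 1 * pd 0 v p) + p 2 * (p 0 * pd 2 v p + p
    2 * pd 0 v p) + p 3 * (p 0 * pd 3 v p + p 3 * pd 0 v p))

@[fun_prop] lemma ContDiff.morK (hv : Sm v) : Sm (morK v) := by
  unfold _root_.morK; fun_prop

lemma morK_aux (x1 x2 x3 L1 L2 L3 a t b r s E : ℝ) (hr2 : r ^ 2 = x1 ^ 2 + x2 ^ 2 + x3 ^ 2) (s1 : 1
    ≤ s ^ 2) (s2 : t ^ 2 ≤ s ^ 2) (s3 : r ^ 2 ≤ s ^ 2) (hE : a ^ 2 + b ^ 2 + (L1 ^ 2 + L2 ^ 2 + L3 ^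
    2) ≤ E) : (a + t * b + (x1 * L1 + x2 * L2 + x3 * L3)) ^ 2 ≤ 3 * s ^ 2 * E := by
  have h1 : (x1 * L1 + x2 * L2 + x3 * L3) ^ 2 ≤ r ^ 2 * (L1 ^ 2 + L2 ^ 2 + L3 ^ 2) := by
    rw [hr2]
    nlinarith [sq_nonneg (x1 * L2 - x2 * L1), sq_nonneg (x1 * L3 - x3 * L1), sq_nonneg (x2 * L3 - x3
      * L2)]
  generalize x1 * L1 + x2 * L2 + x3 * L3 = y at *
  have h2 : (a + t * b + y) ^ 2 ≤ 3 * (a ^ 2 + t ^ 2 * b ^ 2 + y ^ 2) := by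
    nlinarith [sq_nonneg (a - t * b), sq_nonneg (a - y), sq_nonneg (t * b - y)]
  have t1 := mul_le_mul_of_nonneg_right s1 (sq_nonneg a)
  have t2 := mul_le_mul_of_nonneg_right s2 (sq_nonneg b)
  have t3 := mul_le_mul_of_nonneg_right s3 (by positivity : 0 ≤ L1 ^ 2 + L2 ^ 2 + L3 ^ 2)
  have t4 := mul_le_mul_of_nonneg_left hE (by positivity : (0:ℝ) ≤ s ^ 2)
  linarith

lemma morK_sq_le (v : Fld) (h0 : 0 ≤ p 0) : morK v p ^ 2 ≤ 3 * ss p ^ 2 * confE v p := by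
  have hr := rr_nonneg p
  refine morK_aux (p 1) (p 2) (p 3) _ _ _ _ _ _ (rr p) _ _ (rr_sq p) ?_ ?_ ?_ ?_
  · unfold ss; nlinarith
  · unfold ss; nlinarith
  · unfold ss; nlinarith
  · unfold confE
    linarith [sq_nonneg (pd 1 v p), sq_nonneg (pd 2 v p), sq_nonneg (pd 3 v p), sq_nonneg (p 1 * pd
      2 v p - p 2 * pd 1 v p), sq_nonneg (p 1 * pd 3 v p - p 3 * pd 1 v p), sq_nonneg (p 2 * pd 3 v
      p - p 3 * pd 2 v p)]

lemma ss_pos (h0 : 0 ≤ p 0) : 0 < ss p := by unfold ss; linarith [rr_nonneg p]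

@[fun_prop] lemma continuous_ss : Continuous ss := by unfold ss; fun_prop

lemma conf_energy (hv : Sm v) (hs : Supp M v) {α k l : ℝ} (hα : 0 < α) (hβ : 0 < β) (hr : r ≠ 0)
    (hkl : k + l + 1 = r) (hT : 0 ≤ T) (hXb : ∀ t, 0 ≤ t → t ≤ T → ∫ x, confE v (stp t x) ≤ α ^ 2 *
    (1 + t) ^ (2 * k)) (hYb : ∀ t, 0 ≤ t → t ≤ T → ∫ x, (ss (stp t x) * box v (stp t x)) ^ 2 ≤ β ^ 2
      * (1 + t) ^ (2 * l)) : ∫ x, confE v (stp T x) ≤ (∫ x, confE v (stp 0 x)) + 12 * α * β * (((1 +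
      T) ^ r - 1) / r) := by
  have := energy_le_rpow (M := M) (e := fun p => 1 / 4 * confE v p)
    (g := fun p => 1 / 2 * (-morK v p * box v p))
    (P := fun i p => 1 / 2 * (-((1 + p 0 * p 0 + p 1 * p 1 + p 2 * p 2 + p 3 * p 3) * (pd 0 v p * pd
        (sidx i) v p) + 2 * p 0 * ((p 1 * pd 1 v p + p 2 * pd 2 v p + p 3 * pd 3 v p) * pd (sidx i)
      v p) + p 0 * (p (sidx i) * ((pd 0 v p) ^ 2 - (pd 1 v p) ^ 2 - (pd 2 v p) ^ 2 - (pd 3 v p) ^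
      2)) + 2 * p 0 * (v p * pd (sidx i) v p)) - 2 * p (sidx i) * (v p * pd 0 v p)))
    (X := confE v) (Y := fun p => (ss p * box v p) ^ 2)
    (by fun_prop) (fun i => by fun_prop) (hs.confE hv).mul_left
    (fun i p h0 hp => by simp [hs.pder hv _ p h0 hp]) ?_
    (by fun_prop) (hs.box hv).mul_left.mul_left (hv.confE).continuous (hs.confE hv)
    ((continuous_ss.mul hv.box.continuous).pow 2) (fun p h0 hp => by simp [hs.box hv p h0 hp])
    ?_ hα hβ hr hkl le_rfl hT hXb hYb
  · simp only [integral_const_mul, add_zero, Real.one_rpow] at this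
    linarith
  · intro p _
    simp only [Fin.sum_univ_three, sidx_zero, sidx_one, sidx_two, confE, box, scal2, morK]
    simp (disch := fun_prop) only [pd_add, pd_mul, pd_sq, pd_coord, pd_sub, pd_neg, pd_const]
    rw [pd_comm hv 0 1, pd_comm hv 0 2, pd_comm hv 0 3, pd_comm hv 2 1, pd_comm hv 3 1, pd_comm hv 3 2]
    simp
    ring
  · intro c hc p h0
    have hsp := ss_pos h0
    have := mul_le_weighted (c / 2) (-(morK v p / ss p)) (ss p * box v p) (by positivity)
    have h1 : (-(morK v p / ss p)) ^ 2 ≤ 3 * confE v p := by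
      rw [neg_sq, div_pow, div_le_iff₀ (by positivity)]
      linarith [morK_sq_le v h0]
    have h2 : -(morK v p / ss p) * (ss p * box v p) = -morK v p * box v p := by field_simp
    rw [h2] at this
    have h3 : (c / 2)⁻¹ = 2 * c⁻¹ := by field_simp
    rw [h3] at this
    have h4 := mul_le_mul_of_nonneg_left h1 hc.le
    have h5 : 0 ≤ c⁻¹ * (ss p * box v p) ^ 2 := by positivity
    have h6 := mul_nonneg hc.le (confE_nonneg v p)
    nlinarith

lemma l2_energy (hv : Sm v) (hs : Supp M v) {α k l : ℝ} (hα : 0 < α) (hβ : 0 < β) (hr : r ≠ 0) (hkl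
    : k + l + 1 = r) (hT : 0 ≤ T) (hXb : ∀ t, 0 ≤ t → t ≤ T → ∫ x, (v (stp t x)) ^ 2 ≤ α ^ 2 * (1 +
    t) ^ (2 * k)) (hYb : ∀ t, 0 ≤ t → t ≤ T → ∫ x, confE v (stp t x) ≤ β ^ 2 * (1 + t) ^ (2 * l)) :
    (1 + T) * ∫ x, (v (stp T x)) ^ 2 ≤ (∫ x, (v (stp 0 x)) ^ 2) + 6 * α * β * (((1 + T) ^ r - 1) /
      r) := by
  have := energy_le_rpow (M := M) (e := fun p => 1 / 2 * ((1 + p 0) * (v p) ^ 2))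
    (g := fun p => v p * (scal2 v p + pd 0 v p))
    (P := fun i p => 1 / 2 * (p (sidx i) * (v p) ^ 2)) (X := fun p => (v p) ^ 2) (Y := confE v)
    (by fun_prop) (fun i => by fun_prop)
    (fun p h0 hp => by simp [hs p h0 hp])
    (fun i p h0 hp => by simp [hs p h0 hp]) ?_
    (by fun_prop) hs.mul_right (by fun_prop) (fun p h0 hp => by simp [hs p h0 hp])
    (hv.confE).continuous (hs.confE hv) ?_ hα hβ hr hkl le_rfl hT hXb hYb
  · simp only [integral_const_mul, stp_zero] at this
    simp only [add_zero, one_mul, Real.one_rpow] at this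
    linarith
  · intro p _
    simp only [Fin.sum_univ_three, sidx_zero, sidx_one, sidx_two, scal2]
    simp (disch := fun_prop) only [pd_add, pd_mul, pd_sq, pd_coord, pd_const]
    simp
    ring
  · intro c hc p h0
    have := mul_le_weighted c (v p) (scal2 v p + pd 0 v p) hc
    have h1 : (scal2 v p + pd 0 v p) ^ 2 ≤ 2 * confE v p := by
      unfold confE
      nlinarith [sq_nonneg (scal2 v p - pd 0 v p), sq_nonneg (pd 1 v p), sq_nonneg (pd 2 v p), sq_nonneg (pd 3 v p),
        sq_nonneg (p 0 * pd 1 v p + p 1 * pd 0 v p), sq_nonneg (p 0 * pd 2 v p + p 2 * pd 0 v p),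
        sq_nonneg (p 0 * pd 3 v p + p 3 * pd 0 v p), sq_nonneg (p 1 * pd 2 v p - p 2 * pd 1 v p),
        sq_nonneg (p 1 * pd 3 v p - p 3 * pd 1 v p), sq_nonneg (p 2 * pd 3 v p - p 3 * pd 2 v p)]
    have h2 := mul_le_mul_of_nonneg_left h1 (by positivity : 0 ≤ c⁻¹)
    linarith

lemma zap_sq_le_confE (v : Fld) (Z : ZI) (p : Pt) : zap Z v p ^ 2 ≤ 2 * confE v p + 8 * (v p) ^ 2 :=
    by
  have hc := confE_nonneg v p
  have nn := sq_nonneg (v p)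
  rcases Z with a | ⟨⟨a, b⟩⟩ | u
  · rw [zap_tr]
    have : pd a v p ^ 2 ≤ confE v p := by
      refine le_trans ?_ (flatE_le_confE v p)
      unfold flatE
      have h0 := sq_nonneg (pd 0 v p)
      have h1 := sq_nonneg (pd 1 v p)
      have h2 := sq_nonneg (pd 2 v p)
      have h3 := sq_nonneg (pd 3 v p)
      revert a; simp only [Fin.forall_fin_succ]
      simp
      refine ⟨?_, ?_, ?_, ?_⟩ <;> linarith
    linarith
  · rw [zap_lor]
    have : (m4 a * p a * pd b v p - m4 b * p b * pd a v p) ^ 2 ≤ confE v p := by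
      unfold confE
      have h0 := sq_nonneg (pd 0 v p)
      have h1 := sq_nonneg (pd 1 v p)
      have h2 := sq_nonneg (pd 2 v p)
      have h3 := sq_nonneg (pd 3 v p)
      have h4 := sq_nonneg (scal2 v p)
      have g1 := sq_nonneg (p 0 * pd 1 v p + p 1 * pd 0 v p)
      have g2 := sq_nonneg (p 0 * pd 2 v p + p 2 * pd 0 v p)
      have g3 := sq_nonneg (p 0 * pd 3 v p + p 3 * pd 0 v p)
      have g4 := sq_nonneg (p 1 * pd 2 v p - p 2 * pd 1 v p)
      have g5 := sq_nonneg (p 1 * pd 3 v p - p 3 * pd 1 v p)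
      have g6 := sq_nonneg (p 2 * pd 3 v p - p 3 * pd 2 v p)
      fin_cases a <;> fin_cases b <;> simp [m4] <;> linarith
    linarith
  · rw [zap_sc]
    have e : ∑ a, p a * pd a v p = scal2 v p - 2 * v p := by simp [Fin.sum_univ_four, scal2]
    rw [e]
    have : scal2 v p ^ 2 ≤ confE v p := by
      unfold confE
      nlinarith [sq_nonneg (pd 0 v p), sq_nonneg (pd 1 v p), sq_nonneg (pd 2 v p), sq_nonneg (pd 3 v p),
        sq_nonneg (p 0 * pd 1 v p + p 1 * pd 0 v p), sq_nonneg (p 0 * pd 2 v p + p 2 * pd 0 v p),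
        sq_nonneg (p 0 * pd 3 v p + p 3 * pd 0 v p), sq_nonneg (p 1 * pd 2 v p - p 2 * pd 1 v p),
        sq_nonneg (p 1 * pd 3 v p - p 3 * pd 1 v p), sq_nonneg (p 2 * pd 3 v p - p 3 * pd 2 v p)]
    nlinarith [sq_nonneg (scal2 v p + 2 * v p)]

lemma pd_comp {h : ℝ → ℝ} (hh : ContDiff ℝ (⊤ : ℕ∞) h) (hf : Sm f) (a : Fin 4) : pd a (fun p => h (f
    p)) = fun p => deriv h (f p) * pd a f p := by
  ext p
  have h3 : fderiv ℝ (fun p => h (f p)) p = _ := ((hh.differentiable (by simp) (f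
    p)).hasDerivAt.comp_hasFDerivAt p (hf.diffble p).hasFDerivAt).fderiv
  simp [pd, h3]

lemma tri3 (a b c x y z : ℝ) : Real.sqrt ((a + x) ^ 2 + (b + y) ^ 2 + (c + z) ^ 2) ≤ Real.sqrt (a ^
    2 + b ^ 2 + c ^ 2) + Real.sqrt (x ^ 2 + y ^ 2 + z ^ 2) := by
  simpa [EuclideanSpace.norm_eq, Fin.sum_univ_three] using norm_add_le !₂[a, b, c] !₂[x, y, z]

lemma rr_stp (t : ℝ) (x : Sp) : rr (stp t x) = rad3 x := rfl

lemma rr_le_radq_add (q : Sp) (p : Pt) : rr p ≤ radq q p + rad3 q := by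
  simpa [radq, rad3, rr] using tri3 (p 1 - q 0) (p 2 - q 1) (p 3 - q 2) (q 0) (q 1) (q 2)

lemma rad3_le_radq_add (q : Sp) (p : Pt) : rad3 q ≤ radq q p + rr p := by
  have := tri3 (q 0 - p 1) (q 1 - p 2) (q 2 - p 3) (p 1) (p 2) (p 3)
  simp only [sub_add_cancel, sub_sq_comm (q _)] at this
  exact this

lemma stp_self (p : Pt) : stp (p 0) ![p 1, p 2, p 3] = p := by
  ext i
  fin_cases i <;> rfl

lemma cone_flux_nonneg {a b d x y z s : ℝ} (hs : 0 < s) (h : x ^ 2 + y ^ 2 + z ^ 2 ≤ s ^ 2) : 0 ≤ s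
    * (a ^ 2 + b ^ 2 + c ^ 2 + d ^ 2) - 2 * (x * (a * b) + y * (a * c) + z * (a * d)) := by
  refine (mul_nonneg_iff_of_pos_left hs).1 ?_
  linarith [mul_le_mul_of_nonneg_right h (sq_nonneg a), sq_nonneg (s * b - x * a), sq_nonneg (s * c
    - y * a), sq_nonneg (s * d - z * a)]

/-- The derivatives of the source are bounded on the cone of dependence. -/
lemma exists_box_sq_le (q : Sp) {t0 : ℝ} {B : Fin 4 → Fld} (hB : ∀ a, Continuous (B a)) (hbox : ∀ p
    : Pt, 0 ≤ p 0 → p 0 ≤ t0 → radq q p < c - p 0 → box v p = ∑ a, pd a v p * B a p) : ∃ A, ∀ p :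
    Pt, 0 ≤ p 0 → p 0 ≤ t0 → radq q p < c - p 0 → box v p ^ 2 ≤ A * flatE v p := by
  obtain ⟨A, hA⟩ := (isCompact_Icc (a := (![0, q 0 - c, q 1 - c, q 2 - c] : Pt)) (b := ![t0, q 0 +
    c, q 1 + c, q 2 + c])).exists_bound_of_continuousOn
    (f := fun p => ∑ a, B a p ^ 2) (by fun_prop)
  refine ⟨A, fun p h0 h1 h2 => ?_⟩
  have b : ∀ w : ℝ, w ^ 2 ≤ (p 1 - q 0) ^ 2 + (p 2 - q 1) ^ 2 + (p 3 - q 2) ^ 2 → |w| ≤ c :=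
    fun w hw => (Real.abs_le_sqrt hw).trans (by rw [radq] at h2; linarith)
  have b1 := abs_le.1 (b (p 1 - q 0) (by linarith [sq_nonneg (p 2 - q 1), sq_nonneg (p 3 - q 2)]))
  have b2 := abs_le.1 (b (p 2 - q 1) (by linarith [sq_nonneg (p 1 - q 0), sq_nonneg (p 3 - q 2)]))
  have b3 := abs_le.1 (b (p 3 - q 2) (by linarith [sq_nonneg (p 1 - q 0), sq_nonneg (p 2 - q 1)]))
  have hp := (le_abs_self _).trans (hA p ⟨fun i => by fin_cases i <;> simp <;> linarith,
    fun i => by fin_cases i <;> simp <;> linarith⟩)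
  have e : flatE v p = ∑ a, pd a v p ^ 2 := by rw [flatE, Fin.sum_univ_four]
  rw [hbox p h0 h1 h2, e, mul_comm]
  exact (Finset.sum_mul_sq_le_sq_mul_sq _ _ _).trans
    (mul_le_mul_of_nonneg_left hp (by positivity))

set_option maxHeartbeats 1000000 in
/-- Finite speed of propagation. -/
lemma finite_speed (hv : Sm v) (q : Sp) {t0 : ℝ} (ht0 : 0 ≤ t0) (hc : t0 < c)
    {B : Fin 4 → Fld} (hB : ∀ a, Continuous (B a))
    (hbox : ∀ p : Pt, 0 ≤ p 0 → p 0 ≤ t0 → radq q p < c - p 0 → box v p = ∑ a, pd a v p * B a p)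
    (h0 : ∀ x : Sp, radq q (stp 0 x) < c → v (stp 0 x) = 0 ∧ pd 0 v (stp 0 x) = 0) :
    v (stp t0 q) = 0 := by
  obtain ⟨A, hA⟩ := exists_box_sq_le q hB hbox
  let w : Fld := fun p => (c - p 0) ^ 2
    - ((p 1 - q 0) ^ 2 + (p 2 - q 1) ^ 2 + (p 3 - q 2) ^ 2)
  have hw : Sm w := by fun_prop
  have hwr : ∀ p, 0 < w p → radq q p < |c - p 0| := fun p hp => by
    refine (Real.sqrt_lt' (abs_pos.2 fun h => ?_)).2 (by rw [sq_abs]; exact sub_pos.1 hp)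
    simp only [w, h] at hp
    linarith [sq_nonneg (p 1 - q 0), sq_nonneg (p 2 - q 1), sq_nonneg (p 3 - q 2)]
  have hGs : Sm (fun p => expNegInvGlue (w p)) := expNegInvGlue.contDiff.comp hw
  have hE : Sm (fun p : Pt => -(1 + A) * p 0) := by fun_prop
  have hEs : Sm (fun p : Pt => Real.exp (-(1 + A) * p 0)) := by fun_prop
  let W : Fld := fun p => Real.exp (-(1 + A) * p 0) * expNegInvGlue (w p)
  have hWs : Sm W := hEs.mul hGs
  have hWnn : ∀ p, 0 ≤ W p := fun p => mul_nonneg (Real.exp_pos _).le (expNegInvGlue.nonneg _)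
  have hWz : ∀ p, w p ≤ 0 → W p = 0 := fun p hp => by
    simp only [W, expNegInvGlue.zero_of_nonpos hp, mul_zero]
  have hWd : ∀ (a : Fin 4) (p : Pt), pd a W p
      = Real.exp (-(1 + A) * p 0) * (deriv expNegInvGlue (w p) * pd a w p)
        + expNegInvGlue (w p) * (Real.exp (-(1 + A) * p 0) * (-(1 + A) * if 0 = a then 1 else 0)) := by
    intro a p
    simp only [W]
    rw [pd_mul hEs hGs, pd_comp expNegInvGlue.contDiff hw, pd_comp Real.contDiff_exp hE,
      pd_const_mul (by fun_prop), pd_coord]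
    simp
  have hS : Supp (rad3 q + c) W := fun p hp0 hp => hWz p <| by
    by_contra! hcon
    have := abs_sub c (p 0)
    rw [abs_of_pos (by linarith : 0 < c), abs_of_nonneg hp0] at this
    linarith [rr_le_radq_add q p, hwr p hcon]
  have key : ∀ T, 0 ≤ T → T ≤ t0 → ∫ x, (W (stp T x) * flatE v (stp T x)) ≤ 0 := by
    intro T hT hTt
    refine (energy_le (e := fun p => W p * flatE v p) (P := fun i p => W p * (-2 * (pd 0 v p * pd
      (sidx i) v p))) (g := fun p => pd 0 W p * flatE v p - 2 * (pd 1 W p * (pd 0 v p * pd 1 v p) +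
        pd 2 W p * (pd 0 v p * pd 2 v p) + pd 3 W p * (pd 0 v p * pd 3 v p)) - 2 * W p * pd 0 v p *
        box v p) (by fun_prop) (fun i => by fun_prop) hS.mul_right (fun i => hS.mul_right) (fun p _
      => ?_) le_rfl hT (b := fun _ => 0) (by fun_prop) (fun t _ => hasDerivAt_const t 0) fun t ht =>
        integral_nonpos fun x => ?_).trans_eq ?_
    · simp only [Fin.sum_univ_three, sidx_zero, sidx_one, sidx_two, flatE, box]
      simp (disch := fun_prop) only [pd_add, pd_mul, pd_sq, pd_const]
      rw [pd_comm hv 0 1, pd_comm hv 0 2, pd_comm hv 0 3]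
      ring
    · have hp0 : (stp t x) 0 = t := rfl
      generalize stp t x = p at *
      have hd : ∀ a, pd a w p = 2 * (c - p 0) * -(if 0 = a then 1 else 0) -
          (2 * (p 1 - q 0) * (if 1 = a then 1 else 0) + 2 * (p 2 - q 1) * (if 2 = a then 1 else 0) +
            2 * (p 3 - q 2) * if 3 = a then 1 else 0) := fun a => by
        simp only [w]
        simp (disch := fun_prop) only [pd_add, pd_sub, pd_sq, pd_coord, pd_const, sub_zero, zero_sub]
      simp only [Pi.zero_apply, hWd, hd, Fin.isValue, if_true, Fin.reduceEq, if_false]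
      by_cases hx : 0 < w p
      · have hs : 0 < c - p 0 := by linarith [ht.2]
        have hb := hA p (by linarith [ht.1]) (by linarith [ht.2]) (by simpa [abs_of_pos hs] using hwr p hx)
        have f1 := mul_nonneg (mul_nonneg (Real.exp_pos (-(1 + A) * p 0)).le
          (expNegInvGlue.monotone.deriv_nonneg (x := w p)))
          (cone_flux_nonneg (a := pd 0 v p) (b := pd 1 v p) (c := pd 2 v p) (d := pd 3 v p) hs
            (sub_pos.1 hx).le)
        have f2 := mul_le_mul_of_nonneg_left (show -2 * pd 0 v p * box v p ≤ (1 + A) * flatE v p by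
          have e : flatE v p = pd 0 v p ^ 2 + pd 1 v p ^ 2 + pd 2 v p ^ 2 + pd 3 v p ^ 2 := rfl
          linarith [sq_nonneg (pd 0 v p + box v p), sq_nonneg (pd 1 v p), sq_nonneg (pd 2 v p),
            sq_nonneg (pd 3 v p)]) (hWnn p)
        simp only [W, flatE] at f2 ⊢
        linarith
      · have h1 := expNegInvGlue.zero_of_nonpos (not_lt.1 hx)
        have h2 : IsLocalMin expNegInvGlue (w p) := .of_forall fun y =>
          h1.trans_le (expNegInvGlue.nonneg y)
        simp [W, h1, h2.deriv_eq_zero]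
    · have : ∀ x : Sp, W (stp 0 x) * flatE v (stp 0 x) = 0 := by
        intro x
        by_cases hx : 0 < w (stp 0 x)
        · have hr := hwr _ hx
          simp only [stp_zero, sub_zero, abs_of_pos (ht0.trans_lt hc)] at hr
          have hz : (fun y => v (stp 0 y)) =ᶠ[nhds x] fun _ => 0 := by
            have hcont : Continuous fun y => radq q (stp 0 y) := by unfold radq; fun_prop
            filter_upwards [hcont.continuousAt.eventually (gt_mem_nhds hr)] with y hy
              using (h0 y hy).1
          have hsp : ∀ i : Fin 3, pd (sidx i) v (stp 0 x) = 0 := fun i => by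
            rw [← congrFun (spd_comp_stp hv 0 i) x, spd, hz.fderiv_eq]
            simp
          have e1 := hsp 0
          have e2 := hsp 1
          have e3 := hsp 2
          rw [sidx_zero] at e1; rw [sidx_one] at e2; rw [sidx_two] at e3
          simp [flatE, (h0 x hr).2, e1, e2, e3]
        · rw [hWz _ (not_lt.1 hx), zero_mul]
      simp [this]
  have hzero : ∀ T, 0 ≤ T → T ≤ t0 → pd 0 v (stp T q) = 0 := by
    intro T hT hTt
    by_contra hne
    have h1 : 0 < flatE v (stp T q) := by unfold flatE; positivity
    have h2 : 0 < W (stp T q) := mul_pos (Real.exp_pos _) (expNegInvGlue.pos_of_pos (by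
      have := sub_pos.2 (hTt.trans_lt hc)
      simp [w]
      positivity))
    exact (key T hT hTt).not_gt (Continuous.integral_pos_of_hasCompactSupport_nonneg_nonzero
      ((hWs.continuous.mul hv.flatE.continuous).comp (continuous_stp_right T))
      (hS.mul_right.hasCompactSupport (f := fun p => W p * flatE v p) hT) (fun x => mul_nonneg (hWnn
      _) (flatE_nonneg _ _)) (mul_pos h2 h1).ne')
  rw [constant_of_has_deriv_right_zero (f := fun t => v (stp t q)) (a := 0) (b := t0) (fun t _ =>
    (hasDerivAt_comp_stp hv t q).continuousAt.continuousWithinAt) (fun t ht => hzero t ht.1 ht.2.le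
    ▸ (hasDerivAt_comp_stp hv t q).hasDerivWithinAt) t0 ⟨ht0, le_rfl⟩]
  exact (h0 q (by simpa [radq] using ht0.trans_lt hc)).1

/-- Commutator of a trilinear form with the field `Z`. -/
def FZ (Z : ZI) (F : Ten3) : Ten3 := fun a b c =>
  -∑ d, (zA Z a d * F d b c + zA Z b d * F a d c + zA Z c d * F a b d)

/-- Commutator of a bilinear form with the field `Z`. -/
def GZ (Z : ZI) (G : Ten2) : Ten2 := fun a b => -∑ d, (zA Z a d * G d b + zA Z b d * G a d)

@[fun_prop]
lemma ContDiff.nf3 (F : Ten3) (hf : Sm f) (hg : Sm g) : Sm (nf3 F f g) := by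
  unfold _root_.nf3
  fun_prop

@[fun_prop]
lemma ContDiff.nf2 (G : Ten2) (hf : Sm f) (hg : Sm g) : Sm (nf2 G f g) := by
  unfold _root_.nf2
  fun_prop

lemma zap_pd (hf : Sm f) (Z : ZI) (c : Fin 4) : zap Z (pd c f) = fun p => pd c (zap Z f) p - ∑ a, zA
    Z a c * pd a f p := by
  ext p
  rw [pd_zap hf]
  ring

lemma zap_pd_pd (hf : Sm f) (Z : ZI) (b c : Fin 4) : zap Z (pd b (pd c f)) = fun p => pd b (pd c
    (zap Z f)) p - ∑ a, zA Z a c * pd b (pd a f) p - ∑ a, zA Z a b * pd a (pd c f) p := by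
  rw [zap_pd (hf.pd c), zap_pd hf, pd_sub (by fun_prop) (by fun_prop), pd_sum _ (fun a => by
    fun_prop)]
  simp (disch := fun_prop) only [pd_const_mul]

lemma zap_nf2 (hf : Sm f) (hg : Sm g) (Z : ZI) (G : Ten2) : zap Z (nf2 G f g) = fun p => nf2 G (zap
    Z f) g p + nf2 G f (zap Z g) p + nf2 (GZ Z G) f g p := by
  ext p
  have h1 : zap Z (nf2 G f g) p = ∑ a, ∑ b, G a b * (zap Z (pd a f) p * pd b g p + pd a f p * zap Z
      (pd b g) p) := by
    unfold nf2
    rw [zap_sum _ (fun a => by fun_prop)]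
    refine sum_congr rfl fun a _ => ?_
    rw [zap_sum _ (fun b => by fun_prop)]
    refine sum_congr rfl fun b _ => ?_
    have : (fun p => G a b * pd a f p * pd b g p) = fun p => G a b * (pd a f p * pd b g p) := by
      ext; ring
    rw [this, zap_const_mul (by fun_prop), zap_mul (by fun_prop) (by fun_prop)]
  have e1 : ∑ a, ∑ b, ∑ d, zA Z a d * G d b * (pd a f p * pd b g p)
      = ∑ a, ∑ b, ∑ d, G a b * (zA Z d a * pd d f p * pd b g p) := by
    have : ∀ a, ∑ b, ∑ d, zA Z a d * G d b * (pd a f p * pd b g p)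
        = ∑ d, ∑ b, zA Z a d * G d b * (pd a f p * pd b g p) := fun a => sum_comm
    simp only [this]
    rw [sum_comm]
    refine sum_congr rfl fun a _ => ?_
    rw [sum_comm]
    refine sum_congr rfl fun b _ => sum_congr rfl fun d _ => by ring
  have e2 : ∑ a, ∑ b, ∑ d, zA Z b d * G a d * (pd a f p * pd b g p)
      = ∑ a, ∑ b, ∑ d, G a b * (pd a f p * (zA Z d b * pd d g p)) := by
    refine sum_congr rfl fun a _ => ?_
    rw [sum_comm]
    refine sum_congr rfl fun b _ => sum_congr rfl fun d _ => by ring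
  have e3 : nf2 (GZ Z G) f g p
      = - (∑ a, ∑ b, ∑ d, zA Z a d * G d b * (pd a f p * pd b g p))
        - ∑ a, ∑ b, ∑ d, zA Z b d * G a d * (pd a f p * pd b g p) := by
    simp only [nf2, GZ, ← sum_neg_distrib, ← sum_sub_distrib, sum_mul]
    refine sum_congr rfl fun a _ => sum_congr rfl fun b _ => sum_congr rfl fun d _ => by ring
  rw [h1, e3, e1, e2]
  simp only [nf2, zap_pd hf, zap_pd hg, ← sum_sub_distrib, ← sum_add_distrib, ← sum_neg_distrib]
  refine sum_congr rfl fun a _ => sum_congr rfl fun b _ => ?_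
  simp only [sum_sub_distrib, sum_neg_distrib, ← mul_sum, ← sum_mul]
  ring

lemma zap_nf3 (hf : Sm f) (hg : Sm g) (Z : ZI) (F : Ten3) : zap Z (nf3 F f g) = fun p => nf3 F (zap
    Z f) g p + nf3 F f (zap Z g) p + nf3 (FZ Z F) f g p := by
  ext p
  have h1 : zap Z (nf3 F f g) p = ∑ a, ∑ b, ∑ c, F a b c * (zap Z (pd a f) p * pd b (pd c g) p + pd
      a f p * zap Z (pd b (pd c g)) p) := by
    unfold nf3
    rw [zap_sum _ (fun a => by fun_prop)]
    refine sum_congr rfl fun a _ => ?_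
    rw [zap_sum _ (fun b => by fun_prop)]
    refine sum_congr rfl fun b _ => ?_
    rw [zap_sum _ (fun c => by fun_prop)]
    refine sum_congr rfl fun c _ => ?_
    have : (fun p => F a b c * pd a f p * pd b (pd c g) p)
        = fun p => F a b c * (pd a f p * pd b (pd c g) p) := by ext; ring
    rw [this, zap_const_mul (by fun_prop), zap_mul (by fun_prop) (by fun_prop)]
  set X := fun a => pd a f p with hX
  set Y := fun b c => pd b (pd c g) p with hY
  have e1 : ∑ a, ∑ b, ∑ c, ∑ d, zA Z a d * F d b c * (X a * Y b c)
      = ∑ a, ∑ b, ∑ c, ∑ d, F a b c * (zA Z d a * X d * Y b c) := by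
    have : ∀ a, ∑ b, ∑ c, ∑ d, zA Z a d * F d b c * (X a * Y b c)
        = ∑ d, ∑ b, ∑ c, zA Z a d * F d b c * (X a * Y b c) := fun a => by
      symm
      rw [sum_comm]
      refine sum_congr rfl fun b _ => ?_
      rw [sum_comm]
    simp only [this]
    rw [sum_comm]
    refine sum_congr rfl fun a _ => ?_
    rw [sum_comm]
    refine sum_congr rfl fun b _ => ?_
    rw [sum_comm]
    refine sum_congr rfl fun c _ => sum_congr rfl fun d _ => by ring
  have e2 : ∑ a, ∑ b, ∑ c, ∑ d, zA Z b d * F a d c * (X a * Y b c)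
      = ∑ a, ∑ b, ∑ c, ∑ d, F a b c * (X a * (zA Z d b * Y d c)) := by
    refine sum_congr rfl fun a _ => ?_
    have : ∀ b, ∑ c, ∑ d, zA Z b d * F a d c * (X a * Y b c)
        = ∑ d, ∑ c, zA Z b d * F a d c * (X a * Y b c) := fun b => sum_comm
    simp only [this]
    rw [sum_comm]
    refine sum_congr rfl fun b _ => ?_
    rw [sum_comm]
    refine sum_congr rfl fun c _ => sum_congr rfl fun d _ => by ring
  have e2' : ∑ a, ∑ b, ∑ c, ∑ d, zA Z c d * F a b d * (X a * Y b c)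
      = ∑ a, ∑ b, ∑ c, ∑ d, F a b c * (X a * (zA Z d c * Y b d)) := by
    refine sum_congr rfl fun a _ => sum_congr rfl fun b _ => ?_
    rw [sum_comm]
    refine sum_congr rfl fun c _ => sum_congr rfl fun d _ => by ring
  have e3 : nf3 (FZ Z F) f g p
      = - (∑ a, ∑ b, ∑ c, ∑ d, zA Z a d * F d b c * (X a * Y b c))
        - (∑ a, ∑ b, ∑ c, ∑ d, zA Z b d * F a d c * (X a * Y b c))
        - ∑ a, ∑ b, ∑ c, ∑ d, zA Z c d * F a b d * (X a * Y b c) := by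
    simp only [nf3, FZ, ← sum_neg_distrib, ← sum_sub_distrib, sum_mul]
    refine sum_congr rfl fun a _ => sum_congr rfl fun b _ =>
      sum_congr rfl fun c _ => sum_congr rfl fun d _ => by simp only [hX, hY]; ring
  rw [h1, e3, e1, e2, e2']
  simp only [nf3, zap_pd hf, zap_pd_pd hg, ← sum_sub_distrib, ← sum_add_distrib, ← sum_neg_distrib]
  refine sum_congr rfl fun a _ => sum_congr rfl fun b _ => sum_congr rfl fun c _ => ?_
  simp only [hX, hY]
  simp only [sum_sub_distrib, sum_neg_distrib, ← mul_sum, ← sum_mul]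
  ring

lemma null3_tangent (hF : NullForm3 F) {ξ : ℝ → Pt} {η : Pt} (hd : ∀ i, HasDerivAt (fun τ => ξ τ i)
    (η i) 0) (hm : ∀ τ, mink (ξ τ) = 0) : ∑ a, ∑ b, ∑ c, F a b c * (η a * ξ 0 b * ξ 0 c + ξ 0 a * η
    b * ξ 0 c + ξ 0 a * ξ 0 b * η c) = 0 := by
  have h1 : HasDerivAt (fun τ => ∑ a, ∑ b, ∑ c, F a b c * ξ τ a * ξ τ b * ξ τ c)
      (∑ a, ∑ b, ∑ c, F a b c * (η a * ξ 0 b * ξ 0 c + ξ 0 a * η b * ξ 0 c + ξ 0 a * ξ 0 b * η c)) 0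
        := by
    refine HasDerivAt.fun_sum fun a _ => HasDerivAt.fun_sum fun b _ => HasDerivAt.fun_sum
      fun c _ => ?_
    refine ((((hd a).const_mul (F a b c)).fun_mul (hd b)).fun_mul (hd c)).congr_deriv ?_
    ring
  have h2 : (fun τ => ∑ a, ∑ b, ∑ c, F a b c * ξ τ a * ξ τ b * ξ τ c) = fun _ => 0 := by
    ext τ
    exact hF _ (hm τ)
  rw [h2] at h1
  exact h1.unique (hasDerivAt_const _ _)

lemma null2_tangent {F : Ten2} (hF : NullForm2 F) {ξ : ℝ → Pt} {η : Pt} (hd : ∀ i, HasDerivAt (fun τ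
    => ξ τ i) (η i) 0) (hm : ∀ τ, mink (ξ τ) = 0) : ∑ a, ∑ b, F a b * (η a * ξ 0 b + ξ 0 a * η b) =
    0 := by
  have h1 : HasDerivAt (fun τ => ∑ a, ∑ b, F a b * ξ τ a * ξ τ b)
      (∑ a, ∑ b, F a b * (η a * ξ 0 b + ξ 0 a * η b)) 0 := by
    refine HasDerivAt.fun_sum fun a _ => HasDerivAt.fun_sum fun b _ => ?_
    refine (((hd a).const_mul (F a b)).fun_mul (hd b)).congr_deriv ?_
    ring
  have h2 : (fun τ => ∑ a, ∑ b, F a b * ξ τ a * ξ τ b) = fun _ => 0 := by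
    ext τ
    exact hF _ (hm τ)
  rw [h2] at h1
  exact h1.unique (hasDerivAt_const _ _)

lemma hasDerivAt_rot (x y : ℝ) : HasDerivAt (fun τ : ℝ => x * Real.cos τ + y * Real.sin τ) y 0 := by
  simpa using ((Real.hasDerivAt_cos 0).const_mul x).fun_add ((Real.hasDerivAt_sin 0).const_mul y)

lemma hasDerivAt_hyp (x y : ℝ) : HasDerivAt (fun τ : ℝ => x * Real.cosh τ + y * Real.sinh τ) y 0 :=
    by
  simpa using ((Real.hasDerivAt_cosh 0).const_mul x).fun_add ((Real.hasDerivAt_sinh 0).const_mul y)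

lemma rot_sq (x y τ : ℝ) : (x * Real.cos τ + y * Real.sin τ) ^ 2 + (y * Real.cos τ + -x * Real.sin
    τ) ^ 2 = x ^ 2 + y ^ 2 := by linear_combination (x ^ 2 + y ^ 2) * Real.sin_sq_add_cos_sq τ

lemma hyp_sq (x y τ : ℝ) : (x * Real.cosh τ + y * Real.sinh τ) ^ 2 - (y * Real.cosh τ + x *
    Real.sinh τ) ^ 2 = x ^ 2 - y ^ 2 := by
  linear_combination (x ^ 2 - y ^ 2) * Real.cosh_sq_sub_sinh_sq τ

/-- The dual linear flow of every field admits a curve in the null cone with that velocity. -/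
lemma exists_null_curve (Z : ZI) {ξ : Pt} (hξ : mink ξ = 0) : ∃ x : ℝ → Pt, x 0 = ξ ∧ (∀ i,
    HasDerivAt (fun τ => x τ i) (∑ a, zA Z a i * ξ a) 0) ∧ ∀ τ, mink (x τ) = 0 := by
  rcases Z with d | ⟨a, b⟩ | _
  · refine ⟨fun _ => ξ, rfl, fun i => ?_, fun _ => hξ⟩
    simpa [zA] using hasDerivAt_const (0 : ℝ) (ξ i)
  · have hsum : ∀ i, ∑ d, zA (Sum.inr (Sum.inl (a, b))) d i * ξ d
        = (if i = a then m4 a else 0) * ξ b - (if i = b then m4 b else 0) * ξ a := by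
      intro i
      simp [zA, sub_mul, sum_sub_distrib]
    simp only [hsum]
    by_cases hab : a = b
    · subst hab
      exact ⟨fun _ => ξ, rfl, fun i => by simpa using hasDerivAt_const (0 : ℝ) (ξ i), fun _ => hξ⟩
    by_cases h0 : m4 a = m4 b
    · refine ⟨fun τ i => if i = a then ξ a * Real.cos τ + (m4 a * ξ b) * Real.sin τ
        else if i = b then ξ b * Real.cos τ + -(m4 b * ξ a) * Real.sin τ else ξ i, ?_, ?_, ?_⟩
      · ext i
        by_cases h1 : i = a
        · simp [h1]
        · by_cases h2 : i = b <;> simp [h1, h2, show ¬ b = a from fun h => hab h.symm]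
      · intro i
        by_cases h1 : i = a
        · subst h1
          simpa [hab] using hasDerivAt_rot (ξ i) (m4 i * ξ b)
        · by_cases h2 : i = b
          · subst h2
            simpa [h1] using hasDerivAt_rot (ξ i) (-(m4 i * ξ a))
          · simpa [h1, h2] using hasDerivAt_const (0 : ℝ) (ξ i)
      · intro τ
        unfold mink at hξ ⊢
        fin_cases a <;> fin_cases b <;> first
          | exact absurd rfl hab
          | (exfalso; norm_num [m4] at h0; done)
          | (simp [m4]
             have r1 := rot_sq (ξ 1) (ξ 2) τ
             have r2 := rot_sq (ξ 1) (ξ 3) τ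
             have r3 := rot_sq (ξ 2) (ξ 3) τ
             have r4 := rot_sq (ξ 2) (ξ 1) τ
             have r5 := rot_sq (ξ 3) (ξ 1) τ
             have r6 := rot_sq (ξ 3) (ξ 2) τ
             linarith)
    · refine ⟨fun τ i => if i = a then ξ a * Real.cosh τ + (m4 a * ξ b) * Real.sinh τ
        else if i = b then ξ b * Real.cosh τ + -(m4 b * ξ a) * Real.sinh τ else ξ i, ?_, ?_, ?_⟩
      · ext i
        by_cases h1 : i = a
        · simp [h1]
        · by_cases h2 : i = b <;> simp [h1, h2, show ¬ b = a from fun h => hab h.symm]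
      · intro i
        by_cases h1 : i = a
        · subst h1
          simpa [hab] using hasDerivAt_hyp (ξ i) (m4 i * ξ b)
        · by_cases h2 : i = b
          · subst h2
            simpa [h1] using hasDerivAt_hyp (ξ i) (-(m4 i * ξ a))
          · simpa [h1, h2] using hasDerivAt_const (0 : ℝ) (ξ i)
      · intro τ
        unfold mink at hξ ⊢
        fin_cases a <;> fin_cases b <;> first
          | exact absurd rfl hab
          | (exfalso; norm_num [m4] at h0; done)
          | (simp [m4]
             have c1 := Real.cosh_sq_sub_sinh_sq τ
             have r1 := hyp_sq (ξ 1) (ξ 0) τ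
             have r2 := hyp_sq (ξ 2) (ξ 0) τ
             have r3 := hyp_sq (ξ 3) (ξ 0) τ
             linear_combination r1 + hξ)
          | (simp [m4]
             have r2 := hyp_sq (ξ 2) (ξ 0) τ
             linear_combination r2 + hξ)
          | (simp [m4]
             have r2 := hyp_sq (ξ 3) (ξ 0) τ
             linear_combination r2 + hξ)
  · refine ⟨fun τ i => (1 + τ) * ξ i, by simp, fun i => ?_, fun τ => ?_⟩
    · have := ((hasDerivAt_id (0 : ℝ)).const_add 1).mul_const (ξ i)
      simpa [zA] using this
    · unfold mink at hξ ⊢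
      linear_combination (1 + τ) ^ 2 * hξ

lemma NullForm3.FZ (hF : NullForm3 F) (Z : ZI) : NullForm3 (FZ Z F) := by
  intro ξ hξ
  obtain ⟨x, hx0, hd, hm⟩ := exists_null_curve Z hξ
  have h := null3_tangent hF (η := fun i => ∑ a, zA Z a i * ξ a) hd hm
  rw [hx0] at h
  simp only [_root_.FZ]
  rw [← neg_eq_zero, ← h]
  have e1 : ∑ a, ∑ b, ∑ c, ∑ d, zA Z a d * F d b c * (ξ a * ξ b * ξ c)
      = ∑ a, ∑ b, ∑ c, ∑ d, F a b c * (zA Z d a * ξ d * ξ b * ξ c) := by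
    have : ∀ a, ∑ b, ∑ c, ∑ d, zA Z a d * F d b c * (ξ a * ξ b * ξ c)
        = ∑ d, ∑ b, ∑ c, zA Z a d * F d b c * (ξ a * ξ b * ξ c) := fun a => by
      symm
      rw [sum_comm]
      refine sum_congr rfl fun b _ => ?_
      rw [sum_comm]
    simp only [this]
    rw [sum_comm]
    refine sum_congr rfl fun a _ => ?_
    rw [sum_comm]
    refine sum_congr rfl fun b _ => ?_
    rw [sum_comm]
    refine sum_congr rfl fun c _ => sum_congr rfl fun d _ => by ring
  have e2 : ∑ a, ∑ b, ∑ c, ∑ d, zA Z b d * F a d c * (ξ a * ξ b * ξ c)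
      = ∑ a, ∑ b, ∑ c, ∑ d, F a b c * (ξ a * (zA Z d b * ξ d * ξ c)) := by
    refine sum_congr rfl fun a _ => ?_
    have : ∀ b, ∑ c, ∑ d, zA Z b d * F a d c * (ξ a * ξ b * ξ c)
        = ∑ d, ∑ c, zA Z b d * F a d c * (ξ a * ξ b * ξ c) := fun b => sum_comm
    simp only [this]
    rw [sum_comm]
    refine sum_congr rfl fun b _ => ?_
    rw [sum_comm]
    refine sum_congr rfl fun c _ => sum_congr rfl fun d _ => by ring
  have e2' : ∑ a, ∑ b, ∑ c, ∑ d, zA Z c d * F a b d * (ξ a * ξ b * ξ c)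
      = ∑ a, ∑ b, ∑ c, ∑ d, F a b c * (ξ a * (zA Z d c * ξ b * ξ d)) := by
    refine sum_congr rfl fun a _ => sum_congr rfl fun b _ => ?_
    rw [sum_comm]
    refine sum_congr rfl fun c _ => sum_congr rfl fun d _ => by ring
  have e3 : -∑ a, ∑ b, ∑ c, -(∑ d, (zA Z a d * F d b c + zA Z b d * F a d c + zA Z c d * F a b d))
        * ξ a * ξ b * ξ c
      = (∑ a, ∑ b, ∑ c, ∑ d, zA Z a d * F d b c * (ξ a * ξ b * ξ c))
        + (∑ a, ∑ b, ∑ c, ∑ d, zA Z b d * F a d c * (ξ a * ξ b * ξ c))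
        + ∑ a, ∑ b, ∑ c, ∑ d, zA Z c d * F a b d * (ξ a * ξ b * ξ c) := by
    simp only [← sum_neg_distrib, ← sum_add_distrib, sum_mul]
    refine sum_congr rfl fun a _ => sum_congr rfl fun b _ =>
      sum_congr rfl fun c _ => sum_congr rfl fun d _ => by ring
  rw [e3, e1, e2, e2']
  simp only [← sum_add_distrib]
  refine sum_congr rfl fun a _ => sum_congr rfl fun b _ => sum_congr rfl fun c _ => ?_
  simp only [sum_add_distrib, ← mul_sum, ← sum_mul]
  simp only [mul_sum, sum_mul, ← sum_add_distrib]
  refine sum_congr rfl fun d _ => by ring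

lemma NullForm2.GZ {F : Ten2} (hF : NullForm2 F) (Z : ZI) : NullForm2 (GZ Z F) := by
  intro ξ hξ
  obtain ⟨x, hx0, hd, hm⟩ := exists_null_curve Z hξ
  have h := null2_tangent hF (η := fun i => ∑ a, zA Z a i * ξ a) hd hm
  rw [hx0] at h
  simp only [_root_.GZ]
  rw [← neg_eq_zero, ← h]
  have e1 : ∑ a, ∑ b, ∑ d, zA Z a d * F d b * (ξ a * ξ b)
      = ∑ a, ∑ b, ∑ d, F a b * (zA Z d a * ξ d * ξ b) := by
    have : ∀ a, ∑ b, ∑ d, zA Z a d * F d b * (ξ a * ξ b)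
        = ∑ d, ∑ b, zA Z a d * F d b * (ξ a * ξ b) := fun a => sum_comm
    simp only [this]
    rw [sum_comm]
    refine sum_congr rfl fun a _ => ?_
    rw [sum_comm]
    refine sum_congr rfl fun b _ => sum_congr rfl fun d _ => by ring
  have e2 : ∑ a, ∑ b, ∑ d, zA Z b d * F a d * (ξ a * ξ b)
      = ∑ a, ∑ b, ∑ d, F a b * (ξ a * (zA Z d b * ξ d)) := by
    refine sum_congr rfl fun a _ => ?_
    rw [sum_comm]
    refine sum_congr rfl fun b _ => sum_congr rfl fun d _ => by ring
  have e3 : -∑ a, ∑ b, -(∑ d, (zA Z a d * F d b + zA Z b d * F a d)) * ξ a * ξ b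
      = (∑ a, ∑ b, ∑ d, zA Z a d * F d b * (ξ a * ξ b))
        + ∑ a, ∑ b, ∑ d, zA Z b d * F a d * (ξ a * ξ b) := by
    simp only [← sum_neg_distrib, ← sum_add_distrib, sum_mul]
    refine sum_congr rfl fun a _ => sum_congr rfl fun b _ => sum_congr rfl fun d _ => by ring
  rw [e3, e1, e2]
  simp only [← sum_add_distrib]
  refine sum_congr rfl fun a _ => sum_congr rfl fun b _ => ?_
  simp only [mul_sum, sum_mul, ← sum_add_distrib]
  refine sum_congr rfl fun d _ => by ring

/-- Formal trilinear terms `F(dΓ^A f, d²Γ^B g)`. -/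
abbrev T3 : Type := (Ten3) × List ZI × List ZI

/-- Formal bilinear terms `G(dΓ^A f, dΓ^B g)`. -/
abbrev T2 : Type := (Ten2) × List ZI × List ZI

/-- Evaluation of a list of formal trilinear terms. -/
def ev3 (L : List T3) (f g : Fld) (p : Pt) : ℝ :=
  (L.map fun τ => nf3 τ.1 (gam τ.2.1 f) (gam τ.2.2 g) p).sum

/-- Evaluation of a list of formal bilinear terms. -/
def ev2 (L : List T2) (f g : Fld) (p : Pt) : ℝ :=
  (L.map fun τ => nf2 τ.1 (gam τ.2.1 f) (gam τ.2.2 g) p).sum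

lemma ev3_append (L L' : List T3) (f g : Fld) (p : Pt) : ev3 (L ++ L') f g p = ev3 L f g p + ev3 L'
    f g p := by simp [ev3]

lemma ev2_append (L L' : List T2) (f g : Fld) (p : Pt) : ev2 (L ++ L') f g p = ev2 L f g p + ev2 L'
    f g p := by simp [ev2]

lemma ev3_left (L : List T3) (Z : ZI) (f g : Fld) (p : Pt) : ev3 (L.map fun τ => (τ.1, Z :: τ.2.1,
    τ.2.2)) f g p = ev3 L (zap Z f) g p := by simp [ev3, Function.comp_def, gam]

lemma ev3_right (L : List T3) (Z : ZI) (f g : Fld) (p : Pt) : ev3 (L.map fun τ => (τ.1, τ.2.1, Z ::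
    τ.2.2)) f g p = ev3 L f (zap Z g) p := by simp [ev3, Function.comp_def, gam]

lemma ev2_left (L : List T2) (Z : ZI) (f g : Fld) (p : Pt) : ev2 (L.map fun τ => (τ.1, Z :: τ.2.1,
    τ.2.2)) f g p = ev2 L (zap Z f) g p := by simp [ev2, Function.comp_def, gam]

lemma ev2_right (L : List T2) (Z : ZI) (f g : Fld) (p : Pt) : ev2 (L.map fun τ => (τ.1, τ.2.1, Z ::
    τ.2.2)) f g p = ev2 L f (zap Z g) p := by simp [ev2, Function.comp_def, gam]

lemma nf3_smul (c : ℝ) (F : Ten3) (f g : Fld) (p : Pt) : nf3 (c • F) f g p = c * nf3 F f g p := by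
  simp only [nf3, Pi.smul_apply, smul_eq_mul, mul_sum]
  refine sum_congr rfl fun a _ => sum_congr rfl fun b _ => sum_congr rfl fun d _ => by ring

lemma nf2_smul (c : ℝ) (F : Ten2) (f g : Fld) (p : Pt) : nf2 (c • F) f g p = c * nf2 F f g p := by
  simp only [nf2, Pi.smul_apply, smul_eq_mul, mul_sum]
  refine sum_congr rfl fun a _ => sum_congr rfl fun b _ => by ring

lemma NullForm3.smul (hF : NullForm3 F) (c : ℝ) : NullForm3 (c • F) := by
  intro ξ hξ
  have := hF ξ hξ
  have h2 : ∑ a, ∑ b, ∑ d, (c • F) a b d * ξ a * ξ b * ξ d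
      = c * ∑ a, ∑ b, ∑ d, F a b d * ξ a * ξ b * ξ d := by
    simp only [Pi.smul_apply, smul_eq_mul, mul_sum]
    refine sum_congr rfl fun a _ => sum_congr rfl fun b _ => sum_congr rfl fun d _ => by ring
  rw [h2, this, mul_zero]

lemma NullForm2.smul {F : Ten2} (hF : NullForm2 F) (c : ℝ) : NullForm2 (c • F) := by
  intro ξ hξ
  have := hF ξ hξ
  have h2 : ∑ a, ∑ b, (c • F) a b * ξ a * ξ b = c * ∑ a, ∑ b, F a b * ξ a * ξ b := by
    simp only [Pi.smul_apply, smul_eq_mul, mul_sum]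
    refine sum_congr rfl fun a _ => sum_congr rfl fun b _ => by ring
  rw [h2, this, mul_zero]

lemma ev3_smul (L : List T3) (c : ℝ) (f g : Fld) (p : Pt) : ev3 (L.map fun τ => (c • τ.1, τ.2.1,
    τ.2.2)) f g p = c * ev3 L f g p := by
  simp [ev3, Function.comp_def, nf3_smul, List.sum_map_mul_left]

lemma ev2_smul (L : List T2) (c : ℝ) (f g : Fld) (p : Pt) : ev2 (L.map fun τ => (c • τ.1, τ.2.1,
    τ.2.2)) f g p = c * ev2 L f g p := by
  simp [ev2, Function.comp_def, nf2_smul, List.sum_map_mul_left]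

lemma gam_nf3 (J : List ZI) : ∀ F : Ten3, NullForm3 F → ∃ L : List T3, (∀ τ ∈ L, NullForm3 τ.1 ∧
    τ.2.1.length + τ.2.2.length ≤ J.length ∧ τ.2.2.length < J.length) ∧ ∀ f g : Fld, Sm f → Sm g →
      gam J (nf3 F f g) = fun p => nf3 F f (gam J g) p + ev3 L f g p := by
  induction J with
  | nil => exact fun F _ => ⟨[], by simp, fun f g _ _ => by ext; simp [gam, ev3]⟩
  | cons Z J ih =>
    intro F hF
    obtain ⟨L, hL, hLe⟩ := ih F hF
    obtain ⟨L', hL', hLe'⟩ := ih _ (hF.FZ Z)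
    refine ⟨[(F, [Z], J)] ++ L.map (fun τ => (τ.1, Z :: τ.2.1, τ.2.2)) ++ L.map (fun τ => (τ.1,
      τ.2.1, Z :: τ.2.2)) ++ [(FZ Z F, [], J)] ++ L', ?_, ?_⟩
    · intro τ hτ
      simp only [List.mem_append, List.mem_singleton, List.mem_map] at hτ
      rcases hτ with (((rfl | ⟨σ, hσ, rfl⟩) | ⟨σ, hσ, rfl⟩) | rfl) | hτ
      · exact ⟨hF, by simp; omega, by simp⟩
      · obtain ⟨h1, h2, h3⟩ := hL σ hσ
        exact ⟨h1, by simp; omega, by simp; omega⟩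
      · obtain ⟨h1, h2, h3⟩ := hL σ hσ
        exact ⟨h1, by simp; omega, by simp; omega⟩
      · exact ⟨hF.FZ Z, by simp, by simp⟩
      · obtain ⟨h1, h2, h3⟩ := hL' τ hτ
        exact ⟨h1, by simp; omega, by simp; omega⟩
    · intro f g hf hg
      simp only [gam]
      rw [zap_nf3 hf hg, gam_add (by fun_prop) (by fun_prop), gam_add (by fun_prop) (by fun_prop),
        hLe _ _ (hf.zap Z) hg, hLe _ _ hf (hg.zap Z), hLe' _ _ hf hg]
      ext p
      simp only [ev3_append, ev3_left, ev3_right]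
      simp only [ev3, List.map_cons, List.map_nil, List.sum_cons, List.sum_nil, gam]
      ring

lemma gam_nf2 (J : List ZI) : ∀ F : Ten2, NullForm2 F → ∃ L : List T2, (∀ τ ∈ L, NullForm2 τ.1 ∧
    τ.2.1.length + τ.2.2.length ≤ J.length) ∧ ∀ f g : Fld, Sm f → Sm g → gam J (nf2 F f g) = fun p
      => ev2 L f g p := by
  induction J with
  | nil => exact fun F hF => ⟨[(F, [], [])], by simpa using hF, fun f g _ _ => by
      ext; simp [gam, ev2]⟩
  | cons Z J ih =>
    intro F hF
    obtain ⟨L, hL, hLe⟩ := ih F hF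
    obtain ⟨L', hL', hLe'⟩ := ih _ (hF.GZ Z)
    refine ⟨L.map (fun τ => (τ.1, Z :: τ.2.1, τ.2.2)) ++ L.map (fun τ => (τ.1, τ.2.1, Z :: τ.2.2))
      ++ L', ?_, ?_⟩
    · intro τ hτ
      simp only [List.mem_append, List.mem_map] at hτ
      rcases hτ with (⟨σ, hσ, rfl⟩ | ⟨σ, hσ, rfl⟩) | hτ
      · obtain ⟨h1, h2⟩ := hL σ hσ
        exact ⟨h1, by simp; omega⟩
      · obtain ⟨h1, h2⟩ := hL σ hσ
        exact ⟨h1, by simp; omega⟩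
      · obtain ⟨h1, h2⟩ := hL' τ hτ
        exact ⟨h1, by simp; omega⟩
    · intro f g hf hg
      simp only [gam]
      rw [zap_nf2 hf hg, gam_add (by fun_prop) (by fun_prop), gam_add (by fun_prop) (by fun_prop),
        hLe _ _ (hf.zap Z) hg, hLe _ _ hf (hg.zap Z), hLe' _ _ hf hg]
      ext p
      simp only [ev2_append, ev2_left, ev2_right]

lemma box_gam (J : List ZI) : ∃ L : List (ℝ × List ZI), (∀ τ ∈ L, τ.2.length < J.length) ∧ ∀ f :
    Fld, Sm f → box (gam J f) = fun p => gam J (box f) p + (L.map fun τ => τ.1 * gam τ.2 (box f)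
      p).sum := by
  induction J with
  | nil => exact ⟨[], by simp, fun f _ => by ext; simp [gam]⟩
  | cons Z J ih =>
    obtain ⟨L, hL, hLe⟩ := ih
    refine ⟨[(zw Z, J)] ++ L.map (fun τ => (τ.1, Z :: τ.2)) ++ L.map (fun τ => (zw Z * τ.1, τ.2)),
      ?_, ?_⟩
    · intro τ hτ
      simp only [List.mem_append, List.mem_singleton, List.mem_map] at hτ
      rcases hτ with (rfl | ⟨σ, hσ, rfl⟩) | ⟨σ, hσ, rfl⟩
      · simp
      · have := hL σ hσ
        simp; omega
      · have := hL σ hσ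
        simp; omega
    · intro f hf
      have hb : ∀ K : List ZI, gam K (box (zap Z f)) = fun p =>
          gam K (zap Z (box f)) p + zw Z * gam K (box f) p := by
        intro K
        rw [box_zap hf, gam_add (by fun_prop) (by fun_prop), gam_const_mul (by fun_prop)]
      ext p
      simp only [gam]
      rw [hLe _ (hf.zap Z)]
      simp only [hb, List.map_append, List.map_map, List.sum_append, Function.comp_def, mul_add,
        List.sum_map_add, gam, List.map_cons, List.map_nil, List.sum_cons, List.sum_nil]
      have : ∀ τ : ℝ × List ZI, τ.1 * (zw Z * gam τ.2 (box f) p)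
        = zw Z * τ.1 * gam τ.2 (box f) p := fun τ => by ring
      simp only [this]
      ring

lemma gam_eq_zero_of_halfspace (hs : Sm h) (hz : ∀ p : Pt, 0 ≤ p 0 → h p = 0) (J : List ZI) : ∀ p :
    Pt, 0 ≤ p 0 → gam J h p = 0 := by
  induction J generalizing h with
  | nil => exact hz
  | cons Z J ih =>
    refine ih (hs.zap Z) fun p hp => ?_
    have : ∀ a, pd a h p = 0 := fun a =>
      pd_eq_zero_of_halfspace isOpen_univ hs (fun q _ hq => hz q hq) a p (Set.mem_univ _) hp
    simp [zap, this]

/-- Solutions of the semilinear-quasilinear wave equation on the half space. -/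
def Sol (F : Ten3) (G : Ten2) (φ : Fld) : Prop :=
  Sm φ ∧ ∀ q : Pt, 0 ≤ q 0 → box φ q + nf3 F φ φ q = nf2 G φ φ q

lemma Sol.gam_box (h : Sol F G φ) (J : List ZI) (hp : 0 ≤ p 0) : gam J (box φ) p = -gam J (nf3 F φ
    φ) p + gam J (nf2 G φ φ) p := by
  have hs := h.1
  have := gam_eq_zero_of_halfspace (h := fun q => box φ q + (nf3 F φ φ q + (-1) * nf2 G φ φ q))
    (by fun_prop) (fun q hq => by linarith [h.2 q hq]) J p hp
  rw [gam_add (by fun_prop) (by fun_prop), gam_add (by fun_prop) (by fun_prop), gam_const_mul (by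
    fun_prop)] at this
  linarith

lemma wave_comm (hF : NullForm3 F) (hG : NullForm2 G) (J : List ZI) : ∃ (L : List T3) (L' : List
    T2), (∀ τ ∈ L, NullForm3 τ.1 ∧ τ.2.1.length + τ.2.2.length ≤ J.length ∧ τ.2.2.length < J.length)
      ∧ (∀ τ ∈ L', NullForm2 τ.1 ∧ τ.2.1.length + τ.2.2.length ≤ J.length) ∧ ∀ φ : Fld, Sol F G φ →
      ∀ p : Pt, 0 ≤ p 0 → box (gam J φ) p + nf3 F φ (gam J φ) p = ev3 L φ φ p + ev2 L' φ φ p := by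
  obtain ⟨B, hB, hBe⟩ := box_gam J
  -- every lower order contribution expands formally
  have low : ∀ B : List (ℝ × List ZI), (∀ τ ∈ B, τ.2.length < J.length) →
      ∃ (L : List T3) (L' : List T2), (∀ τ ∈ L, NullForm3 τ.1 ∧ τ.2.1.length + τ.2.2.length ≤
      J.length ∧ τ.2.2.length < J.length) ∧
      (∀ τ ∈ L', NullForm2 τ.1 ∧ τ.2.1.length + τ.2.2.length ≤ J.length) ∧
      ∀ φ : Fld, Sol F G φ → ∀ p : Pt, 0 ≤ p 0 →
        (B.map fun τ => τ.1 * gam τ.2 (box φ) p).sum = ev3 L φ φ p + ev2 L' φ φ p := by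
    intro B
    induction B with
    | nil => exact fun _ => ⟨[], [], by simp, by simp, by simp [ev3, ev2]⟩
    | cons β B ih =>
      intro hB
      obtain ⟨L, L', hL, hL', he⟩ := ih fun τ hτ => hB τ (List.mem_cons_of_mem _ hτ)
      have hβ := hB β List.mem_cons_self
      obtain ⟨M, hM, hMe⟩ := gam_nf3 β.2 F hF
      obtain ⟨M', hM', hMe'⟩ := gam_nf2 β.2 G hG
      refine ⟨[((-β.1) • F, [], β.2)] ++ M.map (fun τ => ((-β.1) • τ.1, τ.2.1, τ.2.2)) ++ L, M'.map
        (fun τ => (β.1 • τ.1, τ.2.1, τ.2.2)) ++ L', ?_, ?_, ?_⟩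
      · intro τ hτ
        simp only [List.mem_append, List.mem_singleton, List.mem_map] at hτ
        rcases hτ with (rfl | ⟨σ, hσ, rfl⟩) | hτ
        · exact ⟨hF.smul _, by simp; omega, hβ⟩
        · obtain ⟨h1, h2, h3⟩ := hM σ hσ
          exact ⟨h1.smul _, by simp; omega, by simp; omega⟩
        · exact hL τ hτ
      · intro τ hτ
        simp only [List.mem_append, List.mem_map] at hτ
        rcases hτ with ⟨σ, hσ, rfl⟩ | hτ
        · obtain ⟨h1, h2⟩ := hM' σ hσ
          exact ⟨h1.smul _, by simp; omega⟩
        · exact hL' τ hτ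
      · intro φ hφ p hp
        have hs := hφ.1
        simp only [List.map_cons, List.sum_cons, he φ hφ p hp, hφ.gam_box β.2 hp, hMe φ φ hs hs,
          hMe' φ φ hs hs, ev3_append, ev2_append, ev3_smul, ev2_smul]
        simp only [ev3, List.map_cons, List.map_nil, List.sum_cons, List.sum_nil, gam, nf3_smul]
        ring
  obtain ⟨L, L', hL, hL', he⟩ := low B hB
  obtain ⟨M, hM, hMe⟩ := gam_nf3 J F hF
  obtain ⟨M', hM', hMe'⟩ := gam_nf2 J G hG
  refine ⟨M.map (fun τ => ((-1 : ℝ) • τ.1, τ.2.1, τ.2.2)) ++ L, M' ++ L', ?_, ?_, ?_⟩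
  · intro τ hτ
    simp only [List.mem_append, List.mem_map] at hτ
    rcases hτ with ⟨σ, hσ, rfl⟩ | hτ
    · obtain ⟨h1, h2, h3⟩ := hM σ hσ
      exact ⟨h1.smul _, h2, h3⟩
    · exact hL τ hτ
  · intro τ hτ
    rcases List.mem_append.1 hτ with hτ | hτ
    · exact hM' τ hτ
    · exact hL' τ hτ
  · intro φ hφ p hp
    have hs := hφ.1
    rw [hBe φ hs]
    simp only [he φ hφ p hp, hφ.gam_box J hp, hMe φ φ hs hs, hMe' φ φ hs hs, ev3_append, ev2_append,
      ev3_smul]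
    ring

/-- Words of length at most `k`. -/
def wds (k : ℕ) : Finset (List ZI) := (List.finite_length_le ZI k).toFinset

lemma mem_wds : J ∈ wds k ↔ J.length ≤ k := by simp [wds]

lemma wds_mono {l : ℕ} (h : k ≤ l) : wds k ⊆ wds l := fun _ hJ => mem_wds.2 ((mem_wds.1 hJ).trans h)

/-- `|∂f|` as a sum. -/
def D1 (f : Fld) (p : Pt) : ℝ := ∑ a, |pd a f p|

/-- `|Γf|`. -/
def G1 (f : Fld) (p : Pt) : ℝ := ∑ Z, |zap Z f p|

/-- `∑_{|J| ≤ k} |Γ^J f|`. -/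
def SS (k : ℕ) (f : Fld) (p : Pt) : ℝ := ∑ J ∈ wds k, |gam J f p|

/-- `∑_{|J| ≤ k} |∂Γ^J f|`. -/
def DD (k : ℕ) (f : Fld) (p : Pt) : ℝ := ∑ J ∈ wds k, D1 (gam J f) p

lemma pdAbs_eq (f : Fld) (p : Pt) : pdAbs f p = D1 f p := by simp [pdAbs, D1, Fin.sum_univ_four]

lemma D1_nonneg (f : Fld) (p : Pt) : 0 ≤ D1 f p := sum_nonneg fun _ _ => abs_nonneg _
lemma G1_nonneg (f : Fld) (p : Pt) : 0 ≤ G1 f p := sum_nonneg fun _ _ => abs_nonneg _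
lemma SS_nonneg (k : ℕ) (f : Fld) (p : Pt) : 0 ≤ SS k f p := sum_nonneg fun _ _ => abs_nonneg _
lemma DD_nonneg (k : ℕ) (f : Fld) (p : Pt) : 0 ≤ DD k f p := sum_nonneg fun _ _ => D1_nonneg _ _

lemma abs_pd_le_D1 (f : Fld) (p : Pt) (a : Fin 4) : |pd a f p| ≤ D1 f p :=
  single_le_sum (f := fun a => |pd a f p|) (fun _ _ => abs_nonneg _) (mem_univ a)

lemma abs_zap_le_G1 (f : Fld) (p : Pt) (Z : ZI) : |zap Z f p| ≤ G1 f p :=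
  single_le_sum (f := fun Z => |zap Z f p|) (fun _ _ => abs_nonneg _) (mem_univ Z)

lemma D1_le_G1 (f : Fld) (p : Pt) : D1 f p ≤ G1 f p := by
  have h := Finset.sum_le_univ_sum_of_nonneg (s := univ.map ⟨Sum.inl, Sum.inl_injective⟩)
    (f := fun Z : ZI => |zap Z f p|) (fun _ => abs_nonneg _)
  simpa [D1, G1, zap_tr] using h

lemma abs_gam_le_SS (h : J.length ≤ k) (f : Fld) (p : Pt) : |gam J f p| ≤ SS k f p :=
  single_le_sum (f := fun J => |gam J f p|) (fun _ _ => abs_nonneg _) (mem_wds.2 h)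

lemma D1_gam_le_DD (h : J.length ≤ k) (f : Fld) (p : Pt) : D1 (gam J f) p ≤ DD k f p :=
  single_le_sum (f := fun J => D1 (gam J f) p) (fun _ _ => D1_nonneg _ _) (mem_wds.2 h)

lemma SS_mono {l : ℕ} (h : k ≤ l) (f : Fld) (p : Pt) : SS k f p ≤ SS l f p :=
  sum_le_sum_of_subset_of_nonneg (wds_mono h) fun _ _ _ => abs_nonneg _

lemma DD_mono {l : ℕ} (h : k ≤ l) (f : Fld) (p : Pt) : DD k f p ≤ DD l f p :=
  sum_le_sum_of_subset_of_nonneg (wds_mono h) fun _ _ _ => D1_nonneg _ _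

lemma sum_wds_gam_le (h : List ZI → ℝ) (hh : ∀ J, 0 ≤ h J) (k : ℕ) (J : List ZI) : ∑ K ∈ wds k, h (J
    ++ K) ≤ ∑ K ∈ wds (J.length + k), h K := by
  have := sum_le_sum_of_subset_of_nonneg (f := h)
    (s := (wds k).map ⟨fun K => J ++ K, List.append_right_injective J⟩) (t := wds (J.length + k))
    (fun K hK => by
      simp only [Finset.mem_map, Function.Embedding.coeFn_mk] at hK
      obtain ⟨K', hK', rfl⟩ := hK
      have := mem_wds.1 hK'
      exact mem_wds.2 (by simp; omega)) fun _ _ _ => hh _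
  simpa using this

lemma SS_gam_le (k : ℕ) (J : List ZI) (f : Fld) (p : Pt) : SS k (gam J f) p ≤ SS (J.length + k) f p
    := by
  have := sum_wds_gam_le (fun J => |gam J f p|) (fun _ => abs_nonneg _) k J
  simpa only [SS, gam_append] using this

lemma DD_gam_le (k : ℕ) (J : List ZI) (f : Fld) (p : Pt) : DD k (gam J f) p ≤ DD (J.length + k) f p
    := by
  have := sum_wds_gam_le (fun J => D1 (gam J f) p) (fun _ => D1_nonneg _ _) k J
  simpa only [DD, gam_append] using this

lemma G1_le_SS (f : Fld) (p : Pt) : G1 f p ≤ SS 1 f p := by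
  have hinj : Function.Injective fun Z : ZI => [Z] := fun _ _ h => by simpa using h
  have h := sum_le_sum_of_subset_of_nonneg (f := fun J => |gam J f p|)
    (s := univ.image fun Z : ZI => [Z]) (t := wds 1)
    (fun K hK => by
      obtain ⟨K', hK', rfl⟩ := Finset.mem_image.1 hK
      exact mem_wds.2 (by simp)) fun _ _ _ => abs_nonneg _
  rw [Finset.sum_image hinj.injOn] at h
  exact h

lemma G1_gam_le_SS (h : J.length + 1 ≤ k) (f : Fld) (p : Pt) : G1 (gam J f) p ≤ SS k f p :=
  (G1_le_SS _ p).trans ((SS_gam_le 1 J f p).trans (SS_mono h f p))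

lemma D1_pd_gam_le (h : J.length + 1 ≤ k) (f : Fld) (p : Pt) (a : Fin 4) : D1 (pd a (gam J f)) p ≤
    DD k f p := by
  have : pd a (gam J f) = gam (J ++ [Sum.inl a]) f := by rw [gam_snoc, zap_tr]
  rw [this]
  exact D1_gam_le_DD (by simpa using h) f p

lemma sum_D1_pd_gam_le (h : J.length + 1 ≤ k) (f : Fld) (p : Pt) : ∑ a, D1 (pd a (gam J f)) p ≤ 4 *
    DD k f p := by
  have := sum_le_card_nsmul univ (fun a => D1 (pd a (gam J f)) p) (DD k f p)
    fun a _ => D1_pd_gam_le h f p a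
  simpa using this

lemma DD_le_SS (k : ℕ) (f : Fld) (p : Pt) : DD k f p ≤ SS (k + 1) f p := by
  have hinj : Function.Injective fun x : List ZI × Fin 4 => x.1 ++ [(Sum.inl x.2 : ZI)] := by
    intro x y h
    have h' := List.append_inj' h rfl
    simp only [List.cons.injEq, Sum.inl.injEq, and_true] at h'
    exact Prod.ext h'.1 h'.2
  have h := sum_le_sum_of_subset_of_nonneg (f := fun J => |gam J f p|)
    (s := ((wds k) ×ˢ (univ : Finset (Fin 4))).image fun x : List ZI × Fin 4 => x.1 ++ [(Sum.inl x.2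
      : ZI)]) (t := wds (k + 1))
    (fun K hK => by
      obtain ⟨⟨K', a⟩, hK', rfl⟩ := Finset.mem_image.1 hK
      have := mem_wds.1 (Finset.mem_product.1 hK').1
      exact mem_wds.2 (by simpa using this)) fun _ _ _ => abs_nonneg _
  rw [Finset.sum_image hinj.injOn, Finset.sum_product] at h
  simpa only [DD, D1, SS, gam_snoc, zap_tr] using h

lemma abs_zA_le (Z : ZI) (a c : Fin 4) : |zA Z a c| ≤ 2 := by
  have hm : ∀ a, |m4 a| ≤ 1 := fun a => by fin_cases a <;> simp [m4]
  rcases Z with d | ⟨d, e⟩ | _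
  · simp [zA]
  · have h1 : ∀ (P Q : Prop) [Decidable P] [Decidable Q] (i : Fin 4),
        |(if P then m4 i else 0) * (if Q then (1 : ℝ) else 0)| ≤ 1 := by
      intro P Q _ _ i
      split_ifs <;> simp [hm]
    calc _ ≤ _ := abs_sub _ _
      _ ≤ 1 + 1 := add_le_add (h1 _ _ _) (h1 _ _ _)
      _ = 2 := by norm_num
  · simp only [zA]
    split_ifs <;> norm_num

lemma abs_zap_pd_le (hf : Sm f) (Z : ZI) (a : Fin 4) (p : Pt) : |zap Z (pd a f) p| ≤ D1 (zap Z f) p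
    + 2 * D1 f p := by
  rw [zap_pd hf]
  refine (abs_sub _ _).trans (add_le_add (abs_pd_le_D1 _ _ _) ?_)
  refine (abs_sum_le_sum_abs _ _).trans ?_
  rw [D1, mul_sum]
  refine sum_le_sum fun b _ => ?_
  rw [abs_mul]
  exact mul_le_mul_of_nonneg_right (abs_zA_le _ _ _) (abs_nonneg _)

lemma sum_G1_pd_gam_le (h : J.length + 1 ≤ k) (hf : Sm f) (p : Pt) : ∑ a, G1 (pd a (gam J f)) p ≤ 4
    * ((Fintype.card ZI : ℝ) * (3 * DD k f p)) := by
  have h1 : ∀ a, G1 (pd a (gam J f)) p ≤ (Fintype.card ZI : ℝ) * (3 * DD k f p) := by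
    intro a
    have := sum_le_card_nsmul univ (fun Z => |zap Z (pd a (gam J f)) p|)
      (3 * DD k f p) fun Z _ => by
        refine (abs_zap_pd_le (hf.gam J) Z a p).trans ?_
        have e : zap Z (gam J f) = gam (J ++ [Z]) f := by rw [gam_snoc]
        have h2 := D1_gam_le_DD (k := k) (J := J ++ [Z]) (by simpa using h) f p
        have h3 := D1_gam_le_DD (k := k) (J := J) (by omega) f p
        rw [e]
        linarith
    simpa [G1] using this
  have := sum_le_card_nsmul univ (fun a => G1 (pd a (gam J f)) p) _ fun a _ => h1 a
  simpa using this

lemma exists_unit_dir (p : Pt) : ∃ x y z : ℝ, x ^ 2 + y ^ 2 + z ^ 2 = 1 ∧ p 1 = rr p * x ∧ p 2 = rr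
    p * y ∧ p 3 = rr p * z := by
  have h := rr_sq p
  by_cases h0 : rr p = 0
  · rw [h0] at h
    have h1 := sq_nonneg (p 1)
    have h2 := sq_nonneg (p 2)
    have h3 := sq_nonneg (p 3)
    refine ⟨1, 0, 0, by norm_num, ?_, ?_, ?_⟩ <;> rw [h0, zero_mul] <;>
      exact pow_eq_zero_iff two_ne_zero |>.1 (by linarith)
  · refine ⟨p 1 / rr p, p 2 / rr p, p 3 / rr p, ?_, ?_, ?_, ?_⟩ <;> field_simp
    linarith

lemma abs_sub_rr_mul_pd_le (f : Fld) (hp : 0 ≤ p 0) (a : Fin 4) : |p 0 - rr p| * |pd a f p| ≤ 6 * G1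
    f p := by
  have hr := rr_nonneg p
  have hG := G1_nonneg f p
  rcases (add_nonneg hp hr).eq_or_lt with h0 | hpos
  · have e1 : p 0 = 0 := by linarith
    have e2 : rr p = 0 := by linarith
    simp [e1, e2]; linarith
  have hx1 := abs_coord_le_rr p 0
  have hx2 := abs_coord_le_rr p 1
  have hx3 := abs_coord_le_rr p 2
  rw [sidx_zero] at hx1; rw [sidx_one] at hx2; rw [sidx_two] at hx3
  have hS := zap_sc f p
  have hL := fun i : Fin 4 => zap_lor i 0 f p
  have hO := fun i j : Fin 4 => zap_lor i j f p
  have bd := abs_zap_le_G1 f p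
  have hx : ∀ i : Fin 4, i ≠ 0 → |p i| ≤ p 0 + rr p := by
    intro i hi
    fin_cases i
    · exact absurd rfl hi
    all_goals simp; linarith
  have ht : |p 0| ≤ p 0 + rr p := by rw [abs_of_nonneg hp]; linarith
  have mulbd : ∀ (c : ℝ) (Z : ZI), |c| ≤ p 0 + rr p → |c * zap Z f p| ≤ (p 0 + rr p) * G1 f p := by
    intro c Z hc
    rw [abs_mul]
    exact mul_le_mul hc (bd Z) (abs_nonneg _) hpos.le
  have key : |(p 0 + rr p) * ((p 0 - rr p) * pd a f p)| ≤ (p 0 + rr p) * (6 * G1 f p) := by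
    have hr2 := rr_sq p
    have h5 : ∀ v w x y z : ℝ, ∀ B : ℝ, |v| ≤ B → |w| ≤ B → |x| ≤ B → |y| ≤ B → |z| ≤ B →
        |v - w - x - y - z| ≤ 6 * B := by
      intro v w x y z B h1 h2 h3 h4 h5
      rw [abs_le] at *
      constructor <;> linarith [h1.1, h1.2]
    have fin : ∀ v w x y z : ℝ, (p 0 + rr p) * ((p 0 - rr p) * pd a f p) = v - w - x - y - z →
        |v| ≤ (p 0 + rr p) * G1 f p → |w| ≤ (p 0 + rr p) * G1 f p →
        |x| ≤ (p 0 + rr p) * G1 f p → |y| ≤ (p 0 + rr p) * G1 f p →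
        |z| ≤ (p 0 + rr p) * G1 f p →
        |(p 0 + rr p) * ((p 0 - rr p) * pd a f p)| ≤ (p 0 + rr p) * (6 * G1 f p) := by
      intro v w x y z he h1 h2 h3 h4 h6
      rw [he]
      refine (h5 v w x y z _ h1 h2 h3 h4 h6).trans (le_of_eq (by ring))
    have h00 : |(0 : ℝ)| ≤ (p 0 + rr p) * G1 f p := by rw [abs_zero]; positivity
    have nz1 : (1 : Fin 4) ≠ 0 := by decide
    have nz2 : (2 : Fin 4) ≠ 0 := by decide
    have nz3 : (3 : Fin 4) ≠ 0 := by decide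
    have m0 : m4 0 = -1 := rfl
    have m1 : m4 1 = 1 := rfl
    have m2 : m4 2 = 1 := rfl
    have m3 : m4 3 = 1 := rfl
    have em : ∀ i : Fin 4, i ≠ 0 → m4 i = 1 := fun i hi => by
      fin_cases i
      · exact absurd rfl hi
      all_goals rfl
    rcases eq_or_ne a 0 with rfl | ha
    · refine fin _ _ _ _ _ ?_ (mulbd (p 0) (Sum.inr (Sum.inr ())) ht)
        (mulbd (p 1) (Sum.inr (Sum.inl (1, 0))) (hx 1 nz1))
        (mulbd (p 2) (Sum.inr (Sum.inl (2, 0))) (hx 2 nz2))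
        (mulbd (p 3) (Sum.inr (Sum.inl (3, 0))) (hx 3 nz3)) h00
      simp only [hL, hS, m0, m1, m2, m3, Fin.sum_univ_four]
      linear_combination (-pd 0 f p) * hr2
    · refine fin _ _ _ _ _ ?_ (mulbd (p 0) (Sum.inr (Sum.inl (a, 0))) ht)
        (mulbd (p a) (Sum.inr (Sum.inr ())) (hx a ha))
        (mulbd (p 1) (Sum.inr (Sum.inl (1, a))) (hx 1 nz1))
        (mulbd (p 2) (Sum.inr (Sum.inl (2, a))) (hx 2 nz2))
        (mulbd (p 3) (Sum.inr (Sum.inl (3, a))) (hx 3 nz3))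
      simp only [hL, hO, hS, m0, m1, m2, m3, Fin.sum_univ_four, em a ha]
      linear_combination (-pd a f p) * hr2
  rw [abs_mul, abs_of_pos hpos] at key
  have := le_of_mul_le_mul_left key hpos
  rwa [abs_mul] at this

lemma one_add_abs_mul_pd_le (f : Fld) (hp : 0 ≤ p 0) (a : Fin 4) : (1 + |p 0 - rr p|) * |pd a f p| ≤
    7 * G1 f p := by
  have h1 := abs_sub_rr_mul_pd_le f hp a
  have h2 := (abs_pd_le_D1 f p a).trans (D1_le_G1 f p)
  linarith

/-- Decomposition of the gradient along a null covector. -/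
lemma exists_null_decomp (hp : 0 ≤ p 0) : ∃ ξ : Pt, mink ξ = 0 ∧ (∀ a, |ξ a| ≤ 1) ∧ ∀ (f : Fld) (a :
    Fin 4), ss p * |pd a f p - ξ a * pd 0 f p| ≤ 16 * G1 f p := by
  obtain ⟨x, y, z, hu, h1, h2, h3⟩ := exists_unit_dir p
  have hr := rr_nonneg p
  have key : ∀ (w : ℝ) (i : Fin 4), |w| ≤ 1 → m4 i = 1 → p i = rr p * w → ∀ f : Fld,
      ss p * |pd i f p - -w * pd 0 f p| ≤ 16 * G1 f p := by
    intro w i hw hi hpi f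
    have hL := abs_zap_le_G1 f p (Sum.inr (Sum.inl (i, 0)))
    rw [zap_lor, hi, hpi] at hL
    have hm : m4 0 = -1 := rfl
    rw [hm] at hL
    have b0 := abs_sub_rr_mul_pd_le f hp 0
    have bi := abs_sub_rr_mul_pd_le f hp i
    have d0 := (abs_pd_le_D1 f p 0).trans (D1_le_G1 f p)
    have di := (abs_pd_le_D1 f p i).trans (D1_le_G1 f p)
    have e : ss p * (pd i f p - -w * pd 0 f p) = pd i f p + w * pd 0 f p
        + 2 * (1 * (rr p * w) * pd 0 f p - -1 * p 0 * pd i f p)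
        + (w * ((p 0 - rr p) * pd 0 f p) - (p 0 - rr p) * pd i f p) := by rw [ss]; ring
    have hs := ss_pos hp
    rw [← abs_of_pos hs, ← abs_mul, e]
    rw [← abs_mul] at b0 bi
    have w1 : |w * pd 0 f p| ≤ |pd 0 f p| := by
      rw [abs_mul]; exact mul_le_of_le_one_left (abs_nonneg _) hw
    have w2 : |w * ((p 0 - rr p) * pd 0 f p)| ≤ |(p 0 - rr p) * pd 0 f p| := by
      rw [abs_mul]; exact mul_le_of_le_one_left (abs_nonneg _) hw
    refine (abs_add_le _ _).trans ?_
    have t1 := abs_add_le (pd i f p + w * pd 0 f p)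
      (2 * (1 * (rr p * w) * pd 0 f p - -1 * p 0 * pd i f p))
    have t2 := abs_add_le (pd i f p) (w * pd 0 f p)
    have t3 := abs_sub (w * ((p 0 - rr p) * pd 0 f p)) ((p 0 - rr p) * pd i f p)
    rw [abs_mul (2 : ℝ), abs_of_pos (two_pos : (0 : ℝ) < 2)] at t1
    linarith
  refine ⟨![1, -x, -y, -z], ?_, ?_, ?_⟩
  · simp [mink]; linarith
  · intro a
    have hx : |x| ≤ 1 := abs_le_one_iff_mul_self_le_one.2 (by nlinarith [sq_nonneg y, sq_nonneg z])
    have hy : |y| ≤ 1 := abs_le_one_iff_mul_self_le_one.2 (by nlinarith [sq_nonneg x, sq_nonneg z])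
    have hz : |z| ≤ 1 := abs_le_one_iff_mul_self_le_one.2 (by nlinarith [sq_nonneg x, sq_nonneg y])
    fin_cases a <;> simp [hx, hy, hz]
  · intro f a
    have hx : |x| ≤ 1 := abs_le_one_iff_mul_self_le_one.2 (by nlinarith [sq_nonneg y, sq_nonneg z])
    have hy : |y| ≤ 1 := abs_le_one_iff_mul_self_le_one.2 (by nlinarith [sq_nonneg x, sq_nonneg z])
    have hz : |z| ≤ 1 := abs_le_one_iff_mul_self_le_one.2 (by nlinarith [sq_nonneg x, sq_nonneg y])
    fin_cases a
    · simpa using G1_nonneg f p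
    · exact key x 1 hx rfl h1 f
    · exact key y 2 hy rfl h2 f
    · exact key z 3 hz rfl h3 f

lemma null2_pt (hG : NullForm2 G) : ∃ C : ℝ, 0 ≤ C ∧ ∀ (f g : Fld) (p : Pt), 0 ≤ p 0 → ss p * |nf2 G
      f g p| ≤ C * (G1 f p * D1 g p + D1 f p * G1 g p) := by
  refine ⟨16 * ∑ a, ∑ b, |G a b|, by positivity, fun f g p hp => ?_⟩
  obtain ⟨ξ, hξ, hξ1, hT⟩ := exists_null_decomp hp
  have e : nf2 G f g p = ∑ a, ∑ b, G a b * (ξ a * pd 0 f p * (pd b g p - ξ b * pd 0 g p) + (pd a f p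
      - ξ a * pd 0 f p) * pd b g p) := by
    have h0 := hG ξ hξ
    have : nf2 G f g p = ∑ a, ∑ b, G a b * (ξ a * pd 0 f p * (pd b g p - ξ b * pd 0 g p) + (pd a f p
      - ξ a * pd 0 f p) * pd b g p)
      + (∑ a, ∑ b, G a b * ξ a * ξ b) * (pd 0 f p * pd 0 g p) := by
      simp only [nf2, sum_mul, ← sum_add_distrib]
      exact sum_congr rfl fun _ _ => sum_congr rfl fun _ _ => by ring
    rw [this, h0]; ring
  have hs := ss_pos hp
  rw [e, ← abs_of_pos hs, ← abs_mul, mul_sum]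
  refine (abs_sum_le_sum_abs _ _).trans ?_
  rw [mul_sum, sum_mul]
  refine sum_le_sum fun a _ => ?_
  rw [mul_sum]
  refine (abs_sum_le_sum_abs _ _).trans ?_
  rw [mul_sum, sum_mul]
  refine sum_le_sum fun b _ => ?_
  rw [mul_left_comm, abs_mul, mul_comm (16 : ℝ), mul_assoc |G a b|]
  refine mul_le_mul_of_nonneg_left ?_ (abs_nonneg _)
  rw [mul_add]
  refine (abs_add_le _ _).trans ?_
  have b1 : |ss p * (ξ a * pd 0 f p * (pd b g p - ξ b * pd 0 g p))| ≤ D1 f p * (16 * G1 g p) := by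
    have e1 : ss p * (ξ a * pd 0 f p * (pd b g p - ξ b * pd 0 g p))
        = ξ a * pd 0 f p * (ss p * (pd b g p - ξ b * pd 0 g p)) := by ring
    rw [e1, abs_mul, abs_mul, abs_mul (ss p), abs_of_pos hs]
    exact mul_le_mul ((mul_le_of_le_one_left (abs_nonneg _) (hξ1 a)).trans (abs_pd_le_D1 f p 0))
      (hT g b) (by positivity) (D1_nonneg _ _)
  have b2 : |ss p * ((pd a f p - ξ a * pd 0 f p) * pd b g p)| ≤ 16 * G1 f p * D1 g p := by
    rw [← mul_assoc, abs_mul, abs_mul (ss p), abs_of_pos hs]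
    exact mul_le_mul (hT f a) (abs_pd_le_D1 g p b) (abs_nonneg _) (by have := G1_nonneg f p; positivity)
  linarith

lemma null3_pt (hF : NullForm3 F) : ∃ C : ℝ, 0 ≤ C ∧ ∀ (f g : Fld) (p : Pt), Sm g → 0 ≤ p 0 → ss p *
      |nf3 F f g p| ≤ C * (G1 f p * (∑ c, D1 (pd c g) p) + D1 f p * ∑ c, G1 (pd c g) p) := by
  refine ⟨32 * ∑ a, ∑ b, ∑ c, |F a b c|, by positivity, fun f g p hg hp => ?_⟩
  obtain ⟨ξ, hξ, hξ1, hT⟩ := exists_null_decomp hp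
  set X := G1 f p * (∑ c, D1 (pd c g) p) + D1 f p * ∑ c, G1 (pd c g) p with hX
  have comm : ∀ c, pd 0 (pd c g) p = pd c (pd 0 g) p := fun c => by rw [pd_comm hg]
  have e : nf3 F f g p = ∑ a, ∑ b, ∑ c, F a b c *
      (ξ a * pd 0 f p * ((pd b (pd c g) p - ξ b * pd 0 (pd c g) p) + ξ b * (pd c (pd 0 g) p - ξ c *
        pd 0 (pd 0 g) p)) + (pd a f p - ξ a * pd 0 f p) * pd b (pd c g) p) := by
    have h0 := hF ξ hξ
    have : nf3 F f g p = ∑ a, ∑ b, ∑ c, F a b c *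
      (ξ a * pd 0 f p * ((pd b (pd c g) p - ξ b * pd 0 (pd c g) p) + ξ b * (pd c (pd 0 g) p - ξ c *
        pd 0 (pd 0 g) p)) + (pd a f p - ξ a * pd 0 f p) * pd b (pd c g) p)
      + (∑ a, ∑ b, ∑ c, F a b c * ξ a * ξ b * ξ c) * (pd 0 f p * pd 0 (pd 0 g) p) := by
      simp only [nf3, sum_mul, ← sum_add_distrib, comm]
      exact sum_congr rfl fun _ _ => sum_congr rfl fun _ _ => sum_congr rfl fun _ _ => by ring
    rw [this, h0]; ring
  have hs := ss_pos hp
  rw [e, ← abs_of_pos hs, ← abs_mul, mul_sum]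
  refine (abs_sum_le_sum_abs _ _).trans ?_
  rw [mul_sum, sum_mul]
  refine sum_le_sum fun a _ => ?_
  rw [mul_sum]
  refine (abs_sum_le_sum_abs _ _).trans ?_
  rw [mul_sum, sum_mul]
  refine sum_le_sum fun b _ => ?_
  rw [mul_sum]
  refine (abs_sum_le_sum_abs _ _).trans ?_
  rw [mul_sum, sum_mul]
  refine sum_le_sum fun c _ => ?_
  rw [mul_left_comm, abs_mul, mul_comm (32 : ℝ), mul_assoc |F a b c|]
  refine mul_le_mul_of_nonneg_left ?_ (abs_nonneg _)
  have sG : ∀ c, G1 (pd c g) p ≤ ∑ c, G1 (pd c g) p := fun c =>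
    single_le_sum (f := fun c => G1 (pd c g) p) (fun _ _ => G1_nonneg _ _) (mem_univ c)
  have sD : ∀ c, D1 (pd c g) p ≤ ∑ c, D1 (pd c g) p := fun c =>
    single_le_sum (f := fun c => D1 (pd c g) p) (fun _ _ => D1_nonneg _ _) (mem_univ c)
  have hD0 : |ξ a * pd 0 f p| ≤ D1 f p := by
    rw [abs_mul]
    exact (mul_le_of_le_one_left (abs_nonneg _) (hξ1 a)).trans (abs_pd_le_D1 f p 0)
  have b1 : |ss p * (ξ a * pd 0 f p * ((pd b (pd c g) p - ξ b * pd 0 (pd c g) p) + ξ b * (pd c (pd 0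
        g) p - ξ c * pd 0 (pd 0 g) p)))|
      ≤ D1 f p * (32 * ∑ c, G1 (pd c g) p) := by
    have e1 : ss p * (ξ a * pd 0 f p * ((pd b (pd c g) p - ξ b * pd 0 (pd c g) p) + ξ b * (pd c (pd
        0 g) p - ξ c * pd 0 (pd 0 g) p)))
        = ξ a * pd 0 f p * (ss p * (pd b (pd c g) p - ξ b * pd 0 (pd c g) p) + ξ b * (ss p * (pd c
        (pd 0 g) p - ξ c * pd 0 (pd 0 g) p))) := by ring
    rw [e1, abs_mul]
    refine mul_le_mul hD0 ?_ (abs_nonneg _) (D1_nonneg _ _)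
    refine (abs_add_le _ _).trans ?_
    rw [abs_mul (ss p), abs_mul (ξ b), abs_mul (ss p), abs_of_pos hs]
    have u1 := hT (pd c g) b
    have u2 := hT (pd 0 g) c
    have u3 := mul_le_of_le_one_left (b := ss p * |pd c (pd 0 g) p - ξ c * pd 0 (pd 0 g) p|)
      (by positivity) (hξ1 b)
    have := sG c
    have := sG 0
    linarith
  have b2 : |ss p * ((pd a f p - ξ a * pd 0 f p) * pd b (pd c g) p)|
      ≤ 16 * G1 f p * ∑ c, D1 (pd c g) p := by
    rw [← mul_assoc, abs_mul, abs_mul (ss p), abs_of_pos hs]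
    exact mul_le_mul (hT f a) ((abs_pd_le_D1 (pd c g) p b).trans (sD c)) (abs_nonneg _)
      (by have := G1_nonneg f p; positivity)
  have h3 : 0 ≤ G1 f p * ∑ c, D1 (pd c g) p :=
    mul_nonneg (G1_nonneg _ _) (sum_nonneg fun _ _ => D1_nonneg _ _)
  rw [mul_add]
  refine (abs_add_le _ _).trans ?_
  rw [hX]
  linarith

lemma crude2_pt (G : Ten2) : ∃ C : ℝ, 0 ≤ C ∧ ∀ (f g : Fld) (p : Pt), |nf2 G f g p| ≤ C * (D1 f p *
    D1 g p) := by
  refine ⟨∑ a, ∑ b, |G a b|, by positivity, fun f g p => ?_⟩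
  rw [nf2]
  refine (abs_sum_le_sum_abs _ _).trans ?_
  rw [sum_mul]
  refine sum_le_sum fun a _ => ?_
  refine (abs_sum_le_sum_abs _ _).trans ?_
  rw [sum_mul]
  refine sum_le_sum fun b _ => ?_
  rw [mul_assoc, abs_mul, abs_mul]
  exact mul_le_mul_of_nonneg_left (mul_le_mul (abs_pd_le_D1 f p a) (abs_pd_le_D1 g p b) (abs_nonneg
    _) (D1_nonneg _ _)) (abs_nonneg _)

lemma crude3_pt (F : Ten3) : ∃ C : ℝ, 0 ≤ C ∧ ∀ (f g : Fld) (p : Pt), |nf3 F f g p| ≤ C * (D1 f p *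
    ∑ c, D1 (pd c g) p) := by
  refine ⟨∑ a, ∑ b, ∑ c, |F a b c|, by positivity, fun f g p => ?_⟩
  rw [nf3]
  refine (abs_sum_le_sum_abs _ _).trans ?_
  rw [sum_mul]
  refine sum_le_sum fun a _ => ?_
  refine (abs_sum_le_sum_abs _ _).trans ?_
  rw [sum_mul]
  refine sum_le_sum fun b _ => ?_
  refine (abs_sum_le_sum_abs _ _).trans ?_
  rw [sum_mul]
  refine sum_le_sum fun c _ => ?_
  rw [mul_assoc, abs_mul, abs_mul]
  exact mul_le_mul_of_nonneg_left (mul_le_mul (abs_pd_le_D1 f p a) ((abs_pd_le_D1 (pd c g) p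
    b).trans (single_le_sum (f := fun c => D1 (pd c g) p) (fun _ _ => D1_nonneg _ _) (mem_univ c)))
      (abs_nonneg _) (D1_nonneg _ _)) (abs_nonneg _)

lemma list_sum_bound {α ι : Type*} (L : List α) (v : α → ι → ℝ) (X : ι → ℝ) (P : ι → Prop) (h : ∀ τ
    ∈ L, ∃ C : ℝ, 0 ≤ C ∧ ∀ i, P i → |v τ i| ≤ C * X i) : ∃ C : ℝ, 0 ≤ C ∧ ∀ i, P i → |(L.map fun τ
    => v τ i).sum| ≤ C * X i := by
  induction L with
  | nil => exact ⟨0, le_rfl, fun i _ => by simp⟩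
  | cons τ L ih =>
    obtain ⟨C, hC, hb⟩ := ih fun τ hτ => h τ (List.mem_cons_of_mem _ hτ)
    obtain ⟨C', hC', hb'⟩ := h τ List.mem_cons_self
    refine ⟨C' + C, by positivity, fun i hi => ?_⟩
    rw [List.map_cons, List.sum_cons, add_mul]
    exact (abs_add_le _ _).trans (add_le_add (hb' i hi) (hb i hi))

/-- Null-form products at order `k`. -/
def PX (k : ℕ) (φ : Fld) (p : Pt) : ℝ := ∑ i ∈ range (k + 1), SS (i + 1) φ p * DD (k + 1 - i) φ p

/-- Gradient products at order `k`. -/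
def PY (k : ℕ) (φ : Fld) (p : Pt) : ℝ := ∑ i ∈ range k, DD (i + 1) φ p * DD (k - i) φ p

lemma le_PX {i j : ℕ} (hi : 1 ≤ i) (hik : i ≤ k + 1) (hij : i + j ≤ k + 2) (φ : Fld) (p : Pt) : SS i
    φ p * DD j φ p ≤ PX k φ p := by
  refine le_trans ?_ (single_le_sum (s := range (k + 1)) (f := fun i => SS (i + 1) φ p * DD (k + 1 -
    i) φ p) (fun _ _ => mul_nonneg (SS_nonneg _ _ _) (DD_nonneg _ _ _)) (a := i - 1) (mem_range.2
    (by omega)))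
  exact mul_le_mul (SS_mono (by omega) _ _) (DD_mono (by omega) _ _) (DD_nonneg _ _ _)
    (SS_nonneg _ _ _)

lemma le_PY {i j : ℕ} (hi : i ≤ k) (hk : 1 ≤ k) (hj : j ≤ k) (hij : i + j ≤ k + 1) (φ : Fld) (p :
    Pt) : DD i φ p * DD j φ p ≤ PY k φ p := by
  refine le_trans ?_ (single_le_sum (s := range k) (f := fun i => DD (i + 1) φ p * DD (k - i) φ p)
    (fun _ _ => mul_nonneg (DD_nonneg _ _ _) (DD_nonneg _ _ _)) (a := i - 1) (mem_range.2 (by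
    omega)))
  exact mul_le_mul (DD_mono (by omega) _ _) (DD_mono (by omega) _ _) (DD_nonneg _ _ _)
    (DD_nonneg _ _ _)

lemma null3_gam (hF : NullForm3 F) {A B : List ZI} (h : A.length + B.length ≤ k) : ∃ C : ℝ, 0 ≤ C ∧
    ∀ i : (Fld) × Pt, (Sm i.1 ∧ 0 ≤ i.2 0) → |ss i.2 * nf3 F (gam A i.1) (gam B i.1) i.2| ≤ C * PX k
      i.1 i.2 := by
  obtain ⟨C, hC, hb⟩ := null3_pt hF
  obtain ⟨c, hc⟩ : ∃ c : ℝ, c = ((Fintype.card ZI : ℕ) : ℝ) := ⟨_, rfl⟩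
  have hc0 : 0 ≤ c := hc ▸ Nat.cast_nonneg _
  refine ⟨C * (4 + 4 * (c * 3)), by positivity, ?_⟩
  rintro ⟨φ, p⟩ ⟨hφ, hp⟩
  simp only at hφ hp ⊢
  rw [abs_mul, abs_of_pos (ss_pos hp)]
  refine (hb _ _ p (hφ.gam B) hp).trans ?_
  rw [mul_assoc]
  refine mul_le_mul_of_nonneg_left ?_ hC
  have h1 := sum_D1_pd_gam_le (J := B) le_rfl φ p
  have h2 := sum_G1_pd_gam_le (J := B) le_rfl hφ p
  rw [← hc] at h2
  have h3 := G1_gam_le_SS (J := A) le_rfl φ p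
  have h4 : D1 (gam A φ) p ≤ SS (A.length + 1) φ p :=
    (D1_gam_le_DD le_rfl φ p).trans (DD_le_SS _ φ p)
  have h5 := le_PX (k := k) (i := A.length + 1) (j := B.length + 1) (by omega) (by omega)
    (by omega) φ p
  have hD := DD_nonneg (B.length + 1) φ p
  have m1 := mul_le_mul h3 h1 (sum_nonneg fun _ _ => D1_nonneg _ _) (SS_nonneg _ _ _)
  have m2 := mul_le_mul h4 h2 (sum_nonneg fun _ _ => G1_nonneg _ _) (SS_nonneg _ _ _)
  have m3 := mul_le_mul_of_nonneg_left h5 (by positivity : (0 : ℝ) ≤ 4 + 4 * (c * 3))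
  refine (add_le_add m1 m2).trans (le_trans (le_of_eq ?_) (m3.trans (le_of_eq (mul_comm _ _))) |>.trans
    (le_of_eq (mul_comm _ _)))
  ring

lemma null2_gam (hG : NullForm2 G) {A B : List ZI} (h : A.length + B.length ≤ k) : ∃ C : ℝ, 0 ≤ C ∧
    ∀ i : (Fld) × Pt, (Sm i.1 ∧ 0 ≤ i.2 0) → |ss i.2 * nf2 G (gam A i.1) (gam B i.1) i.2| ≤ C * PX k
      i.1 i.2 := by
  obtain ⟨C, hC, hb⟩ := null2_pt hG
  refine ⟨C * 2, by positivity, ?_⟩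
  rintro ⟨φ, p⟩ ⟨hφ, hp⟩
  simp only at hφ hp ⊢
  rw [abs_mul, abs_of_pos (ss_pos hp)]
  refine (hb _ _ p hp).trans ?_
  rw [mul_assoc]
  refine mul_le_mul_of_nonneg_left ?_ hC
  have m1 := mul_le_mul (G1_gam_le_SS (J := A) le_rfl φ p) (D1_gam_le_DD (J := B) le_rfl φ p)
    (D1_nonneg _ _) (SS_nonneg _ _ _)
  have m2 := mul_le_mul (G1_gam_le_SS (J := B) le_rfl φ p) (D1_gam_le_DD (J := A) le_rfl φ p)
    (D1_nonneg _ _) (SS_nonneg _ _ _)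
  have h5 := le_PX (k := k) (i := A.length + 1) (j := B.length) (by omega) (by omega) (by omega) φ p
  have h6 := le_PX (k := k) (i := B.length + 1) (j := A.length) (by omega) (by omega) (by omega) φ p
  linarith

/-- Commuted sources with the null gain. -/
lemma src_null (hF : NullForm3 F) (hG : NullForm2 G) (hJ : J.length ≤ k) : ∃ C : ℝ, 0 ≤ C ∧ ∀ φ :
    Fld, Sol F G φ → ∀ p : Pt, 0 ≤ p 0 → ss p * |box (gam J φ) p| ≤ C * PX k φ p := by
  obtain ⟨L, L', hL, hL', he⟩ := wave_comm hF hG J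
  obtain ⟨C0, h0, b0⟩ := null3_gam hF (A := []) (B := J) (k := k) (by simpa using hJ)
  obtain ⟨C1, h1, b1⟩ := list_sum_bound L
    (fun τ (i : (Fld) × Pt) => ss i.2 * nf3 τ.1 (gam τ.2.1 i.1) (gam τ.2.2 i.1) i.2)
    (fun i => PX k i.1 i.2) _ fun τ hτ => null3_gam (hL τ hτ).1 ((hL τ hτ).2.1.trans hJ)
  obtain ⟨C2, h2, b2⟩ := list_sum_bound L'
    (fun τ (i : (Fld) × Pt) => ss i.2 * nf2 τ.1 (gam τ.2.1 i.1) (gam τ.2.2 i.1) i.2)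
    (fun i => PX k i.1 i.2) _ fun τ hτ => null2_gam (hL' τ hτ).1 ((hL' τ hτ).2.trans hJ)
  refine ⟨C0 + C1 + C2, by positivity, fun φ hφ p hp => ?_⟩
  have e := he φ hφ p hp
  have c0 := b0 (φ, p) ⟨hφ.1, hp⟩
  have c1 := b1 (φ, p) ⟨hφ.1, hp⟩
  have c2 := b2 (φ, p) ⟨hφ.1, hp⟩
  simp only [List.sum_map_mul_left, gam] at c0 c1 c2
  have hs := ss_pos hp
  rw [← abs_of_pos hs, ← abs_mul]
  have e' : ss p * box (gam J φ) p = -(ss p * nf3 F φ (gam J φ) p) + ss p * ev3 L φ φ p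
      + ss p * ev2 L' φ φ p := by
    have : box (gam J φ) p = -nf3 F φ (gam J φ) p + ev3 L φ φ p + ev2 L' φ φ p := by linarith
    rw [this]; ring
  rw [e']
  refine (abs_add_le _ _).trans ?_
  have t := abs_add_le (-(ss p * nf3 F φ (gam J φ) p)) (ss p * ev3 L φ φ p)
  rw [abs_neg] at t
  simp only [ev3, ev2] at t ⊢
  linarith

/-- Commuted sources at top order, without using the null structure. -/
lemma src_top (hF : NullForm3 F) (hG : NullForm2 G) (hk : 1 ≤ k) (hJ : J.length ≤ k) : ∃ C : ℝ, 0 ≤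
    C ∧ ∀ φ : Fld, Sol F G φ → ∀ p : Pt, 0 ≤ p 0 → |box (gam J φ) p + nf3 F φ (gam J φ) p| ≤ C * PY
      k φ p := by
  obtain ⟨L, L', hL, hL', he⟩ := wave_comm hF hG J
  obtain ⟨C1, h1, b1⟩ := list_sum_bound L
    (fun τ (i : (Fld) × Pt) => nf3 τ.1 (gam τ.2.1 i.1) (gam τ.2.2 i.1) i.2)
    (fun i => PY k i.1 i.2) (fun _ => True) fun τ hτ => by
      obtain ⟨C, hC, hb⟩ := crude3_pt τ.1
      refine ⟨C * 4, by positivity, fun i _ => (hb _ _ _).trans ?_⟩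
      have h := hL τ hτ
      rw [mul_assoc]
      refine mul_le_mul_of_nonneg_left ?_ hC
      have m1 := mul_le_mul (D1_gam_le_DD (J := τ.2.1) le_rfl i.1 i.2)
        (sum_D1_pd_gam_le (J := τ.2.2) le_rfl i.1 i.2)
        (sum_nonneg fun _ _ => D1_nonneg _ _) (DD_nonneg _ _ _)
      have m2 := le_PY (k := k) (i := τ.2.1.length) (j := τ.2.2.length + 1) (by omega) hk (by omega)
        (by omega) i.1 i.2
      linarith
  obtain ⟨C2, h2, b2⟩ := list_sum_bound L'
    (fun τ (i : (Fld) × Pt) => nf2 τ.1 (gam τ.2.1 i.1) (gam τ.2.2 i.1) i.2)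
    (fun i => PY k i.1 i.2) (fun _ => True) fun τ hτ => by
      obtain ⟨C, hC, hb⟩ := crude2_pt τ.1
      refine ⟨C, by positivity, fun i _ => (hb _ _ _).trans ?_⟩
      have h := hL' τ hτ
      refine mul_le_mul_of_nonneg_left ?_ hC
      exact (mul_le_mul (D1_gam_le_DD (J := τ.2.1) le_rfl i.1 i.2) (D1_gam_le_DD (J := τ.2.2) le_rfl
        i.1 i.2) (D1_nonneg _ _) (DD_nonneg _ _ _)).trans
        (le_PY (k := k) (by omega) hk (by omega) (by omega) i.1 i.2)
  refine ⟨C1 + C2, by positivity, fun φ hφ p hp => ?_⟩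
  rw [he φ hφ p hp, add_mul]
  exact (abs_add_le _ _).trans (add_le_add (b1 (φ, p) trivial) (b2 (φ, p) trivial))

lemma Sol.supp (h : Sol F G φ) (h0 : ∀ x : Sp, M < rad3 x → φ (stp 0 x) = 0 ∧ pd 0 φ (stp 0 x) = 0)
    : Supp M φ := by
  intro p hp hM
  have hs := h.1
  have key := finite_speed (v := φ) hs ![p 1, p 2, p 3] (c := rr p - M) hp (by linarith)
    (B := fun a p => ∑ b, (G a b * pd b φ p) - ∑ b, ∑ c, F a b c * pd b (pd c φ) p)
    (fun a => ContDiff.continuous (𝕜 := ℝ) (n := (⊤ : ℕ∞)) (by fun_prop))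
    (fun q hq _ _ => by
      rw [eq_sub_of_add_eq (h.2 q hq), nf2, nf3]
      simp only [mul_sub, sum_sub_distrib, mul_sum, mul_left_comm, mul_assoc])
    (fun x hx => by
      have h1 := rad3_le_radq_add ![p 1, p 2, p 3] (stp 0 x)
      rw [rr_stp, show rad3 ![p 1, p 2, p 3] = rr p by simp [rad3, rr]] at h1
      exact h0 x (by linarith))
  rwa [stp_self] at key

/-- A wave without source on the slab and without data vanishes there. -/
lemma eq_zero_of_box_eq_zero (hv : Sm v) (hp : 0 ≤ p 0) (hc : p 0 < c) (hbox : ∀ p' : Pt, 0 ≤ p' 0 →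
    p' 0 ≤ p 0 → radq ![p 1, p 2, p 3] p' < c - p' 0 → box v p' = 0) (h0 : ∀ x, v (stp 0 x) = 0) (h1
    : ∀ x, pd 0 v (stp 0 x) = 0) : v p = 0 := by
  have key := finite_speed (v := v) hv ![p 1, p 2, p 3] hp hc (B := fun _ _ => 0)
    (fun _ => continuous_const) (fun p' a b c => by simp [hbox p' a b c]) (fun x _ => ⟨h0 x, h1 x⟩)
  rwa [stp_self] at key

/-- One dimensional averaging inequality on a segment. -/
lemma abs_le_segment_integral {k k' w : ℝ → ℝ} (hL : 0 < L) (hk : ∀ s ∈ Icc 0 L, HasDerivAt k (k' s)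
    s) (hw : Continuous w) (hb : ∀ s ∈ Icc 0 L, |k s| + L * |k' s| ≤ w s) : |k 0| ≤ 2 / L * ∫ s in
    (0)..L, w s := by
  have hW : ∀ s, HasDerivAt (fun s => ∫ x in (0)..s, w x) (w s) s := fun s =>
    intervalIntegral.integral_hasDerivAt_right (hw.intervalIntegrable _ _)
      (hw.stronglyMeasurableAtFilter _ _) hw.continuousAt
  obtain ⟨σ, hσ, h0⟩ : ∃ σ : ℝ, |σ| = 1 ∧ σ * k 0 = |k 0| := by
    rcases abs_choice (k 0) with h | h
    exacts [⟨1, by simp, by linarith⟩, ⟨-1, by simp, by linarith⟩]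
  have hd : ∀ s ∈ Icc 0 L, HasDerivAt (fun s => (∫ x in (0)..s, w x) + (L - s) * (σ * k s))
      (w s + (-1 * (σ * k s) + (L - s) * (σ * k' s))) s := fun s hs =>
    (hW s).fun_add (((hasDerivAt_id' s).const_sub L).fun_mul ((hk s hs).const_mul σ))
  have key := monotoneOn_of_deriv_nonneg (convex_Icc 0 L)
    (fun s hs => (hd s hs).continuousAt.continuousWithinAt)
    (fun s hs => (hd s (interior_subset hs)).differentiableAt.differentiableWithinAt)
    (fun s hs => by
      have hs := interior_subset hs
      rw [(hd s hs).deriv]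
      have h1 := le_abs_self (σ * k s)
      have h2 := neg_abs_le (σ * k' s)
      rw [abs_mul, hσ, one_mul] at h1 h2
      nlinarith [hb s hs, mul_nonneg hs.1 (abs_nonneg (k' s)), hs.2])
    ⟨le_rfl, hL.le⟩ ⟨hL.le, le_rfl⟩ hL.le
  simp [h0] at key
  rw [div_mul_eq_mul_div, le_div_iff₀ hL]
  linarith [mul_nonneg hL.le (abs_nonneg (k 0))]

lemma continuous_SS (hf : Sm f) (k : ℕ) : Continuous (SS k f) :=
  continuous_finsetSum _ fun J _ => (hf.gam J).continuous.abs

lemma continuous_DD (hf : Sm f) (k : ℕ) : Continuous (DD k f) :=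
  continuous_finsetSum _ fun J _ => continuous_finsetSum _ fun a _ =>
    ((hf.gam J).pd a).continuous.abs

/-- A path along which derivatives are controlled by the vector fields, at length scale `L`. -/
def GoodPath (γ : ℝ → Pt) (L : ℝ) : Prop :=
  Continuous γ ∧ 0 < L ∧ ∀ f : Fld, Sm f → ∀ s ∈ Icc 0 L,
    ∃ k', HasDerivAt (fun s => f (γ s)) k' s ∧ L * |k'| ≤ 7 * G1 f (γ s)

lemma GoodPath.le (h : GoodPath γ L) (hf : Sm f) : ofReal |f (γ 0)| ≤ ofReal (16 / L) * ∫⁻ s in Icc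
      0 L, ofReal (SS 1 f (γ s)) := by
  obtain ⟨hc, hL, hd⟩ := h
  choose! k' hk using hd f hf
  have hcw : Continuous fun s => SS 1 f (γ s) := (continuous_SS hf 1).comp hc
  have key := abs_le_segment_integral (k := fun s => f (γ s)) (k' := k') (w := fun s => 8 * SS 1 f (γ s))
    hL (fun s hs => (hk s hs).1) (by fun_prop) (fun s hs => by
      have h1 := (hk s hs).2
      have h2 := G1_le_SS f (γ s)
      have h3 := abs_gam_le_SS (J := []) (k := 1) (by simp) f (γ s)
      simp only [gam] at h3
      linarith)
  rw [intervalIntegral.integral_const_mul] at key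
  have e : ∫⁻ s in Icc 0 L, ofReal (SS 1 f (γ s))
      = ofReal (∫ s in (0)..L, SS 1 f (γ s)) := by
    rw [intervalIntegral.integral_of_le hL.le, ← integral_Icc_eq_integral_Ioc,
      ofReal_integral_eq_lintegral_ofReal]
    · exact hcw.continuousOn.integrableOn_Icc
    · exact .of_forall fun s => SS_nonneg _ _ _
  rw [e, ← ofReal_mul (by positivity)]
  refine ofReal_le_ofReal (key.trans (le_of_eq ?_))
  ring

lemma GoodPath.SS_le (h : GoodPath γ L) (hf : Sm f) (m : ℕ) : ofReal (SS m f (γ 0)) ≤ ofReal ((wds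
    m).card * (16 / L)) * ∫⁻ s in Icc 0 L, ofReal (SS (m + 1) f (γ s)) := by
  have hL := h.2.1
  rw [SS, ENNReal.ofReal_sum_of_nonneg fun _ _ => abs_nonneg _]
  have : ∀ J ∈ wds m, ofReal |gam J f (γ 0)| ≤ ofReal (16 / L) *
      ∫⁻ s in Icc 0 L, ofReal (SS (m + 1) f (γ s)) := by
    intro J hJ
    refine (h.le (hf.gam J)).trans ?_
    gcongr with s
    have := mem_wds.1 hJ
    exact (SS_gam_le 1 J f _).trans (SS_mono (by omega) _ _)
  refine (sum_le_card_nsmul _ _ _ this).trans (le_of_eq ?_)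
  simp [ofReal_mul, mul_assoc]

/-- Composition of three segment estimates. -/
lemma three_paths {γ : ℝ → ℝ → ℝ → Pt} {ℓ : ℝ} (hL : 0 < L) (hℓ : 0 < ℓ) (h1 : GoodPath (fun s => γ
    s 0 0) L) (h2 : ∀ s ∈ Icc 0 L, GoodPath (fun s' => γ s s' 0) L) (h3 : ∀ s ∈ Icc 0 L, ∀ s' ∈ Icc
    0 L, GoodPath (γ s s') ℓ) (hf : Sm f) : ofReal |f (γ 0 0 0)| ≤ ofReal (16 ^ 3 * (wds 1).card *
      (wds 2).card / (L ^ 2 * ℓ)) * ∫⁻ s in Icc 0 L, ∫⁻ s' in Icc 0 L, ∫⁻ s'' in Icc 0 ℓ, ofReal (SS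
        3 f (γ s s' s'')) := by
  have e : (16 ^ 3 * (wds 1).card * (wds 2).card / (L ^ 2 * ℓ) : ℝ)
      = 16 / L * (((wds 1).card * (16 / L)) * ((wds 2).card * (16 / ℓ))) := by field_simp
  rw [e, ofReal_mul (by positivity), ofReal_mul (by positivity), mul_assoc]
  refine (h1.le hf).trans ?_
  gcongr
  rw [← lintegral_const_mul' _ _ (by finiteness)]
  refine setLIntegral_mono' measurableSet_Icc fun s hs => ?_
  refine ((h2 s hs).SS_le hf 1).trans ?_
  rw [mul_assoc]
  gcongr
  rw [← lintegral_const_mul' _ _ (by finiteness)]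
  refine setLIntegral_mono' measurableSet_Icc fun s' hs' => ?_
  exact (h3 s hs s' hs').SS_le hf 2

/-- The point at time `t` whose spatial coordinates are `c, a, b` up to the permutation `e`. -/
def mkp (e : Equiv.Perm (Fin 3)) (t c a b : ℝ) : Pt := stp t (fun m => ![c, a, b] (e m))

lemma mkp_time (e : Equiv.Perm (Fin 3)) (t c a b : ℝ) : mkp e t c a b 0 = t := rfl

lemma mkp_coord (e : Equiv.Perm (Fin 3)) (t c a b : ℝ) (m : Fin 3) : mkp e t c a b (sidx (e.symm m))
    = ![c, a, b] m := by rw [mkp, stp_sidx, e.apply_symm_apply]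

lemma rr_stp_sq (t : ℝ) (x : Sp) : rr (stp t x) ^ 2 = ∑ m, x m ^ 2 := by
  rw [rr_sq, Fin.sum_univ_three]; rfl

lemma rr_mkp_sq (e : Equiv.Perm (Fin 3)) (t c a b : ℝ) : rr (mkp e t c a b) ^ 2 = c ^ 2 + a ^ 2 + b
    ^ 2 := by
  rw [mkp, rr_stp_sq, Equiv.sum_comp e (fun m => ![c, a, b] m ^ 2), Fin.sum_univ_three]
  rfl

lemma mkp_eta (e : Equiv.Perm (Fin 3)) (p : Pt) : mkp e (p 0) (p (sidx (e.symm 0))) (p (sidx (e.symm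
    1))) (p (sidx (e.symm 2))) = p := by
  rw [mkp]
  conv_rhs => rw [← stp_eta p]
  congr 1
  funext m
  conv_rhs => rw [← e.symm_apply_apply m]
  generalize e m = n
  fin_cases n <;> rfl

lemma continuous_mkp (e : Equiv.Perm (Fin 3)) (t : ℝ) {c a b : ℝ → ℝ} (hc : Continuous c) (ha :
    Continuous a) (hb : Continuous b) : Continuous fun s => mkp e t (c s) (a s) (b s) := by
  refine (continuous_stp_right t).comp (continuous_pi fun m => ?_)
  generalize e m = n
  fin_cases n <;> simpa

lemma hasDerivAt_mkp (e : Equiv.Perm (Fin 3)) (t : ℝ) (hf : Sm f) {c a b : ℝ → ℝ} {c' a' b' s : ℝ}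
    (hc : HasDerivAt c c' s) (ha : HasDerivAt a a' s) (hb : HasDerivAt b b' s) : HasDerivAt (fun s
    => f (mkp e t (c s) (a s) (b s))) (c' * pd (sidx (e.symm 0)) f (mkp e t (c s) (a s) (b s)) + a'
        * pd (sidx (e.symm 1)) f (mkp e t (c s) (a s) (b s)) + b' * pd (sidx (e.symm 2)) f (mkp e t
        (c s) (a s) (b s))) s := by
  have hx : ∀ n, HasDerivAt (fun s => ![c s, a s, b s] n) (![c', a', b'] n) s := by
    intro n; fin_cases n <;> simpa
  have hp : HasDerivAt (fun s => mkp e t (c s) (a s) (b s)) (mkp e 0 c' a' b') s := by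
    rw [hasDerivAt_pi]
    intro i
    fin_cases i
    exacts [hasDerivAt_const _ _, hx (e 0), hx (e 1), hx (e 2)]
  refine ((hf.diffble _).hasFDerivAt.comp_hasDerivAt s hp).congr_deriv
    ((vApp_eq (fun _ => mkp e 0 c' a' b') _).trans ?_)
  rw [Fin.sum_univ_succ, mkp_time, zero_mul, zero_add]
  change ∑ i, mkp e 0 c' a' b' (sidx i) * pd (sidx i) f _ = _
  rw [← e.symm.sum_comp]
  simp [Fin.sum_univ_three, mkp_coord]

lemma lintegral_fin_three {W : (Fin 3 → ℝ) → ENNReal} (hW : Measurable W) : ∫⁻ y, W y = ∫⁻ a, ∫⁻ b,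
    ∫⁻ c, W ![c, a, b] := by
  have h1 := (volume_preserving_piFinSuccAbove (fun _ : Fin 3 => ℝ) 0).symm
  have h2 := (volume_preserving_finTwoArrow ℝ).symm
  have hm := (hW.comp h1.measurable).lintegral_prod_left' (μ := volume)
  rw [← h1.lintegral_comp hW]
  refine (lintegral_prod_symm _ (hW.comp h1.measurable).aemeasurable).trans ?_
  rw [← h2.lintegral_comp hm]
  refine (lintegral_prod _ (hm.comp h2.measurable).aemeasurable).trans ?_
  refine lintegral_congr fun a => lintegral_congr fun b => lintegral_congr fun c => ?_
  refine congrArg W (funext fun i => ?_)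
  fin_cases i <;> rfl

lemma lintegral_mkp (e : Equiv.Perm (Fin 3)) (t : ℝ) {W : Pt → ENNReal} (hW : Measurable W) : ∫⁻ x :
    Sp, W (stp t x) = ∫⁻ a, ∫⁻ b, ∫⁻ c, W (mkp e t c a b) := by
  have hm : Measurable fun x : Sp => W (stp t x) := hW.comp (continuous_stp_right t).measurable
  have hm2 : Measurable fun y : Sp => W (stp t (fun m => y (e m))) :=
    hm.comp (measurable_pi_lambda _ fun m => measurable_pi_apply _)
  rw [← (volume_measurePreserving_piCongrLeft (fun _ : Fin 3 => ℝ) e.symm).lintegral_comp hm]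
  refine (lintegral_congr fun y => ?_).trans (lintegral_fin_three hm2)
  congr 2
  funext m
  simpa using MeasurableEquiv.piCongrLeft_apply_apply (β := fun _ : Fin 3 => ℝ) e.symm y (e m)

lemma setLIntegral_affine_le (h : ℝ → ENNReal) (S : Set ℝ) (x : ℝ) {η : ℝ} (hη : |η| = 1) :
    ∫⁻ s in S, h (x + η * s) ≤ ∫⁻ s, h s := by
  refine (setLIntegral_le_lintegral _ _).trans (le_of_eq ?_)
  rcases eq_or_eq_neg_of_abs_eq hη with rfl | rfl
  · simpa using lintegral_add_left_eq_self h x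
  · simpa [lintegral_add_left_eq_self] using lintegral_neg_eq_self (μ := volume) (fun s => h (x + s))

lemma three_lintegral_le (e : Equiv.Perm (Fin 3)) (t : ℝ) {W : Pt → ENNReal} (hW : Measurable W) (S
    S' S'' : Set ℝ) (a0 b0 : ℝ) (c : ℝ → ℝ → ℝ) {η η' η'' : ℝ} (h : |η| = 1) (h' : |η'| = 1) (h'' : |η''| = 1) : ∫⁻ s in S, ∫⁻ s' in S', ∫⁻ s'' in S'', W (mkp e t (c s s'
      + η'' * s'') (a0 + η * s) (b0 + η' * s')) ≤ ∫⁻ x : Sp, W (stp t x) := by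
  rw [lintegral_mkp e t hW]
  refine le_trans ?_ (setLIntegral_affine_le (fun a => ∫⁻ b, ∫⁻ c, W (mkp e t c a b)) S a0 h)
  refine lintegral_mono fun s => ?_
  refine le_trans ?_ (setLIntegral_affine_le (fun b => ∫⁻ c, W (mkp e t c (a0 + η * s) b)) S' b0 h')
  refine lintegral_mono fun s' => ?_
  exact setLIntegral_affine_le (fun c => W (mkp e t c (a0 + η * s) (b0 + η' * s'))) S'' _ h''

lemma exists_sign (x : ℝ) : ∃ η : ℝ, (|η| = 1) ∧ η * x ≤ 0 := by
  rcases le_total x 0 with h | h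
  · exact ⟨1, abs_one, by linarith⟩
  · exact ⟨-1, by simp, by linarith⟩

lemma sq_add_sign_le {η x s : ℝ} (h : |η| = 1) (hx : η * x ≤ 0) (hs : s ∈ Icc 0 L) : (x + η *
    s) ^ 2 ≤ x ^ 2 + L ^ 2 := by
  rcases eq_or_eq_neg_of_abs_eq h with rfl | rfl <;> nlinarith [pow_le_pow_left₀ hs.1 hs.2 2, hs.1]

/-- Pointwise bound from paths to the full slice integral. -/
lemma le_slice_of_paths (e : Equiv.Perm (Fin 3)) (t a0 b0 : ℝ) (c : ℝ → ℝ → ℝ) {η η' η'' : ℝ} (h : |η| = 1)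
    (h' : |η'| = 1) (h'' : |η''| = 1) {ℓ : ℝ} (hL : 0 < L) (hℓ : 0 <
    ℓ) (h1 : GoodPath (fun s => mkp e t (c s 0) (a0 + η * s) b0) L) (h2 : ∀ s ∈ Icc 0 L, GoodPath
    (fun s' => mkp e t (c s s') (a0 + η * s) (b0 + η' * s')) L) (h3 : ∀ s ∈ Icc 0 L, ∀ s' ∈ Icc 0 L,
      GoodPath (fun s'' => mkp e t (c s s' + η'' * s'') (a0 + η * s) (b0 + η' * s')) ℓ) (hf : Sm f)
     : ofReal |f (mkp e t (c 0 0) a0 b0)| ≤ ofReal (16 ^ 3 * (wds 1).card * (wds 2).card / (L ^ 2 *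
      ℓ)) * ∫⁻ x : Sp, ofReal (SS 3 f (stp t x)) := by
  have key := three_paths
    (γ := fun s s' s'' => mkp e t (c s s' + η'' * s'') (a0 + η * s) (b0 + η' * s')) hL hℓ
    (by simpa using h1) (by simpa using h2) h3 hf
  simp only [mul_zero, add_zero] at key
  refine key.trans ?_
  gcongr
  exact three_lintegral_le e t (W := fun p => ofReal (SS 3 f p))
    (continuous_SS hf 3).measurable.ennreal_ofReal _ _ _ a0 b0 c h h' h''

lemma hasDerivAt_affine (x η s : ℝ) : HasDerivAt (fun s => x + η * s) η s := by
  simpa using ((hasDerivAt_id s).const_mul η).const_add x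

lemma mkp_swap (e : Equiv.Perm (Fin 3)) (t c a b : ℝ) :
    mkp e t c a b = mkp (e.trans (Equiv.swap 1 2)) t c b a := by
  simp only [mkp, Equiv.trans_apply]
  congr 1
  funext m
  generalize e m = n
  fin_cases n <;> rfl

lemma goodPath_line (e : Equiv.Perm (Fin 3)) (ht : 0 ≤ t) (hL : 0 < L) {a b c η : ℝ} (hη : |η| = 1)
    (hu : ∀ s ∈ Icc 0 L, L ≤ 1 + |t - rr (mkp e t (c + η * s) a b)|) :
    GoodPath (fun s => mkp e t (c + η * s) a b) L := by
  refine ⟨continuous_mkp e t (by fun_prop) continuous_const continuous_const, hL, fun f hf s hs =>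
    ⟨_, hasDerivAt_mkp e t hf (hasDerivAt_affine c η s) (hasDerivAt_const s a)
      (hasDerivAt_const s b), ?_⟩⟩
  have h := one_add_abs_mul_pd_le f (p := mkp e t (c + η * s) a b) ht (sidx (e.symm 0))
  rw [zero_mul, zero_mul, add_zero, add_zero, abs_mul, hη, one_mul]
  exact (mul_le_mul_of_nonneg_right (hu s hs) (abs_nonneg _)).trans h

lemma goodPath_sphere (e : Equiv.Perm (Fin 3)) (t : ℝ) (hL : 0 < L) {ρ a b η σ : ℝ} (hη : |η| = 1)
    (hσ : |σ| = 1) (h : ∀ s ∈ Icc 0 L, L ^ 2 ≤ ρ - (a + η * s) ^ 2 - b ^ 2) :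
    GoodPath (fun s => mkp e t (σ * √(ρ - (a + η * s) ^ 2 - b ^ 2)) (a + η * s) b) L := by
  refine ⟨continuous_mkp e t (by fun_prop) (by fun_prop) continuous_const, hL, fun f hf s hs => ?_⟩
  have h0 : 0 < ρ - (a + η * s) ^ 2 - b ^ 2 := lt_of_lt_of_le (by positivity) (h s hs)
  refine ⟨_, hasDerivAt_mkp e t hf ((((((hasDerivAt_affine a η s).fun_pow 2).const_sub ρ).sub_const
    (b ^ 2)).sqrt h0.ne').const_mul σ) (hasDerivAt_affine a η s) (hasDerivAt_const s b), ?_⟩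
  have hX := Real.le_sqrt_of_sq_le (h s hs)
  have hm : ∀ k : Fin 3, m4 (sidx k) = 1 := by intro k; fin_cases k <;> rfl
  have h4 := abs_zap_le_G1 f (mkp e t (σ * √(ρ - (a + η * s) ^ 2 - b ^ 2)) (a + η * s) b)
    (Sum.inr (Sum.inl (sidx (e.symm 0), sidx (e.symm 1))))
  rw [zap_lor, hm, hm, one_mul, one_mul, mkp_coord, mkp_coord] at h4
  refine (mul_le_mul_of_nonneg_right hX (abs_nonneg _)).trans ?_
  beta_reduce
  generalize √(ρ - (a + η * s) ^ 2 - b ^ 2) = X at *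
  have hX0 : 0 < X := hL.trans_le hX
  change |σ * X * _ - (a + η * s) * _| ≤ _ at h4
  rw [← abs_of_pos hX0, ← abs_mul, abs_of_pos hX0]
  refine (le_of_eq (abs_eq_abs.2 ?_)).trans
    (h4.trans (le_mul_of_one_le_left (G1_nonneg _ _) (show (1 : ℝ) ≤ 7 by norm_num)))
  rcases eq_or_eq_neg_of_abs_eq hσ with rfl | rfl <;> rcases eq_or_eq_neg_of_abs_eq hη with rfl | rfl
    <;> [left; right; right; left] <;> norm_num <;> field_simp <;> ring

lemma exterior_le (hp : 0 ≤ p 0) (hext : (1 + p 0) / 2 ≤ rr p) (hf : Sm f) : ofReal |f p| ≤ ofReal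
      (16 ^ 3 * (wds 1).card * (wds 2).card / ((rr p / 3) ^ 2 * ((1 + |p 0 - rr p|) / 6))) * ∫⁻ x :
        Sp, ofReal (SS 3 f (stp (p 0) x)) := by
  obtain ⟨i, hi⟩ : ∃ i : Fin 3, rr p ^ 2 / 3 ≤ p (sidx i) ^ 2 := by
    by_contra! hcon
    have := rr_sq p
    have h0 := hcon 0; have h1 := hcon 1; have h2 := hcon 2
    rw [sidx_zero] at h0; rw [sidx_one] at h1; rw [sidx_two] at h2
    linarith
  obtain ⟨e, he⟩ : ∃ e : Equiv.Perm (Fin 3), e.symm 0 = i := ⟨Equiv.swap 0 i, by simp⟩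
  have hρ : 0 < rr p := by linarith
  have heta := mkp_eta e p
  have hrr := rr_mkp_sq e (p 0) (p (sidx (e.symm 0))) (p (sidx (e.symm 1))) (p (sidx (e.symm 2)))
  rw [heta, he] at hrr
  rw [he] at heta
  set c0 := p (sidx i)
  set a0 := p (sidx (e.symm 1))
  set b0 := p (sidx (e.symm 2))
  set ρ := rr p
  set t := p 0
  obtain ⟨η, hη, hηa⟩ := exists_sign a0
  obtain ⟨η', hη', hηb⟩ := exists_sign b0
  obtain ⟨ηc, hηc, hηcc⟩ : ∃ ηc : ℝ, |ηc| = 1 ∧ ηc * |c0| = c0 := by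
    rcases abs_choice c0 with h | h
    exacts [⟨1, abs_one, by linarith⟩, ⟨-1, by simp, by linarith⟩]
  obtain ⟨L, hLdef⟩ : ∃ L, L = ρ / 3 := ⟨_, rfl⟩
  have hL : 0 < L := by rw [hLdef]; positivity
  obtain ⟨ℓ, hℓdef⟩ : ∃ ℓ, ℓ = (1 + |t - ρ|) / 6 := ⟨_, rfl⟩
  have hℓ : 0 < ℓ := by rw [hℓdef]; positivity
  rw [← hLdef, ← hℓdef]
  have hbd : ∀ s ∈ Icc 0 L, ∀ s' ∈ Icc 0 L,
      L ^ 2 ≤ ρ ^ 2 - (a0 + η * s) ^ 2 - (b0 + η' * s') ^ 2 := by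
    intro s hs s' hs'
    have h1 := sq_add_sign_le hη hηa hs
    have h2 := sq_add_sign_le hη' hηb hs'
    have h3 : L ^ 2 = ρ ^ 2 / 9 := by rw [hLdef]; ring
    linarith
  obtain ⟨σ, hσ, hu⟩ : ∃ σ : ℝ, |σ| = 1 ∧ ∀ r x s : ℝ, 0 ≤ r → L ≤ x → s ∈ Icc 0 ℓ →
      r ^ 2 - ρ ^ 2 = (x + σ * s) ^ 2 - x ^ 2 → |t - ρ| ≤ |t - r| := by
    rcases le_total t ρ with h | h
    · refine ⟨1, abs_one, fun r x s hr hx hs e => ?_⟩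
      have : ρ ≤ r := (pow_le_pow_iff_left₀ hρ.le hr two_ne_zero).1 (by nlinarith [hs.1])
      rw [abs_of_nonpos (by linarith)]
      linarith [neg_abs_le (t - r)]
    · refine ⟨-1, by simp, fun r x s hr hx hs e => ?_⟩
      rw [abs_of_nonneg (show 0 ≤ t - ρ by linarith)] at hℓdef ⊢
      have : r ≤ ρ := (pow_le_pow_iff_left₀ hr hρ.le two_ne_zero).1
        (by nlinarith [mul_nonneg hs.1 (show 0 ≤ 2 * x - s by linarith [hs.2])])
      linarith [le_abs_self (t - r)]
  have hcσ : |ηc * σ| = 1 := by rw [abs_mul, hηc, hσ, one_mul]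
  have key := le_slice_of_paths e t a0 b0
    (fun s s' => ηc * √(ρ ^ 2 - (a0 + η * s) ^ 2 - (b0 + η' * s') ^ 2)) hη hη' hcσ hL hℓ
    (by simpa using goodPath_sphere e t hL hη hηc fun s hs => hbd s hs 0 ⟨le_rfl, hL.le⟩)
    (fun s hs => by
      simp only [mkp_swap e, sub_right_comm (ρ ^ 2) ((a0 + η * s) ^ 2)]
      exact goodPath_sphere _ t hL hη' hηc fun s' hs' => by linarith [hbd s hs s' hs'])
    (fun s hs s' hs' => goodPath_line e hp hℓ hcσ fun s'' hs'' => by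
      have h1 := hbd s hs s' hs'
      have h2 := Real.sq_sqrt ((sq_nonneg L).trans h1)
      have h3 := Real.le_sqrt_of_sq_le h1
      have h4 : ηc ^ 2 = 1 := by rw [← sq_abs, hηc, one_pow]
      generalize √(ρ ^ 2 - (a0 + η * s) ^ 2 - (b0 + η' * s') ^ 2) = y at *
      have h5 := rr_mkp_sq e t (ηc * y + ηc * σ * s'') (a0 + η * s) (b0 + η' * s')
      rw [show (ηc * y + ηc * σ * s'') ^ 2 = ηc ^ 2 * (y + σ * s'') ^ 2 by ring, h4] at h5
      linarith [abs_nonneg (t - ρ), hu _ y s'' (rr_nonneg _) h3 hs'' (by linarith)]) hf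
  rwa [mul_zero, mul_zero, add_zero, add_zero, hrr, show c0 ^ 2 + a0 ^ 2 + b0 ^ 2 - a0 ^ 2 - b0 ^ 2 =
    c0 ^ 2 by ring, Real.sqrt_sq_eq_abs, hηcc, heta] at key

lemma mkp_swap01 (e : Equiv.Perm (Fin 3)) (t c a b : ℝ) :
    mkp e t c a b = mkp (e.trans (Equiv.swap 0 1)) t a c b := by
  simp only [mkp, Equiv.trans_apply]
  congr 1
  funext m
  generalize e m = n
  fin_cases n <;> rfl

lemma mkp_swap02 (e : Equiv.Perm (Fin 3)) (t c a b : ℝ) :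
    mkp e t c a b = mkp (e.trans (Equiv.swap 0 2)) t b a c := by
  simp only [mkp, Equiv.trans_apply]
  congr 1
  funext m
  generalize e m = n
  fin_cases n <;> rfl

lemma interior_le (hp : 0 ≤ p 0) (hint : rr p ≤ (1 + p 0) / 2) (hf : Sm f) : ofReal |f p| ≤ ofReal
      (16 ^ 3 * (wds 1).card * (wds 2).card / (((1 + p 0) / 8) ^ 2 * ((1 + p 0) / 8))) * ∫⁻ x,
        ofReal (SS 3 f (stp (p 0) x)) := by
  have heta := mkp_eta 1 p
  have hrr := rr_mkp_sq 1 (p 0) (p (sidx 0)) (p (sidx 1)) (p (sidx 2))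
  change mkp 1 (p 0) (p (sidx 0)) (p (sidx 1)) (p (sidx 2)) = p at heta
  rw [heta] at hrr
  have hr0 := rr_nonneg p
  generalize p (sidx 0) = c0 at *
  generalize p (sidx 1) = a0 at *
  generalize p (sidx 2) = b0 at *
  obtain ⟨η, hη, hηa⟩ := exists_sign a0
  obtain ⟨η', hη', hηb⟩ := exists_sign b0
  obtain ⟨η'', hη'', hηc⟩ := exists_sign c0
  set t := p 0
  obtain ⟨L, hLdef⟩ : ∃ L, L = (1 + t) / 8 := ⟨_, rfl⟩
  have hL : 0 < L := by rw [hLdef]; positivity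
  rw [← hLdef]
  have h0mem : (0 : ℝ) ∈ Icc 0 L := ⟨le_rfl, hL.le⟩
  have hbd : ∀ s ∈ Icc 0 L, ∀ s' ∈ Icc 0 L, ∀ s'' ∈ Icc 0 L,
      L ≤ 1 + |t - rr (mkp 1 t (c0 + η'' * s'') (a0 + η * s) (b0 + η' * s'))| := by
    intro s hs s' hs' s'' hs''
    have h1 := sq_add_sign_le hη hηa hs
    have h2 := sq_add_sign_le hη' hηb hs'
    have h3 := sq_add_sign_le hη'' hηc hs''
    have h4 := rr_mkp_sq 1 t (c0 + η'' * s'') (a0 + η * s) (b0 + η' * s')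
    generalize rr (mkp 1 t (c0 + η'' * s'') (a0 + η * s) (b0 + η' * s')) = r at *
    have h5 : rr p ^ 2 ≤ (4 * L) ^ 2 := pow_le_pow_left₀ hr0 (by linarith) 2
    have h6 : r ≤ 7 * L := by
      apply le_of_not_gt
      intro h
      have := mul_pos hL hL
      nlinarith
    have := le_abs_self (t - r)
    linarith
  have key := le_slice_of_paths 1 t a0 b0 (fun _ _ => c0) hη hη' hη'' hL hL ?_ ?_ ?_ hf
  · rwa [heta] at key
  · simp only [mkp_swap01 1]
    exact goodPath_line _ hp hL hη fun s hs => by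
      simpa [mkp_swap01 1] using hbd s hs 0 h0mem 0 h0mem
  · simp only [mkp_swap02 1]
    exact fun s hs => goodPath_line _ hp hL hη' fun s' hs' => by
      simpa [mkp_swap02 1] using hbd s hs s' hs' 0 h0mem
  · exact fun s hs s' hs' => goodPath_line 1 hp hL hη'' (hbd s hs s' hs')

lemma exists_weighted_sup_le : ∃ C : ℝ, 0 < C ∧ ∀ p : Pt, 0 ≤ p 0 → ∀ f : Fld, Sm f → ofReal (ss p ^
    2 * (1 + |p 0 - rr p|) * |f p|) ≤ ofReal C * ∫⁻ x, ofReal (SS 3 f (stp (p 0) x)) := by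
  obtain ⟨K, hK⟩ : ∃ K : ℝ, K = 16 ^ 3 * (wds 1).card * (wds 2).card := ⟨_, rfl⟩
  have hKp : 0 ≤ K := by rw [hK]; positivity
  refine ⟨4000 * (K + 1), by positivity, fun p hp f hf => ?_⟩
  have hr0 := rr_nonneg p
  have hd := abs_nonneg (p 0 - rr p)
  suffices ∃ D, 0 < D ∧ ss p ^ 2 * (1 + |p 0 - rr p|) ≤ 4000 * D ∧
      ofReal |f p| ≤ ofReal (K / D) * ∫⁻ x, ofReal (SS 3 f (stp (p 0) x)) by
    obtain ⟨D, hD, h1, h2⟩ := this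
    rw [ofReal_mul (by positivity)]
    refine (mul_le_mul_right h2 _).trans ?_
    rw [← mul_assoc, ← ofReal_mul (by positivity)]
    refine mul_le_mul_left (ofReal_le_ofReal ?_) _
    rw [mul_div_assoc', div_le_iff₀ hD]
    nlinarith
  unfold ss
  rw [hK]
  rcases le_total ((1 + p 0) / 2) (rr p) with h | h
  · have : 0 < rr p := by linarith
    refine ⟨_, by positivity, ?_, exterior_le hp h hf⟩
    have h1 : (1 + p 0 + rr p) ^ 2 ≤ (3 * rr p) ^ 2 :=
      pow_le_pow_left₀ (by linarith) (by linarith) 2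
    nlinarith [mul_le_mul_of_nonneg_right h1 (show 0 ≤ 1 + |p 0 - rr p| by positivity),
      mul_nonneg (sq_nonneg (rr p)) (show 0 ≤ 1 + |p 0 - rr p| by positivity)]
  · refine ⟨_, by positivity, ?_, interior_le hp h hf⟩
    have h2 : |p 0 - rr p| ≤ 1.5 * (1 + p 0) - 1 := by rw [abs_le]; constructor <;> linarith
    calc _ ≤ (2 * (1 + p 0)) ^ 2 * (1.5 * (1 + p 0)) := by gcongr <;> linarith
      _ ≤ _ := by nlinarith [pow_nonneg (show 0 ≤ 1 + p 0 by linarith) 3]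

lemma abs_gam_mul_le (J : List ZI) : ∀ {f g : Fld}, Sm f → Sm g → ∀ p, |gam J (fun p => f p * g p)
    p| ≤ 2 ^ J.length * (SS J.length f p * SS J.length g p) := by
  induction J with
  | nil =>
    intro f g _ _ p
    have h1 := abs_gam_le_SS (J := []) (k := 0) (by simp) f p
    have h2 := abs_gam_le_SS (J := []) (k := 0) (by simp) g p
    simp only [gam, List.length_nil, pow_zero, one_mul, abs_mul] at *
    exact mul_le_mul h1 h2 (abs_nonneg _) (SS_nonneg _ _ _)
  | cons Z J ih =>
    intro f g hf hg p
    rw [gam, zap_mul hf hg, gam_add (by fun_prop) (by fun_prop)]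
    have h1 := ih (hf.zap Z) hg p
    have h2 := ih hf (hg.zap Z) p
    have h3 (h : Fld) : SS J.length (zap Z h) p ≤ SS (J.length + 1) h p := by
      simpa [add_comm, gam] using SS_gam_le J.length [Z] h p
    have h4 (h : Fld) := SS_mono (Nat.le_succ J.length) h p
    have h7 := mul_le_mul_of_nonneg_left (add_le_add
      (mul_le_mul (h3 f) (h4 g) (SS_nonneg _ _ _) (SS_nonneg _ _ _))
      (mul_le_mul (h4 f) (h3 g) (SS_nonneg _ _ _) (SS_nonneg _ _ _)))
      (pow_nonneg (zero_le_two (α := ℝ)) J.length)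
    refine (abs_add_le _ _).trans ?_
    rw [List.length_cons, pow_succ]
    linarith

lemma SS_mul_le (k : ℕ) (hf : Sm f) (hg : Sm g) (p : Pt) : SS k (fun p => f p * g p) p ≤ (wds
    k).card * 2 ^ k * (SS k f p * SS k g p) := by
  have h : ∀ J ∈ wds k, |gam J (fun p => f p * g p) p| ≤ 2 ^ k * (SS k f p * SS k g p) := by
    intro J hJ
    have hk := mem_wds.1 hJ
    have h0 (f : Fld) := SS_nonneg k f p
    have h1 (f : Fld) := SS_mono hk f p
    exact (abs_gam_mul_le J hf hg p).trans (mul_le_mul (pow_le_pow_right₀ (by norm_num) hk)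
      (mul_le_mul (h1 f) (h1 g) (SS_nonneg _ _ _) (h0 f))
      (mul_nonneg (SS_nonneg _ _ _) (SS_nonneg _ _ _)) (by positivity))
  simpa [SS, mul_assoc] using sum_le_card_nsmul _ _ _ h

lemma SS_sq_le (k : ℕ) (f : Fld) (p : Pt) : SS k f p ^ 2 ≤ (wds k).card * ∑ J ∈ wds k, gam J f p ^ 2
    := by
  have := sq_sum_le_card_mul_sum_sq (s := wds k) (f := fun J => |gam J f p|)
  simpa [SS] using this

/-- The squared `L²` norm on a time slice. -/
def en (f : Fld) (t : ℝ) : ℝ := ∫ x, f (stp t x) ^ 2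

lemma en_nonneg (f : Fld) (t : ℝ) : 0 ≤ en f t := integral_nonneg fun _ => sq_nonneg _

lemma Supp.integrable_sq (hc : Continuous f) (hf : Supp M f) (ht : 0 ≤ t) : Integrable fun x =>
    f (stp t x) ^ 2 := by
  have h : Supp M (fun p => f p ^ 2) := fun p h0 h1 => by simp [hf p h0 h1]
  exact h.integrable (hc.pow 2) ht

/-- Klainerman–Sobolev inequality with a loss of three fields. -/
lemma klainerman_sobolev : ∃ C : ℝ, 0 < C ∧ ∀ M : ℝ, ∀ f : Fld, Sm f → Supp M f → ∀ p : Pt, 0 ≤ p 0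
    → ss p ^ 2 * (1 + |p 0 - rr p|) * f p ^ 2 ≤ C * ∑ J ∈ wds 3, en (gam J f) (p 0) := by
  obtain ⟨C, hC, h⟩ := exists_weighted_sup_le
  obtain ⟨c, hc⟩ : ∃ c : ℝ, c = (wds 3).card := ⟨_, rfl⟩
  have hc0 : 0 ≤ c := by rw [hc]; positivity
  refine ⟨C * (c * 2 ^ 3 * c + 1), by positivity, fun M f hf hs p hp => ?_⟩
  have h1 := h p hp (fun p => f p * f p) (by fun_prop)
  have hint : ∀ J ∈ wds 3, Integrable fun x => gam J f (stp (p 0) x) ^ 2 := fun J _ =>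
    (hs.gam hf J).integrable_sq (hf.gam J).continuous hp
  have h2 : ∫⁻ x, ofReal (SS 3 (fun p => f p * f p) (stp (p 0) x)) ≤
      ofReal (∫ x, c * 2 ^ 3 * c * ∑ J ∈ wds 3, gam J f (stp (p 0) x) ^ 2) := by
    rw [ofReal_integral_eq_lintegral_ofReal ((integrable_finsetSum _ hint).const_mul _) (.of_forall
      fun x => mul_nonneg (by positivity) (sum_nonneg fun _ _ => sq_nonneg _))]
    refine lintegral_mono fun x => ofReal_le_ofReal ?_
    have h3 := SS_mul_le 3 hf hf (stp (p 0) x)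
    have h4 := SS_sq_le 3 f (stp (p 0) x)
    rw [← hc] at h3 h4
    linarith [mul_le_mul_of_nonneg_left h4 (show 0 ≤ c * 2 ^ 3 by positivity)]
  rw [integral_const_mul, integral_finsetSum _ hint] at h2
  have h3 := h1.trans (mul_le_mul_right h2 _)
  rw [← ofReal_mul hC.le] at h3
  have hE : 0 ≤ ∑ J ∈ wds 3, en (gam J f) (p 0) := sum_nonneg fun _ _ => en_nonneg _ _
  have h4 := (ENNReal.ofReal_le_ofReal_iff (by unfold en at hE; positivity)).1 h3
  rw [abs_of_nonneg (mul_self_nonneg (f p)), ← sq] at h4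
  unfold en at hE ⊢
  linarith [mul_nonneg hC.le hE]

/-- Iterated coordinate derivative; the head of the word acts first. -/
def der : List (Fin 4) → (Fld) → Fld | [], f => f | a :: w, f => der w (pd a f)

lemma der_eq_gam (w : List (Fin 4)) (f : Fld) : der w f = gam (w.map Sum.inl) f := by
  induction w generalizing f with
  | nil => rfl
  | cons a w ih => rw [der, ih, List.map_cons, gam, zap_tr]

lemma der_perm {w w' : List (Fin 4)} (h : w.Perm w') (hf : Sm f) : der w f = der w' f := by
  induction h generalizing f with
  | nil => rfl
  | cons a _ ih => exact ih (hf.pd a)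
  | swap a b w => rw [der, der, der, der, pd_comm hf]
  | trans _ _ ih1 ih2 => rw [ih1 hf, ih2 hf]

lemma der_add (hf : Sm f) (hg : Sm g) (w : List (Fin 4)) : der w (fun p => f p + g p) = fun p => der
    w f p + der w g p := by simp only [der_eq_gam]; exact gam_add hf hg _

lemma der_const_mul (hf : Sm f) (c : ℝ) (w : List (Fin 4)) : der w (fun p => c * f p) = fun p => c *
    der w f p := by simp only [der_eq_gam]; exact gam_const_mul hf _ _

/-- Weighted derivative bounds at the point `p`. -/
def Wt (p : Pt) (m : ℕ) (α : ℤ) (B : ℝ) (f : Fld) : Prop :=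
  ∀ w : List (Fin 4), w.length ≤ m → |der w f p| ≤ B * (1 + rr p) ^ (-(α + w.length))

lemma one_le_rho (p : Pt) : 1 ≤ 1 + rr p := by have := rr_nonneg p; linarith

lemma Wt.mono {m m' : ℕ} {α : ℤ} {B' : ℝ} (h : Wt p m α B f) (hm : m' ≤ m) (hB : B ≤ B') : Wt p m' α
    B' f := fun w hw =>
  (h w (hw.trans hm)).trans (mul_le_mul_of_nonneg_right hB (zpow_nonneg (by linarith [one_le_rho p])
    _))

lemma Wt.weaken {m : ℕ} {α β : ℤ} (h : Wt p m α B f) (hB : 0 ≤ B) (hβ : β ≤ α) : Wt p m β B f := fun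
    w hw =>
  (h w hw).trans (mul_le_mul_of_nonneg_left (zpow_le_zpow_right₀ (one_le_rho p) (by omega)) hB)

lemma Wt.pd {m : ℕ} {α : ℤ} (h : Wt p (m + 1) α B f) (a : Fin 4) : Wt p m (α + 1) B (pd a f) := fun
    w hw => by
  have := h (a :: w) (by simpa using hw)
  rw [der, List.length_cons] at this
  convert this using 3
  push_cast; ring

lemma Wt.add {m : ℕ} {α : ℤ} {B' : ℝ} (h : Wt p m α B f) (h' : Wt p m α B' g) (hf : Sm f) (hg : Sm
    g) : Wt p m α (B + B') (fun p => f p + g p) :=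
  fun w hw => by
    rw [der_add hf hg, add_mul]
    exact (abs_add_le _ _).trans (add_le_add (h w hw) (h' w hw))

lemma Wt.const_mul {m : ℕ} {α : ℤ} (h : Wt p m α B f) (hf : Sm f) (c : ℝ) : Wt p m α (|c| * B) (fun
    p => c * f p) := fun w hw => by
  rw [der_const_mul hf, abs_mul, mul_assoc]
  exact mul_le_mul_of_nonneg_left (h w hw) (abs_nonneg _)

lemma der_zero (w : List (Fin 4)) : der w (fun _ => (0 : ℝ)) = fun _ => 0 := by
  induction w with
  | nil => rfl
  | cons a w ih => rw [der, pd_const, ih]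

lemma Wt.zero (p : Pt) (m : ℕ) (α : ℤ) : Wt p m α 0 (fun _ => 0) := fun w _ => by simp [der_zero]

lemma Wt.sum {ι : Type*} (s : Finset ι) {m : ℕ} {α : ℤ} {B : ι → ℝ} {f : ι → Fld} (h : ∀ i, Wt p m α
    (B i) (f i)) (hf : ∀ i, Sm (f i)) : Wt p m α (∑ i ∈ s, B i) (fun p => ∑ i ∈ s, f i p) := by
  classical
  induction s using Finset.induction_on with
  | empty => simpa using Wt.zero p m α
  | insert i s hi ih =>
    simp only [Finset.sum_insert hi]
    exact (h i).add ih (hf i) (by fun_prop)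

lemma der_mul_le (w : List (Fin 4)) : ∀ {α β : ℤ} {B B' : ℝ} {f g : Fld}, Sm f → Sm g → 0 ≤ B → 0 ≤
    B' → Wt p w.length α B f → Wt p w.length β B' g → |der w (fun p => f p * g p) p| ≤ 2 ^ w.length
    * (B * B') * (1 + rr p) ^ (-(α + β + w.length)) := by
  have hρ : (0 : ℝ) < 1 + rr p := by linarith [one_le_rho p]
  induction w with
  | nil =>
    intro α β B B' f g hf hg hB hB' h h'
    have h1 := h [] le_rfl
    have h2 := h' [] le_rfl
    simp only [der, List.length_nil, Nat.cast_zero, add_zero, pow_zero, one_mul] at *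
    rw [abs_mul, neg_add, zpow_add₀ hρ.ne']
    refine (mul_le_mul h1 h2 (abs_nonneg _) (by positivity)).trans (le_of_eq ?_)
    ring
  | cons a w ih =>
    intro α β B B' f g hf hg hB hB' h h'
    rw [der, pd_mul hf hg, der_add (by fun_prop) (by fun_prop)]
    rw [List.length_cons] at *
    have h1 := ih hg (hf.pd a) hB' hB (h'.mono (Nat.le_succ _) le_rfl) (h.pd a)
    have h2 := ih hf (hg.pd a) hB hB' (h.mono (Nat.le_succ _) le_rfl) (h'.pd a)
    refine (abs_add_le _ _).trans ((add_le_add h2 h1).trans (le_of_eq ?_))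
    rw [show β + (α + 1) + (w.length : ℤ) = α + β + ((w.length + 1 : ℕ) : ℤ) by push_cast; ring,
      show α + (β + 1) + (w.length : ℤ) = α + β + ((w.length + 1 : ℕ) : ℤ) by push_cast; ring]
    ring

lemma Wt.mul {m : ℕ} {α β : ℤ} {B' : ℝ} (h : Wt p m α B f) (h' : Wt p m β B' g) (hf : Sm f) (hg : Sm
    g) (hB : 0 ≤ B) (hB' : 0 ≤ B') : Wt p m (α + β) (2 ^ m * (B * B')) (fun p => f p * g p) := fun w
    hw => by
  refine (der_mul_le w hf hg hB hB' (h.mono hw le_rfl) (h'.mono hw le_rfl)).trans ?_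
  have hρ : (0 : ℝ) < 1 + rr p := by linarith [one_le_rho p]
  gcongr
  norm_num

lemma Wt.coord (hp : p 0 = 0) (m : ℕ) (c : Fin 4) : Wt p m (-1) 1 (fun p => p c) := by
  have hρ : (0 : ℝ) < 1 + rr p := by linarith [one_le_rho p]
  intro w _
  match w with
  | [] =>
    have : |p c| ≤ 1 + rr p := by
      have hr := rr_nonneg p
      refine Fin.cases ?_ (fun i => ?_) c
      · rw [hp, abs_zero]; linarith
      · have := abs_coord_le_rr p i
        change |p (sidx i)| ≤ _
        linarith
    simpa [der] using this
  | [a] =>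
    rw [der, pd_coord]
    simp only [der, List.length_singleton]
    norm_num
    split_ifs <;> norm_num
  | a :: b :: w =>
    rw [der, pd_coord, der, pd_const, der_zero]
    rw [abs_zero, one_mul]
    positivity

lemma Wt.zap (hp : p 0 = 0) {m : ℕ} (h : Wt p (m + 1) 2 B f) (hf : Sm f) (hB : 0 ≤ B) (Z : ZI) : Wt
    p m 2 ((4 * (1 + 8 * 2 ^ m)) * B) (zap Z f) := by
  have h1 : ∀ a, Wt p m 2 ((1 + 8 * 2 ^ m) * B)
      (fun p => zb Z a * _root_.pd a f p + ∑ c, zA Z a c * (p c * _root_.pd a f p)) := by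
    intro a
    have hb : |zb Z a| ≤ 1 := by
      rcases Z with d | d <;> simp only [zb]
      · split_ifs <;> norm_num
      · norm_num
    have h2 := (((h.pd a).weaken hB (show (2 : ℤ) ≤ 2 + 1 by norm_num)).const_mul (hf.pd a) (zb Z
      a)).mono le_rfl (mul_le_of_le_one_left hB hb)
    have h3 : ∀ c, Wt p m 2 (2 * (2 ^ m * B)) (fun p => zA Z a c * (p c * _root_.pd a f p)) := by
      intro c
      have h4 := (((Wt.coord hp m c).mul (h.pd a) (by fun_prop) (hf.pd a) zero_le_one hB).const_mul
        (by fun_prop) (zA Z a c))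
      rw [one_mul] at h4
      exact h4.mono le_rfl (mul_le_mul_of_nonneg_right (abs_zA_le _ _ _) (by positivity))
    have h5 := Wt.sum univ h3 (fun c => by fun_prop)
    refine (h2.add h5 (by fun_prop) (by fun_prop)).mono le_rfl (le_of_eq ?_)
    simp only [Finset.sum_const, card_univ, Fintype.card_fin, nsmul_eq_mul]
    push_cast; ring
  have h2 := Wt.sum univ h1 (fun a => by fun_prop)
  have e : _root_.zap Z f = fun p => ∑ a, (zb Z a * _root_.pd a f p + ∑ c, zA Z a c * (p c *
      _root_.pd a f p)) := by
    funext p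
    simp only [_root_.zap, add_mul, sum_mul, mul_assoc]
  rw [e]
  refine h2.mono le_rfl (le_of_eq ?_)
  simp only [Finset.sum_const, card_univ, Fintype.card_fin, nsmul_eq_mul]
  push_cast; ring

lemma Wt.gam (m : ℕ) (J : List ZI) : ∃ C : ℝ, 0 < C ∧ ∀ p : Pt, p 0 = 0 → ∀ (B : ℝ) (f : Fld), 0 ≤ B
    → Sm f → Wt p (J.length + m) 2 B f → Wt p m 2 (C * B) (gam J f) := by
  induction J with
  | nil => exact ⟨1, one_pos, fun p _ B f _ _ h => by simpa [_root_.gam] using h⟩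
  | cons Z J ih =>
    obtain ⟨C, hC, h⟩ := ih
    refine ⟨C * (4 * (1 + 8 * 2 ^ (J.length + m))), by positivity, fun p hp B f hB hf hw => ?_⟩
    rw [List.length_cons, show J.length + 1 + m = J.length + m + 1 by ring] at hw
    rw [mul_assoc]
    exact h p hp _ _ (by positivity) (hf.zap Z) (hw.zap hp hf hB Z)

lemma der_eq_zero_of_halfspace (hs : Sm h) (hz : ∀ p : Pt, 0 ≤ p 0 → h p = 0) (w : List (Fin 4)) (hp
    : 0 ≤ p 0) : der w h p = 0 := by rw [der_eq_gam]; exact gam_eq_zero_of_halfspace hs hz _ p hp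

lemma Wt.nf3 {m : ℕ} (F : Ten3) (hf : Sm φ) (hB : 0 ≤ B) (hD : 0 ≤ D) (h1 : Wt p (m + 1) 2 B φ) (h2
    : Wt p (m + 2) 2 D φ) : Wt p m 4 ((∑ a, ∑ b, ∑ c, |F a b c|) * 2 ^ m * (B * D)) (nf3 F φ φ) :=
    by
  have h : ∀ a b c, Wt p m 4 (|F a b c| * (2 ^ m * (B * D)))
      (fun q => F a b c * (_root_.pd a φ q * _root_.pd b (_root_.pd c φ) q)) := fun a b c =>
    (((h1.pd a).mul ((h2.pd c).pd b) (by fun_prop) (by fun_prop) hB hD).weaken (by positivity) (by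
      norm_num)).const_mul (by fun_prop) _
  have h' := Wt.sum univ (fun a => Wt.sum univ (fun b => Wt.sum univ (fun c => h a b c) (fun c => by
    fun_prop)) (fun b => by fun_prop)) (fun a => by fun_prop)
  have e : _root_.nf3 F φ φ = fun q => ∑ a, ∑ b, ∑ c,
      F a b c * (_root_.pd a φ q * _root_.pd b (_root_.pd c φ) q) := by
    funext q; simp only [_root_.nf3, mul_assoc]
  rw [e]
  refine h'.mono le_rfl (le_of_eq ?_)
  simp only [← sum_mul, mul_assoc]

lemma Wt.nf2 {m : ℕ} (G : Ten2) (hf : Sm φ) (hB : 0 ≤ B) (hD : 0 ≤ D) (h1 : Wt p (m + 1) 2 B φ) (h2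
    : Wt p (m + 1) 2 D φ) : Wt p m 4 ((∑ a, ∑ b, |G a b|) * 2 ^ m * (B * D)) (nf2 G φ φ) := by
  have h : ∀ a b, Wt p m 4 (|G a b| * (2 ^ m * (B * D)))
      (fun q => G a b * (_root_.pd a φ q * _root_.pd b φ q)) := fun a b =>
    (((h1.pd a).mul (h2.pd b) (by fun_prop) (by fun_prop) hB hD).weaken (by positivity) (by
      norm_num)).const_mul (by fun_prop) _
  have h' := Wt.sum univ (fun a => Wt.sum univ (fun b => h a b) (fun b => by fun_prop)) (fun a => by
    fun_prop)
  have e : _root_.nf2 G φ φ = fun q => ∑ a, ∑ b,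
      G a b * (_root_.pd a φ q * _root_.pd b φ q) := by funext q; simp only [_root_.nf2, mul_assoc]
  rw [e]
  refine h'.mono le_rfl (le_of_eq ?_)
  simp only [← sum_mul, mul_assoc]

lemma Sol.der_tt (h : Sol F G φ) (w : List (Fin 4)) (hp : 0 ≤ p 0) : der (0 :: 0 :: w) φ p = der (1
    :: 1 :: w) φ p + der (2 :: 2 :: w) φ p + der (3 :: 3 :: w) φ p + der w (nf3 F φ φ) p + -1 * der
      w (nf2 G φ φ) p := by
  have hf : Sm φ := h.1
  have h3 : Sm (nf3 F φ φ) := hf.nf3 F hf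
  have h2 : Sm (nf2 G φ φ) := hf.nf2 G hf
  have e : der w (fun q => (((((-1 * pd 0 (pd 0 φ) q) + pd 1 (pd 1 φ) q) + pd 2 (pd 2 φ) q) + pd 3
      (pd 3 φ) q) + nf3 F φ φ q) + -1 * nf2 G φ φ q) p = 0 := by
    refine der_eq_zero_of_halfspace (by fun_prop) (fun q hq => ?_) w hp
    have := h.2 q hq
    simp only [box] at this
    linarith
  rw [der_add (by fun_prop) (by fun_prop), der_add (by fun_prop) (by fun_prop), der_add (by
    fun_prop) (by fun_prop), der_add (by fun_prop) (by fun_prop), der_add (by fun_prop) (by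
    fun_prop), der_const_mul (by fun_prop), der_const_mul (by fun_prop)] at e
  simp only [der]
  linarith

/-- Weighted bounds for the Cauchy data at a point of the initial slice. -/
def DataAt (p : Pt) (m : ℕ) (ε : ℝ) (φ : Fld) : Prop :=
  ∀ w : List (Fin 4), w.length ≤ m → 0 ∉ w →
    |der w φ p| ≤ ε * (1 + rr p) ^ (-(2 + w.length : ℤ)) ∧
    |der w (pd 0 φ) p| ≤ ε * (1 + rr p) ^ (-(3 + w.length : ℤ))

lemma DataAt.low {m : ℕ} (h : DataAt p m ε φ) (hf : Sm φ) {w : List (Fin 4)} (hw : w.length ≤ m) (h0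
    : w.count 0 ≤ 1) : |der w φ p| ≤ ε * (1 + rr p) ^ (-(2 + w.length : ℤ)) := by
  by_cases h1 : (0 : Fin 4) ∈ w
  · have hp := List.perm_cons_erase h1
    have hl := hp.length_eq
    rw [List.length_cons] at hl
    have h2 : (0 : Fin 4) ∉ w.erase 0 := by
      intro h2
      have := List.count_pos_iff.2 h2
      rw [List.count_erase_self] at this
      omega
    rw [der_perm hp hf, der]
    convert (h _ (by omega) h2).2 using 3
    rw [hl]; push_cast; ring
  · exact (h w hw h1).1

lemma DataAt.high {m : ℕ} (h : DataAt p m ε φ) (hs : Sol F G φ) (hp : p 0 = 0) (hD : 0 ≤ D) (hε : 0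
    ≤ ε) (hQ : ∀ w : List (Fin 4), w.length + 2 = m → |der w (nf3 F φ φ) p| + |der w (nf2 G φ φ) p|
    ≤ D * (1 + rr p) ^ (-(2 + m : ℤ))) (k : ℕ) : ∀ w : List (Fin 4), w.length = m → w.count 0 ≤ k →
      |der w φ p| ≤ 4 ^ k * (ε + D) * (1 + rr p) ^ (-(2 + m : ℤ)) := by
  have hf : Sm φ := hs.1
  have hρ : (0 : ℝ) ≤ (1 + rr p) ^ (-(2 + m : ℤ)) := zpow_nonneg (by linarith [one_le_rho p]) _
  induction k using Nat.strong_induction_on with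
  | _ k ih =>
    intro w hw hk
    by_cases h1 : w.count 0 ≤ 1
    · have := h.low hf hw.le h1
      rw [hw] at this
      refine this.trans (mul_le_mul_of_nonneg_right ?_ hρ)
      have : (1 : ℝ) ≤ 4 ^ k := one_le_pow₀ (by norm_num)
      nlinarith
    · push Not at h1
      have m1 : (0 : Fin 4) ∈ w := List.count_pos_iff.1 (by omega)
      have p1 := List.perm_cons_erase m1
      have m2 : (0 : Fin 4) ∈ w.erase 0 := List.count_pos_iff.1 (by
        rw [List.count_erase_self]; omega)
      have p2 := List.perm_cons_erase m2
      set w' := (w.erase 0).erase 0 with hw'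
      have p3 : w.Perm (0 :: 0 :: w') := p1.trans (List.Perm.cons 0 p2)
      have hc : w'.count 0 = w.count 0 - 2 := by
        rw [hw', List.count_erase_self, List.count_erase_self]; omega
      have hl := p3.length_eq
      simp only [List.length_cons] at hl
      rw [der_perm p3 hf, hs.der_tt w' hp.ge]
      have hi : ∀ i : Fin 3, |der (sidx i :: sidx i :: w') φ p|
          ≤ 4 ^ (k - 2) * (ε + D) * (1 + rr p) ^ (-(2 + m : ℤ)) := fun i => by
        refine ih (k - 2) (by omega) _ (by simp only [List.length_cons]; omega) ?_
        rw [List.count_cons_of_ne (by simp [sidx]), List.count_cons_of_ne (by simp [sidx])]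
        omega
      have i1 := hi 0
      have i2 := hi 1
      have i3 := hi 2
      rw [sidx_zero] at i1
      rw [sidx_one] at i2
      rw [sidx_two] at i3
      have hq := hQ w' (by omega)
      have h4 : (4 : ℝ) ^ k = 16 * 4 ^ (k - 2) := by
        rw [← Nat.sub_add_cancel (show 2 ≤ k by omega), pow_add]; norm_num; ring
      have h5 : (1 : ℝ) ≤ 4 ^ (k - 2) := one_le_pow₀ (by norm_num)
      have h6 : |der (1 :: 1 :: w') φ p + der (2 :: 2 :: w') φ p + der (3 :: 3 :: w') φ p
          + der w' (nf3 F φ φ) p + -1 * der w' (nf2 G φ φ) p| ≤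
          (3 * (4 ^ (k - 2) * (ε + D)) + D) * (1 + rr p) ^ (-(2 + m : ℤ)) := by
        rw [abs_le] at i1 i2 i3 ⊢
        have a1 := abs_le.1 (le_refl |der w' (nf3 F φ φ) p|)
        have a2 := abs_le.1 (le_refl |der w' (nf2 G φ φ) p|)
        constructor <;> linarith [i1.1, i2.1, i3.1, i1.2, i2.2, i3.2, a1.1, a1.2, a2.1, a2.2]
      refine h6.trans (mul_le_mul_of_nonneg_right ?_ hρ)
      rw [h4]
      nlinarith

lemma Sol.data_wt (F : Ten3) (G : Ten2) (m : ℕ) : ∃ C : ℝ, 0 < C ∧ ∃ ε0 : ℝ, 0 < ε0 ∧ ∀ φ : Fld, Sol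
    F G φ → ∀ ε : ℝ, 0 < ε → ε < ε0 → ∀ p : Pt, p 0 = 0 → DataAt p m ε φ → Wt p m 2 (C * ε) φ := by
  induction m with
  | zero =>
    refine ⟨1, one_pos, 1, one_pos, fun φ hs ε h0 _ p _ h w hw => ?_⟩
    rw [one_mul]
    refine h.low hs.1 hw ?_
    rw [List.length_eq_zero_iff.1 (Nat.le_zero.1 hw)]; simp
  | succ m ih =>
    obtain ⟨C, hC, ε0, hε0, ih⟩ := ih
    set K : ℝ := ((∑ a, ∑ b, ∑ c, |F a b c|) + ∑ a, ∑ b, |G a b|) * 2 ^ m with hK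
    have hK0 : 0 ≤ K := by positivity
    set L : ℝ := 4 ^ (m + 1) with hL
    have hL0 : 1 ≤ L := one_le_pow₀ (by norm_num)
    refine ⟨C + 2 * L + 1, by positivity, min ε0 (1 / (2 * (L * K * C * (1 + C)) + 1)),
      lt_min hε0 (by positivity), fun φ hs ε h0 hε p hp h => ?_⟩
    have hf : Sm φ := hs.1
    have hρ : (0 : ℝ) < 1 + rr p := by linarith [one_le_rho p]
    have hB := ih φ hs ε h0 (hε.trans_le (min_le_left _ _)) p hp
      (fun w hw => h w (hw.trans (Nat.le_succ m)))
    have hsm : 2 * (L * K * C * (1 + C)) * ε ≤ 1 := by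
      have := hε.trans_le (min_le_right _ _)
      rw [lt_div_iff₀ (by positivity)] at this
      nlinarith
    obtain ⟨v, -, hv⟩ := Finset.exists_max_image (univ : Finset (Fin (m + 1) → Fin 4))
      (fun v => |der (List.ofFn v) φ p|) Finset.univ_nonempty
    set Y : ℝ := |der (List.ofFn v) φ p| * (1 + rr p) ^ (2 + (m + 1 : ℕ) : ℤ) with hY
    have hY0 : 0 ≤ Y := by positivity
    have hYe : |der (List.ofFn v) φ p| = Y * (1 + rr p) ^ (-(2 + (m + 1 : ℕ) : ℤ)) := by
      rw [hY, mul_assoc, ← zpow_add₀ hρ.ne', add_neg_cancel, zpow_zero, mul_one]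
    have htop : ∀ w : List (Fin 4), w.length = m + 1 →
        |der w φ p| ≤ Y * (1 + rr p) ^ (-(2 + (m + 1 : ℕ) : ℤ)) := by
      intro w hw
      rw [← hYe]
      have : ∀ k, w.length = k → ∃ u : Fin k → Fin 4, List.ofFn u = w := by
        rintro k rfl; exact ⟨w.get, List.ofFn_get w⟩
      obtain ⟨u, rfl⟩ := this _ hw
      exact hv u (mem_univ _)
    have hBY : Wt p (m + 1) 2 (C * ε + Y) φ := by
      intro w hw
      rcases Nat.lt_or_ge w.length (m + 1) with h1 | h1
      · exact hB.mono le_rfl (le_add_of_nonneg_right hY0) w (by omega)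
      · have h2 : w.length = m + 1 := le_antisymm hw h1
        have := htop w h2
        rw [h2]
        refine this.trans (mul_le_mul_of_nonneg_right ?_ (by positivity))
        have : 0 ≤ C * ε := by positivity
        linarith
    have hYb : Y ≤ L * (ε + K * (C * ε * (C * ε + Y))) := by
      have h2 := h.high hs hp (D := K * (C * ε * (C * ε + Y))) (by positivity) h0.le ?_ (m + 1)
        (List.ofFn v) (by simp) (List.count_le_length.trans (by simp))
      · rw [hYe] at h2
        exact le_of_mul_le_mul_right h2 (by positivity)
      · intro w hw
        obtain ⟨m', rfl⟩ : ∃ m', m = m' + 1 := ⟨m - 1, by omega⟩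
        have q3 := (hB.nf3 F hf (by positivity) (by positivity) hBY) w (by omega)
        have q2 := (hB.nf2 G hf (by positivity) (by positivity) (hBY.mono (Nat.le_succ _) le_rfl)) w
          (by omega)
        refine (add_le_add q3 q2).trans ?_
        rw [← add_mul, show (4 + (w.length : ℤ)) = 2 + ((m' + 1 + 1 : ℕ) : ℤ) by
          rw [← hw]; push_cast; ring]
        refine mul_le_mul_of_nonneg_right ?_ (by positivity)
        rw [← add_mul, ← add_mul]
        refine mul_le_mul_of_nonneg_right ?_ (by positivity)
        rw [hK]
        refine mul_le_mul_of_nonneg_left ?_ (by positivity)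
        exact pow_le_pow_right₀ (by norm_num) (by omega)
    refine hBY.mono le_rfl ?_
    have e1 : L * (ε + K * (C * ε * (C * ε + Y))) =
      L * ε + (L * K * C * C * ε) * ε + (L * K * C * ε) * Y := by ring
    rw [e1] at hYb
    have e2 : L * K * C * C * ε ≤ 1 / 2 := by
      have : 0 ≤ L * K * C * ε := by positivity
      nlinarith
    have e3 : L * K * C * ε ≤ 1 / 2 := by
      have : 0 ≤ L * K * C * C * ε := by positivity
      nlinarith
    nlinarith [mul_le_mul_of_nonneg_right e2 h0.le, mul_le_mul_of_nonneg_right e3 hY0]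

lemma der_snoc (w : List (Fin 4)) (a : Fin 4) (f : Fld) : der (w ++ [a]) f = pd a (der w f) := by
  rw [der_eq_gam, der_eq_gam, List.map_append, List.map_singleton, gam_snoc, zap_tr]

lemma ContDiff.der (hf : Sm f) (w : List (Fin 4)) : Sm (der w f) := by
  rw [der_eq_gam]; exact hf.gam _

lemma spdIter_comp_stp (hf : Sm f) (t : ℝ) (L : List (Fin 3)) : spdIter L (fun y => f (stp t y)) =
    fun y => der (L.map sidx) f (stp t y) := by
  have : ∀ L : List (Fin 3), spdIter L (fun y => f (stp t y)) =
      fun y => der (L.map sidx).reverse f (stp t y) := by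
    intro L
    induction L with
    | nil => rfl
    | cons i L ih =>
      rw [spdIter, ih, spd_comp_stp (hf.der _), List.map_cons, List.reverse_cons, der_snoc]
  rw [this, der_perm (List.reverse_perm _) hf]

lemma abs_spdIter_le_hatD (L : List (Fin 3)) (g : Sp → ℝ) (x : Sp) : |spdIter L g x| ≤ hatD L.length
    g x := by
  refine le_trans (le_of_eq ?_) (single_le_sum (f := fun I : Fin L.length → Fin 3 => |spdIter
    (List.ofFn I) g x|) (fun _ _ => abs_nonneg _) (mem_univ L.get))
  simp only [List.ofFn_get]

lemma exists_map_sidx {w : List (Fin 4)} (h : 0 ∉ w) : ∃ L : List (Fin 3), L.map sidx = w := by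
  induction w with
  | nil => exact ⟨[], rfl⟩
  | cons a w ih =>
    simp only [List.mem_cons, not_or] at h
    obtain ⟨L, hL⟩ := ih h.2
    exact ⟨a.pred (Ne.symm h.1) :: L, by simp [hL, sidx]⟩

lemma dataAt_of_hatD (hf : Sm φ) {m : ℕ} (h1 : ∀ k ≤ m, ∀ x, hatD k (fun y => φ (stp 0 y)) x ≤ ε /
    (1 + rad3 x) ^ (k + 2)) (h2 : ∀ k ≤ m, ∀ x, hatD k (fun y => pd 0 φ (stp 0 y)) x ≤ ε / (1 + rad3
    x) ^ (k + 3)) (x : Sp) : DataAt (stp 0 x) m ε φ := by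
  intro w hw h0
  obtain ⟨L, rfl⟩ := exists_map_sidx h0
  rw [List.length_map] at hw ⊢
  have a1 := (abs_spdIter_le_hatD L _ x).trans (h1 _ hw x)
  have a2 := (abs_spdIter_le_hatD L _ x).trans (h2 _ hw x)
  rw [spdIter_comp_stp hf] at a1
  rw [spdIter_comp_stp (hf.pd 0)] at a2
  rw [rr_stp, zpow_neg, zpow_neg, ← div_eq_mul_inv, ← div_eq_mul_inv]
  constructor
  · rw [show (2 + (L.length : ℤ)) = ((L.length + 2 : ℕ) : ℤ) by push_cast; ring, zpow_natCast]
    exact a1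
  · rw [show (3 + (L.length : ℤ)) = ((L.length + 3 : ℕ) : ℤ) by push_cast; ring, zpow_natCast]
    exact a2

lemma norm_le_rad3 (x : Sp) : ‖x‖ ≤ rad3 x := by
  rw [← rr_stp 0 x]
  refine (pi_norm_le_iff_of_nonneg (rr_nonneg _)).2 fun i => ?_
  have := abs_coord_le_rr (stp 0 x) i
  rwa [stp_sidx] at this

lemma integrable_rad3_weight : Integrable fun x => (1 + rad3 x) ^ (-4 : ℤ) := by
  have h := integrable_one_add_norm (E := Sp) (μ := volume) (r := 4) (by simp; norm_num)
  have hc : Continuous fun x => (1 + rad3 x) ^ (-4 : ℤ) := by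
    have : Continuous rad3 := by unfold rad3; fun_prop
    refine Continuous.zpow₀ (by fun_prop) _ fun x => Or.inl ?_
    have : 0 ≤ rad3 x := Real.sqrt_nonneg _
    positivity
  refine h.mono' hc.aestronglyMeasurable (.of_forall fun x => ?_)
  have h0 := norm_le_rad3 x
  have h1 := norm_nonneg x
  rw [Real.norm_of_nonneg (by have : 0 ≤ rad3 x := h1.trans h0; positivity), zpow_neg, Real.rpow_neg
    (by positivity)]
  refine inv_anti₀ (by positivity) ?_
  have : (1 + ‖x‖) ^ (4 : ℝ) = (1 + ‖x‖) ^ (4 : ℕ) := by rw [← Real.rpow_natCast]; norm_num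
  rw [this, show ((4 : ℤ)) = ((4 : ℕ) : ℤ) by norm_num, zpow_natCast]
  gcongr

/-- Smallness of all vector field derivatives on the initial slice. -/
lemma Sol.data_en (F : Ten3) (G : Ten2) (m : ℕ) : ∃ C : ℝ, 0 < C ∧ ∃ ε0 : ℝ, 0 < ε0 ∧ ∀ φ : Fld, Sol
    F G φ → ∀ ε : ℝ, 0 < ε → ε < ε0 → (∀ x, DataAt (stp 0 x) m ε φ) → ∀ J ∈ wds m, en (gam J φ)
      0 ≤ C * ε ^ 2 := by
  obtain ⟨C, hC, ε0, hε0, h⟩ := Sol.data_wt F G m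
  have hJ : ∀ J ∈ wds m, ∃ C' : ℝ, 0 < C' ∧ ∀ p : Pt, p 0 = 0 → ∀ (B : ℝ) (f : Fld), 0 ≤ B →
      Sm f → Wt p m 2 B f → |gam J f p| ≤ C' * B * (1 + rr p) ^ (-2 : ℤ) := by
    intro J hJ
    rw [mem_wds] at hJ
    obtain ⟨C', hC', h'⟩ := Wt.gam 0 J
    refine ⟨C', hC', fun p hp B f hB hf hw => ?_⟩
    simpa [der] using h' p hp B f hB hf (hw.mono (by simpa using hJ) le_rfl) [] le_rfl
  choose! C' hC' hJ using hJ
  obtain ⟨I, hI⟩ : ∃ I : ℝ, I = ∫ x, (1 + rad3 x) ^ (-4 : ℤ) := ⟨_, rfl⟩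
  have hρ : ∀ x, 0 < 1 + rad3 x := fun x => by
    have : 0 ≤ rad3 x := Real.sqrt_nonneg _
    positivity
  have hI0 : 0 ≤ I := by rw [hI]; exact integral_nonneg fun x => zpow_nonneg (hρ x).le _
  have hc : ∀ J ∈ wds m, C' J ^ 2 ≤ ∑ J ∈ wds m, C' J ^ 2 := fun J hJ' =>
    single_le_sum (f := fun J => C' J ^ 2) (fun _ _ => sq_nonneg _) hJ'
  have hc0 : 0 ≤ ∑ J ∈ wds m, C' J ^ 2 := sum_nonneg fun _ _ => sq_nonneg _
  refine ⟨(∑ J ∈ wds m, C' J ^ 2) * C ^ 2 * I + 1, by positivity, ε0, hε0,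
    fun φ hs ε h0 hε hd J hJ' => ?_⟩
  have hp : ∀ x, gam J φ (stp 0 x) ^ 2 ≤ C' J ^ 2 * C ^ 2 * ε ^ 2 * (1 + rad3 x) ^ (-4 : ℤ) := by
    intro x
    have h1 := hJ J hJ' (stp 0 x) rfl _ φ (by positivity) hs.1 (h φ hs ε h0 hε _ rfl (hd x))
    rw [rr_stp] at h1
    have h2 := pow_le_pow_left₀ (abs_nonneg _) h1 2
    rw [sq_abs] at h2
    refine h2.trans (le_of_eq ?_)
    rw [show (-4 : ℤ) = -2 + -2 by norm_num, zpow_add₀ (hρ x).ne']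
    ring
  calc en (gam J φ) 0 ≤ ∫ x, C' J ^ 2 * C ^ 2 * ε ^ 2 * (1 + rad3 x) ^ (-4 : ℤ) :=
        integral_mono_of_nonneg (.of_forall fun x => sq_nonneg _)
          (integrable_rad3_weight.const_mul _) (.of_forall hp)
    _ = C' J ^ 2 * (C ^ 2 * ε ^ 2 * I) := by rw [integral_const_mul, ← hI]; ring
    _ ≤ (∑ J ∈ wds m, C' J ^ 2) * (C ^ 2 * ε ^ 2 * I) :=
        mul_le_mul_of_nonneg_right (hc J hJ') (by positivity)
    _ ≤ _ := by nlinarith [sq_nonneg ε]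

lemma abs_gam_pd_le (K : List ZI) : ∀ {f : Fld}, Sm f → ∀ (a : Fin 4) (p : Pt), |gam K (pd a f) p| ≤
    9 ^ K.length * DD K.length f p := by
  induction K with
  | nil =>
    intro f hf a p
    simpa [gam] using (abs_pd_le_D1 f p a).trans (D1_gam_le_DD (J := []) le_rfl f p)
  | cons Z K ih =>
    intro f hf a p
    have e : gam (Z :: K) (pd a f) p = gam K (pd a (zap Z f)) p
        + ∑ c, -zA Z c a * gam K (pd c f) p := by
      have e1 : zap Z (pd a f) = fun p => pd a (zap Z f) p + ∑ c, -zA Z c a * pd c f p := by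
        rw [zap_pd hf]; funext p
        simp only [neg_mul, sum_neg_distrib, sub_eq_add_neg]
      rw [gam, e1, gam_add (by fun_prop) (by fun_prop), gam_sum _ (fun c => by fun_prop)]
      refine congrArg _ (sum_congr rfl fun c _ => ?_)
      rw [gam_const_mul (hf.pd c)]
    have h1 := ih (hf.zap Z) a p
    have h2 : DD K.length (zap Z f) p ≤ DD (K.length + 1) f p := by
      have := DD_gam_le K.length [Z] f p
      rwa [List.length_singleton, add_comm] at this
    have h3 : |∑ c, -zA Z c a * gam K (pd c f) p| ≤ 8 * (9 ^ K.length * DD (K.length + 1) f p) := by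
      refine (abs_sum_le_sum_abs _ _).trans ?_
      have : ∀ c ∈ univ, |-zA Z c a * gam K (pd c f) p| ≤
          2 * (9 ^ K.length * DD (K.length + 1) f p) := fun c _ => by
        rw [abs_mul, abs_neg]
        refine mul_le_mul (abs_zA_le _ _ _) ((ih hf c p).trans ?_) (abs_nonneg _) (by norm_num)
        exact mul_le_mul_of_nonneg_left (DD_mono (Nat.le_succ _) _ _) (by positivity)
      refine (sum_le_card_nsmul _ _ _ this).trans (le_of_eq ?_)
      simp; ring
    rw [e, List.length_cons, pow_succ]
    have h4 := mul_le_mul_of_nonneg_left h2 (show (0 : ℝ) ≤ 9 ^ K.length by positivity)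
    refine (abs_add_le _ _).trans ?_
    linarith

lemma D1_sq_le (f : Fld) (p : Pt) : D1 f p ^ 2 ≤ 4 * flatE f p := by
  have := sq_sum_le_card_mul_sum_sq (s := (univ : Finset (Fin 4))) (f := fun a => |pd a f p|)
  simpa [D1, flatE, Fin.sum_univ_four] using this

lemma pd_sq_le_flatE (f : Fld) (p : Pt) (a : Fin 4) : pd a f p ^ 2 ≤ flatE f p := by
  have := single_le_sum (f := fun a => pd a f p ^ 2) (fun _ _ => sq_nonneg _)
    (mem_univ a)
  simpa [flatE, Fin.sum_univ_four] using this

lemma DD_sq_le (k : ℕ) (f : Fld) (p : Pt) : DD k f p ^ 2 ≤ 4 * (wds k).card * ∑ J ∈ wds k, flatE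
    (gam J f) p := by
  have h := sq_sum_le_card_mul_sum_sq (s := wds k) (f := fun J => D1 (gam J f) p)
  calc _ ≤ _ := h
    _ ≤ ((wds k).card : ℝ) * (4 * ∑ J ∈ wds k, flatE (gam J f) p) :=
        mul_le_mul_of_nonneg_left (by
          rw [mul_sum]; exact sum_le_sum fun J _ => D1_sq_le _ _) (Nat.cast_nonneg _)
    _ = _ := by ring

lemma Supp.ss (hf : Sm f) (h : Supp M f) (k : ℕ) : Supp M (SS k f) :=
  fun p h0 hp => sum_eq_zero fun J _ => by rw [h.gam hf J p h0 hp, abs_zero]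

lemma Supp.dd (hf : Sm f) (h : Supp M f) (k : ℕ) : Supp M (DD k f) :=
  fun p h0 hp => sum_eq_zero fun J _ => sum_eq_zero fun a _ => by
    rw [(h.gam hf J).pder (hf.gam J) a p h0 hp, abs_zero]

/-- Total squared `L²` norm of the derivatives of order at most `k`. -/
def AA (k : ℕ) (f : Fld) (t : ℝ) : ℝ := ∑ J ∈ wds k, en (gam J f) t

/-- Total energy of the derivatives of order at most `k`. -/
def BB (k : ℕ) (f : Fld) (t : ℝ) : ℝ := ∑ J ∈ wds k, ∫ x, flatE (gam J f) (stp t x)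

lemma BB_term_nonneg (f : Fld) (t : ℝ) : 0 ≤ ∫ x, flatE f (stp t x) :=
  integral_nonneg fun _ => flatE_nonneg _ _

lemma AA_nonneg (k : ℕ) (f : Fld) (t : ℝ) : 0 ≤ AA k f t := sum_nonneg fun _ _ => en_nonneg _ _

lemma BB_nonneg (k : ℕ) (f : Fld) (t : ℝ) : 0 ≤ BB k f t := sum_nonneg fun _ _ => BB_term_nonneg _ _

lemma AA_mono {l : ℕ} (h : k ≤ l) (f : Fld) (t : ℝ) : AA k f t ≤ AA l f t :=
  sum_le_sum_of_subset_of_nonneg (wds_mono h) fun _ _ _ => en_nonneg _ _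

lemma BB_mono {l : ℕ} (h : k ≤ l) (f : Fld) (t : ℝ) : BB k f t ≤ BB l f t :=
  sum_le_sum_of_subset_of_nonneg (wds_mono h) fun _ _ _ => BB_term_nonneg _ _

lemma en_gam_le_AA (h : J.length ≤ k) (f : Fld) (t : ℝ) : en (gam J f) t ≤ AA k f t :=
  single_le_sum (f := fun J => en (gam J f) t) (fun _ _ => en_nonneg _ _) (mem_wds.2 h)

lemma flatE_gam_le_BB (h : J.length ≤ k) (f : Fld) (t : ℝ) : ∫ x, flatE (gam J f) (stp t x) ≤ BB k f
    t :=
  single_le_sum (f := fun J => ∫ x, flatE (gam J f) (stp t x))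
    (fun _ _ => BB_term_nonneg _ _) (mem_wds.2 h)

lemma integrable_sum_flatE (hf : Sm f) (hs : Supp M f) (ht : 0 ≤ t) (J : List ZI) : Integrable fun x
    : Sp => flatE (gam J f) (stp t x) :=
  ((hs.gam hf J).flatE (hf.gam J)).integrable (ContDiff.flatE (hf.gam J)).continuous ht

lemma integral_SS_sq_le (hf : Sm f) (hs : Supp M f) (ht : 0 ≤ t) (k : ℕ) : ∫ x, SS k f (stp t x) ^ 2
    ≤ (wds k).card * AA k f t := by
  have hi : ∀ J ∈ wds k, Integrable fun x => gam J f (stp t x) ^ 2 := fun J _ =>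
    (hs.gam hf J).integrable_sq (hf.gam J).continuous ht
  calc _ ≤ ∫ x, (wds k).card * ∑ J ∈ wds k, gam J f (stp t x) ^ 2 :=
        integral_mono_of_nonneg (.of_forall fun x => sq_nonneg _)
          ((integrable_finsetSum _ hi).const_mul _)
          (.of_forall fun x => SS_sq_le _ _ _)
    _ = _ := by rw [integral_const_mul, integral_finsetSum _ hi]; rfl

lemma integral_DD_sq_le (hf : Sm f) (hs : Supp M f) (ht : 0 ≤ t) (k : ℕ) : ∫ x, DD k f (stp t x) ^ 2
    ≤ 4 * (wds k).card * BB k f t := by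
  have hi : ∀ J ∈ wds k, Integrable fun x => flatE (gam J f) (stp t x) := fun J _ =>
    integrable_sum_flatE hf hs ht J
  calc _ ≤ ∫ x, 4 * (wds k).card * ∑ J ∈ wds k, flatE (gam J f) (stp t x) :=
        integral_mono_of_nonneg (.of_forall fun x => sq_nonneg _)
          ((integrable_finsetSum _ hi).const_mul _)
          (.of_forall fun x => DD_sq_le _ _ _)
    _ = _ := by rw [integral_const_mul, integral_finsetSum _ hi]; rfl

lemma ks_gam : ∃ C : ℝ, 0 < C ∧ ∀ M : ℝ, ∀ f : Fld, Sm f → Supp M f → ∀ (J : List ZI) (p : Pt), 0 ≤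
    p 0 → ss p ^ 2 * (1 + |p 0 - rr p|) * gam J f p ^ 2 ≤ C * AA (J.length + 3) f (p 0) := by
  obtain ⟨C, hC, h⟩ := klainerman_sobolev
  refine ⟨C, hC, fun M f hf hs J p hp => (h M _ (hf.gam J) (hs.gam hf J) p hp).trans ?_⟩
  refine mul_le_mul_of_nonneg_left ?_ hC.le
  simp only [← gam_append]
  exact sum_wds_gam_le (fun K => en (gam K f) (p 0)) (fun K => en_nonneg _ _) 3 J

lemma ks_pd_gam : ∃ C : ℝ, 0 < C ∧ ∀ M : ℝ, ∀ f : Fld, Sm f → Supp M f → ∀ (J : List ZI) (a : Fin 4)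
    (p : Pt), 0 ≤ p 0 → ss p ^ 2 * (1 + |p 0 - rr p|) * pd a (gam J f) p ^ 2 ≤ C * BB (J.length + 3)
      f (p 0) := by
  obtain ⟨C, hC, h⟩ := klainerman_sobolev
  obtain ⟨c, hc⟩ : ∃ c : ℝ, c = ((wds 3).card : ℕ) := ⟨_, rfl⟩
  have hc0 : 0 ≤ c := by rw [hc]; positivity
  refine ⟨C * (c * (9 ^ 6 * (4 * c))) + 1, by positivity, fun M f hf hs J a p hp =>
    (h M _ ((hf.gam J).pd a) ((hs.gam hf J).pder (hf.gam J) a) p hp).trans ?_⟩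
  have hB := BB_nonneg (J.length + 3) f (p 0)
  have h1 : ∀ K ∈ wds 3, en (gam K (pd a (gam J f))) (p 0) ≤
      9 ^ 6 * (4 * c) * BB (J.length + 3) f (p 0) := by
    intro K hK
    have hb : BB 3 (gam J f) (p 0) ≤ BB (J.length + 3) f (p 0) := by
      unfold BB
      simp only [← gam_append]
      exact sum_wds_gam_le (fun K => ∫ x, flatE (gam K f) (stp (p 0) x))
        (fun K => BB_term_nonneg _ _) 3 J
    have hd := integral_DD_sq_le (hf.gam J) (hs.gam hf J) hp 3
    rw [← hc] at hd
    have hi : Integrable fun x => DD 3 (gam J f) (stp (p 0) x) ^ 2 :=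
      ((hs.gam hf J).dd (hf.gam J) 3).integrable_sq (continuous_DD (hf.gam J) 3) hp
    calc en (gam K (pd a (gam J f))) (p 0)
        ≤ ∫ x, 9 ^ 6 * DD 3 (gam J f) (stp (p 0) x) ^ 2 := by
          refine integral_mono_of_nonneg (.of_forall fun x => sq_nonneg _)
            (hi.const_mul _) (.of_forall fun x => ?_)
          have hK' := mem_wds.1 hK
          have h2 := (abs_gam_pd_le K (hf.gam J) a (stp (p 0) x)).trans
            (mul_le_mul (pow_le_pow_right₀ (by norm_num) hK') (DD_mono hK' _ _) (DD_nonneg _ _ _)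
              (by positivity : (0 : ℝ) ≤ 9 ^ 3))
          have h3 := pow_le_pow_left₀ (abs_nonneg _) h2 2
          rw [sq_abs] at h3
          refine h3.trans (le_of_eq ?_)
          ring
      _ = 9 ^ 6 * ∫ x, DD 3 (gam J f) (stp (p 0) x) ^ 2 := integral_const_mul _ _
      _ ≤ 9 ^ 6 * (4 * c * BB (J.length + 3) f (p 0)) := by
          refine mul_le_mul_of_nonneg_left (hd.trans ?_) (by norm_num)
          exact mul_le_mul_of_nonneg_left hb (by positivity)
      _ = _ := by ring
  have h2 := sum_le_card_nsmul _ _ _ h1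
  rw [nsmul_eq_mul, ← hc] at h2
  calc _ ≤ C * (c * (9 ^ 6 * (4 * c) * BB (J.length + 3) f (p 0))) :=
        mul_le_mul_of_nonneg_left h2 hC.le
    _ ≤ _ := by nlinarith

lemma ks_SS (k : ℕ) : ∃ C : ℝ, 0 < C ∧ ∀ M : ℝ, ∀ f : Fld, Sm f → Supp M f → ∀ p : Pt, 0 ≤ p 0 → ∀ A
    : ℝ, 0 ≤ A → AA (k + 3) f (p 0) ≤ A ^ 2 → ss p * SS k f p ≤ C * A := by
  obtain ⟨C, hC, h⟩ := ks_gam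
  obtain ⟨c, hc⟩ : ∃ c : ℝ, c = ((wds k).card : ℕ) := ⟨_, rfl⟩
  have hc0 : 0 ≤ c := by rw [hc]; positivity
  refine ⟨c * (C + 1) + 1, by positivity, fun M f hf hs p hp A hA hA' => ?_⟩
  have h1 : ∀ J ∈ wds k, ss p * |gam J f p| ≤ (C + 1) * A := by
    intro J hJ
    have h2 := (h M f hf hs J p hp).trans (mul_le_mul_of_nonneg_left ((AA_mono (Nat.add_le_add_right
      (mem_wds.1 hJ) 3) f _).trans hA') hC.le)
    have h3 : (ss p * |gam J f p|) ^ 2 ≤ ((C + 1) * A) ^ 2 := by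
      have h4 : (0 : ℝ) ≤ |p 0 - rr p| * (ss p ^ 2 * gam J f p ^ 2) := by positivity
      rw [mul_pow, sq_abs, mul_pow]
      nlinarith [sq_nonneg A, mul_nonneg hC.le (sq_nonneg A), mul_nonneg (sq_nonneg C) (sq_nonneg A)]
    exact (sq_le_sq₀ (mul_nonneg (ss_pos hp).le (abs_nonneg _)) (by positivity)).1 h3
  have h2 := sum_le_card_nsmul _ _ _ h1
  rw [nsmul_eq_mul, ← hc, ← mul_sum] at h2
  unfold SS
  nlinarith

lemma ks_DD (k : ℕ) : ∃ C : ℝ, 0 < C ∧ ∀ M : ℝ, ∀ f : Fld, Sm f → Supp M f → ∀ p : Pt, 0 ≤ p 0 → ∀ A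
    : ℝ, 0 ≤ A → BB (k + 3) f (p 0) ≤ A ^ 2 → ss p * DD k f p ≤ C * A := by
  obtain ⟨C, hC, h⟩ := ks_pd_gam
  obtain ⟨c, hc⟩ : ∃ c : ℝ, c = ((wds k).card : ℕ) := ⟨_, rfl⟩
  have hc0 : 0 ≤ c := by rw [hc]; positivity
  refine ⟨c * (4 * (C + 1)) + 1, by positivity, fun M f hf hs p hp A hA hA' => ?_⟩
  have h1 : ∀ J ∈ wds k, ss p * D1 (gam J f) p ≤ 4 * (C + 1) * A := by
    intro J hJ
    have h5 : ∀ a ∈ (univ : Finset (Fin 4)), ss p * |pd a (gam J f) p| ≤ (C + 1) * A := by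
      intro a _
      have h2 := (h M f hf hs J a p hp).trans (mul_le_mul_of_nonneg_left ((BB_mono
        (Nat.add_le_add_right (mem_wds.1 hJ) 3) f _).trans hA') hC.le)
      have h3 : (ss p * |pd a (gam J f) p|) ^ 2 ≤ ((C + 1) * A) ^ 2 := by
        have h4 : (0 : ℝ) ≤ |p 0 - rr p| * (ss p ^ 2 * pd a (gam J f) p ^ 2) := by positivity
        rw [mul_pow, sq_abs, mul_pow]
        nlinarith [sq_nonneg A, mul_nonneg hC.le (sq_nonneg A), mul_nonneg (sq_nonneg C) (sq_nonneg
          A)]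
      exact (sq_le_sq₀ (mul_nonneg (ss_pos hp).le (abs_nonneg _)) (by positivity)).1 h3
    have h2 := sum_le_card_nsmul _ _ _ h5
    rw [nsmul_eq_mul, ← mul_sum, card_univ, Fintype.card_fin] at h2
    unfold D1
    push_cast at h2
    linarith
  have h2 := sum_le_card_nsmul _ _ _ h1
  rw [nsmul_eq_mul, ← hc, ← mul_sum] at h2
  unfold DD
  nlinarith

lemma ks_all (N : ℕ) : ∃ C : ℝ, 0 < C ∧ ∀ k ≤ N, ∀ M : ℝ, ∀ f : Fld, Sm f → Supp M f → ∀ p : Pt, 0 ≤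
    p 0 → ∀ A : ℝ, 0 ≤ A → (AA (k + 3) f (p 0) ≤ A ^ 2 → ss p * SS k f p ≤ C * A) ∧ (BB (k + 3) f (p
      0) ≤ A ^ 2 → ss p * DD k f p ≤ C * A) := by
  choose C1 hC1 h1 using ks_SS
  choose C2 hC2 h2 using ks_DD
  have m1 : ∀ k ≤ N, C1 k + C2 k ≤ ∑ k ∈ range (N + 1), (C1 k + C2 k) := fun k hk =>
    single_le_sum (f := fun k => C1 k + C2 k)
      (fun k _ => (add_pos (hC1 k) (hC2 k)).le) (mem_range.2 (by omega))
  refine ⟨∑ k ∈ range (N + 1), (C1 k + C2 k), (add_pos (hC1 0) (hC2 0)).trans_le (m1 0 (Nat.zero_le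
    _)), fun k hk M f hf hs p hp A hA => ⟨fun h => ?_, fun h => ?_⟩⟩
  · refine (h1 k M f hf hs p hp A hA h).trans (mul_le_mul_of_nonneg_right ?_ hA)
    linarith [m1 k hk, hC2 k]
  · refine (h2 k M f hf hs p hp A hA h).trans (mul_le_mul_of_nonneg_right ?_ hA)
    linarith [m1 k hk, hC1 k]

lemma integral_mul_sq_le {X Y : Fld} (hY : Continuous Y) (hs : Supp M Y) {a b : ℝ} (ht : 0 ≤ t) (hXa
    : ∀ x, |X (stp t x)| ≤ a) (hYb : ∫ x, Y (stp t x) ^ 2 ≤ b ^ 2) : ∫ x, (X (stp t x) * Y (stp t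
    x)) ^ 2 ≤ (a * b) ^ 2 := by
  calc _ ≤ ∫ x, a ^ 2 * Y (stp t x) ^ 2 :=
        integral_mono_of_nonneg (.of_forall fun x => sq_nonneg _)
          ((hs.integrable_sq hY ht).const_mul _) (.of_forall fun x => by
            simp only [mul_pow]
            exact mul_le_mul_of_nonneg_right (sq_le_sq.2 ((hXa x).trans (le_abs_self a)))
              (sq_nonneg _))
    _ ≤ _ := by
        rw [integral_const_mul, mul_pow]
        exact mul_le_mul_of_nonneg_left hYb (sq_nonneg _)

lemma integral_sum_sq_le {f : ℕ → Fld} (hf : ∀ i, Continuous (f i)) (hs : ∀ i, Supp M (f i)) {b : ℝ}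
    (ht : 0 ≤ t) (hb : ∀ i < n, ∫ x, f i (stp t x) ^ 2 ≤ b ^ 2) : ∫ x, (∑ i ∈ range n, f i (stp t
    x)) ^ 2 ≤ (n * b) ^ 2 := by
  have hi : ∀ i ∈ range n, Integrable fun x => f i (stp t x) ^ 2 := fun i _ =>
    (hs i).integrable_sq (hf i) ht
  calc _ ≤ ∫ x, (n : ℝ) * ∑ i ∈ range n, f i (stp t x) ^ 2 :=
        integral_mono_of_nonneg (.of_forall fun x => sq_nonneg _)
          ((integrable_finsetSum _ hi).const_mul _) (.of_forall fun x => by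
            simpa using sq_sum_le_card_mul_sum_sq (s := range n)
              (f := fun i => f i (stp t x)))
    _ = n * ∑ i ∈ range n, ∫ x, f i (stp t x) ^ 2 := by
        rw [integral_const_mul, integral_finsetSum _ hi]
    _ ≤ n * (n * b ^ 2) := by
        refine mul_le_mul_of_nonneg_left ?_ (Nat.cast_nonneg _)
        have := sum_le_card_nsmul (range n) _ _
          (fun i hi => hb i (mem_range.1 hi))
        rwa [nsmul_eq_mul, Finset.card_range] at this
    _ = _ := by ring

/-- The bootstrap bounds at time `t`; `θ` is the growth factor. -/
structure Boot (N : ℕ) (κ θ : ℝ) (φ : Fld) (t : ℝ) : Prop where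
  a0 : AA N φ t ≤ (κ * θ ^ 2) ^ 2
  a1 : AA (N - 1) φ t ≤ (κ * θ) ^ 2
  b0 : BB N φ t ≤ (κ * θ) ^ 2
  b1 : BB (N - 1) φ t ≤ κ ^ 2

lemma le_div_of_ss_mul_le {X : ℝ} (ht : 0 ≤ t) (hp : p 0 = t) (hX : 0 ≤ X) (h : ss p * X ≤ A) : |X|
    ≤ A / (1 + t) := by
  rw [abs_of_nonneg hX, le_div_iff₀ (by linarith)]
  have : 1 + t ≤ ss p := by unfold ss; have := rr_nonneg p; linarith
  nlinarith

lemma exists_boot_mul_bound (N : ℕ) (hN : 7 ≤ N) : ∃ C : ℝ, 0 < C ∧ ∀ (M : ℝ) (φ : Fld), Sm φ → Supp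
    M φ → ∀ t κ θ : ℝ, 0 ≤ t → 0 ≤ κ → 1 ≤ θ → Boot N κ θ φ t → (∀ i j, 1 ≤ i → 1 ≤ j → i + j = N +
    1 → ∫ x, (SS i φ (stp t x) * DD j φ (stp t x)) ^ 2 ≤ (C * κ ^ 2 * θ ^ 2 / (1 + t)) ^ 2) ∧ (∀ i
    j, 1 ≤ i → 1 ≤ j → i + j = N → ∫ x, (SS i φ (stp t x) * DD j φ (stp t x)) ^ 2 ≤ (C * κ ^ 2 * θ /
      (1 + t)) ^ 2) ∧ (∀ i j, 1 ≤ i → 1 ≤ j → i + j = N + 1 → ∫ x, (DD i φ (stp t x) * DD j φ (stp t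
      x)) ^ 2 ≤ (C * κ ^ 2 * θ / (1 + t)) ^ 2) ∧ (∀ x, ss (stp t x) * DD 1 φ (stp t x) ≤ C * κ)
    := by
  obtain ⟨C, hC, h⟩ := ks_all N
  obtain ⟨c, hc⟩ : ∃ c : ℝ, c = ((wds N).card : ℕ) := ⟨_, rfl⟩
  have hc0 : 0 ≤ c := by rw [hc]; positivity
  have hcm : ∀ k ≤ N, ((wds k).card : ℝ) ≤ c := fun k hk => by
    rw [hc]; exact_mod_cast card_le_card (wds_mono hk)
  refine ⟨C * (4 * c + 1) + C, by positivity, fun M φ hf hs t κ θ ht hκ hθ hb => ?_⟩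
  have ht1 : 0 < 1 + t := by linarith
  -- `L²` bounds
  have iS : ∀ k ≤ N, ∀ A : ℝ, 0 ≤ A → AA k φ t ≤ A ^ 2 →
      ∫ x, SS k φ (stp t x) ^ 2 ≤ ((4 * c + 1) * A) ^ 2 := fun k hk A hA hA' => by
    refine (integral_SS_sq_le hf hs ht k).trans ((mul_le_mul (hcm k hk) hA' (AA_nonneg _ _ _)
      hc0).trans ?_)
    nlinarith [mul_nonneg hc0 (sq_nonneg A), mul_nonneg (sq_nonneg c) (sq_nonneg A), sq_nonneg A]
  have iD : ∀ k ≤ N, ∀ A : ℝ, 0 ≤ A → BB k φ t ≤ A ^ 2 →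
      ∫ x, DD k φ (stp t x) ^ 2 ≤ ((4 * c + 1) * A) ^ 2 := fun k hk A hA hA' => by
    refine (integral_DD_sq_le hf hs ht k).trans ((mul_le_mul (mul_le_mul_of_nonneg_left (hcm k hk)
      (by norm_num)) hA' (BB_nonneg _ _ _) (by positivity)).trans ?_)
    nlinarith [mul_nonneg hc0 (sq_nonneg A), mul_nonneg (sq_nonneg c) (sq_nonneg A), sq_nonneg A]
  -- pointwise bounds
  have pS : ∀ k ≤ N, ∀ A : ℝ, 0 ≤ A → AA (k + 3) φ t ≤ A ^ 2 → ∀ x,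
      |SS k φ (stp t x)| ≤ C * A / (1 + t) := fun k hk A hA hA' x =>
    le_div_of_ss_mul_le ht rfl (SS_nonneg _ _ _) ((h k hk M φ hf hs (stp t x) ht A hA).1 hA')
  have pD : ∀ k ≤ N, ∀ A : ℝ, 0 ≤ A → BB (k + 3) φ t ≤ A ^ 2 → ∀ x,
      |DD k φ (stp t x)| ≤ C * A / (1 + t) := fun k hk A hA hA' x =>
    le_div_of_ss_mul_le ht rfl (DD_nonneg _ _ _) ((h k hk M φ hf hs (stp t x) ht A hA).2 hA')
  have hθ0 : 0 ≤ θ := by linarith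
  have k0 : 0 ≤ κ * θ := by positivity
  have k2 : 0 ≤ κ * θ ^ 2 := by positivity
  have pD1 := fun k (hk : k + 3 ≤ N - 1) =>
    pD k (by omega) κ hκ ((BB_mono hk φ t).trans hb.b1)
  have iD0 := fun k (hk : k ≤ N) => iD k hk _ k0 ((BB_mono hk φ t).trans hb.b0)
  have iD1 := fun k (hk : k ≤ N - 1) =>
    iD k (by omega) κ hκ ((BB_mono hk φ t).trans hb.b1)
  have fin : ∀ {X Y : Fld} {A B E : ℝ}, Continuous Y → Supp M Y → 0 ≤ A → 0 ≤ B → A * B = E →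
      (∀ x, |X (stp t x)| ≤ C * A / (1 + t)) → ∫ x, Y (stp t x) ^ 2 ≤ ((4 * c + 1) * B) ^ 2 →
      ∫ x, (X (stp t x) * Y (stp t x)) ^ 2 ≤ ((C * (4 * c + 1) + C) * E / (1 + t)) ^ 2 := by
    intro X Y A B E hY hs hA hB hE h1 h2
    refine (integral_mul_sq_le hY hs ht h1 h2).trans (pow_le_pow_left₀ (by positivity) ?_ 2)
    rw [div_mul_eq_mul_div, ← hE]
    refine div_le_div_of_nonneg_right ?_ ht1.le
    linarith [show 0 ≤ C * (A * B) by positivity]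
  refine ⟨fun i j hi hj hij => ?_, fun i j hi hj hij => ?_, fun i j hi hj hij => ?_, fun x => ?_⟩
  · rw [mul_assoc (C * (4 * c + 1) + C)]
    by_cases h1 : j + 3 ≤ N - 1
    · simp only [mul_comm (SS i φ _)]
      exact fin (continuous_SS hf i) (hs.ss hf i) hκ k2 (by ring) (pD1 j h1)
        (iS i (by omega) _ k2 ((AA_mono (by omega) _ _).trans hb.a0))
    by_cases h2 : j = N
    · exact fin (continuous_DD hf j) (hs.dd hf j) k0 k0 (by ring)
        (pS i (by omega) _ k0 ((AA_mono (by omega) _ _).trans hb.a1)) (iD0 j (by omega))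
    · exact fin (continuous_DD hf j) (hs.dd hf j) k2 hκ (by ring)
        (pS i (by omega) _ k2 ((AA_mono (by omega) _ _).trans hb.a0)) (iD1 j (by omega))
  · rw [mul_assoc (C * (4 * c + 1) + C)]
    by_cases h1 : j + 3 ≤ N - 1
    · simp only [mul_comm (SS i φ _)]
      exact fin (continuous_SS hf i) (hs.ss hf i) hκ k0 (by ring) (pD1 j h1)
        (iS i (by omega) _ k0 ((AA_mono (by omega) _ _).trans hb.a1))
    · exact fin (continuous_DD hf j) (hs.dd hf j) k0 hκ (by ring)
        (pS i (by omega) _ k0 ((AA_mono (by omega) _ _).trans hb.a1)) (iD1 j (by omega))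
  · rw [mul_assoc (C * (4 * c + 1) + C)]
    by_cases h1 : i + 3 ≤ N - 1
    · exact fin (continuous_DD hf j) (hs.dd hf j) hκ k0 (by ring) (pD1 i h1) (iD0 j (by omega))
    by_cases h2 : j + 3 ≤ N - 1
    · simp only [mul_comm (DD i φ _)]
      exact fin (continuous_DD hf i) (hs.dd hf i) hκ k0 (by ring) (pD1 j h2) (iD0 i (by omega))
    · exact fin (continuous_DD hf j) (hs.dd hf j) k0 hκ (by ring)
        (pD i (by omega) _ k0 ((BB_mono (by omega) _ _).trans hb.b0)) (iD1 j (by omega))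
  · refine ((h 1 (by omega) M φ hf hs (stp t x) ht κ hκ).2 ((BB_mono (by omega) _ _).trans
      hb.b1)).trans (mul_le_mul_of_nonneg_right ?_ hκ)
    nlinarith [mul_nonneg hC.le hc0]

/-- Source bounds under the bootstrap assumptions. -/
lemma boot_sources (hF : NullForm3 F) (hG : NullForm2 G) (N : ℕ) (hN : 7 ≤ N) : ∃ C : ℝ, 0 < C ∧ ∀
    (M : ℝ) (φ : Fld), Sol F G φ → Supp M φ → ∀ t κ θ : ℝ, 0 ≤ t → 0 ≤ κ → 1 ≤ θ → Boot N κ θ φ t →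
    (∀ J : List ZI, J.length ≤ N - 1 → ∫ x, (ss (stp t x) * box (gam J φ) (stp t x)) ^ 2 ≤ (C * κ ^
      2 * θ ^ 2 / (1 + t)) ^ 2) ∧ (∀ J : List ZI, J.length ≤ N - 2 → ∫ x, (ss (stp t x) * box (gam J
    φ) (stp t x)) ^ 2 ≤ (C * κ ^ 2 * θ / (1 + t)) ^ 2) ∧ (∀ J : List ZI, J.length ≤ N → ∫ x, (box
    (gam J φ) (stp t x) + nf3 F φ (gam J φ) (stp t x)) ^ 2 ≤ (C * κ ^ 2 * θ / (1 + t)) ^ 2) ∧ (∀ x :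
    Sp, ss (stp t x) * DD 1 φ (stp t x) ≤ C * κ) := by
  obtain ⟨C, hC, h⟩ := exists_boot_mul_bound N hN
  choose! D1 hD1 s1 using fun J (hJ : J ∈ wds (N - 1)) => src_null hF hG (mem_wds.1 hJ)
  choose! D2 hD2 s2 using fun J (hJ : J ∈ wds (N - 2)) => src_null hF hG (mem_wds.1 hJ)
  choose! D3 hD3 s3 using fun J (hJ : J ∈ wds N) =>
    src_top hF hG (show 1 ≤ N by omega) (mem_wds.1 hJ)
  set E : ℝ := (∑ J ∈ wds (N - 1), D1 J) + (∑ J ∈ wds (N - 2), D2 J) + ∑ J ∈ wds N, D3 J with hE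
  have p1 : 0 ≤ ∑ J ∈ wds (N - 1), D1 J := sum_nonneg hD1
  have p2 : 0 ≤ ∑ J ∈ wds (N - 2), D2 J := sum_nonneg hD2
  have p3 : 0 ≤ ∑ J ∈ wds N, D3 J := sum_nonneg hD3
  refine ⟨E * N * C + C, by positivity, fun M φ hφ hs t κ θ ht hκ hθ hb => ?_⟩
  have hf : Sm φ := hφ.1
  obtain ⟨b1, b2, b3, b4⟩ := h M φ hf hs t κ θ ht hκ hθ hb
  have ht1 : 0 < 1 + t := by linarith
  have hθ0 : 0 ≤ θ := by linarith
  have fin : ∀ (n : ℕ) (v : Sp → ℝ) (f : ℕ → Fld) (D B : ℝ), n ≤ N → 0 ≤ D → D ≤ E →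
      0 ≤ B → (∀ i, Continuous (f i)) → (∀ i, Supp M (f i)) →
      (∀ i < n, ∫ x, f i (stp t x) ^ 2 ≤ (C * B) ^ 2) →
      (∀ x, |v x| ≤ D * ∑ i ∈ range n, f i (stp t x)) →
      ∫ x, v x ^ 2 ≤ ((E * N * C + C) * B) ^ 2 := by
    intro n v f D B hn hD hDE hB hc hsu hb hv
    have e1 := integral_sum_sq_le hc hsu ht hb
    have hi : Integrable fun x => (∑ i ∈ range n, f i (stp t x)) ^ 2 := by
      have h1 : Supp M (fun p => ∑ i ∈ range n, f i p) := fun p h0 h1 =>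
        sum_eq_zero fun i _ => hsu i p h0 h1
      exact h1.integrable_sq (continuous_finsetSum _ fun i _ => hc i) ht
    calc ∫ x, v x ^ 2 ≤ ∫ x, D ^ 2 * (∑ i ∈ range n, f i (stp t x)) ^ 2 :=
          integral_mono_of_nonneg (.of_forall fun x => sq_nonneg _)
            (hi.const_mul _) (.of_forall fun x => by
              have := pow_le_pow_left₀ (abs_nonneg _) (hv x) 2
              rwa [sq_abs, mul_pow] at this)
      _ ≤ D ^ 2 * (n * (C * B)) ^ 2 := by
          rw [integral_const_mul]
          exact mul_le_mul_of_nonneg_left e1 (sq_nonneg _)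
      _ = (D * n * (C * B)) ^ 2 := by ring
      _ ≤ (E * N * (C * B) + C * B) ^ 2 := by
          gcongr
          exact le_add_of_le_of_nonneg (by gcongr) (by positivity)
      _ = _ := by ring
  refine ⟨fun J hJ => ?_, fun J hJ => ?_, fun J hJ => ?_, fun x => (b4 x).trans ?_⟩
  · have hm := mem_wds.2 hJ
    rw [mul_assoc (E * N * C + C), mul_div_assoc]
    refine fin (N - 1 + 1) _ (fun i p => SS (i + 1) φ p * DD (N - 1 + 1 - i) φ p) (D1 J) _ (by omega)
      (hD1 J hm) ?_ (by positivity) (fun i => (continuous_SS hf _).mul (continuous_DD hf _))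
      (fun i => (hs.dd hf _).mul_left) (fun i hi => ?_) (fun x => ?_)
    · have := single_le_sum (f := D1) hD1 hm
      linarith
    · rw [← mul_div_assoc, ← mul_assoc]
      exact b1 _ _ (by omega) (by omega) (by omega)
    · rw [abs_mul, abs_of_pos (ss_pos (show 0 ≤ (stp t x) 0 from ht))]
      exact s1 J hm φ hφ _ ht
  · have hm := mem_wds.2 hJ
    rw [mul_assoc (E * N * C + C), mul_div_assoc]
    refine fin (N - 2 + 1) _ (fun i p => SS (i + 1) φ p * DD (N - 2 + 1 - i) φ p) (D2 J) _ (by omega)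
      (hD2 J hm) ?_ (by positivity) (fun i => (continuous_SS hf _).mul (continuous_DD hf _))
      (fun i => (hs.dd hf _).mul_left) (fun i hi => ?_) (fun x => ?_)
    · have := single_le_sum (f := D2) hD2 hm
      linarith
    · rw [← mul_div_assoc, ← mul_assoc]
      exact b2 _ _ (by omega) (by omega) (by omega)
    · rw [abs_mul, abs_of_pos (ss_pos (show 0 ≤ (stp t x) 0 from ht))]
      exact s2 J hm φ hφ _ ht
  · have hm := mem_wds.2 hJ
    rw [mul_assoc (E * N * C + C), mul_div_assoc]
    refine fin N _ (fun i p => DD (i + 1) φ p * DD (N - i) φ p) (D3 J) _ le_rfl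
      (hD3 J hm) ?_ (by positivity) (fun i => (continuous_DD hf _).mul (continuous_DD hf _))
      (fun i => (hs.dd hf _).mul_left) (fun i hi => ?_) (fun x => ?_)
    · have := single_le_sum (f := D3) hD3 hm
      linarith
    · rw [← mul_div_assoc, ← mul_assoc]
      exact b3 _ _ (by omega) (by omega) (by omega)
    · exact s3 J hm φ hφ _ ht
  · refine mul_le_mul_of_nonneg_right ?_ hκ
    have : 0 ≤ E * N * C := by positivity
    linarith

/-- The energy identity for `□v + H^{bc}∂_b∂_c v` with symmetric `H`. -/
lemma quasi_identity (hv : Sm v) {H : Fin 4 → Fin 4 → Fld} (hH : ∀ b c, Sm (H b c)) (hsym : ∀ b c, H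
    b c = H c b) (p : Pt) : pd 0 (fun p => 1 / 2 * flatE v p - (∑ c, H 0 c p * (pd 0 v p * pd c v
    p)) + 1 / 2 * ∑ b, ∑ c, H b c p * (pd b v p * pd c v p)) p + ∑ i : Fin 3, pd (sidx i) (fun p =>
      -(pd 0 v p * pd (sidx i) v p) - ∑ c, H (sidx i) c p * (pd 0 v p * pd c v p)) p = -pd 0 v p *
    (box v p + ∑ b, ∑ c, H b c p * pd b (pd c v) p) - (∑ b, ∑ c, pd b (H b c) p * (pd 0 v p * pd c v
      p)) + 1 / 2 * ∑ b, ∑ c, pd 0 (H b c) p * (pd b v p * pd c v p) := by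
  simp only [Fin.sum_univ_three, Fin.sum_univ_four, sidx_zero, sidx_one, sidx_two, flatE, box]
  simp (disch := fun_prop) only [pd_add, pd_sub, pd_mul, pd_sq, pd_neg, pd_const]
  rw [hsym 1 0, hsym 2 0, hsym 3 0, hsym 2 1, hsym 3 1, hsym 3 2, pd_comm hv 1 0, pd_comm hv 2 0,
    pd_comm hv 3 0, pd_comm hv 2 1, pd_comm hv 3 1, pd_comm hv 3 2]
  ring

lemma abs_pd_mul_pd_le (v : Fld) (p : Pt) (b c : Fin 4) : |pd b v p * pd c v p| ≤ flatE v p := by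
  have h1 := pd_sq_le_flatE v p b
  have h2 := pd_sq_le_flatE v p c
  rw [abs_le]
  constructor <;> nlinarith [sq_nonneg (pd b v p + pd c v p), sq_nonneg (pd b v p - pd c v p)]

lemma abs_sum_mul_le_flatE {ι : Type*} (s : Finset ι) {h : ι → ℝ} {b c : ι → Fin 4} {q : ℝ} (v :
    Fld) (p : Pt) (hh : ∀ i ∈ s, |h i| ≤ q) (hq : 0 ≤ q) : |∑ i ∈ s, h i * (pd (b i) v p * pd (c i)
    v p)| ≤ s.card * (q * flatE v p) := by
  refine (abs_sum_le_sum_abs _ _).trans ?_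
  rw [← nsmul_eq_mul]
  refine sum_le_card_nsmul _ _ _ fun i hi => ?_
  rw [abs_mul]
  exact mul_le_mul (hh i hi) (abs_pd_mul_pd_le _ _ _ _) (abs_nonneg _) hq

lemma quasi_energy (hv : Sm v) (hs : Supp M v) {H : Fin 4 → Fin 4 → Fld} (hH : ∀ b c, Sm (H b c))
    (hsym : ∀ b c, H b c = H c b) {Q : Fld} (hQc : Continuous Q) (hQ : ∀ a b c p, 0 ≤ p 0 → |pd a (H
    b c) p| ≤ Q p) {α k l : ℝ} (hα : 0 < α) (hβ : 0 < β) (hr : r ≠ 0) (hkl : k + l + 1 = r) (hT : 0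
    ≤ T) (h0 : ∀ b c x, |H b c (stp 0 x)| ≤ 1 / 80) (h1 : ∀ b c x, |H b c (stp T x)| ≤ 1 / 80) (hXb
    : ∀ t, 0 ≤ t → t ≤ T → ∫ x, flatE v (stp t x) ≤ α ^ 2 * (1 + t) ^ (2 * k)) (hYb : ∀ t, 0 ≤ t → t
    ≤ T → ∫ x, ((box v (stp t x) + ∑ b, ∑ c, H b c (stp t x) * pd b (pd c v) (stp t x)) ^ 2 + 576 *
      Q (stp t x) ^ 2 * flatE v (stp t x)) ≤ β ^ 2 * (1 + t) ^ (2 * l)) : ∫ x, flatE v (stp T x) ≤ 3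
    * (∫ x, flatE v (stp 0 x)) + 12 * α * β * (((1 + T) ^ r - 1) / r) := by
  have key : ∀ p, (∀ b c, |H b c p| ≤ 1 / 80) →
      |-(∑ c, H 0 c p * (pd 0 v p * pd c v p))
        + 1 / 2 * ∑ b, ∑ c, H b c p * (pd b v p * pd c v p)| ≤ 1 / 4 * flatE v p := by
    intro p hp
    have e1 := abs_sum_mul_le_flatE univ (h := fun c => H 0 c p) (b := fun _ => 0)
      (c := fun c => c) v p (fun c _ => hp 0 c) (by norm_num)
    have e2 := abs_sum_mul_le_flatE univ (h := fun i : Fin 4 × Fin 4 => H i.1 i.2 p)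
      (b := fun i => i.1) (c := fun i => i.2) v p (fun i _ => hp i.1 i.2) (by norm_num)
    rw [Fintype.sum_prod_type] at e2
    simp only [card_univ, Fintype.card_prod, Fintype.card_fin] at e1 e2
    norm_num at e1 e2
    rw [abs_le] at *
    constructor <;> linarith [flatE_nonneg v p]
  have hS : ∀ b c, Supp M fun p => pd b v p * pd c v p := fun b c => (hs.pder hv c).mul_left
  have := energy_le_rpow (M := M) (X := flatE v) (Y := fun p => (box v p + ∑ b, ∑ c, H b c p * pd b (pd c v) p) ^ 2 + 576 * Q p ^
      2 * flatE v p)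
    ?_ ?_ ?_ ?_ (fun p _ => quasi_identity hv hH hsym p) ?_ ?_ hv.flatE.continuous
    (hs.flatE hv) ?_ ?_ ?_ hα hβ hr hkl le_rfl hT hXb hYb
  · rw [add_zero, Real.one_rpow] at this
    have i1 : ∀ t, 0 ≤ t → Integrable fun x => flatE v (stp t x) := fun t ht =>
      (hs.flatE hv).integrable hv.flatE.continuous ht
    have l1 : 1 / 4 * ∫ x, flatE v (stp T x) ≤ ∫ x, (1 / 2 * flatE v (stp T x) - (∑ c, H 0 c (stp T
        x) * (pd 0 v (stp T x) * pd c v (stp T x))) + 1 / 2 * ∑ b, ∑ c, H b c (stp T x) * (pd b v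
        (stp T x) * pd c v (stp T x))) := by
      rw [← integral_const_mul]
      refine integral_mono ((i1 T hT).const_mul _) ?_ fun x => ?_
      · refine Supp.integrable (M := M) (f := fun p => 1 / 2 * flatE v p - (∑ c, H 0 c p * (pd 0 v p
          * pd c v p)) + 1 / 2 * ∑ b, ∑ c, H b c p * (pd b v p * pd c v p)) ?_ ?_ hT
        · have := hv.flatE.continuous
          have : ∀ b c, Continuous (H b c) := fun b c => (hH b c).continuous
          have : ∀ b, Continuous (pd b v) := fun b => (hv.pd b).continuous
          fun_prop
        · intro p h0 hp
          simp [hs.flatE hv p h0 hp, hs.pder hv _ p h0 hp]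
      · have := (abs_le.1 (key (stp T x) fun b c => h1 b c x)).1
        dsimp only; linarith
    have l2 : ∫ x, (1 / 2 * flatE v (stp 0 x) - (∑ c, H 0 c (stp 0 x) * (pd 0 v (stp 0 x) * pd c v
        (stp 0 x))) + 1 / 2 * ∑ b, ∑ c, H b c (stp 0 x) * (pd b v (stp 0 x) * pd c v (stp 0 x)))
        ≤ 3 / 4 * ∫ x, flatE v (stp 0 x) := by
      rw [← integral_const_mul]
      refine integral_mono_of_nonneg (ae_of_all _ fun x => ?_) ((i1 0 le_rfl).const_mul _)
        (ae_of_all _ fun x => ?_)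
      · have := (abs_le.1 (key (stp 0 x) fun b c => h0 b c x)).1
        have := flatE_nonneg v (stp 0 x)
        dsimp only [Pi.zero_apply]; linarith
      · have := (abs_le.1 (key (stp 0 x) fun b c => h0 b c x)).2
        dsimp only; linarith
    linarith
  · fun_prop
  · intro i; fun_prop
  · intro p h0 hp
    simp [hs.flatE hv p h0 hp, hs.pder hv _ p h0 hp]
  · intro i p h0 hp
    simp [hs.pder hv _ p h0 hp]
  · fun_prop
  · intro p h0 hp
    simp [hs.pder hv _ p h0 hp]
  · have h2 : Continuous (fun p => box v p + ∑ b, ∑ c, H b c p * pd b (pd c v) p) := by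
      refine ContDiff.continuous (𝕜 := ℝ) (n := (⊤ : ℕ∞)) ?_
      fun_prop
    exact (h2.pow 2).add ((continuous_const.mul (hQc.pow 2)).mul hv.flatE.continuous)
  · intro p h0 hp
    simp [hs.flatE hv p h0 hp, hs.box hv p h0 hp, (hs.pder hv _).pder (hv.pd _) _ p h0 hp]
  · intro c hc p hp
    have hQ0 : 0 ≤ Q p := (abs_nonneg _).trans (hQ 0 0 0 p hp)
    have e1 := abs_sum_mul_le_flatE univ
      (h := fun i : Fin 4 × Fin 4 => pd i.1 (H i.1 i.2) p) (b := fun _ => 0)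
      (c := fun i => i.2) v p (fun i _ => hQ _ _ _ p hp) hQ0
    have e2 := abs_sum_mul_le_flatE univ
      (h := fun i : Fin 4 × Fin 4 => pd 0 (H i.1 i.2) p) (b := fun i => i.1)
      (c := fun i => i.2) v p (fun i _ => hQ _ _ _ p hp) hQ0
    rw [Fintype.sum_prod_type] at e1 e2
    simp only [card_univ, Fintype.card_prod, Fintype.card_fin] at e1 e2
    norm_num at e1 e2
    generalize box v p + ∑ b, ∑ c, H b c p * pd b (pd c v) p = f
    have h3 := mul_le_weighted (c / 2) (-pd 0 v p) f (by positivity)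
    have h4 := mul_le_weighted (c / 2) 1 (24 * Q p) (by positivity)
    have h5 := mul_le_mul_of_nonneg_right h4 (flatE_nonneg v p)
    have h6 := mul_le_mul_of_nonneg_left (pd_sq_le_flatE v p 0) hc.le
    have h7 : (c / 2)⁻¹ = 2 * c⁻¹ := by field_simp
    rw [h7] at h3 h5
    have := (abs_le.1 e1).1
    have := (abs_le.1 e2).2
    nlinarith

/-- The symmetrized coefficients `½ ∑_a (F^{abc} + F^{acb}) ∂_aφ`. -/
def symH (F : Ten3) (φ : Fld) (b c : Fin 4) : Fld := fun p =>
  ∑ a, (F a b c + F a c b) / 2 * pd a φ p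

@[fun_prop]
lemma ContDiff.symH (h : Sm φ) (F : Ten3) (b c : Fin 4) : Sm (symH F φ b c) := by
  unfold _root_.symH; fun_prop

lemma sum_symH (hv : Sm v) (F : Ten3) (φ : Fld) (p : Pt) : ∑ b, ∑ c, symH F φ b c p * pd b (pd c v)
    p = nf3 F φ v p := by
  simp only [symH, nf3, Fin.sum_univ_four]
  rw [pd_comm hv 1 0, pd_comm hv 2 0, pd_comm hv 3 0, pd_comm hv 2 1, pd_comm hv 3 1, pd_comm hv 3
    2]
  ring

lemma exists_symH_bound (F : Ten3) : ∃ C : ℝ, 0 < C ∧ ∀ φ : Fld, Sm φ → ∀ b c p, |symH F φ b c p| ≤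
    C * D1 φ p ∧ ∀ a, |pd a (symH F φ b c) p| ≤ C * DD 1 φ p := by
  refine ⟨1 + ∑ b, ∑ c, ∑ a, |(F a b c + F a c b) / 2|, by positivity, fun φ hφ b c p => ?_⟩
  have hC : ∀ g : Fin 4 → ℝ, ∀ X : ℝ, (∀ a, |g a| ≤ X) →
      |∑ a, (F a b c + F a c b) / 2 * g a|
        ≤ (1 + ∑ b, ∑ c, ∑ a, |(F a b c + F a c b) / 2|) * X := by
    intro g X hg
    have hX : 0 ≤ X := (abs_nonneg _).trans (hg 0)
    refine (abs_sum_le_sum_abs _ _).trans ?_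
    refine (sum_le_sum fun a _ => (abs_mul _ _).trans_le
      (mul_le_mul_of_nonneg_left (hg a) (abs_nonneg _))).trans ?_
    rw [← sum_mul]
    refine mul_le_mul_of_nonneg_right ?_ hX
    have h1 := single_le_sum (f := fun c => ∑ a, |(F a b c + F a c b) / 2|)
      (fun _ _ => by positivity) (mem_univ c)
    have h2 := single_le_sum (f := fun b => ∑ c, ∑ a, |(F a b c + F a c b) / 2|)
      (fun _ _ => by positivity) (mem_univ b)
    linarith
  refine ⟨hC _ _ fun a => abs_pd_le_D1 _ _ _, fun d => ?_⟩
  have : pd d (symH F φ b c) = fun p => ∑ a, (F a b c + F a c b) / 2 * pd d (pd a φ) p := by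
    unfold symH
    rw [pd_sum _ (fun a => by fun_prop)]
    funext p
    exact sum_congr rfl fun a _ => by rw [pd_const_mul (hφ.pd a)]
  rw [this]
  exact hC _ _ fun a => (abs_pd_le_D1 _ _ _).trans (D1_pd_gam_le (J := []) le_rfl φ p a)

lemma top_energy (F : Ten3) : ∃ C : ℝ, 0 < C ∧ ∀ (M : ℝ) (φ v : Fld), Sm φ → Sm v → Supp M v → ∀ α β
    k l r : ℝ, 0 < α → 0 < β → r ≠ 0 → k + l + 1 = r → ∀ T, 0 ≤ T → (∀ x, C * D1 φ (stp 0 x) ≤ 1) →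
    (∀ x, C * D1 φ (stp T x) ≤ 1) → (∀ t, 0 ≤ t → t ≤ T → ∫ x, flatE v (stp t x) ≤ α ^ 2 * (1 + t) ^
    (2 * k)) → (∀ t, 0 ≤ t → t ≤ T → ∫ x, ((box v (stp t x) + nf3 F φ v (stp t x)) ^ 2 + C * DD 1 φ
      (stp t x) ^ 2 * flatE v (stp t x)) ≤ β ^ 2 * (1 + t) ^ (2 * l)) → ∫ x, flatE v (stp T x) ≤ 3 *
    (∫ x, flatE v (stp 0 x)) + 12 * α * β * (((1 + T) ^ r - 1) / r) := by
  obtain ⟨C, hC, h⟩ := exists_symH_bound F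
  refine ⟨80 * C + 576 * C ^ 2, by positivity, fun M φ v hφ hv hs α β k l r hα hβ hr hkl T hT h0 h1
    hX hY => ?_⟩
  have hle : ∀ p, (80 * C + 576 * C ^ 2) * D1 φ p ≤ 1 → ∀ b c, |symH F φ b c p| ≤ 1 / 80 := by
    intro p hp b c
    have := (h φ hφ b c p).1
    have := mul_nonneg (sq_nonneg C) (D1_nonneg φ p)
    linarith
  refine quasi_energy hv hs (H := symH F φ) (fun b c => hφ.symH F b c)
    (fun b c => by funext p; simp only [symH, add_comm]) (Q := fun p => C * DD 1 φ p)
    ((continuous_DD hφ 1).const_mul _ ) (fun a b c p _ => (h φ hφ b c p).2 a) hα hβ hr hkl hT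
    (fun b c x => hle _ (h0 x) b c) (fun b c x => hle _ (h1 x) b c) hX fun t ht htT => ?_
  refine le_trans (integral_mono_of_nonneg (ae_of_all _ fun x => ?_) ?_ (ae_of_all _ fun x => ?_))
    (hY t ht htT)
  · have := flatE_nonneg v (stp t x)
    dsimp only [Pi.zero_apply]; positivity
  · refine Supp.integrable (M := M) (f := fun p => (box v p + nf3 F φ v p) ^ 2 + (80 * C + 576 * C ^
      2) * DD 1 φ p ^ 2 * flatE v p) ?_ ?_ ht
    · have := hv.flatE.continuous
      have := continuous_DD hφ 1
      have : Continuous (box v) := ContDiff.continuous (𝕜 := ℝ) (n := (⊤ : ℕ∞)) (by fun_prop)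
      have := (hφ.nf3 F hv).continuous
      fun_prop
    · intro p h0 hp
      simp [hs.flatE hv p h0 hp, hs.box hv p h0 hp, nf3, (hs.pder hv _).pder (hv.pd _) _ p h0 hp]
  · dsimp only
    rw [sum_symH hv]
    have := mul_nonneg (mul_nonneg hC.le (sq_nonneg (DD 1 φ (stp t x))))
      (flatE_nonneg v (stp t x))
    nlinarith

lemma confE_le_SS (v : Fld) (p : Pt) : confE v p ≤ 20 * SS 1 v p ^ 2 := by
  have z : ∀ Z, |zap Z v p| ≤ SS 1 v p := fun Z => (abs_zap_le_G1 v p Z).trans (G1_le_SS v p)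
  have z2 : ∀ {w}, |w| ≤ SS 1 v p → w ^ 2 ≤ SS 1 v p ^ 2 := fun {w} h => sq_le_sq' (abs_le.1 h).1
    (abs_le.1 h).2
  have t : ∀ a, pd a v p ^ 2 ≤ SS 1 v p ^ 2 := fun a => by
    have := z (Sum.inl a); rw [zap_tr] at this; exact z2 this
  have l : ∀ a b, (m4 a * p a * pd b v p - m4 b * p b * pd a v p) ^ 2 ≤ SS 1 v p ^ 2 :=
    fun a b => by have := z (Sum.inr (Sum.inl (a, b))); rw [zap_lor] at this; exact z2 this
  have s := z (Sum.inr (Sum.inr ()))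
  have s0 := abs_gam_le_SS (J := []) (Nat.zero_le 1) v p
  rw [zap_sc] at s
  have e : scal2 v p = ∑ a, p a * pd a v p + 2 * v p := by simp [Fin.sum_univ_four, scal2]
  have s1 : scal2 v p ^ 2 ≤ 9 * SS 1 v p ^ 2 := by
    rw [e]
    simp only [gam] at s0
    rw [abs_le] at s s0
    nlinarith
  have l1 := l 0 1
  have l2 := l 0 2
  have l3 := l 0 3
  have l4 := l 1 2
  have l5 := l 1 3
  have l6 := l 2 3
  simp [m4] at l1 l2 l3 l4 l5 l6
  unfold confE
  nlinarith [t 0, t 1, t 2, t 3, sq_nonneg (SS 1 v p)]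

lemma exists_conf_bound (N : ℕ) : ∃ c : ℝ, 1 ≤ c ∧ ∀ (M : ℝ) (φ : Fld), Sm φ → Supp M φ → ∀ t, 0 ≤ t
    → ∀ k ≤ N, ∀ J : List ZI, J.length + 1 ≤ k → ∫ x, confE (gam J φ) (stp t x) ≤ c * AA k φ t := by
  refine ⟨1 + 20 * (wds N).card, by linarith [Nat.cast_nonneg (α := ℝ) (wds N).card],
    fun M φ hf hs t ht k hk J hJ => ?_⟩
  have h := integral_SS_sq_le hf hs ht k
  have hc : ((wds k).card : ℝ) ≤ (wds N).card := by exact_mod_cast card_le_card (wds_mono hk)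
  have hA := AA_nonneg k φ t
  calc _ ≤ ∫ x, 20 * SS k φ (stp t x) ^ 2 := by
        refine integral_mono_of_nonneg (ae_of_all _ fun x => confE_nonneg _ _)
          (((hs.ss hf k).integrable_sq (continuous_SS hf k) ht).const_mul _) (ae_of_all _ fun x => ?_)
        refine (confE_le_SS _ _).trans ?_
        have h1 : SS 1 (gam J φ) (stp t x) ≤ SS k φ (stp t x) :=
          (SS_gam_le 1 J φ _).trans (SS_mono hJ _ _)
        have h2 := pow_le_pow_left₀ (SS_nonneg _ _ _) h1 2
        dsimp only; linarith
    _ ≤ _ := by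
      rw [integral_const_mul]
      nlinarith [mul_le_mul_of_nonneg_right hc hA]

/-- The growth factor of the highest order norms. -/
def th (t : ℝ) : ℝ := (1 + t) ^ (1 / 16 : ℝ)

lemma one_le_th (ht : 0 ≤ t) : 1 ≤ th t := Real.one_le_rpow (by linarith) (by norm_num)

lemma rpow_eq_th (ht : 0 ≤ t) {x : ℝ} (j : ℕ) (i : ℤ) (hx : x = j / 16 + i) : (1 + t) ^ x = th t ^ j
    * (1 + t) ^ i := by
  have h : 0 < 1 + t := by linarith
  rw [hx, Real.rpow_add h, Real.rpow_intCast, th, ← Real.rpow_natCast, ← Real.rpow_mul h.le]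
  congr 2; ring

lemma continuousOn_th (T : ℝ) : ContinuousOn th (Icc 0 T) := by
  intro t ht
  refine ContinuousAt.continuousWithinAt ?_
  unfold th
  exact ContinuousAt.rpow_const (by fun_prop) (Or.inl (by linarith [ht.1]))

lemma en_zap_le (hv : Sm v) (hs : Supp M v) (Z : ZI) (ht : 0 ≤ t) : en (zap Z v) t ≤ 2 * (∫ x, confE
    v (stp t x)) + 8 * en v t := by
  have i1 : Integrable fun x => confE v (stp t x) := (hs.confE hv).integrable hv.confE.continuous ht
  have i2 : Integrable fun x => v (stp t x) ^ 2 := hs.integrable_sq hv.continuous ht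
  unfold en
  rw [← integral_const_mul, ← integral_const_mul, ← integral_add (i1.const_mul _) (i2.const_mul _)]
  exact integral_mono ((hs.zap hv Z).integrable_sq (hv.zap Z).continuous ht)
    ((i1.const_mul _).add (i2.const_mul _)) fun x => zap_sq_le_confE v Z _

lemma en_gam_le_of_conf (hf : Sm φ) (hs : Supp M φ) {N : ℕ} (hN : 1 ≤ N) {X θ : ℝ} (ht : 0 ≤ t) (hθ
    : 1 ≤ θ) (hB : 0 ≤ B) (h0 : en φ t ≤ X * θ ^ 2) (hX : 2 * B ≤ X) (h1 : ∀ J : List ZI, J.length ≤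
    N - 2 → ∫ x, confE (gam J φ) (stp t x) ≤ B * θ ^ 2) (h2 : ∀ J : List ZI, J.length ≤ N - 1 → ∫ x,
    confE (gam J φ) (stp t x) ≤ B * θ ^ 4) : AA (N - 1) φ t ≤ (wds N).card * 9 ^ N * X * θ ^ 2 ∧ AA
      N φ t ≤ (wds N).card * 9 ^ N * X * θ ^ 4 := by
  have hX0 : 0 ≤ X := by linarith
  have lo : ∀ J : List ZI, J.length ≤ N - 1 → en (gam J φ) t ≤ 9 ^ J.length * X * θ ^ 2 := by
    intro J
    induction J using List.reverseRecOn with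
    | nil => intro _; simpa [gam] using h0
    | append_singleton J Z ih =>
      intro hJ
      simp only [List.length_append, List.length_singleton] at hJ ⊢
      rw [gam_snoc]
      refine (en_zap_le (hf.gam J) (hs.gam hf J) Z ht).trans ?_
      have a1 := ih (by omega)
      have a2 := h1 J (by omega)
      have a3 : X * θ ^ 2 * 1 ≤ X * θ ^ 2 * 9 ^ J.length :=
        mul_le_mul_of_nonneg_left (one_le_pow₀ (by norm_num)) (by positivity)
      have a4 := mul_le_mul_of_nonneg_right hX (sq_nonneg θ)
      rw [pow_succ]
      nlinarith
  have p9 : ∀ J : List ZI, J.length ≤ N → X * 9 ^ J.length ≤ X * 9 ^ N := fun J hJ =>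
    mul_le_mul_of_nonneg_left (pow_le_pow_right₀ (by norm_num) hJ) hX0
  have t24 : θ ^ 2 ≤ θ ^ 4 := pow_le_pow_right₀ hθ (by norm_num)
  have hi : ∀ J : List ZI, J.length ≤ N → en (gam J φ) t ≤ 9 ^ N * X * θ ^ 4 := by
    intro J hJ
    by_cases hJ' : J.length ≤ N - 1
    · refine (lo J hJ').trans ?_
      have := p9 J hJ
      calc _ ≤ X * 9 ^ J.length * θ ^ 4 := by
            rw [mul_comm X]; exact mul_le_mul_of_nonneg_left t24 (by positivity)
        _ ≤ X * 9 ^ N * θ ^ 4 := mul_le_mul_of_nonneg_right this (by positivity)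
        _ = _ := by ring
    · rcases List.eq_nil_or_concat J with rfl | ⟨K, Z, rfl⟩
      · simp at hJ'
      · rw [List.concat_eq_append, List.length_append, List.length_singleton] at hJ hJ'
        rw [List.concat_eq_append, gam_snoc]
        refine (en_zap_le (hf.gam K) (hs.gam hf K) Z ht).trans ?_
        have a1 := lo K (by omega)
        have a2 := h2 K (by omega)
        have e : N = K.length + 1 := by omega
        have a3 : X * θ ^ 4 * 1 ≤ X * θ ^ 4 * 9 ^ K.length :=
          mul_le_mul_of_nonneg_left (one_le_pow₀ (by norm_num)) (by positivity)
        have a4 := mul_le_mul_of_nonneg_right hX (show 0 ≤ θ ^ 4 by positivity)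
        have a5 := mul_le_mul_of_nonneg_left t24 (show 0 ≤ 9 ^ K.length * X by positivity)
        rw [e, pow_succ]
        nlinarith
  have hcard : ((wds (N - 1)).card : ℝ) ≤ (wds N).card := by
    exact_mod_cast card_le_card (wds_mono (Nat.sub_le _ _))
  constructor
  · have := sum_le_card_nsmul (wds (N - 1)) (fun J => en (gam J φ) t) (9 ^ N * X * θ ^ 2)
      fun J hJ => (lo J (mem_wds.1 hJ)).trans (by
        have := mul_le_mul_of_nonneg_right (p9 J ((mem_wds.1 hJ).trans (Nat.sub_le _ _)))
          (sq_nonneg θ)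
        linarith)
    rw [nsmul_eq_mul] at this
    refine this.trans ?_
    calc _ ≤ ((wds N).card : ℝ) * (9 ^ N * X * θ ^ 2) :=
          mul_le_mul_of_nonneg_right hcard (by positivity)
      _ = _ := by ring
  · have := sum_le_card_nsmul (wds N) (fun J => en (gam J φ) t) (9 ^ N * X * θ ^ 4)
      fun J hJ => hi J (mem_wds.1 hJ)
    rw [nsmul_eq_mul] at this
    exact this.trans (le_of_eq (by ring))

lemma conf_improve (hv : Sm v) (hs : Supp M v) (j : ℕ) (hj : 1 ≤ j) {a κ : ℝ} (ha : 0 ≤ a) (hκ : 0 <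
    κ) (hc : 1 ≤ c) (hC : 0 < C) (hT : 0 ≤ T) (hX : ∀ t, 0 ≤ t → t ≤ T → ∫ x, confE v (stp t x) ≤ c
    * (κ * th t ^ j) ^ 2) (hY : ∀ t, 0 ≤ t → t ≤ T → ∫ x, (ss (stp t x) * box v (stp t x)) ^ 2 ≤ (C
      * κ ^ 2 * th t ^ j / (1 + t)) ^ 2) (h0 : ∫ x, confE v (stp 0 x) ≤ a) : ∫ x, confE v (stp T x)
    ≤ (a + 96 * c * C * κ ^ 3) * th T ^ (2 * j) := by
  have hj0 : (1 : ℝ) ≤ j := by exact_mod_cast hj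
  have h := conf_energy hv hs (α := c * κ) (β := C * κ ^ 2) (k := j / 16) (l := j / 16 - 1)
    (r := j / 8) (by positivity) (by positivity) (by positivity) (by ring) hT
    (fun t ht htT => (hX t ht htT).trans ?_) (fun t ht htT => (hY t ht htT).trans (le_of_eq ?_))
  · have e : (1 + T) ^ ((j : ℝ) / 8) = th T ^ (2 * j) := by
      rw [rpow_eq_th hT (2 * j) 0 (by push_cast; ring)]; simp
    rw [e] at h
    have h1 : 1 ≤ th T ^ (2 * j) := one_le_pow₀ (one_le_th hT)
    have h2 : (th T ^ (2 * j) - 1) / ((j : ℝ) / 8) ≤ 8 * th T ^ (2 * j) := by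
      rw [div_le_iff₀ (by positivity)]
      nlinarith
    have h3 := mul_le_mul_of_nonneg_left h2 (show 0 ≤ 12 * (c * κ) * (C * κ ^ 2) by positivity)
    have h4 := mul_le_mul_of_nonneg_left h1 ha
    nlinarith
  · rw [rpow_eq_th ht (2 * j) 0 (by push_cast; ring)]
    have : 0 ≤ (κ * th t ^ j) ^ 2 := by positivity
    calc c * (κ * th t ^ j) ^ 2 ≤ c * c * (κ * th t ^ j) ^ 2 :=
          mul_le_mul_of_nonneg_right (le_mul_of_one_le_left (by linarith) hc) this
      _ = _ := by simp; ring
  · rw [rpow_eq_th ht (2 * j) (-2) (by push_cast; ring), pow_mul', zpow_neg, div_pow]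
    norm_cast
    field_simp

lemma l2_improve (hv : Sm v) (hs : Supp M v) {a κ : ℝ} (ha : 0 ≤ a) (hκ : 0 < κ) (hβ : 0 < β) (hT :
    0 ≤ T) (hX : ∀ t, 0 ≤ t → t ≤ T → en v t ≤ (κ * th t) ^ 2) (hY : ∀ t, 0 ≤ t → t ≤ T → ∫ x, confE
    v (stp t x) ≤ β ^ 2 * th t ^ 2) (h0 : en v 0 ≤ a) : en v T ≤ (a + 6 * κ * β) * th T ^ 2 := by
  have e : ∀ t, 0 ≤ t → (1 + t) ^ (2 * (1 / 16 : ℝ)) = th t ^ 2 := fun t ht => by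
    rw [rpow_eq_th ht 2 0 (by norm_num)]; simp
  have h := l2_energy hv hs (α := κ) (β := β) (k := 1 / 16) (l := 1 / 16) (r := 9 / 8)
    hκ hβ (by norm_num) (by norm_num) hT
    (fun t ht htT => (hX t ht htT).trans (le_of_eq (by rw [e t ht, mul_pow])))
    (fun t ht htT => by rw [e t ht]; exact hY t ht htT)
  change (1 + T) * en v T ≤ en v 0 + _ at h
  rw [rpow_eq_th hT 2 1 (by norm_num), zpow_one] at h
  have h1 : 1 ≤ th T ^ 2 := one_le_pow₀ (one_le_th hT)
  have h2 : (th T ^ 2 * (1 + T) - 1) / (9 / 8) ≤ th T ^ 2 * (1 + T) := by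
    rw [div_le_iff₀ (by norm_num)]
    nlinarith
  have h3 := mul_le_mul_of_nonneg_left h2 (show 0 ≤ 6 * κ * β by positivity)
  have h4 := mul_le_mul_of_nonneg_left h1 ha
  have h5 := mul_nonneg (mul_nonneg ha (sq_nonneg (th T))) hT
  have : (1 + T) * en v T ≤ (1 + T) * ((a + 6 * κ * β) * th T ^ 2) := by nlinarith
  exact le_of_mul_le_mul_left this (by linarith)

lemma flat_improve (hv : Sm v) (hs : Supp M v) {a κ : ℝ} (hκ : 0 < κ) (hC : 0 < C) (hT : 0 ≤ T) (hX
    : ∀ t, 0 ≤ t → t ≤ T → ∫ x, flatE v (stp t x) ≤ κ ^ 2) (hY : ∀ t, 0 ≤ t → t ≤ T → ∫ x, (ss (stp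
    t x) * box v (stp t x)) ^ 2 ≤ (C * κ ^ 2 * th t ^ 2 / (1 + t)) ^ 2) (h0 : ∫ x, flatE v (stp 0 x)
      ≤ a) : ∫ x, flatE v (stp T x) ≤ a + 12 * C * κ ^ 3 := by
  have h := flat_energy hv hs (α := κ) (β := C * κ ^ 2) (k := 0) (l := -15 / 8) (r := -7 / 8)
    hκ (by positivity) (by norm_num) (by norm_num) le_rfl hT
    (fun t ht htT => (hX t ht htT).trans (by simp)) (fun t ht htT => ?_)
  · rw [add_zero, Real.one_rpow] at h
    have h2 : ((1 + T) ^ (-7 / 8 : ℝ) - 1) / (-7 / 8) ≤ 2 := by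
      rw [div_le_iff_of_neg (by norm_num)]
      have : 0 ≤ (1 + T) ^ (-7 / 8 : ℝ) := by positivity
      linarith
    have h3 := mul_le_mul_of_nonneg_left h2 (show 0 ≤ 6 * κ * (C * κ ^ 2) by positivity)
    linarith
  · have h1 : 0 < 1 + t := by linarith
    have h2 : (1 + t) ^ 2 * ∫ x, box v (stp t x) ^ 2
        ≤ ∫ x, (ss (stp t x) * box v (stp t x)) ^ 2 := by
      rw [← integral_const_mul]
      have hb := hs.box hv
      refine integral_mono ((hb.integrable_sq hv.box.continuous ht).const_mul _)
        (Supp.integrable (M := M) (f := fun p => (ss p * box v p) ^ 2) ?_ ?_ ht) fun x => ?_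
      · have := hv.box.continuous
        have := continuous_rr
        unfold ss
        fun_prop
      · intro p h0 hp
        simp [hb p h0 hp]
      · dsimp only
        rw [mul_pow]
        refine mul_le_mul_of_nonneg_right (pow_le_pow_left₀ h1.le ?_ 2) (sq_nonneg _)
        rw [ss]
        linarith [rr_nonneg (stp t x), show stp t x 0 = t from rfl]
    have h3 := h2.trans (hY t ht htT)
    rw [rpow_eq_th ht 4 (-4) (by norm_num), zpow_neg]
    have e : (1 + t) ^ (4 : ℤ) = (1 + t) ^ 4 := by norm_cast
    rw [e]
    refine le_of_mul_le_mul_left (h3.trans (le_of_eq ?_)) (show 0 < (1 + t) ^ 2 by positivity)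
    field_simp

lemma top_improve (F : Ten3) : ∃ C : ℝ, 0 < C ∧ ∀ (M : ℝ) (φ v : Fld), Sm φ → Sm v → Supp M v → ∀ a
    κ D : ℝ, 0 < κ → 0 < D → ∀ T, 0 ≤ T → C * D * κ ≤ 1 → (∀ t, 0 ≤ t → t ≤ T → ∀ x, ss (stp t x) *
    DD 1 φ (stp t x) ≤ D * κ) → (∀ t, 0 ≤ t → t ≤ T → ∫ x, flatE v (stp t x) ≤ (κ * th t) ^ 2) → (∀
    t, 0 ≤ t → t ≤ T → ∫ x, (box v (stp t x) + nf3 F φ v (stp t x)) ^ 2 ≤ (D * κ ^ 2 * th t / (1 +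
      t)) ^ 2) → ∫ x, flatE v (stp 0 x) ≤ a → 0 ≤ a → ∫ x, flatE v (stp T x) ≤ (3 * a + C * D * κ ^
    3) * th T ^ 2 := by
  obtain ⟨C, hC, h⟩ := top_energy F
  refine ⟨C + 96 * (1 + C), by positivity, fun M φ v hφ hv hs a κ D hκ hD T hT hCD hdd hX hY h0 ha =>
    ?_⟩
  have hss : ∀ t, 0 ≤ t → ∀ x, 1 + t ≤ ss (stp t x) := fun t ht x => by
    rw [ss]; linarith [rr_nonneg (stp t x), show stp t x 0 = t from rfl]
  have hD1 : ∀ t, 0 ≤ t → t ≤ T → ∀ x, C * D1 φ (stp t x) ≤ 1 := by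
    intro t ht htT x
    have h1 := hdd t ht htT x
    have h2 := D1_gam_le_DD (J := []) (Nat.zero_le 1) φ (stp t x)
    have h3 := DD_nonneg 1 φ (stp t x)
    have h4 := mul_le_mul_of_nonneg_right (hss t ht x) h3
    have h5 : D1 φ (stp t x) ≤ D * κ := by
      have := mul_nonneg ht h3
      simp only [gam] at h2
      linarith
    have h6 := mul_le_mul_of_nonneg_left h5 hC.le
    have h7 : 0 ≤ (96 * (1 + C)) * D * κ := by positivity
    linarith
  have h := h M φ v hφ hv hs κ ((1 + C) * D * κ ^ 2) (1 / 16) (-15 / 16) (1 / 8) hκ (by positivity)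
    (by norm_num) (by norm_num) T hT (hD1 0 le_rfl hT) (hD1 T hT le_rfl) (fun t ht htT => ?_)
    (fun t ht htT => ?_)
  · rw [rpow_eq_th hT 2 0 (by norm_num)] at h
    have h1 : 1 ≤ th T ^ 2 := one_le_pow₀ (one_le_th hT)
    have h4 := mul_le_mul_of_nonneg_left h1 ha
    have h5 : 0 ≤ C * D * κ ^ 3 * th T ^ 2 := by positivity
    have h6 : 0 ≤ (1 + C) * D * κ ^ 3 := by positivity
    simp only [zpow_zero, mul_one] at h
    nlinarith
  · refine (hX t ht htT).trans (le_of_eq ?_)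
    rw [rpow_eq_th ht 2 0 (by norm_num)]; simp; ring
  · have h1 : 0 < 1 + t := by linarith
    have hq : ∀ x, DD 1 φ (stp t x) ≤ D * κ / (1 + t) := fun x => by
      rw [le_div_iff₀ h1, mul_comm]
      exact (mul_le_mul_of_nonneg_right (hss t ht x) (DD_nonneg _ _ _)).trans (hdd t ht htT x)
    have i1 : Integrable fun x => (box v (stp t x) + nf3 F φ v (stp t x)) ^ 2 := by
      refine Supp.integrable_sq (M := M) (f := fun p => box v p + nf3 F φ v p) ?_ ?_ ht
      · exact hv.box.continuous.add (hφ.nf3 F hv).continuous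
      · intro p h0 hp
        simp [hs.box hv p h0 hp, nf3, (hs.pder hv _).pder (hv.pd _) _ p h0 hp]
    have i2 : Integrable fun x => flatE v (stp t x) :=
      (hs.flatE hv).integrable hv.flatE.continuous ht
    calc _ ≤ ∫ x, ((box v (stp t x) + nf3 F φ v (stp t x)) ^ 2 + C * (D * κ / (1 + t)) ^ 2 * flatE v
          (stp t x)) := by
          refine integral_mono_of_nonneg (ae_of_all _ fun x => ?_) (i1.add (i2.const_mul _))
            (ae_of_all _ fun x => ?_)
          · have := flatE_nonneg v (stp t x)
            dsimp only [Pi.zero_apply]; positivity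
          · have := mul_le_mul_of_nonneg_right (mul_le_mul_of_nonneg_left (pow_le_pow_left₀
              (DD_nonneg _ _ _) (hq x) 2) hC.le) (flatE_nonneg v (stp t x))
            dsimp only; linarith
      _ = (∫ x, (box v (stp t x) + nf3 F φ v (stp t x)) ^ 2)
          + C * (D * κ / (1 + t)) ^ 2 * ∫ x, flatE v (stp t x) := by
          rw [integral_add i1 (i2.const_mul _), integral_const_mul]
      _ ≤ (D * κ ^ 2 * th t / (1 + t)) ^ 2 + C * (D * κ / (1 + t)) ^ 2 * (κ * th t) ^ 2 :=
          add_le_add (hY t ht htT) (mul_le_mul_of_nonneg_left (hX t ht htT) (by positivity))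
      _ = (1 + C) * (D * κ ^ 2 * th t / (1 + t)) ^ 2 := by field_simp
      _ ≤ (1 + C) ^ 2 * (D * κ ^ 2 * th t / (1 + t)) ^ 2 :=
          mul_le_mul_of_nonneg_right (by nlinarith) (sq_nonneg _)
      _ = _ := by
          rw [rpow_eq_th ht 2 (-2) (by norm_num), zpow_neg]
          have e : (1 + t) ^ (2 : ℤ) = (1 + t) ^ 2 := by norm_cast
          rw [e]
          field_simp

lemma init_energies (N : ℕ) : ∃ c : ℝ, 1 ≤ c ∧ ∀ (M : ℝ) (φ : Fld), Sm φ → Supp M φ → ∀ a : ℝ, 0 ≤ a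
    → (∀ J ∈ wds (N + 1), en (gam J φ) 0 ≤ a) → (∀ J : List ZI, J.length ≤ N → ∫ x, confE (gam J φ)
    (stp 0 x) ≤ c * a) ∧ (∀ J : List ZI, J.length ≤ N → ∫ x, flatE (gam J φ) (stp 0 x) ≤ c * a) ∧ AA
    N φ 0 ≤ c * a ∧ BB N φ 0 ≤ c * a := by
  obtain ⟨c, hc, h⟩ := exists_conf_bound (N + 1)
  obtain ⟨d, hd⟩ : ∃ d : ℝ, d = (((wds (N + 1)).card : ℕ) : ℝ) := ⟨_, rfl⟩
  have hd1 : 1 ≤ d := by rw [hd]; exact_mod_cast Finset.card_pos.2 ⟨[], mem_wds.2 (Nat.zero_le _)⟩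
  have hdN : ((wds N).card : ℝ) ≤ d := by
    rw [hd]; exact_mod_cast card_le_card (wds_mono (Nat.le_succ _))
  refine ⟨d * (c * d), one_le_mul_of_one_le_of_one_le hd1 (one_le_mul_of_one_le_of_one_le hc hd1),
    fun M φ hf hs a ha hen => ?_⟩
  have hA : AA (N + 1) φ 0 ≤ d * a := by
    have := sum_le_card_nsmul _ _ _ hen
    rwa [nsmul_eq_mul, ← hd] at this
  have hc1 : ∀ J : List ZI, J.length ≤ N → ∫ x, confE (gam J φ) (stp 0 x) ≤ c * d * a :=
    fun J hJ => (h M φ hf hs 0 le_rfl _ le_rfl J (by omega)).trans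
      (by nlinarith)
  have hf1 : ∀ J : List ZI, J.length ≤ N → ∫ x, flatE (gam J φ) (stp 0 x) ≤ c * d * a :=
    fun J hJ => (integral_mono (integrable_sum_flatE hf hs le_rfl J) (((hs.gam hf J).confE (hf.gam
      J)).integrable (hf.gam J).confE.continuous le_rfl) fun x => flatE_le_confE _ _).trans (hc1 J
      hJ)
  have p0 : 0 ≤ c * d * a := by positivity
  have p1 : c * d * a ≤ d * (c * d) * a := by nlinarith
  refine ⟨fun J hJ => (hc1 J hJ).trans p1, fun J hJ => (hf1 J hJ).trans p1, ?_, ?_⟩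
  · have := (AA_mono (Nat.le_succ N) φ 0).trans hA
    nlinarith [mul_nonneg (zero_le_one.trans hd1) ha]
  · have := sum_le_card_nsmul (wds N) _ _ fun J hJ => hf1 J (mem_wds.1 hJ)
    rw [nsmul_eq_mul] at this
    exact this.trans (by linarith [mul_le_mul_of_nonneg_right hdN p0])

lemma improve_numeric {W X C0 D1 κ : ℝ} (hβ2 : β ^ 2 = D1 * (ε ^ 2 + κ ^ 3)) (hX : X = C0 * ε ^ 2 +
    6 * κ * β + 2 * β ^ 2) : W * X ≤ κ ^ 2 / 32 + (W * C0) * ε ^ 2 + (2 * W + 288 * W ^ 2) * D1 * (ε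
    ^ 2 + κ ^ 3) := by
  rw [hX, mul_assoc _ D1, ← hβ2]
  nlinarith [sq_nonneg (κ - 96 * W * β)]

lemma boot_improve (hF : NullForm3 F) (hG : NullForm2 G) (N : ℕ) (hN : 7 ≤ N) (C0 : ℝ) (hC0 : 0 <
    C0) : ∃ A : ℝ, 0 < A ∧ ∀ (M : ℝ) (φ : Fld), Sol F G φ → Supp M φ → ∀ ε κ : ℝ, 0 < ε → 0 < κ → A
    * κ ≤ 1 → (∀ J ∈ wds (N + 1), en (gam J φ) 0 ≤ C0 * ε ^ 2) → (AA N φ 0 ≤ A * ε ^ 2 ∧ BB N φ 0 ≤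
    A * ε ^ 2) ∧ ∀ T, 0 ≤ T → (∀ t, 0 ≤ t → t ≤ T → Boot N κ (th t) φ t) → AA N φ T ≤ (κ ^ 2 / 32 +
    A * (ε ^ 2 + κ ^ 3)) * th T ^ 4 ∧ AA (N - 1) φ T ≤ (κ ^ 2 / 32 + A * (ε ^ 2 + κ ^ 3)) * th T ^ 2
    ∧ BB N φ T ≤ (κ ^ 2 / 32 + A * (ε ^ 2 + κ ^ 3)) * th T ^ 2 ∧ BB (N - 1) φ T ≤ κ ^ 2 / 32 + A *
    (ε ^ 2 + κ ^ 3) := by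
  obtain ⟨c, hc, hinit⟩ := init_energies N
  obtain ⟨c', hc', hconf⟩ := exists_conf_bound N
  obtain ⟨C, hC, hsrc⟩ := boot_sources hF hG N hN
  obtain ⟨Q, hQ, htop⟩ := top_improve F
  obtain ⟨w, hw⟩ : ∃ w : ℝ, w = (((wds N).card : ℕ) : ℝ) := ⟨_, rfl⟩
  have hw0 : 0 ≤ w := by rw [hw]; positivity
  have hwN : ((wds (N - 1)).card : ℝ) ≤ w := by
    rw [hw]; exact_mod_cast card_le_card (wds_mono (Nat.sub_le _ _))
  set D := c * C0 + 96 * c' * C with hD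
  have hD0 : 0 < D := by positivity
  set W := w * 9 ^ N with hW
  set A := W * C0 + (2 * W + 288 * W ^ 2) * D + w * (3 * c * C0 + Q * C + 12 * C) + Q * C + c * C0
    with hA
  have p1 : 0 ≤ W * C0 := by positivity
  have p2 : 0 ≤ (2 * W + 288 * W ^ 2) * D := by positivity
  have p3 : 0 ≤ w * (3 * c * C0 + Q * C + 12 * C) := by positivity
  have p4 : 0 < Q * C := by positivity
  have p5 : 0 < c * C0 := by positivity
  have hA0 : 0 < A := by positivity
  refine ⟨A, hA0, fun M φ hsol hs ε κ hε hκ hAκ hen => ?_⟩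
  have hf := hsol.1
  obtain ⟨i1, i2, i3, i4⟩ := hinit M φ hf hs (C0 * ε ^ 2) (by positivity) hen
  have hcA : c * (C0 * ε ^ 2) ≤ A * ε ^ 2 := by
    rw [← mul_assoc]
    exact mul_le_mul_of_nonneg_right (by linarith) (sq_nonneg ε)
  refine ⟨⟨i3.trans hcA, i4.trans hcA⟩, fun T hT hb => ?_⟩
  have src := fun t (ht : 0 ≤ t) (htT : t ≤ T) =>
    hsrc M φ hsol hs t κ (th t) ht hκ.le (one_le_th ht) (hb t ht htT)
  have hD' : c * (C0 * ε ^ 2) + 96 * c' * C * κ ^ 3 ≤ D * (ε ^ 2 + κ ^ 3) := by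
    have : 0 ≤ c * C0 * κ ^ 3 + 96 * c' * C * ε ^ 2 := by positivity
    rw [hD]; linarith
  obtain ⟨β, hβ⟩ : ∃ β, β = Real.sqrt (D * (ε ^ 2 + κ ^ 3)) := ⟨_, rfl⟩
  have hβ0 : 0 < β := by rw [hβ]; positivity
  have hβ2 : β ^ 2 = D * (ε ^ 2 + κ ^ 3) := hβ ▸ Real.sq_sqrt (by positivity)
  have chi : ∀ t, 0 ≤ t → t ≤ T → ∀ J : List ZI, J.length ≤ N - 1 →
      ∫ x, confE (gam J φ) (stp t x) ≤ β ^ 2 * th t ^ 4 := by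
    intro t ht htT J hJ
    refine (conf_improve (hf.gam J) (hs.gam hf J) 2 (by norm_num) (by positivity) hκ hc' hC ht (fun
      s hs0 hst => (hconf M φ hf hs s hs0 N le_rfl J (by omega)).trans (mul_le_mul_of_nonneg_left
        (hb s hs0 (hst.trans htT)).a0 (by linarith))) (fun s hs0 hst => (src s hs0 (hst.trans
      htT)).1 J hJ) (i1 J (by omega))).trans ?_
    rw [hβ2]
    exact mul_le_mul_of_nonneg_right hD' (pow_nonneg (by linarith [one_le_th ht]) _)
  have clo : ∀ t, 0 ≤ t → t ≤ T → ∀ J : List ZI, J.length ≤ N - 2 →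
      ∫ x, confE (gam J φ) (stp t x) ≤ β ^ 2 * th t ^ 2 := by
    intro t ht htT J hJ
    refine (conf_improve (hf.gam J) (hs.gam hf J) 1 le_rfl (by positivity) hκ hc' hC ht (fun s hs0
      hst => (hconf M φ hf hs s hs0 (N - 1) (by omega) J (by omega)).trans
        (mul_le_mul_of_nonneg_left (by rw [pow_one]; exact (hb s hs0 (hst.trans htT)).a1) (by
          linarith))) (fun s hs0 hst => by rw [pow_one]; exact (src s hs0 (hst.trans htT)).2.1 J hJ)
      (i1 J (by omega))).trans ?_
    rw [hβ2]
    exact mul_le_mul_of_nonneg_right hD' (pow_nonneg (by linarith [one_le_th ht]) _)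
  have h0 : en φ T ≤ (C0 * ε ^ 2 + 6 * κ * β) * th T ^ 2 :=
    l2_improve hf hs (by positivity) hκ hβ0 hT
      (fun t ht htT => (en_gam_le_AA (J := []) (Nat.zero_le _) φ t).trans (hb t ht htT).a1)
      (fun t ht htT => clo t ht htT [] (Nat.zero_le _)) (hen [] (mem_wds.2 (Nat.zero_le _)))
  have hθ := one_le_th hT
  obtain ⟨X, hX⟩ : ∃ X, X = C0 * ε ^ 2 + 6 * κ * β + 2 * β ^ 2 := ⟨_, rfl⟩
  obtain ⟨a1, a0⟩ := en_gam_le_of_conf hf hs (N := N) (by omega) (X := X) (B := β ^ 2) hT hθ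
    (by positivity) (h0.trans (mul_le_mul_of_nonneg_right (by rw [hX]; nlinarith) (sq_nonneg _)))
    (by rw [hX]; have : 0 ≤ C0 * ε ^ 2 + 6 * κ * β := by positivity
        linarith) (clo T hT le_rfl) (chi T hT le_rfl)
  rw [← hw, ← hW] at a1 a0
  have hWX : W * X ≤ κ ^ 2 / 32 + A * (ε ^ 2 + κ ^ 3) := by
    refine (improve_numeric hβ2 hX).trans ?_
    have e2 : 0 ≤ (w * (3 * c * C0 + Q * C + 12 * C) + Q * C + c * C0) * (ε ^ 2 + κ ^ 3) := by
      positivity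
    rw [hA]; linarith [mul_nonneg p1 (pow_pos hκ 3).le]
  have hwB : w * (3 * (c * (C0 * ε ^ 2)) + (Q * C + 12 * C) * κ ^ 3)
      ≤ κ ^ 2 / 32 + A * (ε ^ 2 + κ ^ 3) := by
    have e2 : 0 ≤ (W * C0 + (2 * W + 288 * W ^ 2) * D + Q * C + c * C0) * (ε ^ 2 + κ ^ 3) := by
      positivity
    have e3 : 0 ≤ w * (3 * c * C0) * κ ^ 3 + w * (Q * C + 12 * C) * ε ^ 2 := by positivity
    rw [hA]; linarith [sq_nonneg κ]
  refine ⟨a0.trans (mul_le_mul_of_nonneg_right hWX (by positivity)), a1.trans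
    (mul_le_mul_of_nonneg_right hWX (by positivity)), ?_, ?_⟩
  · have hJ : ∀ J ∈ wds N, ∫ x, flatE (gam J φ) (stp T x)
        ≤ (3 * (c * (C0 * ε ^ 2)) + Q * C * κ ^ 3) * th T ^ 2 := fun J hJ => by
      rw [mem_wds] at hJ
      refine htop M φ _ hf (hf.gam J) (hs.gam hf J) _ κ C hκ hC T hT ?_
        (fun t ht htT => (src t ht htT).2.2.2)
        (fun t ht htT => (flatE_gam_le_BB hJ φ t).trans (hb t ht htT).b0)
        (fun t ht htT => (src t ht htT).2.2.1 J hJ) (i2 J hJ) (by positivity)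
      exact (mul_le_mul_of_nonneg_right (by linarith) hκ.le).trans hAκ
    have := sum_le_card_nsmul _ _ _ hJ
    rw [nsmul_eq_mul, ← hw] at this
    refine this.trans ?_
    rw [← mul_assoc]
    refine mul_le_mul_of_nonneg_right (le_trans ?_ hwB) (sq_nonneg _)
    exact mul_le_mul_of_nonneg_left (by linarith [show 0 ≤ 12 * C * κ ^ 3 by positivity]) hw0
  · have hJ : ∀ J ∈ wds (N - 1), ∫ x, flatE (gam J φ) (stp T x)
        ≤ c * (C0 * ε ^ 2) + 12 * C * κ ^ 3 := fun J hJ => by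
      rw [mem_wds] at hJ
      exact flat_improve (hf.gam J) (hs.gam hf J) hκ hC hT
        (fun t ht htT => (flatE_gam_le_BB hJ φ t).trans (hb t ht htT).b1)
        (fun t ht htT => (src t ht htT).1 J hJ) (i2 J (by omega))
    have := sum_le_card_nsmul _ _ _ hJ
    rw [nsmul_eq_mul] at this
    refine this.trans ((mul_le_mul_of_nonneg_right hwN (by positivity)).trans (le_trans ?_ hwB))
    exact mul_le_mul_of_nonneg_left (by
      linarith [show 0 ≤ Q * C * κ ^ 3 + 2 * (c * (C0 * ε ^ 2)) by positivity]) hw0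

lemma le_of_continuation {Φ : ℝ → ℝ} (hc : ∀ T, ContinuousOn Φ (Icc 0 T)) (h0 : Φ 0 < m) (h : ∀ T, 0
    ≤ T → (∀ t, 0 ≤ t → t ≤ T → Φ t ≤ m) → Φ T < m) (hT : 0 ≤ T) : Φ T ≤ m := by
  by_contra! hm
  have hcl : IsCompact (Icc 0 T ∩ Φ ⁻¹' Set.Ici m) :=
    isCompact_Icc.of_isClosed_subset ((hc T).preimage_isClosed_of_isClosed isClosed_Icc isClosed_Ici)
      Set.inter_subset_left
  obtain ⟨t, ⟨ht, htm⟩, hmin⟩ := hcl.exists_isLeast ⟨T, ⟨hT, le_rfl⟩, hm.le⟩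
  have hlt : ∀ s, 0 ≤ s → s < t → Φ s < m := fun s hs hst => by
    by_contra! h'
    exact absurd (hmin ⟨⟨hs, hst.le.trans ht.2⟩, h'⟩) (not_le.2 hst)
  obtain ⟨s, hs, hsm⟩ := intermediate_value_Icc ht.1 (hc t) ⟨h0.le, htm⟩
  have hst : s = t := by
    by_contra hne
    exact absurd (hlt s hs.1 (lt_of_le_of_ne hs.2 hne)) (by rw [hsm]; exact lt_irrefl m)
  rw [hst] at hsm
  refine absurd (h t ht.1 fun s hs hst => ?_) (by rw [hsm]; exact lt_irrefl m)
  rcases hst.lt_or_eq with h' | rfl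
  · exact (hlt s hs h').le
  · exact hsm.le

lemma continuousOn_AA (hf : Sm φ) (hs : Supp M φ) (k : ℕ) (T : ℝ) : ContinuousOn (AA k φ) (Icc 0 T)
    :=
  continuousOn_finsetSum _ fun J _ => Supp.continuousOn_integral (M := M)
    (f := fun p => gam J φ p ^ 2) (by have := (hf.gam J).continuous; fun_prop)
    (fun p h0 hp => by simp [hs.gam hf J p h0 hp]) T

lemma continuousOn_BB (hf : Sm φ) (hs : Supp M φ) (k : ℕ) (T : ℝ) : ContinuousOn (BB k φ) (Icc 0 T)
    :=
  continuousOn_finsetSum _ fun J _ => Supp.continuousOn_integral (M := M)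
    (hf.gam J).flatE.continuous ((hs.gam hf J).flatE (hf.gam J)) T

lemma bootstrap (hF : NullForm3 F) (hG : NullForm2 G) (N : ℕ) (hN : 7 ≤ N) (C0 : ℝ) (hC0 : 0 < C0) :
    ∃ K : ℝ, 0 < K ∧ ∃ ε0 : ℝ, 0 < ε0 ∧ ∀ (M : ℝ) (φ : Fld), Sol F G φ → Supp M φ → ∀ ε : ℝ, 0 < ε →
    ε < ε0 → (∀ J ∈ wds (N + 1), en (gam J φ) 0 ≤ C0 * ε ^ 2) → ∀ t, 0 ≤ t → Boot N (K * ε) (th t) φ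
    t := by
  obtain ⟨A, hA, himp⟩ := boot_improve hF hG N hN C0 hC0
  refine ⟨1 + 32 * A, by positivity, 1 / (32 * A * (1 + 32 * A)), by positivity,
    fun M φ hsol hs ε hε hε0 hen => ?_⟩
  have hf := hsol.1
  obtain ⟨κ, hκe⟩ : ∃ κ, κ = (1 + 32 * A) * ε := ⟨_, rfl⟩
  rw [← hκe]
  have hκ : 0 < κ := by rw [hκe]; positivity
  have h32 : 32 * A * κ < 1 := by
    rw [lt_div_iff₀ (by positivity)] at hε0
    rw [hκe]; linarith
  have hκε : 32 * A * ε ^ 2 ≤ κ ^ 2 := by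
    rw [hκe, mul_pow]
    refine mul_le_mul_of_nonneg_right (by nlinarith) (sq_nonneg ε)
  obtain ⟨⟨a0, b0⟩, hstep⟩ := himp M φ hsol hs ε κ hε hκ (by nlinarith) hen
  have hz : κ ^ 2 / 32 + A * (ε ^ 2 + κ ^ 3) < κ ^ 2 / 8 := by
    have := mul_lt_mul_of_pos_right h32 (show 0 < κ ^ 2 by positivity)
    nlinarith
  have th1 : ∀ t, 0 ≤ t → 0 < th t := fun t ht => by linarith [one_le_th ht]
  have hdiv : ∀ {X : ℝ} (t : ℝ) (j : ℕ) {B : ℝ}, 0 ≤ t → (X / th t ^ j ≤ B ↔ X ≤ B * th t ^ j) :=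
    fun t j B ht => div_le_iff₀ (pow_pos (th1 t ht) j)
  obtain ⟨Φ, hΦ⟩ : ∃ Φ : ℝ → ℝ, Φ = fun t => AA N φ t / th t ^ 4 + AA (N - 1) φ t / th t ^ 2
    + BB N φ t / th t ^ 2 + BB (N - 1) φ t := ⟨_, rfl⟩
  have hboot : ∀ t, 0 ≤ t → Φ t ≤ κ ^ 2 → Boot N κ (th t) φ t := by
    intro t ht h
    have p := th1 t ht
    have q1 : 0 ≤ AA N φ t / th t ^ 4 := div_nonneg (AA_nonneg _ _ _) (by positivity)
    have q2 : 0 ≤ AA (N - 1) φ t / th t ^ 2 := div_nonneg (AA_nonneg _ _ _) (by positivity)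
    have q3 : 0 ≤ BB N φ t / th t ^ 2 := div_nonneg (BB_nonneg _ _ _) (by positivity)
    have q4 := BB_nonneg (N - 1) φ t
    rw [hΦ] at h
    dsimp only at h
    refine ⟨?_, ?_, ?_, by linarith⟩
    · have := (hdiv t 4 ht).1 (show AA N φ t / th t ^ 4 ≤ κ ^ 2 by linarith)
      exact this.trans (le_of_eq (by ring))
    · have := (hdiv t 2 ht).1 (show AA (N - 1) φ t / th t ^ 2 ≤ κ ^ 2 by linarith)
      exact this.trans (le_of_eq (by ring))
    · have := (hdiv t 2 ht).1 (show BB N φ t / th t ^ 2 ≤ κ ^ 2 by linarith)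
      exact this.trans (le_of_eq (by ring))
  intro t ht
  refine hboot t ht (le_of_continuation (fun T => ?_) ?_ (fun T hT hall => ?_) ht)
  · have hth := continuousOn_th T
    have hne : ∀ j : ℕ, ∀ t ∈ Icc 0 T, th t ^ j ≠ 0 := fun j t ht => (pow_pos (th1 t ht.1) j).ne'
    rw [hΦ]
    exact ((((continuousOn_AA hf hs N T).div (hth.pow 4) (hne 4)).add ((continuousOn_AA hf hs (N -
      1) T).div (hth.pow 2) (hne 2))).add ((continuousOn_BB hf hs N T).div (hth.pow 2) (hne 2))).add
      (continuousOn_BB hf hs (N - 1) T)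
  · have e : th 0 = 1 := by simp [th]
    rw [hΦ]
    dsimp only
    rw [e]
    have := AA_mono (Nat.sub_le N 1) φ 0
    have := BB_mono (Nat.sub_le N 1) φ 0
    have : 0 < κ ^ 2 := by positivity
    simp only [one_pow, div_one]
    linarith
  · obtain ⟨s1, s2, s3, s4⟩ := hstep T hT fun t ht htT => hboot t ht (hall t ht htT)
    rw [← hdiv T _ hT] at s1 s2 s3
    rw [hΦ]
    dsimp only
    linarith [show 0 < κ ^ 2 by positivity]

/-- The square root of the distance weight to the light cone. -/
def av (p : Pt) : ℝ := Real.sqrt (1 + |p 0 - rr p|)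

lemma av_sq (p : Pt) : av p ^ 2 = 1 + |p 0 - rr p| := Real.sq_sqrt (by positivity)

lemma one_le_av (p : Pt) : 1 ≤ av p := by
  rw [av, Real.one_le_sqrt]
  linarith [abs_nonneg (p 0 - rr p)]

lemma ks_av (k : ℕ) : ∃ C : ℝ, 0 < C ∧ ∀ M : ℝ, ∀ f : Fld, Sm f → Supp M f → ∀ p : Pt, 0 ≤ p 0 → ∀ A
    : ℝ, 0 ≤ A → AA (k + 3) f (p 0) ≤ A ^ 2 → SS k f p * (ss p * av p) ≤ C * A := by
  obtain ⟨C, hC, h⟩ := ks_gam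
  obtain ⟨c, hc⟩ : ∃ c : ℝ, c = ((wds k).card : ℕ) := ⟨_, rfl⟩
  have hc0 : 0 ≤ c := by rw [hc]; positivity
  refine ⟨c * (C + 1) + 1, by positivity, fun M f hf hs p hp A hA hA' => ?_⟩
  have hsp := ss_pos hp
  have ha := one_le_av p
  have h1 : ∀ J ∈ wds k, |gam J f p| * (ss p * av p) ≤ (C + 1) * A := by
    intro J hJ
    have h2 := (h M f hf hs J p hp).trans (mul_le_mul_of_nonneg_left ((AA_mono
      (by have := mem_wds.1 hJ; omega) f _).trans hA') hC.le)
    rw [← av_sq] at h2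
    refine abs_le_of_sq_le_sq' (a := |gam J f p| * (ss p * av p)) ?_ (by positivity) |>.2
    calc (|gam J f p| * (ss p * av p)) ^ 2 = ss p ^ 2 * av p ^ 2 * gam J f p ^ 2 := by
          rw [mul_pow, sq_abs]; ring
      _ ≤ C * A ^ 2 := h2
      _ ≤ ((C + 1) * A) ^ 2 := by nlinarith [sq_nonneg A, sq_nonneg (C * A), mul_nonneg hC.le (sq_nonneg A)]
  have h3 := sum_le_card_nsmul (wds k) (fun J => |gam J f p| * (ss p * av p)) _ h1
  rw [nsmul_eq_mul, ← hc, ← sum_mul] at h3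
  have : SS k f p = ∑ J ∈ wds k, |gam J f p| := rfl
  rw [this]
  linarith

lemma DD_av_le (k : ℕ) (f : Fld) (hp : 0 ≤ p 0) : DD k f p * av p ^ 2 ≤ 28 * ((wds k).card * SS (k +
    1) f p) := by
  have h1 : ∀ J ∈ wds k, D1 (gam J f) p * av p ^ 2 ≤ 28 * SS (k + 1) f p := by
    intro J hJ
    have : ∀ a ∈ (univ : Finset (Fin 4)), |pd a (gam J f) p| * av p ^ 2 ≤ 7 * SS (k + 1) f p := by
      intro a _
      rw [av_sq, mul_comm]
      exact (one_add_abs_mul_pd_le _ hp a).trans (mul_le_mul_of_nonneg_left (G1_gam_le_SS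
        (by have := mem_wds.1 hJ; omega) f p) (by norm_num))
    have := sum_le_card_nsmul _ _ _ this
    rw [← sum_mul, nsmul_eq_mul] at this
    simp only [card_univ, Fintype.card_fin] at this
    push_cast at this
    unfold D1
    linarith
  have := sum_le_card_nsmul _ _ _ h1
  rw [← sum_mul, nsmul_eq_mul] at this
  unfold DD
  linarith

/-- Pointwise decay of a function emitted near the spatial origin, for `k + 1` commuted fields. -/
structure Dec (ρ K : ℝ) (k : ℕ) (f : Fld) : Prop where
  sm : Sm f
  supp : Supp ρ f
  val : ∀ J : List ZI, J.length ≤ k + 1 → ∀ p : Pt, 0 ≤ p 0 →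
    |gam J f p| * (ss p * av p) ≤ K * th (p 0)
  bx : ∀ J : List ZI, J.length ≤ k → ∀ p : Pt, 0 ≤ p 0 →
    |box (gam J f) p| * (ss p ^ 2 * av p ^ 3) ≤ K * th (p 0)

lemma th_le (ht : 0 ≤ t) : th t ≤ 1 + t := by
  unfold th
  exact Real.rpow_le_self_of_one_le (by linarith) (by norm_num)

lemma src_dec (hF : NullForm3 F) (hG : NullForm2 G) (k : ℕ) : ∃ C : ℝ, 0 ≤ C ∧ ∀ φ : Fld, Sol F G φ
    → ∀ p : Pt, 0 ≤ p 0 → ∀ B : ℝ, 0 ≤ B → SS (k + 2) φ p * (ss p * av p) ≤ B → ∀ J : List ZI,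
      J.length ≤ k → |box (gam J φ) p| * (ss p ^ 3 * av p ^ 4) ≤ C * B ^ 2 := by
  choose! c hc0 hc using fun (J : List ZI) (hJ : J.length ≤ k) => src_null hF hG hJ
  obtain ⟨n, hn⟩ : ∃ n : ℝ, n = ((wds (k + 1)).card : ℕ) := ⟨_, rfl⟩
  have hn0 : 0 ≤ n := by rw [hn]; positivity
  have hCs : 0 ≤ ∑ J ∈ wds k, c J := sum_nonneg fun J hJ => hc0 J (mem_wds.1 hJ)
  refine ⟨(∑ J ∈ wds k, c J) * ((k + 1) * (28 * n)), by positivity, ?_⟩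
  intro φ hφ p hp B hB hS J hJ
  have hs := ss_pos hp
  have ha := one_le_av p
  have hD : DD (k + 1) φ p * (ss p * av p ^ 3) ≤ 28 * n * B := by
    have := DD_av_le (k + 1) φ hp
    rw [← hn] at this
    calc DD (k + 1) φ p * (ss p * av p ^ 3) = DD (k + 1) φ p * av p ^ 2 * (ss p * av p) := by ring
      _ ≤ 28 * (n * SS (k + 2) φ p) * (ss p * av p) := by gcongr
      _ = 28 * n * (SS (k + 2) φ p * (ss p * av p)) := by ring
      _ ≤ _ := by gcongr
  have hP : PX k φ p * (ss p ^ 2 * av p ^ 4) ≤ (k + 1) * (28 * n) * B ^ 2 := by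
    have h1 : ∀ i ∈ range (k + 1), SS (i + 1) φ p * DD (k + 1 - i) φ p *
        (ss p ^ 2 * av p ^ 4) ≤ 28 * n * B ^ 2 := by
      intro i hi
      have hi' := mem_range.1 hi
      have e1 : SS (i + 1) φ p * (ss p * av p) ≤ B :=
        (mul_le_mul_of_nonneg_right (SS_mono (by omega) φ p) (by positivity)).trans hS
      have e2 : DD (k + 1 - i) φ p * (ss p * av p ^ 3) ≤ 28 * n * B :=
        (mul_le_mul_of_nonneg_right (DD_mono (by omega) φ p) (by positivity)).trans hD
      have := DD_nonneg (k + 1 - i) φ p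
      calc _ = (SS (i + 1) φ p * (ss p * av p)) * (DD (k + 1 - i) φ p * (ss p * av p ^ 3)) := by ring
        _ ≤ B * (28 * n * B) := mul_le_mul e1 e2 (by positivity) hB
        _ = _ := by ring
    have := sum_le_card_nsmul _ _ _ h1
    rw [← sum_mul, nsmul_eq_mul, Finset.card_range] at this
    push_cast at this
    unfold PX
    linarith
  have hX : 0 ≤ PX k φ p := sum_nonneg fun i _ => mul_nonneg (SS_nonneg _ _ _) (DD_nonneg _ _ _)
  have h1 := hc J hJ φ hφ p hp
  have h2 : c J ≤ ∑ J ∈ wds k, c J :=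
    single_le_sum (fun J hJ => hc0 J (mem_wds.1 hJ)) (mem_wds.2 hJ)
  calc |box (gam J φ) p| * (ss p ^ 3 * av p ^ 4)
      = (ss p * |box (gam J φ) p|) * (ss p ^ 2 * av p ^ 4) := by ring
    _ ≤ (∑ J ∈ wds k, c J) * PX k φ p * (ss p ^ 2 * av p ^ 4) := by
        refine mul_le_mul_of_nonneg_right (h1.trans ?_) (by positivity)
        exact mul_le_mul_of_nonneg_right h2 hX
    _ = (∑ J ∈ wds k, c J) * (PX k φ p * (ss p ^ 2 * av p ^ 4)) := by ring
    _ ≤ (∑ J ∈ wds k, c J) * ((k + 1) * (28 * n) * B ^ 2) := by gcongr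
    _ = _ := by ring

lemma decay_of_data (hF : NullForm3 F) (hG : NullForm2 G) (n : ℕ) (hn : 1 ≤ n) : ∃ K : ℝ, 0 < K ∧ ∃
    ε0 : ℝ, 0 < ε0 ∧ ∀ (M : ℝ) (φ : Fld), Sol F G φ → Supp M φ → ∀ ε : ℝ, 0 < ε → ε < ε0 → (∀ x,
    DataAt (stp 0 x) (n + 7) ε φ) → Dec M (K * ε) n φ := by
  obtain ⟨C0, hC0, ε1, hε1, hdat⟩ := Sol.data_en F G (n + 7)
  obtain ⟨K, hK, ε2, hε2, hboot⟩ := bootstrap hF hG (n + 6) (by omega) C0 hC0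
  obtain ⟨C1, hC1, hks⟩ := ks_av (n + 2)
  obtain ⟨C2, hC2, hsrc⟩ := src_dec hF hG n
  refine ⟨C1 * K + C2 * (C1 * K) ^ 2, by positivity, min (min ε1 ε2) 1, by positivity, ?_⟩
  intro M φ hsol hs ε hε hε0 hd
  have hε1' : ε < ε1 := hε0.trans_le ((min_le_left _ _).trans (min_le_left _ _))
  have hε2' : ε < ε2 := hε0.trans_le ((min_le_left _ _).trans (min_le_right _ _))
  have hε3 : ε < 1 := hε0.trans_le (min_le_right _ _)
  have hb := hboot M φ hsol hs ε hε hε2' (hdat φ hsol ε hε hε1' hd)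
  have hS : ∀ p : Pt, 0 ≤ p 0 → SS (n + 2) φ p * (ss p * av p) ≤ C1 * (K * ε * th (p 0)) := by
    intro p hp
    have h1 := one_le_th hp
    exact hks M φ hsol.1 hs p hp _ (by positivity) (hb (p 0) hp).a1
  refine ⟨hsol.1, hs, fun J hJ p hp => ?_, fun J hJ p hp => ?_⟩
  · have h1 := one_le_th hp
    have ha := one_le_av p
    have hsp := ss_pos hp
    calc _ ≤ SS (n + 2) φ p * (ss p * av p) :=
          mul_le_mul_of_nonneg_right (abs_gam_le_SS (by omega) φ p) (by positivity)
      _ ≤ _ := hS p hp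
      _ = C1 * K * ε * th (p 0) := by ring
      _ ≤ _ := by
        gcongr
        have : 0 ≤ C2 * (C1 * K) ^ 2 := by positivity
        linarith
  · have h1 := one_le_th hp
    have ha := one_le_av p
    have hsp := ss_pos hp
    have h2 := hsrc φ hsol p hp _ (by positivity) (hS p hp) J hJ
    have h3 : th (p 0) ≤ ss p * av p := by
      have : th (p 0) ≤ ss p := by
        have := th_le hp
        unfold ss
        linarith [rr_nonneg p]
      nlinarith
    have h4 : |box (gam J φ) p| * (ss p ^ 2 * av p ^ 3) * (ss p * av p) ≤
        (C2 * (C1 * K) ^ 2 * ε * th (p 0)) * (ss p * av p) := by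
      calc _ = |box (gam J φ) p| * (ss p ^ 3 * av p ^ 4) := by ring
        _ ≤ _ := h2
        _ = C2 * (C1 * K) ^ 2 * ε * th (p 0) * (ε * th (p 0)) := by ring
        _ ≤ C2 * (C1 * K) ^ 2 * ε * th (p 0) * (1 * (ss p * av p)) := by gcongr
        _ = _ := by ring
    refine (le_of_mul_le_mul_right h4 (by positivity)).trans ?_
    gcongr
    have : 0 ≤ C1 * K := by positivity
    linarith

/-- Translation along the `x`-axis. -/
def tr (c : ℝ) (f : Fld) : Fld := fun p => f (p + Pi.single 1 c)

lemma ContDiff.tr (hf : Sm f) (c : ℝ) : Sm (tr c f) :=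
  ContDiff.comp hf (contDiff_id.add contDiff_const)

lemma pd_tr (c : ℝ) (f : Fld) (a : Fin 4) : pd a (tr c f) = tr c (pd a f) := by
  funext p
  change fderiv ℝ (fun q => f (q + Pi.single 1 c)) p _ = _
  rw [fderiv_comp_add_right]
  rfl

lemma tr_tr (c d : ℝ) (f : Fld) : tr c (tr d f) = tr (c + d) f := by
  funext p
  simp only [tr, Pi.single_add, add_assoc]

lemma tr_zero (f : Fld) : tr 0 f = f := by funext p; simp [tr]

lemma box_tr (c : ℝ) (f : Fld) : box (tr c f) = tr c (box f) := by
  rw [box_eq, box_eq]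
  funext p
  simp only [pd_tr]
  rfl

lemma nf3_tr (c : ℝ) (F : Ten3) (f g : Fld) : nf3 F (tr c f) (tr c g) = tr c (nf3 F f g) := by
  funext p
  simp only [nf3, pd_tr]
  rfl

lemma nf2_tr (c : ℝ) (G : Ten2) (f g : Fld) : nf2 G (tr c f) (tr c g) = tr c (nf2 G f g) := by
  funext p
  simp only [nf2, pd_tr]
  rfl

lemma tr_zap (c : ℝ) (Z : ZI) (f : Fld) : tr c (zap Z f) = fun p => zap Z (tr c f) p + ∑ a, (c * zA
    Z a 1) * pd a (tr c f) p := by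
  funext p
  simp only [tr, zap, pd_tr, ← sum_add_distrib, ← add_mul]
  refine sum_congr rfl fun a _ => ?_
  congr 1
  rw [add_assoc]
  congr 1
  simp only [Pi.add_apply, mul_add, sum_add_distrib]
  congr 1
  rw [Finset.sum_eq_single 1 (fun b _ hb => by simp [Pi.single_eq_of_ne hb]) (by simp)]
  rw [Pi.single_eq_same, mul_comm]

/-- Iterated action of multiples of fields; the head of the list acts first. -/
def lamI : List (ZI × ℝ) → (Fld) → Fld | [], f => f | z :: l, f => lamI l (fun p => z.2 * zap z.1 f
  p)

/-- The operators conjugate to `lamI` under the wave operator. -/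
def opI : List (ZI × ℝ) → (Fld) → Fld | [], f => f | z :: l, f => opI l (fun p => z.2 * (zap z.1 f p
  + zw z.1 * f p))

lemma lamI_snoc (l : List (ZI × ℝ)) (z : ZI × ℝ) (f : Fld) : lamI (l ++ [z]) f = fun p => z.2 * zap
    z.1 (lamI l f) p := by
  induction l generalizing f with
  | nil => rfl
  | cons y l ih => exact ih _

lemma ContDiff.lamI (hf : Sm f) (l : List (ZI × ℝ)) : Sm (lamI l f) := by
  induction l generalizing f with
  | nil => exact hf
  | cons y l ih => exact ih (contDiff_const.mul (hf.zap y.1))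

lemma sm_op (hf : Sm f) (z : ZI × ℝ) : Sm (fun p => z.2 * (zap z.1 f p + zw z.1 * f p)) :=
  contDiff_const.mul ((hf.zap z.1).add (contDiff_const.mul hf))

lemma box_lamI (hf : Sm f) (l : List (ZI × ℝ)) : box (lamI l f) = opI l (box f) := by
  induction l generalizing f with
  | nil => rfl
  | cons y l ih =>
    rw [lamI, opI, ih (contDiff_const.mul (hf.zap y.1)), box_const_mul (hf.zap y.1), box_zap hf]

lemma opI_add (hf : Sm f) (hg : Sm g) (l : List (ZI × ℝ)) : opI l (fun p => f p + g p) = fun p =>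
    opI l f p + opI l g p := by
  induction l generalizing f g with
  | nil => rfl
  | cons y l ih =>
    rw [opI, opI, opI, ← ih (sm_op hf y) (sm_op hg y)]
    congr 1
    funext p
    rw [zap_add hf hg]
    ring

lemma opI_const_mul (hf : Sm f) (c : ℝ) (l : List (ZI × ℝ)) : opI l (fun p => c * f p) = fun p => c
    * opI l f p := by
  induction l generalizing f with
  | nil => rfl
  | cons y l ih =>
    rw [opI, opI, ← ih (sm_op hf y)]
    congr 1
    funext p
    rw [zap_const_mul hf]
    ring

lemma zap_eq_zero_of_open (hs : Sm h) {U : Set Pt} (hU : IsOpen U) (hz : ∀ p ∈ U, 0 ≤ p 0 → h p = 0)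
    (Z : ZI) : ∀ p ∈ U, 0 ≤ p 0 → zap Z h p = 0 := by
  intro p hp h0
  have : ∀ a, pd a h p = 0 := fun a => pd_eq_zero_of_halfspace hU hs hz a p hp h0
  simp [zap, this]

lemma opI_eq_zero (hs : Sm h) (hz : ∀ p : Pt, 0 ≤ p 0 → h p = 0) (l : List (ZI × ℝ)) : ∀ p : Pt, 0 ≤
    p 0 → opI l h p = 0 := by
  induction l generalizing h with
  | nil => exact hz
  | cons y l ih =>
    refine ih (sm_op hs y) fun p hp => ?_
    rw [zap_eq_zero_of_open hs isOpen_univ (fun q _ hq => hz q hq) y.1 p (Set.mem_univ _) hp, hz p hp]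
    ring

lemma lamI_eq_zero_of_open (hs : Sm h) {U : Set Pt} (hU : IsOpen U) (hz : ∀ p ∈ U, 0 ≤ p 0 → h p =
    0) (l : List (ZI × ℝ)) : ∀ p ∈ U, 0 ≤ p 0 → lamI l h p = 0 := by
  induction l generalizing h with
  | nil => exact hz
  | cons y l ih =>
    refine ih (contDiff_const.mul (hs.zap y.1)) fun p hp h0 => ?_
    rw [zap_eq_zero_of_open hs hU hz y.1 p hp h0, mul_zero]

/-- Multiples of fields whose recentering at `c` only costs bounded multiples of translations. -/
def Adm (c : ℝ) (z : ZI × ℝ) : Prop := |z.2| ≤ 1 ∧ ∀ a, |z.2 * (c * zA z.1 a 1)| ≤ 4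

/-- Decay away from the point `(c,0,0)` on the axis. -/
def Good (R c K : ℝ) (k : ℕ) (f : Fld) : Prop := Dec (R / 2) K k (tr c f)

lemma Dec.pd {ρ : ℝ} (h : Dec ρ K (k + 1) f) (a : Fin 4) : Dec ρ K k (pd a f) := by
  have e : ∀ J, gam J (_root_.pd a f) = gam (Sum.inl a :: J) f := by
    intro J
    rw [gam, zap_tr]
  refine ⟨h.sm.pd a, h.supp.pder h.sm a, fun J hJ p hp => ?_, fun J hJ p hp => ?_⟩
  · rw [e]
    exact h.val _ (by simpa using hJ) p hp
  · rw [e]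
    exact h.bx _ (by simpa using hJ) p hp

lemma Good.pd (h : Good R c K (k + 1) f) (a : Fin 4) : Good R c K k (pd a f) := by
  unfold Good
  rw [← pd_tr]
  exact Dec.pd h a

lemma Good.mono {l : ℕ} (h : Good R c K l f) (hk : k ≤ l) : Good R c K k f :=
  ⟨h.sm, h.supp, fun J hJ => h.val J (by omega), fun J hJ => h.bx J (by omega)⟩

lemma Good.sm (h : Good R c K k f) : Sm f := by
  have := (Dec.sm h).tr (-c)
  rwa [tr_tr, neg_add_cancel, tr_zero] at this

lemma Good.op (h : Good R c K (k + 1) f) {z : ZI × ℝ} (hz : Adm c z) : Good R c (17 * K) k (fun p =>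
    z.2 * zap z.1 f p) := by
  have hf := h.sm
  have hg : Sm (tr c f) := hf.tr c
  have e : tr c (fun p => z.2 * zap z.1 f p) = fun p => z.2 * zap z.1 (tr c f) p +
      ∑ a, (z.2 * (c * zA z.1 a 1)) * _root_.pd a (tr c f) p := by
    funext p
    have := congrFun (tr_zap c z.1 f) p
    simp only [tr] at this ⊢
    rw [this, mul_add, mul_sum]
    simp only [mul_assoc]
  have s1 : Sm (fun p => z.2 * zap z.1 (tr c f) p) := contDiff_const.mul (hg.zap z.1)
  have s2 : ∀ a, Sm (fun p => (z.2 * (c * zA z.1 a 1)) * _root_.pd a (tr c f) p) := fun a =>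
    contDiff_const.mul (hg.pd a)
  have s3 : Sm (fun p => ∑ a, (z.2 * (c * zA z.1 a 1)) * _root_.pd a (tr c f) p) :=
    ContDiff.sum fun a _ => s2 a
  have eJ : ∀ J, gam J (tr c (fun p => z.2 * zap z.1 f p)) = fun p =>
      z.2 * gam (z.1 :: J) (tr c f) p +
        ∑ a, (z.2 * (c * zA z.1 a 1)) * gam (Sum.inl a :: J) (tr c f) p := by
    intro J
    rw [e, gam_add s1 s3, gam_const_mul (hg.zap z.1), gam_sum _ s2]
    funext p
    congr 1
    refine sum_congr rfl fun a _ => ?_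
    rw [gam_const_mul (hg.pd a), gam, zap_tr]
  have eB : ∀ J, box (gam J (tr c (fun p => z.2 * zap z.1 f p))) = fun p =>
      z.2 * box (gam (z.1 :: J) (tr c f)) p +
        ∑ a, (z.2 * (c * zA z.1 a 1)) * box (gam (Sum.inl a :: J) (tr c f)) p := by
    intro J
    rw [eJ, box_add (contDiff_const.mul (hg.gam _)) (ContDiff.sum fun a _ => contDiff_const.mul
      (hg.gam _)), box_const_mul (hg.gam _), box_sum _ (fun a => contDiff_const.mul (hg.gam _))]
    funext p
    congr 1
    refine sum_congr rfl fun a _ => ?_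
    rw [box_const_mul (hg.gam _)]
  have key : ∀ (X : ℝ) (Y : Fin 4 → ℝ) (W B : ℝ), 0 ≤ W → |X| * W ≤ B → (∀ a, |Y a| * W ≤ B) →
      |z.2 * X + ∑ a, (z.2 * (c * zA z.1 a 1)) * Y a| * W ≤ 17 * B := by
    intro X Y W B hW hX hY
    have h1 : |z.2 * X| * W ≤ B := by
      rw [abs_mul]
      calc |z.2| * |X| * W = |z.2| * (|X| * W) := by ring
        _ ≤ 1 * (|X| * W) := mul_le_mul_of_nonneg_right hz.1 (by positivity)
        _ ≤ B := by linarith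
    have h2 : ∀ a, |(z.2 * (c * zA z.1 a 1)) * Y a| * W ≤ 4 * B := by
      intro a
      rw [abs_mul, mul_assoc]
      exact mul_le_mul (hz.2 a) (hY a) (by positivity) (by norm_num)
    have h3 : |z.2 * X + ∑ a, (z.2 * (c * zA z.1 a 1)) * Y a| ≤
        |z.2 * X| + ∑ a, |(z.2 * (c * zA z.1 a 1)) * Y a| :=
      (abs_add_le _ _).trans (by gcongr; exact abs_sum_le_sum_abs _ _)
    have h4 := mul_le_mul_of_nonneg_right h3 hW
    rw [add_mul, sum_mul] at h4
    have h5 := sum_le_card_nsmul univ _ _ fun a _ => h2 a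
    rw [card_univ, Fintype.card_fin, nsmul_eq_mul] at h5
    push_cast at h5
    linarith
  have hs : Supp (R / 2) (tr c (fun p => z.2 * zap z.1 f p)) := by
    rw [e]
    intro p hp hp'
    have h1 := (h.supp.zap hg z.1) p hp hp'
    have h2 := fun a => (h.supp.pder hg a) p hp hp'
    simp only [h1, h2, mul_zero, Finset.sum_const_zero, add_zero]
  refine ⟨by rw [e]; exact s1.add s3, hs, fun J hJ p hp => ?_, fun J hJ p hp => ?_⟩
  · have hs := ss_pos hp
    have ha := one_le_av p
    rw [eJ, mul_assoc 17 K]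
    exact key _ _ _ _ (by positivity) (h.val _ (by simpa using hJ) p hp)
      (fun a => h.val _ (by simpa using hJ) p hp)
  · have hs := ss_pos hp
    have ha := one_le_av p
    rw [eB, mul_assoc 17 K]
    exact key _ _ _ _ (by positivity) (h.bx _ (by simpa using hJ) p hp)
      (fun a => h.bx _ (by simpa using hJ) p hp)

/-- Jets of two functions emitted from centers at distance `|D| = 2R`, at one spacetime point. -/
structure Loc (t T R D κ i1 i2 : ℝ) (u v X1 X2 : Fin 4 → ℝ) (f g bf bg : ℝ) : Prop where
  tpos : 0 < t
  tT : t ≤ T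
  Tt : T ≤ 3 * t
  R1 : 1 ≤ R
  Rt : R ≤ 2 * t
  D2 : D ^ 2 = 4 * R ^ 2
  κ0 : 0 ≤ κ
  pos1 : 0 < i1
  le1 : i1 ≤ 1
  pos2 : 0 < i2
  le2 : i2 ≤ 1
  far1 : 1 ≤ 4 * T * i1 ^ 2
  far2 : 1 ≤ 4 * T * i2 ^ 2
  hf : |f| ≤ κ * i1
  hg : |g| ≤ κ * i2
  hu : ∀ a, |u a| ≤ κ * i1 ^ 3
  hv : ∀ a, |v a| ≤ κ * i2 ^ 3
  hU : ∀ a, |t * u a - X1 a * u 0| ≤ κ * i1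
  hV : ∀ a, |t * v a - X2 a * v 0| ≤ κ * i2
  hbf : |bf| * T ≤ κ * i1 ^ 3
  hbg : |bg| * T ≤ κ * i2 ^ 3
  hX1 : ∀ a, |X1 a| ≤ 4 * T
  hX2 : ∀ a, |X2 a| ≤ 4 * T
  hm1 : |∑ a, m4 a * (X1 a * X1 a)| * i1 ^ 2 ≤ 4 * T
  hm2 : |∑ a, m4 a * (X2 a * X2 a)| * i2 ^ 2 ≤ 4 * T
  hD : ∀ a, X1 a = X2 a + D * (if a = 1 then 1 else 0)

/-- The interaction weight. -/
def omw (κ i1 i2 : ℝ) : ℝ := κ ^ 2 * (i1 * i2 ^ 3 + i1 ^ 3 * i2)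

lemma abs_mul_le_omw_left {κ i1 i2 x y : ℝ} (h1 : 0 < i1) (h2 : 0 < i2) (hx : |x| ≤ κ * i1) (hy :
    |y| ≤ κ * i2 ^ 3) : |x| * |y| ≤ omw κ i1 i2 := by
  have := mul_le_mul hx hy (abs_nonneg _) ((abs_nonneg _).trans hx)
  have h3 : 0 ≤ κ ^ 2 * (i1 ^ 3 * i2) := by positivity
  unfold omw
  linarith

lemma abs_mul_le_omw_right {κ i1 i2 x y : ℝ} (h1 : 0 < i1) (h2 : 0 < i2) (hx : |x| ≤ κ * i1 ^ 3) (hy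
    : |y| ≤ κ * i2) : |x| * |y| ≤ omw κ i1 i2 := by
  have := mul_le_mul hx hy (abs_nonneg _) ((abs_nonneg _).trans hx)
  have h3 : 0 ≤ κ ^ 2 * (i1 * i2 ^ 3) := by positivity
  unfold omw
  linarith

lemma omw_nonneg {κ i1 i2 : ℝ} (h1 : 0 < i1) (h2 : 0 < i2) : 0 ≤ omw κ i1 i2 := by
  unfold omw
  positivity

namespace Loc

variable {t T R D κ i1 i2 : ℝ} {u v X1 X2 : Fin 4 → ℝ} {f g bf bg : ℝ}

lemma cube_le1 (h : Loc t T R D κ i1 i2 u v X1 X2 f g bf bg) : κ * i1 ^ 3 ≤ κ * i1 := by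
  have := h.κ0
  have := pow_le_of_le_one h.pos1.le h.le1 (n := 3) (by norm_num)
  gcongr

lemma cube_le2 (h : Loc t T R D κ i1 i2 u v X1 X2 f g bf bg) : κ * i2 ^ 3 ≤ κ * i2 := by
  have := h.κ0
  have := pow_le_of_le_one h.pos2.le h.le2 (n := 3) (by norm_num)
  gcongr

lemma term (h : Loc t T R D κ i1 i2 u v X1 X2 f g bf bg) (a b : Fin 4) : |t ^ 2 * (u a * v b) - X1 a
    * X2 b * (u 0 * v 0)| ≤ 5 * T * omw κ i1 i2 := by
  have e : t ^ 2 * (u a * v b) - X1 a * X2 b * (u 0 * v 0) =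
      X1 a * (u 0 * (t * v b - X2 b * v 0)) + t * ((t * u a - X1 a * u 0) * v b) := by ring
  have ho := omw_nonneg (κ := κ) h.pos1 h.pos2
  have hT : 0 ≤ T := h.tpos.le.trans h.tT
  have h1 := abs_mul_le_omw_right h.pos1 h.pos2 (h.hu 0) (h.hV b)
  have h2 := abs_mul_le_omw_left h.pos1 h.pos2 (h.hU a) (h.hv b)
  rw [e]
  refine (abs_add_le _ _).trans ?_
  rw [abs_mul, abs_mul (u 0), abs_mul t, abs_mul (t * u a - _), abs_of_pos h.tpos]
  have h3 := mul_le_mul (h.hX1 a) h1 (by positivity) (by positivity)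
  have h4 := mul_le_mul h.tT h2 (by positivity) (by positivity)
  linarith

lemma uv_weight1 (h : Loc t T R D κ i1 i2 u v X1 X2 f g bf bg) {m : ℝ} (hm : |m| * i1 ^ 2 ≤ 4 * T) :
    |m * (u 0 * v 0)| ≤ 4 * T * omw κ i1 i2 := by
  have := h.κ0
  have := h.pos1
  have := h.pos2
  have h1 := mul_le_mul (h.hu 0) (h.hv 0) (abs_nonneg _) (by positivity)
  have h3 : 0 ≤ κ ^ 2 * (i1 ^ 3 * i2) := by positivity
  rw [abs_mul, abs_mul]
  calc |m| * (|u 0| * |v 0|) ≤ |m| * (κ * i1 ^ 3 * (κ * i2 ^ 3)) := by gcongr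
    _ = (|m| * i1 ^ 2) * (κ ^ 2 * (i1 * i2 ^ 3)) := by ring
    _ ≤ 4 * T * (κ ^ 2 * (i1 * i2 ^ 3)) := by gcongr
    _ ≤ _ := by
      have := h.tpos.le.trans h.tT
      unfold omw
      gcongr
      nlinarith [mul_pos (pow_pos h.pos1 3) h.pos2]

lemma uv_weight2 (h : Loc t T R D κ i1 i2 u v X1 X2 f g bf bg) {m : ℝ} (hm : |m| * i2 ^ 2 ≤ 4 * T) :
    |m * (u 0 * v 0)| ≤ 4 * T * omw κ i1 i2 := by
  have := h.κ0
  have := h.pos1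
  have := h.pos2
  have h1 := mul_le_mul (h.hu 0) (h.hv 0) (abs_nonneg _) (by positivity)
  rw [abs_mul, abs_mul]
  calc |m| * (|u 0| * |v 0|) ≤ |m| * (κ * i1 ^ 3 * (κ * i2 ^ 3)) := by gcongr
    _ = (|m| * i2 ^ 2) * (κ ^ 2 * (i1 ^ 3 * i2)) := by ring
    _ ≤ 4 * T * (κ ^ 2 * (i1 ^ 3 * i2)) := by gcongr
    _ ≤ _ := by
      have := h.tpos.le.trans h.tT
      unfold omw
      gcongr
      nlinarith [mul_pos (pow_pos h.pos2 3) h.pos1]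

lemma mink_term (h : Loc t T R D κ i1 i2 u v X1 X2 f g bf bg) : |t ^ 2 * (∑ d, m4 d * (u d * v d)) +
    D ^ 2 / 2 * (u 0 * v 0)| ≤ 24 * T * omw κ i1 i2 := by
  have e : t ^ 2 * (∑ d, m4 d * (u d * v d)) + D ^ 2 / 2 * (u 0 * v 0) =
      (∑ d, m4 d * (t ^ 2 * (u d * v d) - X1 d * X2 d * (u 0 * v 0))) +
      ((∑ a, m4 a * (X1 a * X1 a)) * (u 0 * v 0) + (∑ a, m4 a * (X2 a * X2 a)) * (u 0 * v 0)) / 2 := by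
    have e0 := h.hD 0
    have e1 := h.hD 1
    have e2 := h.hD 2
    have e3 := h.hD 3
    simp only [Fin.isValue, Fin.reduceEq, if_true, if_false, mul_one, mul_zero, add_zero] at e0 e1 e2 e3
    have m0 : m4 0 = -1 := rfl
    have m1 : m4 1 = 1 := rfl
    have m2 : m4 2 = 1 := rfl
    have m3 : m4 3 = 1 := rfl
    simp only [Fin.sum_univ_four, e0, e1, e2, e3, m0, m1, m2, m3]
    ring
  have h1 : |∑ d, m4 d * (t ^ 2 * (u d * v d) - X1 d * X2 d * (u 0 * v 0))| ≤ 20 * T * omw κ i1 i2 := by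
    have : ∀ d ∈ (univ : Finset (Fin 4)), |m4 d * (t ^ 2 * (u d * v d) - X1 d * X2 d * (u 0 * v 0))|
        ≤ 5 * T * omw κ i1 i2 := by
      intro d _
      have hm : |m4 d| = 1 := by fin_cases d <;> simp [m4]
      rw [abs_mul, hm, one_mul]
      exact h.term d d
    have := (abs_sum_le_sum_abs _ _).trans (sum_le_card_nsmul _ _ _ this)
    rw [card_univ, Fintype.card_fin, nsmul_eq_mul] at this
    push_cast at this
    linarith
  have h2 := h.uv_weight1 h.hm1
  have h3 := h.uv_weight2 h.hm2
  rw [e]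
  refine (abs_add_le _ _).trans ?_
  rw [abs_div, abs_of_pos (by norm_num : (0:ℝ) < 2)]
  have := abs_add_le ((∑ a, m4 a * (X1 a * X1 a)) * (u 0 * v 0)) ((∑ a, m4 a * (X2 a * X2 a)) * (u 0 * v 0))
  linarith

lemma form_term (h : Loc t T R D κ i1 i2 u v X1 X2 f g bf bg) {B : Ten2} {β : ℝ} (hB : ∀ a b, |B a
    b| ≤ β) : |t ^ 2 * (∑ a, ∑ b, B a b * u a * v b) - (∑ a, ∑ b, B a b * X2 a * X2 b) * (u 0 * v 0)
      - D * (∑ b, B 1 b * X2 b) * (u 0 * v 0)| ≤ 80 * β * T * omw κ i1 i2 := by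
  have e : t ^ 2 * (∑ a, ∑ b, B a b * u a * v b) - (∑ a, ∑ b, B a b * X2 a * X2 b) * (u 0 * v 0)
      - D * (∑ b, B 1 b * X2 b) * (u 0 * v 0) =
      ∑ a, ∑ b, B a b * (t ^ 2 * (u a * v b) - X1 a * X2 b * (u 0 * v 0)) := by
    have e0 := h.hD 0
    have e1 := h.hD 1
    have e2 := h.hD 2
    have e3 := h.hD 3
    simp only [Fin.isValue, Fin.reduceEq, if_true, if_false, mul_one, mul_zero, add_zero] at e0 e1 e2 e3
    simp only [Fin.sum_univ_four, e0, e1, e2, e3]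
    ring
  have ho := omw_nonneg (κ := κ) h.pos1 h.pos2
  have hT : 0 ≤ T := h.tpos.le.trans h.tT
  have hb : 0 ≤ β := (abs_nonneg _).trans (hB 0 0)
  have h1 : ∀ a ∈ (univ : Finset (Fin 4)),
      |∑ b, B a b * (t ^ 2 * (u a * v b) - X1 a * X2 b * (u 0 * v 0))| ≤ 20 * β * T * omw κ i1 i2 := by
    intro a _
    have : ∀ b ∈ (univ : Finset (Fin 4)),
        |B a b * (t ^ 2 * (u a * v b) - X1 a * X2 b * (u 0 * v 0))| ≤ β * (5 * T * omw κ i1 i2) := by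
      intro b _
      rw [abs_mul]
      exact mul_le_mul (hB a b) (h.term a b) (abs_nonneg _) hb
    have := (abs_sum_le_sum_abs _ _).trans (sum_le_card_nsmul _ _ _ this)
    rw [card_univ, Fintype.card_fin, nsmul_eq_mul] at this
    push_cast at this
    linarith
  rw [e]
  have := (abs_sum_le_sum_abs _ _).trans (sum_le_card_nsmul _ _ _ h1)
  rw [card_univ, Fintype.card_fin, nsmul_eq_mul] at this
  push_cast at this
  linarith

lemma abs_ell_le (h : Loc t T R D κ i1 i2 u v X1 X2 f g bf bg) {B : Ten2} {β : ℝ} (hB : ∀ a b, |B a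
    b| ≤ β) : |∑ b, B 1 b * X2 b| ≤ 16 * β * T := by
  have hb : 0 ≤ β := (abs_nonneg _).trans (hB 0 0)
  have : ∀ b ∈ (univ : Finset (Fin 4)), |B 1 b * X2 b| ≤ β * (4 * T) := by
    intro b _
    rw [abs_mul]
    exact mul_le_mul (hB 1 b) (h.hX2 b) (abs_nonneg _) hb
  have := (abs_sum_le_sum_abs _ _).trans (sum_le_card_nsmul _ _ _ this)
  rw [card_univ, Fintype.card_fin, nsmul_eq_mul] at this
  push_cast at this
  linarith

/-- Size of a bilinear form in the two gradients. -/
lemma form_le (h : Loc t T R D κ i1 i2 u v X1 X2 f g bf bg) {B : Ten2} {β : ℝ} (hB : ∀ a b, |B a b|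
    ≤ β) : |t ^ 2 * (∑ a, ∑ b, B a b * u a * v b) - (∑ a, ∑ b, B a b * X2 a * X2 b) * (u 0 * v 0)| ≤
      336 * β * (R * t) * omw κ i1 i2 := by
  have ho := omw_nonneg (κ := κ) h.pos1 h.pos2
  have hb : 0 ≤ β := (abs_nonneg _).trans (hB 0 0)
  have h1 := h.form_term hB
  have hR := h.R1
  have ht := h.tpos
  have hT : 0 ≤ T := ht.le.trans h.tT
  have hD : |D| = 2 * R := by
    rw [← abs_of_nonneg (by linarith : 0 ≤ 2 * R)]
    exact (sq_eq_sq_iff_abs_eq_abs _ _).1 (by rw [h.D2]; ring)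
  have h2 : |D * (∑ b, B 1 b * X2 b) * (u 0 * v 0)| ≤ 2 * R * (16 * β * T) * omw κ i1 i2 := by
    rw [abs_mul, abs_mul, abs_mul (u 0), hD]
    have := abs_mul_le_omw_left h.pos1 h.pos2 ((h.hu 0).trans h.cube_le1) (h.hv 0)
    have h3 := h.abs_ell_le hB
    gcongr
  have h3 : T ≤ 3 * (R * t) := by nlinarith [h.Tt]
  have h4 : R * T ≤ 3 * (R * t) := by nlinarith [h.Tt]
  have h5 : β * T * omw κ i1 i2 ≤ β * (3 * (R * t)) * omw κ i1 i2 := by gcongr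
  have h6 : β * (R * T) * omw κ i1 i2 ≤ β * (3 * (R * t)) * omw κ i1 i2 := by gcongr
  have h7 := abs_add_le (t ^ 2 * (∑ a, ∑ b, B a b * u a * v b) - (∑ a, ∑ b, B a b * X2 a * X2 b) *
    (u 0 * v 0) - D * (∑ b, B 1 b * X2 b) * (u 0 * v 0))
    (D * (∑ b, B 1 b * X2 b) * (u 0 * v 0))
  rw [sub_add_cancel] at h7
  linarith

/-- The remainder after subtracting the normal form correction. -/
lemma normal_form_le (h : Loc t T R D κ i1 i2 u v X1 X2 f g bf bg) {B : Ten2} {β : ℝ} (hB : ∀ a b,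
    |B a b| ≤ β) {l' : Fin 4 → ℝ} (hl' : ∀ a, |l' a| ≤ β) : |t ^ 2 * ((∑ a, ∑ b, B a b * u a * v b)
    - -D⁻¹ * ((∑ b, B 1 b * X2 b) * (f * bg + g * bf + 2 * ∑ d, m4 d * (u d * v d)) + 2 * ∑ d, m4 d
      * (l' d * (f * v d + g * u d)))) - (∑ a, ∑ b, B a b * X2 a * X2 b) * (u 0 * v 0)| * R ≤ 20000
      * β * t ^ 2 * omw κ i1 i2 := by
  obtain ⟨L, hL⟩ : ∃ L, L = ∑ b, B 1 b * X2 b := ⟨_, rfl⟩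
  obtain ⟨S, hS⟩ : ∃ S, S = ∑ d, m4 d * (u d * v d) := ⟨_, rfl⟩
  obtain ⟨Q, hQ⟩ : ∃ Q, Q = ∑ d, m4 d * (l' d * (f * v d + g * u d)) := ⟨_, rfl⟩
  have h1 := h.form_term hB
  have h2 := h.mink_term
  have h3 := h.abs_ell_le hB
  rw [← hL] at h1 h3 ⊢
  rw [← hS] at h2 ⊢
  rw [← hQ]
  obtain ⟨H, hH⟩ : ∃ H, H = ∑ a, ∑ b, B a b * u a * v b := ⟨_, rfl⟩
  obtain ⟨Y, hY⟩ : ∃ Y, Y = (∑ a, ∑ b, B a b * X2 a * X2 b) * (u 0 * v 0) := ⟨_, rfl⟩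
  rw [← hH, ← hY] at h1 ⊢
  have ho := omw_nonneg (κ := κ) h.pos1 h.pos2
  obtain ⟨W, hW⟩ : ∃ W, W = omw κ i1 i2 := ⟨_, rfl⟩
  have hb : 0 ≤ β := (abs_nonneg _).trans (hB 0 0)
  have hR := h.R1
  have ht := h.tpos
  have hT : 0 < T := ht.trans_le h.tT
  have hD : |D| = 2 * R := by
    rw [← abs_of_nonneg (by linarith : 0 ≤ 2 * R)]
    exact (sq_eq_sq_iff_abs_eq_abs _ _).1 (by rw [h.D2]; ring)
  have hD0 : D ≠ 0 := by
    intro h0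
    rw [h0, abs_zero] at hD
    linarith
  have hDi : |D⁻¹| * R = 1 / 2 := by
    rw [abs_inv, hD]
    field_simp
  have hbx : |f * bg + g * bf| * T ≤ 2 * omw κ i1 i2 := by
    have e1 : |f| * (|bg| * T) ≤ omw κ i1 i2 := by
      have := abs_mul_le_omw_left (x := f) (y := bg * T) h.pos1 h.pos2 h.hf
        (by rw [abs_mul, abs_of_pos hT]; exact h.hbg)
      rwa [abs_mul, abs_of_pos hT] at this
    have e2 : |bf| * T * |g| ≤ omw κ i1 i2 := by
      have := abs_mul_le_omw_right (x := bf * T) (y := g) h.pos1 h.pos2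
        (by rw [abs_mul, abs_of_pos hT]; exact h.hbf) h.hg
      rwa [abs_mul, abs_of_pos hT] at this
    have e3 := mul_le_mul_of_nonneg_right (abs_add_le (f * bg) (g * bf)) hT.le
    rw [abs_mul, abs_mul] at e3
    linarith
  have hQ1 : |Q| ≤ 8 * β * omw κ i1 i2 := by
    have : ∀ d ∈ (univ : Finset (Fin 4)), |m4 d * (l' d * (f * v d + g * u d))|
        ≤ β * (2 * omw κ i1 i2) := by
      intro d _
      have hm : |m4 d| = 1 := by fin_cases d <;> simp [m4]
      have e1 := abs_mul_le_omw_left h.pos1 h.pos2 h.hf (h.hv d)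
      have e2 := abs_mul_le_omw_right h.pos1 h.pos2 (h.hu d) h.hg
      have e3 := abs_add_le (f * v d) (g * u d)
      rw [abs_mul, abs_mul] at e3
      rw [abs_mul, hm, one_mul, abs_mul]
      exact mul_le_mul (hl' d) (by linarith) (abs_nonneg _) hb
    have := (abs_sum_le_sum_abs _ _).trans (sum_le_card_nsmul _ _ _ this)
    rw [card_univ, Fintype.card_fin, nsmul_eq_mul] at this
    push_cast at this
    rw [hQ]
    linarith
  rw [← hW] at h1 h2 hbx hQ1 ho ⊢
  have e : t ^ 2 * (H - -D⁻¹ * (L * (f * bg + g * bf + 2 * S) + 2 * Q)) - Y =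
      (t ^ 2 * H - Y - D * L * (u 0 * v 0)) + D⁻¹ * (2 * L * (t ^ 2 * S + D ^ 2 / 2 * (u 0 * v 0)))
      + D⁻¹ * (t ^ 2 * (L * (f * bg + g * bf))) + D⁻¹ * (t ^ 2 * (2 * Q)) := by
    field_simp
    ring
  have p1 : |t ^ 2 * H - Y - D * L * (u 0 * v 0)| * R ≤ 80 * β * (6 * t ^ 2) * W := by
    have : T * R ≤ 6 * t ^ 2 := by nlinarith [h.Tt, h.Rt]
    calc _ ≤ 80 * β * T * W * R := by gcongr
      _ = 80 * β * (T * R) * W := by ring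
      _ ≤ _ := by gcongr
  have p2 : |2 * L * (t ^ 2 * S + D ^ 2 / 2 * (u 0 * v 0))| ≤ 768 * β * (9 * t ^ 2) * W := by
    have : T * T ≤ 9 * t ^ 2 := by nlinarith [h.Tt, h.tT]
    rw [abs_mul, abs_mul, abs_of_pos (by norm_num : (0:ℝ) < 2)]
    calc _ ≤ 2 * (16 * β * T) * (24 * T * W) := by gcongr
      _ = 768 * β * (T * T) * W := by ring
      _ ≤ _ := by gcongr
  have p3 : |t ^ 2 * (L * (f * bg + g * bf))| ≤ 32 * β * t ^ 2 * W := by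
    rw [abs_mul, abs_mul L, abs_of_pos (by positivity : 0 < t ^ 2)]
    calc _ ≤ t ^ 2 * (16 * β * T * |f * bg + g * bf|) := by gcongr
      _ = t ^ 2 * (16 * β) * (|f * bg + g * bf| * T) := by ring
      _ ≤ t ^ 2 * (16 * β) * (2 * W) := by gcongr
      _ = _ := by ring
  have p4 : |t ^ 2 * (2 * Q)| ≤ 16 * β * t ^ 2 * W := by
    rw [abs_mul, abs_mul 2, abs_of_pos (by positivity : 0 < t ^ 2), abs_of_pos (by norm_num : (0:ℝ) < 2)]
    nlinarith [mul_le_mul_of_nonneg_left hQ1 (sq_nonneg t)]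
  have key : ∀ x : ℝ, |D⁻¹ * x| * R = |x| / 2 := by
    intro x
    rw [abs_mul, mul_right_comm, hDi]
    ring
  rw [e]
  have q1 := abs_add_le ((t ^ 2 * H - Y - D * L * (u 0 * v 0)) + D⁻¹ * (2 * L * (t ^ 2 * S + D ^ 2 / 2 * (u 0 * v 0)))
      + D⁻¹ * (t ^ 2 * (L * (f * bg + g * bf)))) (D⁻¹ * (t ^ 2 * (2 * Q)))
  have q2 := abs_add_le ((t ^ 2 * H - Y - D * L * (u 0 * v 0)) + D⁻¹ * (2 * L * (t ^ 2 * S + D ^ 2 / 2 * (u 0 * v 0))))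
      (D⁻¹ * (t ^ 2 * (L * (f * bg + g * bf))))
  have q3 := abs_add_le (t ^ 2 * H - Y - D * L * (u 0 * v 0)) (D⁻¹ * (2 * L * (t ^ 2 * S + D ^ 2 / 2 * (u 0 * v 0))))
  have q := mul_le_mul_of_nonneg_right (q1.trans (add_le_add_left (q2.trans (add_le_add_left q3 _)) _))
    (by linarith : 0 ≤ R)
  rw [add_mul, add_mul, add_mul, key, key, key] at q
  have : 0 ≤ β * t ^ 2 * W := by positivity
  linarith

/-- The gradient of the normal form correction. -/
lemma normal_form_grad_le (h : Loc t T R D κ i1 i2 u v X1 X2 f g bf bg) {B : Ten2} {β : ℝ} (hB : ∀ a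
    b, |B a b| ≤ β) {l : ℝ} (hl : |l| ≤ β) (a : Fin 4) : |-D⁻¹ * (l * (f * g) + (∑ b, B 1 b * X2 b)
    * (f * v a + g * u a))| * R ≤ 60 * β * t * omw κ i1 i2 := by
  have h3 := h.abs_ell_le hB
  obtain ⟨L, hL⟩ : ∃ L, L = ∑ b, B 1 b * X2 b := ⟨_, rfl⟩
  rw [← hL] at h3 ⊢
  have ho := omw_nonneg (κ := κ) h.pos1 h.pos2
  have hb : 0 ≤ β := (abs_nonneg _).trans (hB 0 0)
  have hR := h.R1
  have ht := h.tpos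
  have hT : 0 < T := ht.trans_le h.tT
  have hD : |D| = 2 * R := by
    rw [← abs_of_nonneg (by linarith : 0 ≤ 2 * R)]
    exact (sq_eq_sq_iff_abs_eq_abs _ _).1 (by rw [h.D2]; ring)
  have hDi : |D⁻¹| * R = 1 / 2 := by
    rw [abs_inv, hD]
    field_simp
  have e1 := abs_mul_le_omw_left h.pos1 h.pos2 h.hf (h.hv a)
  have e2 := abs_mul_le_omw_right h.pos1 h.pos2 (h.hu a) h.hg
  have e3 := abs_add_le (f * v a) (g * u a)
  rw [abs_mul, abs_mul] at e3
  have e4 : |f| * |g| ≤ 4 * T * omw κ i1 i2 := by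
    have := h.κ0
    have := h.pos1
    have := h.pos2
    have h1 := mul_le_mul h.hf h.hg (abs_nonneg _) (by positivity)
    have h3 : 0 ≤ κ ^ 2 * (i1 ^ 3 * i2) := by positivity
    calc |f| * |g| ≤ κ * i1 * (κ * i2) * 1 := by linarith
      _ ≤ κ * i1 * (κ * i2) * (4 * T * i2 ^ 2) := by gcongr; exact h.far2
      _ = 4 * T * (κ ^ 2 * (i1 * i2 ^ 3)) := by ring
      _ ≤ _ := by
        unfold omw
        gcongr
        nlinarith [mul_pos (pow_pos h.pos1 3) h.pos2]
  have e5 := abs_add_le (l * (f * g)) (L * (f * v a + g * u a))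
  rw [abs_mul, abs_mul f, abs_mul L] at e5
  have e6 : |l| * (|f| * |g|) ≤ β * (4 * T * omw κ i1 i2) := by gcongr
  have e7 : |L| * |f * v a + g * u a| ≤ 16 * β * T * (2 * omw κ i1 i2) := by
    gcongr
    linarith
  rw [abs_mul, abs_neg, mul_right_comm, hDi]
  have h4 : β * T * omw κ i1 i2 ≤ β * (3 * t) * omw κ i1 i2 := by
    have := h.Tt
    gcongr
  have h5 : 0 ≤ β * t * omw κ i1 i2 := by positivity
  linarith

end Loc

/-- Translation of a spacetime point along the `x`-axis. -/
def sh (c : ℝ) (p : Pt) : Pt := p - Pi.single 1 c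

lemma tr_sh (c : ℝ) (f : Fld) (p : Pt) : tr c f (sh c p) = f p := by
  unfold tr sh
  rw [sub_add_cancel]

lemma sh_zero (c : ℝ) (p : Pt) : sh c p 0 = p 0 := by simp [sh]

/-- Minus the lowered position vector relative to the center `c`. -/
def xc (c : ℝ) (p : Pt) (a : Fin 4) : ℝ := -(m4 a * sh c p a)

lemma abs_m4 (a : Fin 4) : |m4 a| = 1 := by fin_cases a <;> simp [m4]

lemma th_pos (ht : 0 ≤ t) : 0 < th t := Real.rpow_pos_of_pos (by linarith) _

/-- The pointwise content of `Good`. -/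
lemma point_of_good (h : Good R c K 0 f) (hK : 0 ≤ K) (hp : 0 ≤ p 0) : |f p| ≤ 147 * K * (th (p 0) /
    (1 + p 0)) * (av (sh c p))⁻¹ ∧ (∀ a, |pd a f p| ≤ 147 * K * (th (p 0) / (1 + p 0)) * (av (sh c
    p))⁻¹ ^ 3) ∧ (∀ a, |p 0 * pd a f p - xc c p a * pd 0 f p| ≤ 147 * K * (th (p 0) / (1 + p 0)) *
      (av (sh c p))⁻¹) ∧ |box f p| * (1 + p 0) ≤ 147 * K * (th (p 0) / (1 + p 0)) * (av (sh c p))⁻¹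
    ^ 3 := by
  have hq : 0 ≤ sh c p 0 := by rwa [sh_zero]
  have hθ := th_pos hp
  have ha := one_le_av (sh c p)
  have hsq := av_sq (sh c p)
  obtain ⟨A, hA⟩ : ∃ A, A = av (sh c p) := ⟨_, rfl⟩
  rw [← hA] at ha hsq ⊢
  have hT : 0 < 1 + p 0 := by linarith
  have hr := rr_nonneg (sh c p)
  have hs : 1 + p 0 ≤ ss (sh c p) := by unfold ss; rw [sh_zero]; linarith
  have hA0 : 0 < A := by linarith
  have key : ∀ x : ℝ, |x| * (ss (sh c p) * A) ≤ K * th (p 0) →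
      |x| ≤ K * (th (p 0) / (1 + p 0)) * A⁻¹ := by
    intro x hx
    have : |x| * ((1 + p 0) * A) ≤ K * th (p 0) := le_trans (by gcongr) hx
    rw [show K * (th (p 0) / (1 + p 0)) * A⁻¹ = K * th (p 0) / ((1 + p 0) * A) by field_simp]
    rwa [le_div_iff₀ (by positivity)]
  have hB : 0 ≤ K * (th (p 0) / (1 + p 0)) * A⁻¹ := by positivity
  have h0 : ∀ Z, |zap Z (tr c f) (sh c p)| ≤ K * (th (p 0) / (1 + p 0)) * A⁻¹ := by
    intro Z
    refine key _ ?_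
    have := h.val [Z] (by simp) (sh c p) hq
    rw [sh_zero, ← hA] at this
    exact this
  have hd : ∀ a, pd a (tr c f) (sh c p) = pd a f p := fun a => by rw [pd_tr, tr_sh]
  refine ⟨?_, fun a => ?_, fun a => ?_, ?_⟩
  · have := h.val [] (by simp) (sh c p) hq
    rw [sh_zero, ← hA, gam, tr_sh] at this
    linarith [key _ this]
  · have h1 := one_add_abs_mul_pd_le (tr c f) hq a
    have h2 : G1 (tr c f) (sh c p) ≤ 21 * (K * (th (p 0) / (1 + p 0)) * A⁻¹) := by
      unfold G1
      refine (sum_le_card_nsmul univ _ _ fun Z _ => h0 Z).trans_eq ?_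
      rw [nsmul_eq_mul]
      congr 1
    rw [← hsq, hd] at h1
    calc |pd a f p| = (A ^ 2 * |pd a f p|) * A⁻¹ ^ 2 := by field_simp
      _ ≤ (7 * (21 * (K * (th (p 0) / (1 + p 0)) * A⁻¹))) * A⁻¹ ^ 2 := by
        exact mul_le_mul_of_nonneg_right (h1.trans (by linarith)) (by positivity)
      _ = _ := by ring
  · by_cases h00 : a = 0
    · subst h00
      have : p 0 * pd 0 f p - xc c p 0 * pd 0 f p = 0 := by simp [xc, m4, sh_zero]
      rw [this, abs_zero]
      linarith
    · have h1 := h0 (Sum.inr (Sum.inl (a, 0)))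
      rw [zap_lor, hd, hd, sh_zero] at h1
      have : p 0 * pd a f p - xc c p a * pd 0 f p =
          m4 a * sh c p a * pd 0 f p - m4 0 * p 0 * pd a f p := by
        simp only [xc, m4, Matrix.cons_val_zero]
        ring
      rw [this]
      linarith
  · have := h.bx [] (by simp) (sh c p) hq
    rw [sh_zero, ← hA, gam, box_tr, tr_sh] at this
    have h1 : |box f p| * ((1 + p 0) ^ 2 * A ^ 3) ≤ K * th (p 0) := le_trans (by gcongr) this
    calc |box f p| * (1 + p 0) = (|box f p| * ((1 + p 0) ^ 2 * A ^ 3)) * ((1 + p 0)⁻¹ * A⁻¹ ^ 3) := by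
          field_simp
      _ ≤ (K * th (p 0)) * ((1 + p 0)⁻¹ * A⁻¹ ^ 3) := by gcongr
      _ = K * (th (p 0) / (1 + p 0)) * A⁻¹ ^ 3 := by ring
      _ ≤ _ := by
        have : 0 ≤ K * (th (p 0) / (1 + p 0)) * A⁻¹ ^ 3 := by positivity
        linarith

lemma zero_off_of_good (h : Good R c K 0 f) (hp : 0 ≤ p 0) (hs : R / 2 + p 0 < rr (sh c p)) : f p =
    0 ∧ (∀ a, pd a f p = 0) ∧ box f p = 0 := by
  have hf : Sm (tr c f) := h.sm.tr c
  have hq : 0 ≤ sh c p 0 := by rwa [sh_zero]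
  have hs' : R / 2 + sh c p 0 < rr (sh c p) := by rwa [sh_zero]
  refine ⟨?_, fun a => ?_, ?_⟩
  · rw [← tr_sh c f p]; exact h.supp _ hq hs'
  · rw [← tr_sh c (pd a f) p, ← pd_tr]; exact h.supp.pder hf a _ hq hs'
  · rw [← tr_sh c (box f) p, ← box_tr]; exact h.supp.box hf _ hq hs'

lemma far_aux {i : ℝ} (ht : 0 < t) (hr : 0 ≤ r) (hRt : R ≤ 2 * t) (hT : T = 1 + t) (hs : r ≤ R / 2 +
    t) (hi : i ^ 2 * (1 + |t - r|) = 1) : 1 ≤ 4 * T * i ^ 2 ∧ |r ^ 2 - t ^ 2| * i ^ 2 ≤ 4 * T := by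
  have h1 : |t - r| ≤ t := abs_le.2 ⟨by linarith, by linarith⟩
  have h2 : |r ^ 2 - t ^ 2| = |t - r| * (t + r) := by
    rw [show r ^ 2 - t ^ 2 = -((t - r) * (t + r)) by ring, abs_neg, abs_mul,
      abs_of_nonneg (by linarith : 0 ≤ t + r)]
  have h3 : 0 ≤ i ^ 2 := sq_nonneg _
  constructor
  · nlinarith
  · rw [h2]
    have h4 : i ^ 2 * |t - r| ≤ 1 := by nlinarith
    nlinarith [mul_le_mul_of_nonneg_right h4 (by linarith : 0 ≤ t + r)]

lemma sq_rr_sh (c : ℝ) (p : Pt) : ∑ a, m4 a * (xc c p a * xc c p a) = rr (sh c p) ^ 2 - p 0 ^ 2 :=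
    by
  rw [rr_sq]
  simp only [Fin.sum_univ_four, xc, m4, sh_zero]
  simp
  ring

lemma abs_xc_le (c : ℝ) (hp : 0 ≤ p 0) (a : Fin 4) : |xc c p a| ≤ p 0 + rr (sh c p) := by
  have hr := rr_nonneg (sh c p)
  unfold xc
  rw [abs_neg, abs_mul, abs_m4, one_mul]
  refine Fin.cases ?_ (fun i => ?_) a
  · rw [sh_zero, abs_of_nonneg hp]; linarith
  · have := abs_coord_le_rr (sh c p) i
    unfold sidx at this
    linarith

lemma two_R_le (hD : (c1 - c2) ^ 2 = 4 * R ^ 2) (hR : 1 ≤ R) (p : Pt) : 2 * R ≤ rr (sh c1 p) + rr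
    (sh c2 p) := by
  have h1 := abs_coord_le_rr (sh c1 p) 0
  have h2 := abs_coord_le_rr (sh c2 p) 0
  rw [sidx_zero] at h1 h2
  have e : ∀ c, sh c p 1 = p 1 - c := fun c => by simp [sh]
  rw [e] at h1 h2
  have : |c1 - c2| = 2 * R := by
    rw [← abs_of_nonneg (by linarith : 0 ≤ 2 * R)]
    exact (sq_eq_sq_iff_abs_eq_abs _ _).1 (by rw [hD]; ring)
  have h3 := abs_sub (p 1 - c2) (p 1 - c1)
  rw [show p 1 - c2 - (p 1 - c1) = c1 - c2 by ring] at h3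
  linarith

lemma loc_of_good (hR : 1 ≤ R) (hD : (c1 - c2) ^ 2 = 4 * R ^ 2) (hK : 0 ≤ K) (hf : Good R c1 K 0 f)
    (hg : Good R c2 K 0 g) (hp : 0 ≤ p 0) (h1 : rr (sh c1 p) ≤ R / 2 + p 0) (h2 : rr (sh c2 p) ≤ R /
    2 + p 0) : Loc (p 0) (1 + p 0) R (c1 - c2) (147 * K * (th (p 0) / (1 + p 0))) (av (sh c1 p))⁻¹
      (av (sh c2 p))⁻¹ (fun a => pd a f p) (fun a => pd a g p) (xc c1 p) (xc c2 p) (f p) (g p) (box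
      f p) (box g p) := by
  have h3 := two_R_le hD hR p
  have hRt : R ≤ 2 * p 0 := by linarith
  have ht : 0 < p 0 := by linarith
  have hθ := th_pos hp
  obtain ⟨f1, f2, f3, f4⟩ := point_of_good hf hK hp
  obtain ⟨g1, g2, g3, g4⟩ := point_of_good hg hK hp
  have ha := fun c => one_le_av (sh c p)
  have hi : ∀ c, (av (sh c p))⁻¹ ^ 2 * (1 + |p 0 - rr (sh c p)|) = 1 := fun c => by
    have e := av_sq (sh c p)
    rw [sh_zero] at e
    have := ha c
    rw [← e, ← mul_pow, inv_mul_cancel₀ (by linarith), one_pow]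
  have q1 := far_aux ht (rr_nonneg _) hRt rfl h1 (hi c1)
  have q2 := far_aux ht (rr_nonneg _) hRt rfl h2 (hi c2)
  exact
    { tpos := ht
      tT := by linarith
      Tt := by linarith
      R1 := hR
      Rt := hRt
      D2 := hD
      κ0 := by positivity
      pos1 := inv_pos.2 (by linarith [ha c1])
      le1 := inv_le_one_of_one_le₀ (ha c1)
      pos2 := inv_pos.2 (by linarith [ha c2])
      le2 := inv_le_one_of_one_le₀ (ha c2)
      far1 := q1.1
      far2 := q2.1
      hf := f1
      hg := g1
      hu := f2
      hv := g2
      hU := f3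
      hV := g3
      hbf := f4
      hbg := g4
      hX1 := fun a => by linarith [abs_xc_le c1 hp a]
      hX2 := fun a => by linarith [abs_xc_le c2 hp a]
      hm1 := by rw [sq_rr_sh]; exact q1.2
      hm2 := by rw [sq_rr_sh]; exact q2.2
      hD := fun a => by
        by_cases h : a = 1
        · subst h
          simp [xc, sh, m4]
        · simp [xc, sh, h] }

/-- The common domain of influence. -/
def Dom (R c1 c2 : ℝ) (p : Pt) : Prop := rr (sh c1 p) ≤ R / 2 + p 0 ∧ rr (sh c2 p) ≤ R / 2 + p 0

open Classical in
/-- The interaction weight of two waves centered at `c1`, `c2`. -/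
def wt (R c1 c2 : ℝ) (p : Pt) : ℝ :=
  if Dom R c1 c2 p then omw (th (p 0) / (1 + p 0)) (av (sh c1 p))⁻¹ (av (sh c2 p))⁻¹ else 0

lemma av_pos (p : Pt) : 0 < av p := lt_of_lt_of_le one_pos (one_le_av p)

lemma omw_mul (a κ i j : ℝ) : omw (a * κ) i j = a ^ 2 * omw κ i j := by unfold omw; ring

lemma wt_nonneg (R c1 c2 : ℝ) (p : Pt) : 0 ≤ wt R c1 c2 p := by
  unfold wt
  split_ifs
  · exact omw_nonneg (inv_pos.2 (av_pos _)) (inv_pos.2 (av_pos _))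
  · exact le_rfl

lemma wt_pos (hp : 0 ≤ p 0) (hd : Dom R c1 c2 p) : 0 < wt R c1 c2 p := by
  have := th_pos hp
  have := av_pos (sh c1 p)
  have := av_pos (sh c2 p)
  rw [wt, if_pos hd, omw]
  positivity

lemma wt_symm (R c1 c2 : ℝ) (p : Pt) : wt R c1 c2 p = wt R c2 c1 p := by
  unfold wt Dom omw
  simp only [and_comm (a := rr (sh c1 p) ≤ R / 2 + p 0)]
  congr 1
  ring

/-- `h` is, up to a term of size `1/R`, the wave operator of a small correction. -/
def PEst (R c1 c2 A : ℝ) (h : Fld) : Prop :=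
  ∃ N : Fld, Sm N ∧ ∀ p : Pt, 0 ≤ p 0 →
    (¬ Dom R c1 c2 p → N p = 0) ∧
    (∀ a, |pd a N p| * R ≤ A * (p 0 * wt R c1 c2 p)) ∧
    |h p - box N p| * R ≤ A * wt R c1 c2 p ∧
    |h p| * p 0 ≤ A * (R * wt R c1 c2 p)

lemma PEst.symm (H : PEst R c1 c2 A h) : PEst R c2 c1 A h := by
  obtain ⟨N, hN, H⟩ := H
  refine ⟨N, hN, fun p hp => ?_⟩
  have e : Dom R c2 c1 p ↔ Dom R c1 c2 p := and_comm
  rw [wt_symm R c2 c1, e]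
  exact H p hp

lemma PEst.mono (H : PEst R c1 c2 A h) (hR : 0 ≤ R) (hAB : A ≤ B) : PEst R c1 c2 B h := by
  obtain ⟨N, hN, H⟩ := H
  refine ⟨N, hN, fun p hp => ?_⟩
  have hw := wt_nonneg R c1 c2 p
  obtain ⟨h1, h2, h3, h4⟩ := H p hp
  exact ⟨h1, fun a => (h2 a).trans (by gcongr), h3.trans (by gcongr), h4.trans (by gcongr)⟩

lemma PEst.add {k : Fld} (H : PEst R c1 c2 A h) (H' : PEst R c1 c2 B k) (hR : 0 ≤ R) : PEst R c1 c2
    (A + B) (fun p => h p + k p) := by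
  obtain ⟨N, hN, H⟩ := H
  obtain ⟨N', hN', H'⟩ := H'
  refine ⟨fun p => N p + N' p, hN.add hN', fun p hp => ?_⟩
  obtain ⟨h1, h2, h3, h4⟩ := H p hp
  obtain ⟨k1, k2, k3, k4⟩ := H' p hp
  have key : ∀ x y z u v : ℝ, 0 ≤ z → |x| * z ≤ A * u → |y| * z ≤ B * u →
      |x + y| * z ≤ (A + B) * u := fun x y z u v hz hx hy => by
    have := mul_le_mul_of_nonneg_right (abs_add_le x y) hz
    linarith
  refine ⟨fun hd => by simp [h1 hd, k1 hd], fun a => ?_, ?_, key _ _ _ _ 0 hp h4 k4⟩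
  · rw [pd_add hN hN']
    exact key _ _ _ _ 0 hR (h2 a) (k2 a)
  · rw [box_add hN hN', show h p + k p - (box N p + box N' p) = h p - box N p + (k p - box N' p) by ring]
    exact key _ _ _ _ 0 hR h3 k3

lemma PEst.const_mul (H : PEst R c1 c2 A h) (c : ℝ) : PEst R c1 c2 (|c| * A) (fun p => c * h p) :=
    by
  obtain ⟨N, hN, H⟩ := H
  refine ⟨fun p => c * N p, contDiff_const.mul hN, fun p hp => ?_⟩
  obtain ⟨h1, h2, h3, h4⟩ := H p hp
  have key : ∀ x z u : ℝ, |x| * z ≤ A * u → |c * x| * z ≤ |c| * A * u := fun x z u hx => by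
    rw [abs_mul, mul_assoc, mul_assoc]
    exact mul_le_mul_of_nonneg_left hx (abs_nonneg c)
  refine ⟨fun hd => by simp [h1 hd], fun a => ?_, ?_, key _ _ _ h4⟩
  · rw [pd_const_mul hN]
    exact key _ _ _ (h2 a)
  · rw [box_const_mul hN, ← mul_sub]
    exact key _ _ _ h3

/-- The normal form for a bilinear form with coefficients `B`. -/
def nrm (B : Ten2) (c1 c2 : ℝ) (f g : Fld) : Fld := fun p =>
  -(c1 - c2)⁻¹ * ((∑ b, B 1 b * xc c2 p b) * (f p * g p))

lemma sm_xc (c : ℝ) (a : Fin 4) : Sm (fun p => xc c p a) := by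
  unfold xc sh
  have : ContDiff ℝ (⊤ : ℕ∞) fun p : Pt => p a := contDiff_apply ℝ ℝ a
  simp only [Pi.sub_apply]
  exact (contDiff_const.mul (this.sub contDiff_const)).neg

lemma pd_xc (c : ℝ) (b a : Fin 4) : pd a (fun p => xc c p b) = fun _ => if b = a then -m4 b else 0 := by
  have e : (fun p => xc c p b) = fun p => (-m4 b) * p b + m4 b * (Pi.single 1 c : Pt) b := by
    funext p
    simp only [xc, sh, Pi.sub_apply]
    ring
  have hs : Sm fun p : Pt => p b := contDiff_apply ℝ ℝ b
  rw [e, pd_add (contDiff_const.mul hs) contDiff_const, pd_const_mul hs, pd_coord, pd_const]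
  funext p
  split_ifs <;> simp

lemma sm_ell (B : Ten2) (c : ℝ) : Sm (fun p => ∑ b, B 1 b * xc c p b) :=
  ContDiff.sum fun b _ => contDiff_const.mul (sm_xc c b)

lemma pd_ell (B : Ten2) (c : ℝ) (a : Fin 4) : pd a (fun p => ∑ b, B 1 b * xc c p b) = fun _ => -(B 1
    a * m4 a) := by
  rw [pd_sum _ (fun b => contDiff_const.mul (sm_xc c b))]
  funext p
  simp only [pd_const_mul (sm_xc c _), pd_xc, mul_ite, mul_zero, Finset.sum_ite_eq', mem_univ,
    if_true]
  ring

lemma box_ell (B : Ten2) (c : ℝ) : box (fun p => ∑ b, B 1 b * xc c p b) = fun _ => 0 := by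
  rw [box_eq]
  funext p
  simp only [pd_ell, pd_const, mul_zero, Finset.sum_const_zero]

lemma sm_nrm (B : Ten2) (c1 c2 : ℝ) (hf : Sm f) (hg : Sm g) : Sm (nrm B c1 c2 f g) :=
  contDiff_const.mul ((sm_ell B c2).mul (hf.mul hg))

lemma pd_nrm (B : Ten2) (c1 c2 : ℝ) (hf : Sm f) (hg : Sm g) (a : Fin 4) (p : Pt) : pd a (nrm B c1 c2
    f g) p = -(c1 - c2)⁻¹ * (-(B 1 a * m4 a) * (f p * g p) + (∑ b, B 1 b * xc c2 p b) * (f p * pd a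
      g p + g p * pd a f p)) := by
  have hl := sm_ell B c2
  have hfg : Sm fun p => f p * g p := hf.mul hg
  unfold nrm
  rw [pd_const_mul (hl.mul hfg), pd_mul hl hfg, pd_ell, pd_mul hf hg]
  ring

lemma box_nrm (B : Ten2) (c1 c2 : ℝ) (hf : Sm f) (hg : Sm g) (p : Pt) : box (nrm B c1 c2 f g) p =
    -(c1 - c2)⁻¹ * ((∑ b, B 1 b * xc c2 p b) * (f p * box g p + g p * box f p + 2 * ∑ d, m4 d * (pd
      d f p * pd d g p)) + 2 * ∑ d, m4 d * (-(B 1 d * m4 d) * (f p * pd d g p + g p * pd d f p))) :=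
      by
  have hl := sm_ell B c2
  have hfg : Sm fun p => f p * g p := hf.mul hg
  unfold nrm
  rw [box_const_mul (hl.mul hfg), box_mul hl hfg, box_ell, box_mul hf hg]
  simp only [pd_ell, pd_mul hf hg]
  ring

/-- The quadratic symbol evaluated on the position covector. -/
def qf (B : Ten2) (X : Fin 4 → ℝ) : ℝ := ∑ a, ∑ b, B a b * X a * X b

/-- Local normal form estimate with remainder `ρ`. -/
def PLoc (R c1 c2 κ A : ℝ) (h N ρ : Fld) : Prop :=
  Sm N ∧ ∀ p : Pt, 0 ≤ p 0 →
    (¬ Dom R c1 c2 p → N p = 0 ∧ (∀ a, pd a N p = 0) ∧ box N p = 0 ∧ h p = 0) ∧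
    (Dom R c1 c2 p → (∀ a, |pd a N p| * R ≤ A * (p 0 * (κ ^ 2 * wt R c1 c2 p))) ∧ |p 0 ^ 2 * (h p -
      box N p) - ρ p| * R ≤ A * (p 0 ^ 2 * (κ ^ 2 * wt R c1 c2 p)) ∧ |p 0 ^ 2 * h p - ρ p| ≤ A * (R
      * p 0 * (κ ^ 2 * wt R c1 c2 p)))

lemma not_dom (hf : Good R c1 K 0 f) (hg : Good R c2 K 0 g) (hp : 0 ≤ p 0) (hd : ¬ Dom R c1 c2 p) :
    (f p = 0 ∧ (∀ a, pd a f p = 0) ∧ box f p = 0) ∨ (g p = 0 ∧ (∀ a, pd a g p = 0) ∧ box g p = 0) := by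
  unfold Dom at hd
  rw [not_and_or, not_le, not_le] at hd
  exact hd.imp (zero_off_of_good hf hp) (zero_off_of_good hg hp)

lemma ploc_bilin {B : Ten2} (hB : ∀ a b, |B a b| ≤ β) (hR : 1 ≤ R) (hD : (c1 - c2) ^ 2 = 4 * R ^ 2)
    (hK : 0 ≤ K) (hf : Good R c1 K 0 f) (hg : Good R c2 K 0 g) : PLoc R c1 c2 (147 * K) (20000 * β)
    (nf2 B f g) (nrm B c1 c2 f g) (fun p => qf B (xc c2 p) * (pd 0 f p * pd 0 g p)) := by
  have hfs : Sm f := hf.sm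
  have hgs : Sm g := hg.sm
  have hβ : 0 ≤ β := (abs_nonneg _).trans (hB 0 0)
  refine ⟨sm_nrm B c1 c2 hfs hgs, fun p hp => ⟨fun hd => ?_, fun hd => ?_⟩⟩
  · rcases not_dom hf hg hp hd with ⟨e1, e2, e3⟩ | ⟨e1, e2, e3⟩
    · refine ⟨?_, fun a => ?_, ?_, ?_⟩
      · simp [nrm, e1]
      · simp [pd_nrm B c1 c2 hfs hgs, e1, e2]
      · simp [box_nrm B c1 c2 hfs hgs, e1, e2, e3]
      · simp [nf2, e2]
    · refine ⟨?_, fun a => ?_, ?_, ?_⟩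
      · simp [nrm, e1]
      · simp [pd_nrm B c1 c2 hfs hgs, e1, e2]
      · simp [box_nrm B c1 c2 hfs hgs, e1, e2, e3]
      · simp [nf2, e2]
  · have L := loc_of_good hR hD hK hf hg hp hd.1 hd.2
    have hl : ∀ a, |-(B 1 a * m4 a)| ≤ β := fun a => by
      rw [abs_neg, abs_mul, abs_m4, mul_one]
      exact hB 1 a
    have h1 := fun a => L.normal_form_grad_le hB (hl a) a
    have h2 := L.normal_form_le hB hl
    have h3 := L.form_le hB
    have ew : (147 * K) ^ 2 * wt R c1 c2 p =
        omw (147 * K * (th (p 0) / (1 + p 0))) (av (sh c1 p))⁻¹ (av (sh c2 p))⁻¹ := by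
      rw [omw_mul, wt, if_pos hd]
    rw [ew]
    have ho : 0 ≤ omw (147 * K * (th (p 0) / (1 + p 0))) (av (sh c1 p))⁻¹ (av (sh c2 p))⁻¹ :=
      omw_nonneg L.pos1 L.pos2
    refine ⟨fun a => ?_, ?_, ?_⟩
    · rw [pd_nrm B c1 c2 hfs hgs]
      refine (h1 a).trans ?_
      have : 0 ≤ β * (p 0 * omw (147 * K * (th (p 0) / (1 + p 0))) (av (sh c1 p))⁻¹ (av (sh c2 p))⁻¹) := by
        positivity
      linarith
    · rw [box_nrm B c1 c2 hfs hgs]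
      refine h2.trans (le_of_eq ?_)
      ring
    · refine h3.trans ?_
      have : 0 ≤ β * (R * p 0 * omw (147 * K * (th (p 0) / (1 + p 0))) (av (sh c1 p))⁻¹ (av (sh c2
          p))⁻¹) := by positivity
      linarith

lemma PLoc.pest {κ : ℝ} {N ρ : Fld} (H : PLoc R c1 c2 κ A h N ρ) (hR : 1 ≤ R) (hD : (c1 - c2) ^ 2 =
    4 * R ^ 2) (hρ : ∀ p : Pt, 0 ≤ p 0 → Dom R c1 c2 p → |ρ p| ≤ B * (p 0 * (κ ^ 2 * wt R c1 c2 p)))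
    (hB : 0 ≤ B) : PEst R c1 c2 ((A + 2 * B) * κ ^ 2) h := by
  refine ⟨N, H.1, fun p hp => ?_⟩
  obtain ⟨H1, H2⟩ := H.2 p hp
  by_cases hd : Dom R c1 c2 p
  · obtain ⟨h1, h2, h3⟩ := H2 hd
    have h4 := hρ p hp hd
    have hw := wt_nonneg R c1 c2 p
    have h5 := two_R_le hD hR p
    have hRt : R ≤ 2 * p 0 := by linarith [hd.1, hd.2]
    obtain ⟨w, hw'⟩ : ∃ w, w = κ ^ 2 * wt R c1 c2 p := ⟨_, rfl⟩
    have hw0 : 0 ≤ w := by rw [hw']; positivity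
    obtain ⟨t, ht⟩ : ∃ t, t = p 0 := ⟨_, rfl⟩
    rw [← ht] at hRt hp h1 h2 h3 h4 ⊢
    rw [← hw'] at h1 h2 h3 h4
    have htp : 0 < t := by linarith
    have eA : ∀ y, (A + 2 * B) * κ ^ 2 * (y * wt R c1 c2 p) = (A + 2 * B) * (y * w) := fun y => by
      rw [hw']; ring
    have eA' : (A + 2 * B) * κ ^ 2 * wt R c1 c2 p = (A + 2 * B) * w := by rw [hw']; ring
    refine ⟨fun h => absurd hd h, fun a => ?_, ?_, ?_⟩
    · rw [eA]
      have : 0 ≤ B * (t * w) := by positivity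
      linarith [h1 a]
    · rw [eA']
      have e1 := abs_add_le (t ^ 2 * (h p - box N p) - ρ p) (ρ p)
      rw [sub_add_cancel, abs_mul, abs_of_nonneg (by positivity : 0 ≤ t ^ 2)] at e1
      have e2 := mul_le_mul_of_nonneg_right e1 (by linarith : 0 ≤ R)
      have e3 : |ρ p| * R ≤ B * (t * w) * (2 * t) := mul_le_mul h4 hRt (by linarith) (by positivity)
      have e4 : t ^ 2 * (|h p - box N p| * R) ≤ t ^ 2 * ((A + 2 * B) * w) := by linarith
      exact le_of_mul_le_mul_left e4 (by positivity)
    · rw [eA]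
      have e1 := abs_add_le (t ^ 2 * h p - ρ p) (ρ p)
      rw [sub_add_cancel, abs_mul, abs_of_nonneg (by positivity : 0 ≤ t ^ 2)] at e1
      have e3 : 0 ≤ B * (t * w) * (R - 1) := mul_nonneg (by positivity) (by linarith)
      have e5 : 0 ≤ B * (t * w) := by positivity
      have e4 : t * (|h p| * t) ≤ t * ((A + 2 * B) * (R * w)) := by nlinarith
      exact le_of_mul_le_mul_left e4 htp
  · obtain ⟨h1, h2, h3, h4⟩ := H1 hd
    have : wt R c1 c2 p = 0 := if_neg hd
    simp [h1, h2, h3, h4, this]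

/-- The null covector at the angular position of `p` relative to the center `c`. -/
def nuc (c : ℝ) (p : Pt) (a : Fin 4) : ℝ := if a = 0 then rr (sh c p) else xc c p a

lemma mink_nuc (c : ℝ) (p : Pt) : mink (nuc c p) = 0 := by
  have := rr_sq (sh c p)
  simp only [mink, nuc, xc, m4]
  simp
  linarith

lemma abs_xc_sub_nuc (c : ℝ) (p : Pt) (a : Fin 4) : |xc c p a - nuc c p a| ≤ |p 0 - rr (sh c p)| :=
    by
  unfold nuc
  split_ifs with h
  · subst h
    simp [xc, m4, sh_zero]
  · simp

lemma abs_nuc_le (c : ℝ) (hp : 0 ≤ p 0) (a : Fin 4) : |nuc c p a| ≤ p 0 + rr (sh c p) := by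
  have := rr_nonneg (sh c p)
  unfold nuc
  split_ifs with h
  · rw [abs_of_nonneg this]; linarith
  · exact abs_xc_le c hp a

lemma abs_sum4_le {f : Fin 4 → ℝ} (h : ∀ a, |f a| ≤ B) : |∑ a, f a| ≤ 4 * B := by
  refine (abs_sum_le_sum_abs _ _).trans ?_
  refine (sum_le_card_nsmul _ _ _ fun a _ => h a).trans_eq ?_
  rw [nsmul_eq_mul, card_univ, Fintype.card_fin]
  norm_num

lemma abs_mul_sub_mul_le {a b x y N d e : ℝ} (ha : |a| ≤ M) (hy : |y| ≤ N) (hd : |a - x| ≤ d) (he :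
    |b - y| ≤ e) (hM : 0 ≤ M) (hd0 : 0 ≤ d) : |a * b - x * y| ≤ M * e + d * N := by
  rw [show a * b - x * y = a * (b - y) + (a - x) * y by ring]
  refine (abs_add_le _ _).trans ?_
  rw [abs_mul, abs_mul]
  gcongr

lemma qf_null (hG : NullForm2 G) (hβ : ∀ a b, |G a b| ≤ β) (c : ℝ) (hp : 0 ≤ p 0) : |qf G (xc c p)|
    ≤ 32 * β * (p 0 + rr (sh c p)) * |p 0 - rr (sh c p)| := by
  have h0 : qf G (nuc c p) = 0 := hG _ (mink_nuc c p)
  have hr := rr_nonneg (sh c p)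
  rw [← sub_zero (qf G (xc c p)), ← h0]
  unfold qf
  rw [← sum_sub_distrib]
  simp only [← sum_sub_distrib]
  have := abs_sum4_le fun a => abs_sum4_le (B := β * (2 * (p 0 + rr (sh c p)) * |p 0 - rr (sh c p)|))
    (f := fun b => G a b * xc c p a * xc c p b - G a b * nuc c p a * nuc c p b) fun b => by
      rw [show G a b * xc c p a * xc c p b - G a b * nuc c p a * nuc c p b =
        G a b * (xc c p a * xc c p b - nuc c p a * nuc c p b) by ring, abs_mul]
      refine mul_le_mul (hβ a b) ?_ (abs_nonneg _) ((abs_nonneg _).trans (hβ a b))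
      refine (abs_mul_sub_mul_le (abs_xc_le c hp a) (abs_nuc_le c hp b) (abs_xc_sub_nuc c p a)
        (abs_xc_sub_nuc c p b) (by linarith) (abs_nonneg _)).trans (le_of_eq ?_)
      ring
  exact this.trans (le_of_eq (by ring))

lemma qf3_null (hF : NullForm3 F) (hβ : ∀ a b c, |F a b c| ≤ β) (c : ℝ) (hp : 0 ≤ p 0) : |∑ d, qf
    (fun a b => F a b d) (xc c p) * xc c p d| ≤ 192 * β * (p 0 + rr (sh c p)) ^ 2 * |p 0 - rr (sh c
      p)| := by
  have hr := rr_nonneg (sh c p)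
  have e : ∀ X : Pt, (∑ d, qf (fun a b => F a b d) X * X d) =
      ∑ a, ∑ b, ∑ d, F a b d * X a * X b * X d := by
    intro X
    simp only [qf, sum_mul]
    rw [sum_comm]
    exact sum_congr rfl fun a _ => sum_comm
  have h0 := hF _ (mink_nuc c p)
  rw [e, ← sub_zero (∑ a, ∑ b, ∑ d, F a b d * xc c p a * xc c p b * xc c p d), ← h0]
  rw [← sum_sub_distrib]
  simp only [← sum_sub_distrib]
  have := abs_sum4_le fun a => abs_sum4_le fun b => abs_sum4_le
    (B := β * (3 * (p 0 + rr (sh c p)) ^ 2 * |p 0 - rr (sh c p)|))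
    (f := fun d => F a b d * xc c p a * xc c p b * xc c p d - F a b d * nuc c p a * nuc c p b * nuc
      c p d) fun d => by
      rw [show F a b d * xc c p a * xc c p b * xc c p d - F a b d * nuc c p a * nuc c p b * nuc c p d =
        F a b d * (xc c p a * (xc c p b * xc c p d) - nuc c p a * (nuc c p b * nuc c p d)) by ring,
        abs_mul]
      refine mul_le_mul (hβ a b d) ?_ (abs_nonneg _) ((abs_nonneg _).trans (hβ a b d))
      have h1 := abs_mul_sub_mul_le (abs_xc_le c hp b) (abs_nuc_le c hp d) (abs_xc_sub_nuc c p b)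
        (abs_xc_sub_nuc c p d) (by linarith) (abs_nonneg _)
      have h2 : |nuc c p b * nuc c p d| ≤ (p 0 + rr (sh c p)) * (p 0 + rr (sh c p)) := by
        rw [abs_mul]
        exact mul_le_mul (abs_nuc_le c hp b) (abs_nuc_le c hp d) (abs_nonneg _) (by linarith)
      refine (abs_mul_sub_mul_le (abs_xc_le c hp a) h2 (abs_xc_sub_nuc c p a) h1 (by linarith)
        (abs_nonneg _)).trans (le_of_eq ?_)
      ring
  exact this.trans (le_of_eq (by ring))

lemma Loc.uv_weight2_mul {κ i1 i2 : ℝ} {u v X1 X2 : Fin 4 → ℝ} {f g bf bg : ℝ} (h : Loc t T R D κ i1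
    i2 u v X1 X2 f g bf bg) (hc : 0 < c) (hm : |m| * i2 ^ 2 ≤ c * (4 * T)) : |m * (u 0 * v 0)| ≤ c *
    (4 * T * omw κ i1 i2) := by
  have h1 := h.uv_weight2 (m := c⁻¹ * m) (by
    rw [abs_mul, abs_of_pos (inv_pos.2 hc), mul_assoc, inv_mul_le_iff₀ hc]
    exact hm)
  rw [mul_assoc, abs_mul, abs_of_pos (inv_pos.2 hc), inv_mul_le_iff₀ hc] at h1
  exact h1

lemma omw_eq_wt (hd : Dom R c1 c2 p) : omw (147 * K * (th (p 0) / (1 + p 0))) (av (sh c1 p))⁻¹ (av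
    (sh c2 p))⁻¹ = (147 * K) ^ 2 * wt R c1 c2 p := by rw [omw_mul, wt, if_pos hd]

lemma abs_sub_mul_inv_av_le (c : ℝ) (p : Pt) : |p 0 - rr (sh c p)| * (av (sh c p))⁻¹ ^ 2 ≤ 1 := by
  have e := av_sq (sh c p)
  have := av_pos (sh c p)
  rw [sh_zero] at e
  rw [inv_pow, ← div_eq_mul_inv, div_le_one (by positivity), e]
  linarith

lemma dom_bounds (hR : 1 ≤ R) (hD : (c1 - c2) ^ 2 = 4 * R ^ 2) (hd : Dom R c1 c2 p) : R ≤ 2 * p 0 ∧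
    p 0 + rr (sh c2 p) ≤ 3 * (1 + p 0) ∧ 1 + p 0 ≤ 3 * p 0 := by
  have h1 := two_R_le hD hR p
  have h2 := hd.1
  have h3 := hd.2
  refine ⟨?_, ?_, ?_⟩ <;> linarith

lemma pest_nf2 (hG : NullForm2 G) : ∃ C : ℝ, 0 < C ∧ ∀ R c1 c2 K : ℝ, 1 ≤ R → (c1 - c2) ^ 2 = 4 * R
    ^ 2 → 0 ≤ K → ∀ f g : Fld, Good R c1 K 0 f → Good R c2 K 0 g → PEst R c1 c2 (C * K ^ 2) (nf2 G f
      g) := by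
  obtain ⟨β, hβ0, hβ⟩ : ∃ β : ℝ, 0 < β ∧ ∀ a b, |G a b| ≤ β := by
    refine ⟨1 + ∑ a, ∑ b, |G a b|, by positivity, fun a b => ?_⟩
    have h1 : |G a b| ≤ ∑ b, |G a b| :=
      single_le_sum (f := fun b => |G a b|) (fun _ _ => abs_nonneg _) (mem_univ b)
    have h2 : (∑ b, |G a b|) ≤ ∑ a, ∑ b, |G a b| :=
      single_le_sum (f := fun a => ∑ b, |G a b|)
        (fun _ _ => sum_nonneg fun _ _ => abs_nonneg _) (mem_univ a)
    linarith
  refine ⟨(20000 * β + 2 * (288 * β)) * 147 ^ 2, by positivity, fun R c1 c2 K hR hD hK f g hf hg => ?_⟩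
  have H := (ploc_bilin hβ hR hD hK hf hg).pest (B := 288 * β) hR hD (fun p hp hd => ?_)
    (by positivity)
  · rw [mul_pow, ← mul_assoc] at H
    exact H
  · have L := loc_of_good hR hD hK hf hg hp hd.1 hd.2
    obtain ⟨b1, b2, b3⟩ := dom_bounds hR hD hd
    have h1 := qf_null hG hβ c2 hp
    have h2 := abs_sub_mul_inv_av_le c2 p
    have h3 : |qf G (xc c2 p)| * (av (sh c2 p))⁻¹ ^ 2 ≤ 24 * β * (4 * (1 + p 0)) := by
      calc |qf G (xc c2 p)| * (av (sh c2 p))⁻¹ ^ 2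
          ≤ 32 * β * (p 0 + rr (sh c2 p)) * |p 0 - rr (sh c2 p)| * (av (sh c2 p))⁻¹ ^ 2 := by gcongr
        _ = 32 * β * (p 0 + rr (sh c2 p)) * (|p 0 - rr (sh c2 p)| * (av (sh c2 p))⁻¹ ^ 2) := by ring
        _ ≤ 32 * β * (3 * (1 + p 0)) * 1 := by gcongr
        _ = _ := by ring
    have h4 := L.uv_weight2_mul (by positivity) h3
    rw [omw_eq_wt hd] at h4
    have hw := wt_nonneg R c1 c2 p
    calc _ ≤ _ := h4
      _ ≤ 24 * β * (4 * (3 * p 0) * ((147 * K) ^ 2 * wt R c1 c2 p)) := by gcongr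
      _ = _ := by ring

lemma PLoc.sum {κ : ℝ} {h N ρ : Fin 4 → Fld} (hR : 1 ≤ R) (H : ∀ d, PLoc R c1 c2 κ A (h d) (N d) (ρ
    d)) : PLoc R c1 c2 κ (4 * A) (fun p => ∑ d, h d p) (fun p => ∑ d, N d p) (fun p => ∑ d, ρ d p)
    := by
  have hs : ∀ d, Sm (N d) := fun d => (H d).1
  refine ⟨ContDiff.sum fun d _ => hs d, fun p hp => ⟨fun hd => ?_, fun hd => ?_⟩⟩
  · have h1 := fun d => ((H d).2 p hp).1 hd
    refine ⟨sum_eq_zero fun d _ => (h1 d).1, fun a => ?_, ?_, sum_eq_zero fun d _ => (h1 d).2.2.2⟩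
    · rw [pd_sum _ hs]
      exact sum_eq_zero fun d _ => (h1 d).2.1 a
    · rw [box_sum _ hs]
      exact sum_eq_zero fun d _ => (h1 d).2.2.1
  · have h1 := fun d => ((H d).2 p hp).2 hd
    have hR0 : 0 < R := by linarith
    refine ⟨fun a => ?_, ?_, ?_⟩
    · rw [pd_sum _ hs, ← abs_of_pos hR0, ← abs_mul, sum_mul, abs_of_pos hR0, mul_assoc 4 A]
      refine abs_sum4_le fun d => ?_
      rw [abs_mul, abs_of_pos hR0]
      exact (h1 d).1 a
    · rw [box_sum _ hs, ← abs_of_pos hR0, ← abs_mul, ← sum_sub_distrib, mul_sum, ← sum_sub_distrib,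
        sum_mul, abs_of_pos hR0, mul_assoc 4 A]
      refine abs_sum4_le fun d => ?_
      rw [abs_mul, abs_of_pos hR0]
      exact (h1 d).2.1
    · rw [mul_sum, ← sum_sub_distrib, mul_assoc 4 A]
      exact abs_sum4_le fun d => (h1 d).2.2

lemma pest_nf3 (hF : NullForm3 F) : ∃ C : ℝ, 0 < C ∧ ∀ R c1 c2 K : ℝ, 1 ≤ R → (c1 - c2) ^ 2 = 4 * R
    ^ 2 → 0 ≤ K → ∀ f g : Fld, Good R c1 K 0 f → Good R c2 K 1 g → PEst R c1 c2 (C * K ^ 2) (nf3 F f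
      g) := by
  obtain ⟨β, hβ0, hβ⟩ : ∃ β : ℝ, 0 < β ∧ ∀ a b d, |F a b d| ≤ β := by
    refine ⟨1 + ∑ a, ∑ b, ∑ d, |F a b d|, by positivity, fun a b d => ?_⟩
    have h0 : |F a b d| ≤ ∑ d, |F a b d| :=
      single_le_sum (f := fun d => |F a b d|) (fun _ _ => abs_nonneg _) (mem_univ d)
    have h1 : (∑ d, |F a b d|) ≤ ∑ b, ∑ d, |F a b d| :=
      single_le_sum (f := fun b => ∑ d, |F a b d|)
        (fun _ _ => sum_nonneg fun _ _ => abs_nonneg _) (mem_univ b)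
    have h2 : (∑ b, ∑ d, |F a b d|) ≤ ∑ a, ∑ b, ∑ d, |F a b d| :=
      single_le_sum (f := fun a => ∑ b, ∑ d, |F a b d|)
        (fun _ _ => sum_nonneg fun _ _ => sum_nonneg fun _ _ => abs_nonneg _)
        (mem_univ a)
    linarith
  refine ⟨(4 * (20000 * β) + 2 * (25000 * β)) * 147 ^ 2, by positivity,
    fun R c1 c2 K hR hD hK f g hf hg => ?_⟩
  have hgs : Sm g := hg.sm
  have hgd : ∀ d, Good R c2 K 0 (pd d g) := fun d => hg.pd d
  have H0 := PLoc.sum hR fun d => ploc_bilin (B := fun a b => F a b d) (fun a b => hβ a b d) hR hD hK hf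
    (hgd d)
  have eh : (fun p => ∑ d, nf2 (fun a b => F a b d) f (pd d g) p) = nf3 F f g := by
    funext p
    simp only [nf2, nf3]
    rw [sum_comm]
    exact sum_congr rfl fun a _ => sum_comm
  rw [eh] at H0
  have H := H0.pest (B := 25000 * β) hR hD (fun p hp hd => ?_) (by positivity)
  · rw [mul_pow, ← mul_assoc] at H
    exact H
  · have L := loc_of_good hR hD hK hf (hgd 0) hp hd.1 hd.2
    obtain ⟨b1, b2, b3⟩ := dom_bounds hR hD hd
    have hr := rr_nonneg (sh c2 p)
    have hw := wt_nonneg R c1 c2 p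
    have h1 := qf3_null hF hβ c2 hp
    have h2 := abs_sub_mul_inv_av_le c2 p
    obtain ⟨Q, hQ⟩ : ∃ Q, Q = ∑ d, qf (fun a b => F a b d) (xc c2 p) * xc c2 p d := ⟨_, rfl⟩
    rw [← hQ] at h1
    have htp : 0 < p 0 := L.tpos
    have h3 : |Q| * (av (sh c2 p))⁻¹ ^ 2 ≤ 432 * β * (1 + p 0) * (4 * (1 + p 0)) := by
      calc |Q| * (av (sh c2 p))⁻¹ ^ 2
          ≤ 192 * β * (p 0 + rr (sh c2 p)) ^ 2 * |p 0 - rr (sh c2 p)| * (av (sh c2 p))⁻¹ ^ 2 := by gcongr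
        _ = 192 * β * (p 0 + rr (sh c2 p)) ^ 2 * (|p 0 - rr (sh c2 p)| * (av (sh c2 p))⁻¹ ^ 2) := by ring
        _ ≤ 192 * β * (3 * (1 + p 0)) ^ 2 * 1 := by gcongr
        _ = _ := by ring
    have h4 := L.uv_weight2_mul (by positivity) h3
    rw [omw_eq_wt hd] at h4
    obtain ⟨W, hW⟩ : ∃ W, W = (147 * K) ^ 2 * wt R c1 c2 p := ⟨_, rfl⟩
    have hW0 : 0 ≤ W := by rw [hW]; positivity
    have h5 : ∀ d, |qf (fun a b => F a b d) (xc c2 p) *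
        (pd 0 f p * (p 0 * pd 0 (pd d g) p - xc c2 p d * pd 0 (pd 0 g) p))| ≤
          16 * β * (3 * (1 + p 0)) ^ 2 * W := by
      intro d
      rw [abs_mul, abs_mul]
      have q1 : |qf (fun a b => F a b d) (xc c2 p)| ≤ 16 * β * (3 * (1 + p 0)) ^ 2 := by
        refine (abs_sum4_le fun a => abs_sum4_le (B := β * (3 * (1 + p 0)) ^ 2) fun b => ?_).trans_eq
          (by ring)
        rw [mul_assoc, abs_mul, abs_mul, sq]
        have hx := fun a => (abs_xc_le c2 hp a).trans b2
        exact mul_le_mul (hβ a b d) (mul_le_mul (hx a) (hx b) (abs_nonneg _) (by positivity))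
          (by positivity) hβ0.le
      have q2 := L.hV d
      simp only [pd_comm hgs d 0] at q2
      have q3 := abs_mul_le_omw_right L.pos1 L.pos2 (L.hu 0) q2
      rw [omw_eq_wt hd, ← hW] at q3
      rw [pd_comm hgs 0 d]
      rw [pd_comm hgs 0 d] at q3
      exact mul_le_mul q1 q3 (by positivity) (by positivity)
    have h6 := abs_sum4_le h5
    have e : p 0 * (∑ d, qf (fun a b => F a b d) (xc c2 p) * (pd 0 f p * pd 0 (pd d g) p)) =
        Q * (pd 0 f p * pd 0 (pd 0 g) p) + ∑ d, qf (fun a b => F a b d) (xc c2 p) *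
        (pd 0 f p * (p 0 * pd 0 (pd d g) p - xc c2 p d * pd 0 (pd 0 g) p)) := by
      rw [hQ, sum_mul, mul_sum, ← sum_add_distrib]
      exact sum_congr rfl fun d _ => by ring
    rw [← hW] at h4 ⊢
    have h7 := (abs_add_le (Q * (pd 0 f p * pd 0 (pd 0 g) p)) _).trans (add_le_add h4 h6)
    rw [← e, abs_mul, abs_of_pos htp] at h7
    refine le_of_mul_le_mul_left (h7.trans ?_) htp
    have h8 : (1 + p 0) ^ 2 ≤ (3 * p 0) ^ 2 := by gcongr
    have h9 := mul_le_mul_of_nonneg_left h8 (by positivity : 0 ≤ β * W)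
    have h10 : 0 ≤ β * W * p 0 ^ 2 := by positivity
    linarith

lemma Good.mono_const (h : Good R c K k f) (hKL : K ≤ L) :
    Good R c L k f where
  sm := Dec.sm h
  supp := Dec.supp h
  val J hJ p hp := (Dec.val h J hJ p hp).trans (mul_le_mul_of_nonneg_right hKL (th_pos hp).le)
  bx J hJ p hp := (Dec.bx h J hJ p hp).trans (mul_le_mul_of_nonneg_right hKL (th_pos hp).le)

/-- A bilinear form satisfying a Leibniz rule inherits its pointwise estimate under `opI`. -/
lemma pest_opI {T : Type} (B : T → (Fld) → (Fld) → Fld) (N : T → Prop) (act : ZI → T → T)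
    (j : ℕ) (hact : ∀ Z F, N F → N (act Z F))
    (hsm : ∀ F f g, Sm f → Sm g → Sm (B F f g))
    (hmul : ∀ F f g c, Sm f → Sm g → B F (fun p => c * f p) g = (fun p => c * B F f g p) ∧
      B F f (fun p => c * g p) = fun p => c * B F f g p)
    (hzap : ∀ Z F f g, Sm f → Sm g → zap Z (B F f g) =
      fun p => B F (zap Z f) g p + B F f (zap Z g) p + B (act Z F) f g p)
    (hB : ∀ F, N F → ∃ C : ℝ, 0 < C ∧ ∀ R c1 c2 K : ℝ, 1 ≤ R → (c1 - c2) ^ 2 = 4 * R ^ 2 → 0 ≤ K →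
      ∀ f g, Good R c1 K 0 f → Good R c2 K j g → PEst R c1 c2 (C * K ^ 2) (B F f g)) (m : ℕ) :
    ∀ F, N F → ∃ C : ℝ, 0 < C ∧ ∀ R c1 c2 K : ℝ, 1 ≤ R → (c1 - c2) ^ 2 = 4 * R ^ 2 → 0 ≤ K →
      ∀ l : List (ZI × ℝ), l.length = m → (∀ z ∈ l, Adm c1 z ∧ Adm c2 z) →
      ∀ f g, Good R c1 K m f → Good R c2 K (m + j) g →
        PEst R c1 c2 (C * K ^ 2) (opI l (B F f g)) := by
  induction m with
  | zero =>
    intro F hN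
    obtain ⟨C, hC, h⟩ := hB F hN
    refine ⟨C, hC, fun R c1 c2 K hR hD hK l hl _ f g hf hg => ?_⟩
    rw [List.length_eq_zero_iff.1 hl]
    exact h R c1 c2 K hR hD hK f g hf (by simpa using hg)
  | succ m ih =>
    intro F hN
    obtain ⟨C, hC, h⟩ := ih F hN
    choose D hD0 hD1 using fun Z => ih (act Z F) (hact Z F hN)
    refine ⟨578 * C + ∑ Z, D Z + (∑ Z, |zw Z|) * C, by
      have h1 : 0 ≤ ∑ Z, D Z := sum_nonneg fun Z _ => (hD0 Z).le
      have h2 : 0 ≤ ∑ Z, |zw Z| := sum_nonneg fun Z _ => abs_nonneg _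
      positivity, fun R c1 c2 K hR hD hK l hl hA f g hf hg => ?_⟩
    obtain _ | ⟨z, l⟩ := l
    · simp at hl
    have hl' : l.length = m := by simpa using hl
    have hz := hA z (by simp)
    have hA' : ∀ z ∈ l, Adm c1 z ∧ Adm c2 z := fun z h => hA z (by simp [h])
    have hg' : Good R c2 K (m + j + 1) g := by rwa [add_right_comm]
    have hf0 : Good R c1 K m f := hf.mono m.le_succ
    have hg0 : Good R c2 K (m + j) g := hg'.mono (Nat.le_succ _)
    have h17 : K ≤ 17 * K := by linarith
    have hK' : 0 ≤ 17 * K := by linarith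
    have e1 := h R c1 c2 _ hR hD hK' l hl' hA' _ _ (hf.op hz.1) (hg0.mono_const h17)
    have e2 := h R c1 c2 _ hR hD hK' l hl' hA' _ _ (hf0.mono_const h17) (hg'.op hz.2)
    have e3 := (hD1 z.1 R c1 c2 K hR hD hK l hl' hA' _ _ hf0 hg0).const_mul z.2
    have e4 := (h R c1 c2 K hR hD hK l hl' hA' _ _ hf0 hg0).const_mul (z.2 * zw z.1)
    have sf := hf.sm
    have sg := hg.sm
    have szf := (hf.op hz.1).sm
    have szg := (hg'.op hz.2).sm
    have hR0 : (0 : ℝ) ≤ R := by linarith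
    have key := (((e1.add e2 hR0).add e3 hR0).add e4 hR0)
    have heq : opI (z :: l) (B F f g) = fun p => opI l (B F (fun p => z.2 * zap z.1 f p) g) p +
        opI l (B F f (fun p => z.2 * zap z.1 g p)) p + z.2 * opI l (B (act z.1 F) f g) p +
        z.2 * zw z.1 * opI l (B F f g) p := by
      have a1 := hsm F _ _ szf sg
      have a2 := hsm F _ _ sf szg
      have a3 : Sm fun p => z.2 * B (act z.1 F) f g p := contDiff_const.mul (hsm (act z.1 F) _ _ sf sg)
      have a4 : Sm fun p => z.2 * zw z.1 * B F f g p := contDiff_const.mul (hsm F _ _ sf sg)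
      have := opI_add ((a1.add a2).add a3) a4 l
      rw [opI_add (a1.add a2) a3 l, opI_add a1 a2 l, opI_const_mul (hsm _ _ _ sf sg),
        opI_const_mul (hsm _ _ _ sf sg)] at this
      rw [← this]
      change opI l _ = opI l _
      congr 1
      funext p
      rw [hzap _ _ _ _ sf sg, (hmul F _ g z.2 (sf.zap z.1) sg).1,
        (hmul F f _ z.2 sf (sg.zap z.1)).2]
      ring
    rw [heq]
    refine key.mono hR0 ?_
    have b1 : |z.2| * (D z.1 * K ^ 2) ≤ (∑ Z, D Z) * K ^ 2 := by
      have := single_le_sum (f := D) (fun Z _ => (hD0 Z).le) (mem_univ z.1)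
      have h3 := mul_le_mul hz.1.1 (mul_le_mul_of_nonneg_right this (sq_nonneg K))
        (mul_nonneg (hD0 _).le (sq_nonneg K)) zero_le_one
      linarith
    have b2 : |z.2 * zw z.1| * (C * K ^ 2) ≤ (∑ Z, |zw Z|) * C * K ^ 2 := by
      have := single_le_sum (f := fun Z => |zw Z|) (fun Z _ => abs_nonneg _)
        (mem_univ z.1)
      rw [abs_mul, mul_assoc _ C]
      exact mul_le_mul_of_nonneg_right ((mul_le_of_le_one_left (abs_nonneg _) hz.1.1).trans this)
        (by positivity)
    linarith

lemma nf3_mul (hf : Sm f) (hg : Sm g) :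
    nf3 F (fun p => c * f p) g = (fun p => c * nf3 F f g p) ∧
      nf3 F f (fun p => c * g p) = fun p => c * nf3 F f g p := by
  constructor <;> funext p <;> unfold nf3 <;> simp only [mul_sum] <;>
    refine sum_congr rfl fun a _ => sum_congr rfl fun b _ =>
      sum_congr rfl fun d _ => ?_
  · rw [pd_const_mul hf]; ring
  · rw [pd_const_mul hg, pd_const_mul (hg.pd d)]; ring

lemma nf2_mul (hf : Sm f) (hg : Sm g) :
    nf2 G (fun p => c * f p) g = (fun p => c * nf2 G f g p) ∧
      nf2 G f (fun p => c * g p) = fun p => c * nf2 G f g p := by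
  constructor <;> funext p <;> unfold nf2 <;> simp only [mul_sum] <;>
    refine sum_congr rfl fun a _ => sum_congr rfl fun b _ => ?_
  · rw [pd_const_mul hf]; ring
  · rw [pd_const_mul hg]; ring

lemma pest_source (hF : NullForm3 F)
    (hG : NullForm2 G) (n : ℕ) : ∃ C : ℝ, 0 < C ∧ ∀ R c1 c2 K : ℝ, 1 ≤ R →
      (c1 - c2) ^ 2 = 4 * R ^ 2 → 0 ≤ K → ∀ l : List (ZI × ℝ), l.length < n →
      (∀ z ∈ l, Adm c1 z ∧ Adm c2 z) → ∀ f g, Good R c1 K n f → Good R c2 K n g →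
        PEst R c1 c2 (C * K ^ 2) (opI l fun p => 2 * nf2 G f g p + -1 * nf3 F f g p
          + -1 * nf3 F g f p) := by
  choose C hC h using fun m => pest_opI nf3 NullForm3 FZ 1 (fun Z F h => h.FZ Z)
    (fun F f g hf hg => hf.nf3 F hg) (fun F f g c hf hg => nf3_mul hf hg)
    (fun Z F f g hf hg => zap_nf3 hf hg Z F) (fun F h => pest_nf3 h) m F hF
  choose D hD k using fun m => pest_opI nf2 NullForm2 GZ 0 (fun Z F h => h.GZ Z)
    (fun F f g hf hg => hf.nf2 F hg) (fun F f g c hf hg => nf2_mul hf hg)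
    (fun Z F f g hf hg => zap_nf2 hf hg Z F) (fun F h => pest_nf2 h) m G hG
  refine ⟨1 + ∑ m ∈ range n, (2 * D m + 2 * C m), ?_, fun R c1 c2 K hR hc hK l hl hA f g hf hg => ?_⟩
  · have := sum_nonneg fun m (_ : m ∈ range n) =>
      add_nonneg (mul_nonneg zero_le_two (hD m).le) (mul_nonneg zero_le_two (hC m).le)
    linarith
  have sf := hf.sm
  have sg := hg.sm
  have hR0 : (0 : ℝ) ≤ R := by linarith
  have e1 := (k _ R c1 c2 K hR hc hK l rfl hA f g (hf.mono hl.le) (hg.mono hl.le)).const_mul 2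
  have e2 := (h _ R c1 c2 K hR hc hK l rfl hA f g (hf.mono hl.le) (hg.mono hl)).const_mul (-1)
  have e3 := ((h _ R c2 c1 K hR (by linarith) hK l rfl (fun z hz => (hA z hz).symm) g f
    (hg.mono hl.le) (hf.mono hl)).const_mul (-1)).symm
  have key := (e1.add e2 hR0).add e3 hR0
  have a1 := sf.nf2 G sg
  have a2 := sf.nf3 F sg
  have a3 := sg.nf3 F sf
  have a1' : Sm fun p => 2 * nf2 G f g p := contDiff_const.mul a1
  have a2' : Sm fun p => -1 * nf3 F f g p := contDiff_const.mul a2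
  have a3' : Sm fun p => -1 * nf3 F g f p := contDiff_const.mul a3
  rw [opI_add (a1'.add a2') a3' l, opI_add a1' a2' l, opI_const_mul a1, opI_const_mul a2,
    opI_const_mul a3]
  refine key.mono hR0 ?_
  have := single_le_sum (f := fun m => 2 * D m + 2 * C m) (fun m _ =>
    add_nonneg (mul_nonneg zero_le_two (hD m).le) (mul_nonneg zero_le_two (hC m).le))
    (mem_range.2 hl)
  norm_num
  nlinarith [sq_nonneg K]

/-- A radial profile concentrated on the light cone. -/
def cpr (t r : ℝ) : ℝ := if r ≤ 2 * t then (1 + (t - r) ^ 2)⁻¹ else 0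

lemma cpr_nonneg (t r : ℝ) : 0 ≤ cpr t r := by
  unfold cpr
  split_ifs <;> positivity

lemma measurable_cpr (t : ℝ) : Measurable (cpr t) :=
  Measurable.ite measurableSet_Iic (by fun_prop) measurable_const

lemma lintegral_cpr_le (ht : 0 ≤ t) (η : ℝ) : ∫⁻ ρ in Set.Ioi 0, ofReal (ρ * cpr t √(η ^ 2 + ρ ^ 2))
    ≤ ofReal (2 * t * Real.pi) := by
  set g : ℝ → ℝ := fun ρ => 2 * t * Real.arctan (√(η ^ 2 + ρ ^ 2) - t) with hg
  set g' : ℝ → ℝ := fun ρ => 2 * t * (1 / (1 + (√(η ^ 2 + ρ ^ 2) - t) ^ 2) * (2 * ρ / (2 * √(η ^ 2 +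
    ρ ^ 2)))) with hg'
  have hd : ∀ ρ ∈ Set.Ioi (0 : ℝ), HasDerivAt g (g' ρ) ρ := fun ρ hρ => by
    have hρ : 0 < ρ := hρ
    have h1 : HasDerivAt (fun ρ : ℝ => η ^ 2 + ρ ^ 2) (2 * ρ) ρ := by
      simpa using ((hasDerivAt_id ρ).fun_pow 2).const_add (η ^ 2)
    exact (((h1.sqrt (by positivity)).sub_const t).arctan).const_mul _
  have hp : ∀ ρ ∈ Set.Ioi (0 : ℝ), 0 ≤ g' ρ := fun ρ hρ => by
    have hρ : 0 < ρ := hρ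
    positivity
  have hl : Filter.Tendsto g Filter.atTop (nhds (2 * t * (Real.pi / 2))) := by
    refine ((Real.tendsto_arctan_atTop.mono_right nhdsWithin_le_nhds).comp
      (Filter.tendsto_atTop_mono (fun ρ => ?_) (Filter.tendsto_atTop_add_const_right _ (-t)
        Filter.tendsto_id))).const_mul _
    have := Real.le_sqrt_of_sq_le (x := ρ) (y := η ^ 2 + ρ ^ 2) (by nlinarith)
    simp only [id]
    linarith
  have hc : ContinuousWithinAt g (Set.Ici 0) 0 := by
    refine Continuous.continuousWithinAt ?_
    fun_prop
  have h1 := integral_Ioi_of_hasDerivAt_of_nonneg hc hd hp hl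
  have h2 := integrableOn_Ioi_deriv_of_nonneg hc hd hp hl
  have h3 := ofReal_integral_eq_lintegral_ofReal h2
    ((ae_restrict_iff' measurableSet_Ioi).2 (.of_forall hp))
  rw [h1] at h3
  refine le_trans (setLIntegral_mono' measurableSet_Ioi fun ρ hρ => ofReal_le_ofReal ?_)
    (h3.symm.le.trans (ofReal_le_ofReal ?_))
  · have hρ : 0 < ρ := hρ
    have hr : 0 < √(η ^ 2 + ρ ^ 2) := Real.sqrt_pos.2 (by positivity)
    unfold cpr
    split_ifs with h
    · simp only [hg']
      have hu : (√(η ^ 2 + ρ ^ 2) - t) ^ 2 = (t - √(η ^ 2 + ρ ^ 2)) ^ 2 := by ring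
      rw [hu, show 2 * t * (1 / (1 + (t - √(η ^ 2 + ρ ^ 2)) ^ 2) * (2 * ρ / (2 * √(η ^ 2 + ρ ^ 2)))) =
        (ρ * (1 + (t - √(η ^ 2 + ρ ^ 2)) ^ 2)⁻¹) * (2 * t / √(η ^ 2 + ρ ^ 2)) by field_simp]
      exact le_mul_of_one_le_right (by positivity) ((one_le_div hr).2 h)
    · rw [mul_zero]
      exact hp ρ hρ
  · simp only [hg]
    have := (Real.neg_pi_div_two_lt_arctan (√(η ^ 2 + 0 ^ 2) - t)).le
    nlinarith [mul_nonneg (mul_nonneg zero_le_two ht) (by linarith :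
      0 ≤ Real.arctan (√(η ^ 2 + 0 ^ 2) - t) + Real.pi / 2)]

lemma lintegral_plane_cpr_le (ht : 0 ≤ t) (η : ℝ) : ∫⁻ b, ∫⁻ c, ofReal (cpr t √(η ^ 2 + (b ^ 2 + c ^
    2))) ≤ ofReal (2 * t * Real.pi * (2 * Real.pi)) := by
  have hm : Measurable fun p : ℝ × ℝ => ofReal (cpr t √(η ^ 2 + (p.1 ^ 2 + p.2 ^ 2))) :=
    ((measurable_cpr t).comp (by fun_prop)).ennreal_ofReal
  rw [← lintegral_prod _ hm.aemeasurable, ← Measure.volume_eq_prod, ← lintegral_comp_polarCoord_symm,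
    polarCoord_target, Measure.volume_eq_prod, ← Measure.prod_restrict]
  have e : ∀ p : ℝ × ℝ, (polarCoord.symm p).1 ^ 2 + (polarCoord.symm p).2 ^ 2 = p.1 ^ 2 := fun p => by
    simp only [polarCoord_symm_apply]
    linear_combination p.1 ^ 2 * Real.sin_sq_add_cos_sq p.2
  simp only [e, smul_eq_mul]
  have hm2 : Measurable fun ρ => ofReal ρ * ofReal (cpr t √(η ^ 2 + ρ ^ 2)) :=
    ENNReal.measurable_ofReal.mul ((measurable_cpr t).comp (by fun_prop)).ennreal_ofReal
  rw [lintegral_prod _ (by exact (hm2.comp measurable_fst).aemeasurable)]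
  simp only [lintegral_const, Measure.restrict_apply_univ, Real.volume_Ioo]
  rw [lintegral_mul_const _ hm2, ofReal_mul (p := 2 * t * Real.pi) (by positivity)]
  refine mul_le_mul' (le_trans (le_of_eq ?_) (lintegral_cpr_le ht η)) (le_of_eq (by congr 1; ring))
  exact setLIntegral_congr_fun measurableSet_Ioi fun ρ hρ => (ofReal_mul (le_of_lt hρ)).symm

/-- The longitudinal weight. -/
def lpr (R t x : ℝ) : ENNReal :=
  (Icc (-(2 * t)) (2 * t)).indicator (fun _ => ofReal (√R)⁻¹) x +
    (Icc (-(t / √R)) (t / √R)).indicator 1 x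

lemma measurable_lpr (R t : ℝ) : Measurable (lpr R t) :=
  (measurable_const.indicator measurableSet_Icc).add (measurable_one.indicator measurableSet_Icc)

lemma lintegral_lpr (ht : 0 ≤ t) (m : ℝ) : ∫⁻ x, lpr R t (x - m) = ofReal (6 * t / √R) := by
  rw [lintegral_sub_right_eq_self (lpr R t) m]
  unfold lpr
  rw [lintegral_add_left (measurable_const.indicator measurableSet_Icc), lintegral_indicator
    measurableSet_Icc, lintegral_indicator measurableSet_Icc]
  simp only [lintegral_const, Measure.restrict_apply_univ, Real.volume_Icc, Pi.one_apply, one_mul]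
  rw [← ofReal_mul (by positivity), ← ENNReal.ofReal_add (by
    have : 0 ≤ (√R)⁻¹ * (2 * t) := by positivity
    linarith) (by have : 0 ≤ t / √R := by positivity
                  linarith)]
  congr 1
  ring

lemma lintegral_lpr_cpr_le (R : ℝ) (ht : 0 ≤ t) (m c : ℝ) : ∫⁻ x, lpr R t (x 0 - m) * ofReal
    (cpr t (rr (sh c (stp t x)))) ≤ ofReal (240 * t ^ 2 / √R) := by
  have h := lintegral_mkp (Equiv.swap 0 1) t
    (W := fun p => lpr R t (p 1 - m) * ofReal (cpr t (rr (sh c p))))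
    (((measurable_lpr R t).comp (by fun_prop)).mul ((measurable_cpr t).comp (by unfold sh; exact
      (continuous_rr.comp (by fun_prop)).measurable)).ennreal_ofReal)
  refine (le_of_eq h).trans ?_
  have e : ∀ a b c', lpr R t (mkp (Equiv.swap 0 1) t c' a b 1 - m) *
      ofReal (cpr t (rr (sh c (mkp (Equiv.swap 0 1) t c' a b)))) =
      lpr R t (a - m) * ofReal (cpr t √((a - c) ^ 2 + (b ^ 2 + c' ^ 2))) := fun a b c' => by
    have : rr (sh c (mkp (Equiv.swap 0 1) t c' a b)) = √((a - c) ^ 2 + (b ^ 2 + c' ^ 2)) := by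
      rw [← Real.sqrt_sq (rr_nonneg _), rr_sq]
      congr 1
      simp [sh, mkp, stp, Equiv.swap_apply_of_ne_of_ne]
      ring
    rw [this]
    rfl
  simp only [e]
  have hm : ∀ a, Measurable fun p : ℝ × ℝ => ofReal (cpr t √((a - c) ^ 2 + (p.1 ^ 2 + p.2 ^ 2))) :=
    fun a => ((measurable_cpr t).comp (by fun_prop)).ennreal_ofReal
  have hm' : ∀ a b, Measurable fun c' : ℝ => ofReal (cpr t √((a - c) ^ 2 + (b ^ 2 + c' ^ 2))) :=
    fun a b => ((measurable_cpr t).comp (by fun_prop)).ennreal_ofReal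
  calc _ = ∫⁻ a, lpr R t (a - m) * ∫⁻ b, ∫⁻ c', ofReal (cpr t √((a - c) ^ 2 + (b ^ 2 + c' ^ 2))) := by
        refine lintegral_congr fun a => ?_
        rw [← lintegral_const_mul _ (hm a).lintegral_prod_right]
        exact lintegral_congr fun b => lintegral_const_mul _ (hm' a b)
    _ ≤ ∫⁻ a, lpr R t (a - m) * ofReal (2 * t * Real.pi * (2 * Real.pi)) :=
        lintegral_mono fun a => mul_le_mul_right (lintegral_plane_cpr_le ht _) _
    _ = ofReal (6 * t / √R * (2 * t * Real.pi * (2 * Real.pi))) := by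
        rw [lintegral_mul_const' _ _ ENNReal.ofReal_ne_top, lintegral_lpr ht, ofReal_mul (p := 6 * t
          / √R) (by positivity)]
    _ ≤ _ := by
        refine ofReal_le_ofReal ?_
        have : Real.pi ^ 2 ≤ 10 := by nlinarith [Real.pi_lt_d2, Real.pi_pos]
        rw [show 6 * t / √R * (2 * t * Real.pi * (2 * Real.pi)) = 24 * t ^ 2 / √R * Real.pi ^ 2 by ring,
          show 240 * t ^ 2 / √R = 24 * t ^ 2 / √R * 10 by ring]
        gcongr

lemma le_lpr {X U V : ℝ} (hR : 1 ≤ R) (ht : 0 ≤ t) (hU : 1 ≤ U) (hV : 1 ≤ V) (h : R * |X| ≤ t * (U *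
    V)) (hX : |X| ≤ 2 * t) : ofReal (U⁻¹ * V⁻¹) ≤ lpr R t X := by
  unfold lpr
  by_cases h1 : |X| ≤ t / √R
  · refine le_add_left ?_
    rw [Set.indicator_of_mem (by rwa [Set.mem_Icc, ← abs_le]), Pi.one_apply, ENNReal.ofReal_le_one]
    exact mul_le_one₀ (inv_le_one_of_one_le₀ hU) (by positivity) (inv_le_one_of_one_le₀ hV)
  · refine le_add_right ?_
    rw [Set.indicator_of_mem (by rwa [Set.mem_Icc, ← abs_le]), ← mul_inv]
    refine ofReal_le_ofReal (inv_anti₀ (by positivity) ?_)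
    have hs : 0 < √R := Real.sqrt_pos.2 (by linarith)
    have hsq := Real.mul_self_sqrt (by linarith : 0 ≤ R)
    have ht' : 0 < t := ht.lt_of_ne fun h0 => by
      subst h0
      exact h1 (by simpa using hX)
    rw [not_le, div_lt_iff₀ hs] at h1
    nlinarith

lemma wt_sq_le (hR : 1 ≤ R) (hD : (c1 - c2) ^ 2 = 4 * R ^ 2) (hp : 0 ≤ p 0) : ofReal (wt R c1 c2 p ^
    2) ≤ ofReal (2 * (th (p 0) / (1 + p 0)) ^ 4) * (lpr R (p 0) (p 1 - (c1 + c2) / 2) * ofReal (cpr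
      (p 0) (rr (sh c1 p))) + lpr R (p 0) (p 1 - (c1 + c2) / 2) * ofReal (cpr (p 0) (rr (sh c2 p))))
        := by
  by_cases hd : Dom R c1 c2 p
  swap
  · simp [wt, hd]
  obtain ⟨hb, -, -⟩ := dom_bounds hR hD hd
  have hr1 := rr_nonneg (sh c1 p)
  have hr2 := rr_nonneg (sh c2 p)
  have q1 := rr_sq (sh c1 p)
  have q2 := rr_sq (sh c2 p)
  have e1 : ∀ c, sh c p 1 = p 1 - c := fun c => by simp [sh]
  have e2 : ∀ c, sh c p 2 = p 2 := fun c => by simp [sh]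
  have e3 : ∀ c, sh c p 3 = p 3 := fun c => by simp [sh]
  rw [e1, e2, e3] at q1 q2
  have a1 := av_sq (sh c1 p)
  have a2 := av_sq (sh c2 p)
  rw [sh_zero] at a1 a2
  rw [wt, if_pos hd]
  have h1 := hd.1
  have h2 := hd.2
  generalize rr (sh c1 p) = r1 at *
  generalize rr (sh c2 p) = r2 at *
  obtain ⟨X, eX⟩ : ∃ X, X = p 1 - (c1 + c2) / 2 := ⟨_, rfl⟩
  rw [← eX]
  obtain ⟨U, hU⟩ : ∃ U, U = av (sh c1 p) ^ 2 := ⟨_, rfl⟩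
  obtain ⟨V, hV⟩ : ∃ V, V = av (sh c2 p) ^ 2 := ⟨_, rfl⟩
  have hU1 : 1 ≤ U := by rw [hU, a1]; linarith [abs_nonneg (p 0 - r1)]
  have hV1 : 1 ≤ V := by rw [hV, a2]; linarith [abs_nonneg (p 0 - r2)]
  have hc : ∀ W r, 0 ≤ r → r ≤ 2 * p 0 → W = 1 + |p 0 - r| → W⁻¹ ^ 2 ≤ cpr (p 0) r := fun W r h0 h1 h2 => by
    rw [cpr, if_pos h1, inv_pow]
    refine inv_anti₀ (by positivity) ?_
    rw [h2]
    nlinarith [sq_abs (p 0 - r), abs_nonneg (p 0 - r)]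
  have c1' := hc U r1 hr1 (by linarith) (hU.trans a1)
  have c2' := hc V r2 hr2 (by linarith) (hV.trans a2)
  have hX2 : |X| ≤ 2 * p 0 := by
    have : (c1 - c2) * X ≤ |c1 - c2| * |X| := by rw [← abs_mul]; exact le_abs_self _
    refine abs_le_of_sq_le_sq (?_ : X ^ 2 ≤ (2 * p 0) ^ 2) (by linarith)
    subst eX
    nlinarith [sq_nonneg (p 2), sq_nonneg (p 3), sq_nonneg (c1 - c2)]
  have hXR : R * |X| ≤ p 0 * (U * V) := by
    have hcc : |c1 - c2| = 2 * R := by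
      rw [← abs_of_pos (by linarith : 0 < 2 * R), ← sq_eq_sq_iff_abs_eq_abs, hD]; ring
    have h5 : |r1 - r2| * (r1 + r2) = 4 * (R * |X|) := by
      rw [← abs_of_nonneg (add_nonneg hr1 hr2), ← abs_mul, show (r1 - r2) * (r1 + r2) = -2 * ((c1 - c2) * X) by
        subst eX; linear_combination q1 - q2, abs_mul, abs_mul, hcc]
      norm_num
      ring
    have h6 : |r1 - r2| ≤ U * V := by
      have := abs_sub (p 0 - r2) (p 0 - r1)
      rw [show p 0 - r2 - (p 0 - r1) = r1 - r2 by ring] at this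
      nlinarith
    nlinarith [mul_le_mul h6 (by linarith : r1 + r2 ≤ 4 * p 0) (by positivity) (by positivity)]
  have hl := le_lpr hR hp hU1 hV1 hXR hX2
  have ew : omw (th (p 0) / (1 + p 0)) (av (sh c1 p))⁻¹ (av (sh c2 p))⁻¹ ^ 2 =
      (th (p 0) / (1 + p 0)) ^ 4 * ((U⁻¹ * V⁻¹) * (U⁻¹ + V⁻¹) ^ 2) := by
    rw [omw, hU, hV]
    ring
  rw [← mul_add, ← ENNReal.ofReal_add (cpr_nonneg _ _) (cpr_nonneg _ _), ew]
  refine le_trans ?_ (mul_le_mul_right (mul_le_mul_left hl _) _)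
  rw [← ofReal_mul (by positivity), ← ofReal_mul (by positivity)]
  refine ofReal_le_ofReal ?_
  have h7 : (U⁻¹ + V⁻¹) ^ 2 ≤ 2 * (cpr (p 0) r1 + cpr (p 0) r2) := by
    linarith [add_sq_le (a := U⁻¹) (b := V⁻¹)]
  have h8 := mul_le_mul_of_nonneg_left h7
    (by positivity : 0 ≤ (th (p 0) / (1 + p 0)) ^ 4 * (U⁻¹ * V⁻¹))
  linarith

lemma integral_sq_le_of_wt (hR : 1 ≤ R) (hD : (c1 - c2) ^ 2 = 4 * R ^ 2) (hs : Sm h) (ht : 0 ≤ t)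
    (hB : ∀ x, |h (stp t x)| ≤ B * wt R c1 c2 (stp t x)) : ∫ x, h (stp t x) ^ 2 ≤ B ^ 2 * (960 * th
    t ^ 4 / ((1 + t) ^ 2 * √R)) := by
  have hth : 0 < th t := one_pos.trans_le (one_le_th ht)
  rw [integral_eq_lintegral_of_nonneg_ae (.of_forall fun x => sq_nonneg _) (by
    exact ((hs.continuous.comp (continuous_stp_right t)).pow 2).aestronglyMeasurable)]
  refine ENNReal.toReal_le_of_le_ofReal (by positivity) ?_
  set κ := 2 * (th t / (1 + t)) ^ 4
  have hL : Measurable fun x => lpr R t (x 0 - (c1 + c2) / 2) *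
      ofReal (cpr t (rr (sh c1 (stp t x)))) := by
    refine ((measurable_lpr R t).comp (by fun_prop)).mul ((measurable_cpr t).comp ?_).ennreal_ofReal
    have := continuous_stp_right t
    unfold sh
    exact (continuous_rr.comp (by fun_prop)).measurable
  calc _ ≤ ∫⁻ x, ofReal (B ^ 2 * κ) *
        (lpr R t (x 0 - (c1 + c2) / 2) * ofReal (cpr t (rr (sh c1 (stp t x)))) + lpr R t (x 0 - (c1
          + c2) / 2) * ofReal (cpr t (rr (sh c2 (stp t x))))) := by
        refine lintegral_mono fun x => ?_
        have h1 : h (stp t x) ^ 2 ≤ B ^ 2 * wt R c1 c2 (stp t x) ^ 2 := by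
          rw [← mul_pow, ← sq_abs]
          exact pow_le_pow_left₀ (abs_nonneg _) (hB x) 2
        rw [ofReal_mul (sq_nonneg B), mul_assoc]
        refine (ofReal_le_ofReal h1).trans ?_
        rw [ofReal_mul (sq_nonneg B)]
        exact mul_le_mul_right (wt_sq_le hR hD (p := stp t x) ht) _
    _ ≤ ofReal (B ^ 2 * κ) * (ofReal (240 * t ^ 2 / √R) + ofReal (240 * t ^ 2 / √R)) := by
        rw [lintegral_const_mul' _ _ ENNReal.ofReal_ne_top, lintegral_add_left hL]
        exact mul_le_mul_right (add_le_add (lintegral_lpr_cpr_le R ht _ c1) (lintegral_lpr_cpr_le R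
          ht _ c2)) _
    _ ≤ _ := by
        rw [← ENNReal.ofReal_add (by positivity) (by positivity), ← ofReal_mul (by positivity)]
        refine ofReal_le_ofReal ?_
        have hT : t ^ 2 ≤ (1 + t) ^ 2 := by nlinarith
        have hs : 0 < √R := Real.sqrt_pos.2 (by linarith)
        rw [show B ^ 2 * κ * (240 * t ^ 2 / √R + 240 * t ^ 2 / √R) =
          B ^ 2 * (960 * th t ^ 4 / ((1 + t) ^ 4 * √R)) * t ^ 2 by simp only [κ]; field_simp; ring,
          show B ^ 2 * (960 * th t ^ 4 / ((1 + t) ^ 2 * √R)) =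
          B ^ 2 * (960 * th t ^ 4 / ((1 + t) ^ 4 * √R)) * (1 + t) ^ 2 by field_simp]
        gcongr

lemma flat_energy_max (hv : Sm v) (hs : Supp M v) {l ρ : ℝ} (hB : 0 < B) (hr : r ≠ 0) (hl : l + 1 =
    r) (hS : 0 ≤ S) (hT : S ≤ T) (hY : ∀ t, S ≤ t → t ≤ T → ∫ x, box v (stp t x) ^ 2 ≤ B * (1 + t) ^
    (2 * l)) (hρ : ∀ t, S ≤ t → t ≤ T → ((1 + t) ^ r - (1 + S) ^ r) / r ≤ ρ) : ∫ x, flatE v (stp T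
    x) ≤ 2 * (∫ x, flatE v (stp S x)) + 36 * B * ρ ^ 2 := by
  have hn : ∀ t, 0 ≤ ∫ x, flatE v (stp t x) := fun t => integral_nonneg fun x => flatE_nonneg _ _
  obtain ⟨τ, hτ, hm⟩ := isCompact_Icc.exists_isMaxOn (Set.nonempty_Icc.2 hT)
    (((hs.flatE hv).continuousOn_integral hv.flatE.continuous T).mono (Set.Icc_subset_Icc_left hS))
  refine (hm (Set.right_mem_Icc.2 hT)).trans ?_
  dsimp only
  rcases (hn τ).eq_or_lt with h0 | h0
  · linarith [hn S, mul_nonneg hB.le (sq_nonneg ρ)]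
  · have h := flat_energy hv hs (α := √(∫ x, flatE v (stp τ x))) (β := √B) (k := 0) (l := l)
      (Real.sqrt_pos.2 h0) (Real.sqrt_pos.2 hB) hr (by linarith) hS hτ.1
      (fun t h1 h2 => by
        rw [Real.sq_sqrt h0.le]
        simpa using hm (Set.mem_Icc.2 ⟨h1, h2.trans hτ.2⟩))
      (fun t h1 h2 => by
        rw [Real.sq_sqrt hB.le]
        exact hY t h1 (h2.trans hτ.2))
    have h1 := mul_le_mul_of_nonneg_left (hρ τ hτ.1 hτ.2)
      (by positivity : 0 ≤ 6 * √(∫ x, flatE v (stp τ x)) * √B)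
    have h2 := Real.sq_sqrt h0.le
    have h3 := Real.sq_sqrt hB.le
    nlinarith [sq_nonneg (√(∫ x, flatE v (stp τ x)) - 6 * √B * ρ)]

lemma flatE_add_le (hf : Sm f) (hg : Sm g) (p : Pt) : flatE f p ≤ 2 * flatE (fun p => f p - g p) p +
    2 * flatE g p := by
  simp only [flatE, pd_sub hf hg]
  nlinarith [sq_nonneg (pd 0 f p - 2 * pd 0 g p), sq_nonneg (pd 1 f p - 2 * pd 1 g p), sq_nonneg (pd
    2 f p - 2 * pd 2 g p), sq_nonneg (pd 3 f p - 2 * pd 3 g p)]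

lemma box_sub (hf : Sm f) (hg : Sm g) (p : Pt) : box (fun p => f p - g p) p = box f p - box g p :=
    by
  simp only [box, pd_sub hf hg, pd_sub (hf.pd _) (hg.pd _)]
  ring

lemma rr_le_sh (c : ℝ) (p : Pt) : rr p ≤ |c| + rr (sh c p) := by
  have h := abs_coord_le_rr (sh c p) 0
  have e0 := rr_nonneg (sh c p)
  refine abs_le_of_sq_le_sq ?_ (by positivity) |>.trans' (le_abs_self _)
  have e1 := rr_sq p
  have e2 := rr_sq (sh c p)
  have e3 := abs_mul c (p 1 - c)
  simp [sh, sidx_zero] at h e0 e2 ⊢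
  nlinarith [le_abs_self (c * (p 1 - c)), mul_le_mul_of_nonneg_left h (abs_nonneg c), sq_abs c]

lemma energy_of_pest (hR : 1 ≤ R) (hD : (c1 - c2) ^ 2 = 4 * R ^ 2) (hA : 0 < A) (hW : Sm W) (hs :
     Supp M W) (hbox : ∀ p : Pt, 0 ≤ p 0 → box W p = h p) (h0 : ∀ x, flatE W (stp 0 x) = 0) (H :
    PEst R c1 c2 A h) (hT : 0 ≤ T) : ∫ x, flatE W (stp T x) ≤ 30000000 * (A / R) ^ 2 := by
  obtain ⟨N, hN, hp⟩ := H
  have hR0 : 0 < R := by linarith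
  have hAR : 0 < A / R := by positivity
  have hq : 0 < √R := Real.sqrt_pos.2 hR0
  have hth : th (R ^ 2) ^ 4 ≤ 2 * √R := by
    have h1 : th (R ^ 2) ^ 16 = 1 + R ^ 2 := by
      simpa using (rpow_eq_th (t := R ^ 2) (by positivity) 16 0 (x := 1) (by norm_num)).symm
    refine le_of_pow_le_pow_left₀ (n := 4) (by norm_num) (by positivity) ?_
    rw [← pow_mul, h1, mul_pow, show √R ^ 4 = (√R ^ 2) ^ 2 by ring, Real.sq_sqrt hR0.le]
    nlinarith
  have hthm : ∀ t, 0 ≤ t → t ≤ R ^ 2 → th t ^ 4 ≤ 2 * √R := fun t h1 h2 =>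
    (pow_le_pow_left₀ (zero_le_one.trans (one_le_th h1)) (Real.rpow_le_rpow (by linarith) (by
      linarith) (by norm_num)) 4).trans hth
  have hNs : Supp (R / 2 + |c1|) N := fun p h1 h2 => (hp p h1).1 fun hd => by
    have := rr_le_sh c1 p
    linarith [hd.1]
  have hNp : ∀ a t, 0 ≤ t → ∀ x, |pd a N (stp t x)| ≤ A / R * t * wt R c1 c2 (stp t x) := by
    intro a t ht x
    have := (hp (stp t x) ht).2.1 a
    rw [← le_div_iff₀ hR0, stp_zero] at this
    exact this.trans (le_of_eq (by ring))
  have hv := hW.sub hN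
  have hvs := (hs.mono (le_max_left M (R / 2 + |c1|))).sub (hNs.mono (le_max_right _ _))
  have h1 : ∀ T, 0 ≤ T → T ≤ R ^ 2 → ∫ x, flatE W (stp T x) ≤ 9000000 * (A / R) ^ 2 := by
    intro T hT hTR
    have e1 : ∫ x, flatE (fun p => W p - N p) (stp T x) ≤ 36 * ((A / R) ^ 2 * (960 / √R))
        * (8 * th T ^ 2) ^ 2 := by
      refine (flat_energy_max (l := -7 / 8) (r := 1 / 8) (S := 0) hv hvs (by positivity) (by
        norm_num) (by norm_num) le_rfl hT (fun t ht hk => ?_) (fun t ht hk => ?_)).trans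
        (le_of_eq (add_eq_right.2 ?_))
      · refine (integral_sq_le_of_wt (B := A / R) hR hD hv.box ht fun x => ?_).trans (le_of_eq ?_)
        · have := (hp (stp t x) ht).2.2.1
          rw [← le_div_iff₀ hR0] at this
          rw [box_sub hW hN, hbox _ ht]
          exact this.trans (le_of_eq (by ring))
        · rw [rpow_eq_th ht 4 (-2) (by norm_num), zpow_neg, zpow_ofNat]
          field_simp
      · rw [rpow_eq_th ht 2 0 (by norm_num)]
        have : th t ≤ th T := Real.rpow_le_rpow (by linarith) (by linarith) (by norm_num)
        have := pow_le_pow_left₀ (by linarith [one_le_th ht]) this 2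
        simp only [zpow_zero, mul_one, add_zero, Real.one_rpow]
        linarith
      · have : ∀ x, flatE (fun p => W p - N p) (stp 0 x) = 0 := fun x => by
          have e : ∀ a, pd a N (stp 0 x) = 0 := fun a =>
            abs_nonpos_iff.1 ((hNp a 0 le_rfl x).trans (by simp))
          have := h0 x
          simp only [flatE, pd_sub hW hN, e, sub_zero] at this ⊢
          exact this
        simp [this]
    have e2 : ∀ a, ∫ x, pd a N (stp T x) ^ 2 ≤ 1920 * (A / R) ^ 2 := by
      intro a
      refine (integral_sq_le_of_wt hR hD (hN.pd a) hT (hNp a T hT)).trans ?_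
      rw [mul_pow, mul_assoc, mul_comm]
      refine mul_le_mul_of_nonneg_right ?_ (sq_nonneg _)
      rw [← mul_div_assoc, div_le_iff₀ (by positivity)]
      have := mul_le_mul (hthm T hT hTR) (pow_le_pow_left₀ hT (by linarith : T ≤ 1 + T) 2)
        (by positivity) (by positivity)
      linarith
    have e3 : ∫ x, flatE N (stp T x) ≤ 4 * (1920 * (A / R) ^ 2) := by
      have i := fun a => (hNs.pder hN a).integrable_sq (hN.pd a).continuous hT
      have : ∫ x, flatE N (stp T x) = ∑ a, ∫ x, pd a N (stp T x) ^ 2 := by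
        rw [← integral_finsetSum _ fun a _ => i a]
        simp only [Fin.sum_univ_four, flatE]
      rw [this, Fin.sum_univ_four]
      linarith [e2 0, e2 1, e2 2, e2 3]
    have e4 : ∫ x, flatE W (stp T x) ≤ 2 * (∫ x, flatE (fun p => W p - N p) (stp T x)) +
        2 * ∫ x, flatE N (stp T x) := by
      have i1 := ((hvs.flatE hv).integrable hv.flatE.continuous hT).const_mul 2
      have i2 := ((hNs.flatE hN).integrable hN.flatE.continuous hT).const_mul 2
      rw [← integral_const_mul, ← integral_const_mul, ← integral_add i1 i2]
      exact integral_mono ((hs.flatE hW).integrable hW.flatE.continuous hT) (i1.add i2)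
        fun x => flatE_add_le hW hN _
    have e6 := mul_le_mul_of_nonneg_left ((div_le_iff₀ hq).2 (hthm T hT hTR)) (sq_nonneg (A / R))
    rw [div_eq_mul_inv _ √R] at e1 e6
    linarith [sq_nonneg (A / R)]
  rcases le_total T (R ^ 2) with h2 | h2
  · linarith [h1 T hT h2, sq_nonneg (A / R)]
  · have hR2 : 1 ≤ R ^ 2 := one_le_pow₀ hR
    refine (flat_energy_max (l := -15 / 8) (r := -7 / 8) (S := R ^ 2) (B := (A * R) ^ 2 * (3840 / √R))
      (ρ := 2 * (th (R ^ 2) ^ 2 * (1 + R ^ 2)⁻¹)) hW hs (by positivity) (by norm_num) (by norm_num)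
      (by positivity) h2 (fun t ht hk => ?_) (fun t ht hk => ?_)).trans ?_
    · have ht1 : 1 ≤ t := hR2.trans ht
      have ht0 : 0 < t := by linarith
      refine (integral_sq_le_of_wt (B := A * R / t) hR hD hW.box ht0.le fun x => ?_).trans ?_
      · have := (hp (stp t x) ht0.le).2.2.2
        rw [stp_zero, ← le_div_iff₀ ht0] at this
        rw [hbox _ ht0.le]
        exact this.trans (le_of_eq (by ring))
      · rw [rpow_eq_th ht0.le 4 (-4) (by norm_num), zpow_neg, zpow_ofNat]
        have h3 : (1 + t) ^ 2 ≤ 4 * t ^ 2 := by nlinarith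
        have := one_le_th ht0.le
        rw [div_pow, div_mul_div_comm, ← div_eq_mul_inv, mul_div_assoc', mul_div_assoc',
          div_mul_eq_mul_div, div_div, div_le_div_iff₀ (by positivity) (by positivity)]
        have := mul_le_mul_of_nonneg_left h3
          (by positivity : 0 ≤ (A * R) ^ 2 * 960 * th t ^ 4 * (√R * (1 + t) ^ 2))
        linarith
    · have h3 := rpow_eq_th (t := R ^ 2) (x := -7 / 8) (by positivity) 2 (-1) (by norm_num)
      rw [zpow_neg_one] at h3
      rw [← h3, div_le_iff_of_neg (by norm_num)]
      have h5 : 0 ≤ (1 + R ^ 2) ^ (-7 / 8 : ℝ) := by positivity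
      linarith [Real.rpow_nonneg (show 0 ≤ 1 + t by linarith) (-7 / 8)]
    · have h3 := h1 _ (by positivity) le_rfl
      have h4 : (A * R) ^ 2 * (3840 / √R) * (2 * (th (R ^ 2) ^ 2 * (1 + R ^ 2)⁻¹)) ^ 2 ≤
          30720 * (A / R) ^ 2 := by
        have h7 : (R ^ 2 / (1 + R ^ 2)) ^ 2 ≤ 1 :=
          pow_le_one₀ (by positivity) ((div_le_one (by positivity)).2 (by linarith))
        calc _ = 15360 * (A / R) ^ 2 * (th (R ^ 2) ^ 4 / √R * (R ^ 2 / (1 + R ^ 2)) ^ 2) := by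
              field_simp
              ring
          _ ≤ 15360 * (A / R) ^ 2 * (2 * 1) := by
            gcongr
            exact (div_le_iff₀ hq).2 hth
          _ = _ := by ring
      linarith [sq_nonneg (A / R)]

lemma stp_add_single (t c : ℝ) (x : Sp) : stp t x + Pi.single 1 c = stp t (x + axisPt c) := by
  funext i
  fin_cases i <;> simp [stp, axisPt]

lemma spdIter_add (L : List (Fin 3)) (g : Sp → ℝ) (v : Sp) : spdIter L (fun y => g (y + v)) = fun y
    => spdIter L g (y + v) := by
  induction L with
  | nil => rfl
  | cons i L ih =>
    rw [spdIter, ih]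
    funext y
    exact congrArg (fun A : Sp →L[ℝ] ℝ => A (Pi.single i 1)) (fderiv_comp_add_right (𝕜 := ℝ) v)

lemma hatD_tr (k : ℕ) (c : ℝ) (f : Fld) (x : Sp) : hatD k (fun y => tr c f (stp 0 y)) x = hatD k
    (fun y => f (stp 0 y)) (x + axisPt c) := by
  simp only [hatD, tr, stp_add_single]
  exact sum_congr rfl fun I _ =>
    congrArg abs (congrFun (spdIter_add _ (fun y => f (stp 0 y)) (axisPt c)) x)

lemma good_of_data {ε0 : ℝ} (H : ∀ (M : ℝ) (φ : Fld), Sol F G φ → Supp M φ → ∀ ε : ℝ, 0 < ε → ε < ε0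
    → (∀ x, DataAt (stp 0 x) (n + 7) ε φ) → Dec M (K * ε) n φ) {a : ℝ} (he : 0 < ε) (he0 : ε < ε0)
    (hf : Sm φ) (hq : ∀ q : Pt, 0 ≤ q 0 → box φ q + nf3 F φ φ q = nf2 G φ φ q) (h0 :
    (Function.support fun x => φ (stp 0 x)) ⊆ {x | dist3 x (axisPt c) ≤ R / 2}) (h1 :
    (Function.support fun x => pd 0 φ (stp 0 x)) ⊆ {x | dist3 x (axisPt c) ≤ R / 2}) (hd : ∀ k
    ≤ n + 7, ∀ x, hatD k (fun y => φ (stp 0 y)) x ≤ ε / (1 + dist3 x (axisPt c)) ^ (k + 2)) (he1 : ∀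
    k ≤ n + 7, ∀ x, hatD k (fun y => pd 0 φ (stp 0 y)) x ≤ ε / (1 + dist3 x (axisPt c)) ^ (k + 3)) :
      Good R (c - a) (K * ε) n (tr a φ) := by
  have e : ∀ x, dist3 (x + axisPt c) (axisPt c) = rad3 x := fun x => by
    rw [dist3, add_sub_cancel_right]
  have hS : Sol F G (tr c φ) := ⟨hf.tr c, fun q h => by
    rw [box_tr, nf3_tr, nf2_tr]
    exact hq _ (by simpa using h)⟩
  rw [Good, tr_tr, sub_add_cancel]
  refine H _ _ hS (hS.supp fun x hx => ?_) ε he he0 (dataAt_of_hatD (hf.tr c) (fun k hk x => ?_) fun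
    k hk x => ?_)
  · rw [pd_tr]
    simp only [tr, stp_add_single]
    constructor <;> by_contra h
    · exact absurd ((e x).symm.le.trans (h0 h)) hx.not_ge
    · exact absurd ((e x).symm.le.trans (h1 h)) hx.not_ge
  · rw [hatD_tr, ← e]
    exact hd k hk _
  · rw [pd_tr, hatD_tr, ← e]
    exact he1 k hk _

set_option linter.unusedSimpArgs false in
lemma exists_zap_of_mem_gammaFields {a : ℝ} (hR : 1 ≤ R) {X : Pt → Pt}
    (hX : X ∈ GammaFields R a) : ∃ z : ZI × ℝ,
      (∀ f : Fld, tr a (vApp X f) = fun p => z.2 * zap z.1 (tr a f) p) ∧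
      ∀ c, |c| ≤ 2 * R → Adm c z := by
  have hR0 : 0 < R := by linarith
  have h : ∀ (Z : ZI) (r : ℝ), |r| ≤ 1 → (∀ b, |r * zA Z b 1| ≤ R⁻¹) →
      (∀ (p : Pt) b, X (p + Pi.single 1 a) b = r * (zb Z b + ∑ c, zA Z b c * p c)) → ∃ z : ZI × ℝ,
      (∀ f : Fld, tr a (vApp X f) = fun p => z.2 * zap z.1 (tr a f) p) ∧
      ∀ c, |c| ≤ 2 * R → Adm c z := fun Z r hr hA h => by
    refine ⟨(Z, r), fun f => funext fun p => ?_, fun c hc => ⟨hr, fun b => ?_⟩⟩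
    · have e : ∀ q v, fderiv ℝ f q v = ∑ b, v b * pd b f q := fun q v => by
        conv_lhs => rw [pi_eq_sum_univ' v]
        simp [pd]
      simp only [tr, vApp, e, h, zap, pd_tr, mul_sum, mul_assoc]
    · have h1 := mul_le_mul hc (hA b) (abs_nonneg _) (by positivity)
      rw [mul_assoc, mul_inv_cancel₀ hR0.ne'] at h1
      rw [mul_left_comm, abs_mul]
      linarith
  have h1 : |(1 : ℝ)| ≤ 1 := by simp
  have h2 : |R⁻¹| ≤ 1 := by
    rw [abs_of_pos (by positivity)]
    exact inv_le_one_of_one_le₀ hR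
  simp only [GammaFields, List.mem_append, List.mem_map, List.mem_cons, List.not_mem_nil, or_false,
    exists_eq_or_imp, exists_eq_left] at hX
  rcases hX with (rfl | rfl | rfl | rfl | rfl | rfl | rfl) |
    (rfl | rfl | rfl | rfl | rfl | rfl | rfl)
  map_tacs [refine h (.inr (.inl (2, 3))) _ h1 ?_ ?_; refine h (.inr (.inl (2, 0))) _ h1 ?_ ?_;
    refine h (.inr (.inl (3, 0))) _ h1 ?_ ?_; refine h (.inl 0) _ h1 ?_ ?_; refine h (.inl 1) _ h1
    ?_ ?_; refine h (.inl 2) _ h1 ?_ ?_; refine h (.inl 3) _ h1 ?_ ?_; refine h (.inr (.inl (1, 2)))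
    _ h2 ?_ ?_; refine h (.inr (.inl (1, 3))) _ h2 ?_ ?_; refine h (.inr (.inl (2, 3))) _ h2 ?_ ?_;
    refine h (.inr (.inl (1, 0))) _ h2 ?_ ?_; refine h (.inr (.inl (2, 0))) _ h2 ?_ ?_; refine h
    (.inr (.inl (3, 0))) _ h2 ?_ ?_; refine h (.inr (.inr ())) _ h2 ?_ ?_]
  all_goals
    intros
    rename_i b
    fin_cases b <;> simp [rotVF, boostVF, transVF, scaleVF, smulVF, sidx, axisPt, zA, zb, m4,
      Fin.sum_univ_four, hR0.le, abs_of_pos hR0]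

lemma exists_lamI_of_gammaFields {a : ℝ} (hR : 1 ≤ R) (ψ : Fld) (I : List (Pt → Pt)) (hI : ∀ X ∈ I,
    X ∈ GammaFields R a) : ∃ l : List (ZI × ℝ), l.length = I.length ∧ tr a (vIter I ψ) = lamI l (tr
      a ψ) ∧ ∀ c, |c| ≤ 2 * R → ∀ z ∈ l, Adm c z := by
  induction I with
  | nil => exact ⟨[], rfl, rfl, by simp⟩
  | cons X L ih =>
    obtain ⟨l, hl, h1, h2⟩ := ih fun Y hY => hI Y (List.mem_cons_of_mem _ hY)
    obtain ⟨z, h3, h4⟩ := exists_zap_of_mem_gammaFields hR (hI X List.mem_cons_self)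
    refine ⟨l ++ [z], by simp [hl], by rw [vIter, h3, h1, lamI_snoc], fun c hc y hy => ?_⟩
    rcases List.mem_append.1 hy with h | h
    · exact h2 c hc y h
    · exact List.mem_singleton.1 h ▸ h4 c hc

lemma source_eq_zero (hf : Good R c1 K 1 f) (hg : Good R c2 K 1 g) (hp : 0 ≤ p 0) (hd : ¬Dom R c1 c2
    p) : 2 * nf2 G f g p + -1 * nf3 F f g p + -1 * nf3 F g f p = 0 := by
  rw [Dom, not_and_or, not_le, not_le] at hd
  rcases hd with h | h
  · have e := (zero_off_of_good (hf.mono zero_le_one) hp h).2.1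
    simp [nf2, nf3, e, fun a => (zero_off_of_good (hf.pd a) hp h).2.1]
  · have e := (zero_off_of_good (hg.mono zero_le_one) hp h).2.1
    simp [nf2, nf3, e, fun a => (zero_off_of_good (hg.pd a) hp h).2.1]

lemma interaction_energy (hR : 1 ≤ R) (hD : (c1 - c2) ^ 2 = 4 * R ^ 2) (hA : 0 < A) {s : Fld} (hψ :
    Sm ψ) (hs : Sm s) (hb : ∀ p : Pt, 0 ≤ p 0 → box ψ p = s p) (hz : ∀ p : Pt, 0 ≤ p 0 → ¬Dom R c1
    c2 p → s p = 0) (h0 : ∀ x, ψ (stp 0 x) = 0) (h1 : ∀ x, pd 0 ψ (stp 0 x) = 0) (l : List (ZI × ℝ))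
    (H : PEst R c1 c2 A (opI l s)) (hT : 0 ≤ T) : Integrable (fun x => flatE (lamI l ψ) (stp T
    x)) ∧ ∫ x, flatE (lamI l ψ) (stp T x) ≤ 30000000 * (A / R) ^ 2 := by
  have hW := hψ.lamI l
  have e1 : ∀ p : Pt, 0 ≤ p 0 → R / 2 + |c1| + p 0 < rr p → ψ p = 0 := fun p hp h =>
    eq_zero_of_box_eq_zero hψ hp (c := rr p - R / 2 - |c1|) (by linarith) (fun q hq _ h' => by
      refine (hb q hq).trans (hz q hq fun hd => ?_)
      have h2 := rad3_le_radq_add ![p 1, p 2, p 3] q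
      rw [← rr_stp (p 0), stp_self] at h2
      linarith [hd.1, rr_le_sh c1 q]) h0 h1
  have e2 : ∀ p : Pt, 0 ≤ p 0 → p 0 < R / 2 → ψ p = 0 := fun p hp h =>
    eq_zero_of_box_eq_zero hψ hp (lt_add_one _) (fun q hq hqp _ => (hb q hq).trans (hz q hq fun hd
      => by linarith [(dom_bounds hR hD hd).1])) h0 h1
  have hS : Supp (R / 2 + |c1|) (lamI l ψ) := fun p hp h =>
    lamI_eq_zero_of_open hψ (U := {p | R / 2 + |c1| + p 0 < rr p})
      (isOpen_lt (by fun_prop) (by unfold rr; fun_prop)) (fun q hq h' => e1 q h' hq) l p h hp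
  refine ⟨(hS.flatE hW).integrable hW.flatE.continuous hT, energy_of_pest hR hD hA hW hS (fun p hp
    => ?_) (fun x => ?_) H hT⟩
  · have h2 := opI_add hs (hψ.box.sub hs) l
    rw [show (fun p => s p + (box ψ p - s p)) = box ψ by funext p; ring, ← box_lamI hψ] at h2
    rw [h2]
    simp only
    rw [opI_eq_zero (hψ.box.sub hs) (fun q hq => sub_eq_zero.2 (hb q hq)) l p hp, add_zero]
  · have hU : IsOpen {p : Pt | p 0 < R / 2} := isOpen_lt (by fun_prop) (by fun_prop)
    have h2 := fun a => pd_eq_zero_of_halfspace hU hW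
      (lamI_eq_zero_of_open hψ hU (fun q hq h' => e2 q h' hq) l) a (stp 0 x)
      (by simp [stp]; linarith) (by simp [stp])
    simp [flatE, h2]

theorem interaction_energy_estimate
    (F : Fin 4 → Fin 4 → Fin 4 → ℝ) (G : Fin 4 → Fin 4 → ℝ)
    (hF : NullForm3 F) (hG : NullForm2 G) (n : ℕ) (hn : 1 ≤ n) :
    ∃ C > (0 : ℝ), ∃ ε0 > (0 : ℝ), ∀ R : ℝ, 1 ≤ R → ∀ ε : ℝ, 0 < ε → ε < ε0 →
      ∀ φ1 φ2 ψ : Pt → ℝ,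
        ContDiff ℝ (⊤ : ℕ∞) φ1 → ContDiff ℝ (⊤ : ℕ∞) φ2 → ContDiff ℝ (⊤ : ℕ∞) ψ →
        (∀ q : Pt, 0 ≤ q 0 → box φ1 q + nf3 F φ1 φ1 q = nf2 G φ1 φ1 q) →
        (∀ q : Pt, 0 ≤ q 0 → box φ2 q + nf3 F φ2 φ2 q = nf2 G φ2 φ2 q) →
        (Function.support (fun x => φ1 (stp 0 x)) ⊆
          {x | dist3 x (axisPt (-R)) ≤ R / 2}) →
        (Function.support (fun x => pd 0 φ1 (stp 0 x)) ⊆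
          {x | dist3 x (axisPt (-R)) ≤ R / 2}) →
        (Function.support (fun x => φ2 (stp 0 x)) ⊆
          {x | dist3 x (axisPt R) ≤ R / 2}) →
        (Function.support (fun x => pd 0 φ2 (stp 0 x)) ⊆
          {x | dist3 x (axisPt R) ≤ R / 2}) →
        (∀ k ≤ n + 7, ∀ x, hatD k (fun y => φ1 (stp 0 y)) x ≤
          ε / (1 + dist3 x (axisPt (-R))) ^ (k + 2)) →
        (∀ k ≤ n + 7, ∀ x, hatD k (fun y => pd 0 φ1 (stp 0 y)) x ≤
          ε / (1 + dist3 x (axisPt (-R))) ^ (k + 3)) →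
        (∀ k ≤ n + 7, ∀ x, hatD k (fun y => φ2 (stp 0 y)) x ≤
          ε / (1 + dist3 x (axisPt R)) ^ (k + 2)) →
        (∀ k ≤ n + 7, ∀ x, hatD k (fun y => pd 0 φ2 (stp 0 y)) x ≤
          ε / (1 + dist3 x (axisPt R)) ^ (k + 3)) →
        (∀ q : Pt, 0 ≤ q 0 →
          box ψ q + nf3 F φ1 φ2 q + nf3 F φ2 φ1 q = 2 * nf2 G φ1 φ2 q) →
        (∀ x, ψ (stp 0 x) = 0) → (∀ x, pd 0 ψ (stp 0 x) = 0) →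
        ∀ a : ℝ, (a = -R ∨ a = R) →
        ∀ I : List (Pt → Pt), I.length ≤ n - 1 → (∀ X ∈ I, X ∈ GammaFields R a) →
        ∀ t : ℝ, 0 ≤ t →
          Real.sqrt (∫ x, (pdAbs (vIter I ψ) (stp t x)) ^ 2) ≤ C * ε ^ 2 / R := by
  obtain ⟨K, hK, ε0, hε0, HK⟩ := decay_of_data hF hG n hn
  obtain ⟨C, hC, HC⟩ := pest_source hF hG n
  refine ⟨11000 * C * K ^ 2, by positivity, ε0, hε0, fun R hR ε he hee φ1 φ2 ψ hf1 hf2 hψ hq1 hq2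
    a1 a2 a3 a4 b1 b2 b3 b4 hq z0 z1 a ha I hI hX t ht => ?_⟩
  have hD : (-R - a - (R - a)) ^ 2 = 4 * R ^ 2 := by ring
  have hf := good_of_data HK (a := a) he hee hf1 hq1 a1 a2 b1 b2
  have hg := good_of_data HK (a := a) he hee hf2 hq2 a3 a4 b3 b4
  obtain ⟨l, hl, hlI, hadm⟩ := exists_lamI_of_gammaFields hR ψ I hX
  have hc1 : |-R - a| ≤ 2 * R := by rcases ha with rfl | rfl <;> rw [abs_le] <;> constructor <;> linarith
  have hc2 : |R - a| ≤ 2 * R := by rcases ha with rfl | rfl <;> rw [abs_le] <;> constructor <;> linarith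
  have HP := HC R _ _ (K * ε) hR hD (by positivity) l (by omega)
    (fun z hz => ⟨hadm _ hc1 z hz, hadm _ hc2 z hz⟩) _ _ hf hg
  obtain ⟨hint, hE⟩ := interaction_energy hR hD (by positivity) (hψ.tr a)
    ((((hf1.tr a).nf2 G (hf2.tr a)).const_smul (2 : ℝ)).add
      (((hf1.tr a).nf3 F (hf2.tr a)).const_smul (-1 : ℝ)) |>.add
      (((hf2.tr a).nf3 F (hf1.tr a)).const_smul (-1 : ℝ)))
    (fun p hp => by
      have h := hq (p + Pi.single 1 a) (by simpa using hp)
      simp only [smul_eq_mul, box_tr, nf2_tr, nf3_tr, tr]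
      linarith)
    (fun p hp hd => source_eq_zero (hf.mono hn) (hg.mono hn) hp hd)
    (fun x => by simp only [tr, stp_add_single, z0]) (fun x => by
      rw [pd_tr]; simp only [tr, stp_add_single, z1]) l HP ht
  rw [Real.sqrt_le_iff]
  refine ⟨by positivity, ?_⟩
  rw [← integral_add_right_eq_self _ (axisPt a)]
  have e : ∀ x, pdAbs (vIter I ψ) (stp t (x + axisPt a)) ^ 2 ≤
      4 * flatE (lamI l (tr a ψ)) (stp t x) := fun x => by
    simp only [← hlI, flatE, pd_tr, pdAbs]
    simp only [tr, stp_add_single]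
    generalize stp t (x + axisPt a) = p
    rw [← sq_abs (pd 0 _ p), ← sq_abs (pd 1 _ p), ← sq_abs (pd 2 _ p), ← sq_abs (pd 3 _ p)]
    generalize |pd 0 _ p| = u, |pd 1 _ p| = v, |pd 2 _ p| = w, |pd 3 _ p| = z
    nlinarith [sq_nonneg (u - v), sq_nonneg (u - w), sq_nonneg (u - z), sq_nonneg (v - w),
      sq_nonneg (v - z), sq_nonneg (w - z)]
  refine (integral_mono_of_nonneg (.of_forall fun x => sq_nonneg _) (hint.const_mul 4)
    (.of_forall e)).trans ?_
  rw [integral_const_mul]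
  have : 11000 * C * K ^ 2 * ε ^ 2 / R = 11000 * (C * (K * ε) ^ 2 / R) := by ring
  rw [this]
  nlinarith [sq_nonneg (C * (K * ε) ^ 2 / R)]

end
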